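/- For every prime p there exist a constant C_p > 0 and x_0(p) such that for all x ≥ x_0(p) and every odd prime l ≠ p with l ≤ (log_2 x)·log(log_2 x), one has |Σ_{r ∈ Q_{p,l}, r ≤ x} 1/r − (log_2 x)/(3(l−1))| ≤ C_p·(log l)/l. -/

import Mathlib

open scoped Classical

/-- The iterated logarithm: `logI 0 x = x`, `logI (ν+1) x = max (log (logI ν x)) 1`,
so that `logI 1 x = log_1 x = max (log x, 1)` and `logI ν x = log_ν x`. -/
noncomputable def logI : ℕ → ℝ → ℝ
  | 0, x => x
  | ν + 1, x => max (Real.log (logI ν x)) 1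

/-- `r ∈ R_{p,k}`: `r` is an odd prime, `r ≠ p`, and `v₂(ℓ_p(r)) = k`. -/
def memR (p k r : ℕ) : Prop :=
  r.Prime ∧ Odd r ∧ r ≠ p ∧ padicValNat 2 (orderOf ((p : ZMod r))) = k

/-- `r ∈ R_p`, where `R_p = R_{p,1}` for `p > 2` and `R_2 = R_{2,2}`. -/
def memRp (p r : ℕ) : Prop :=
  if p = 2 then memR 2 2 r else memR p 1 r

section IdealCount

open NumberField Ideal UniqueFactorizationMonoid

variable {K : Type*} [Field K] [NumberField K]

/-- The rational prime below a nonzero prime ideal of a ring of integers. -/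
noncomputable def resChar (P : Ideal (𝓞 K)) : ℕ := (absNorm P).minFac

theorem resChar_spec {P : Ideal (𝓞 K)} (hP : Prime P) :
    (resChar P).Prime ∧ ∃ k, 0 < k ∧ absNorm P = resChar P ^ k := by
  have hP0 : P ≠ ⊥ := hP.ne_zero
  have hPp : P.IsPrime := Ideal.isPrime_of_prime hP
  have := hPp.isMaximal hP0
  obtain ⟨r, k, hk0, _, hr, h⟩ := exists_prime_and_absNorm_eq_pow P
  have hk : k ≠ 0 := by
    rintro rfl
    rw [pow_zero, absNorm_eq_one_iff] at h
    exact hPp.ne_top h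
  have : resChar P = r := by
    rw [resChar, h, hr.pow_minFac hk]
  rw [this]
  exact ⟨hr, k, Nat.pos_of_ne_zero hk, h⟩

theorem dvd_span_resChar {P : Ideal (𝓞 K)} (hP : Prime P) :
    P ∣ Ideal.span {((resChar P : ℕ) : 𝓞 K)} := by
  obtain ⟨hr, k, hk, h⟩ := resChar_spec hP
  have h1 := absNorm_mem P
  rw [h, Nat.cast_pow] at h1
  rw [Ideal.dvd_span_singleton]
  exact (Ideal.isPrime_of_prime hP).mem_of_pow_mem _ h1

theorem card_le_finrank_of_resChar_eq (F : Finset (Ideal (𝓞 K))) (r : ℕ)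
    (hF : ∀ P ∈ F, Prime P ∧ resChar P = r) : F.card ≤ Module.finrank ℚ K := by
  rcases F.eq_empty_or_nonempty with rfl | ⟨P₀, hP₀⟩
  · simp
  have hr : r.Prime := (hF P₀ hP₀).2 ▸ (resChar_spec (hF P₀ hP₀).1).1
  have h1 : ∏ P ∈ F, P ∣ Ideal.span {((r : ℕ) : 𝓞 K)} := by
    apply Finset.prod_primes_dvd
    · exact fun P hP => (hF P hP).1
    · intro P hP
      have := dvd_span_resChar (hF P hP).1
      rwa [(hF P hP).2] at this
  have h2 : absNorm (∏ P ∈ F, P) ∣ r ^ Module.finrank ℚ K := by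
    have := map_dvd (absNorm (S := 𝓞 K)) h1
    rwa [absNorm_span_natCast, RingOfIntegers.rank] at this
  have h3 : r ^ F.card ∣ absNorm (∏ P ∈ F, P) := by
    rw [map_prod, ← Finset.prod_const]
    apply Finset.prod_dvd_prod_of_dvd
    intro P hP
    obtain ⟨-, k, hk, h⟩ := resChar_spec (hF P hP).1
    rw [h, (hF P hP).2]
    exact dvd_pow_self _ hk.ne'
  exact (Nat.pow_dvd_pow_iff_le_right hr.one_lt).1 (h3.trans h2)

theorem exists_index_primes : ∃ idx : Ideal (𝓞 K) → Fin (Module.finrank ℚ K),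
    ∀ P P' : Ideal (𝓞 K), Prime P → Prime P' → resChar P = resChar P' → idx P = idx P' →
      P = P' := by
  have hn : 0 < Module.finrank ℚ K := Module.finrank_pos
  have key : ∀ r : ℕ, ∃ i : Ideal (𝓞 K) → Fin (Module.finrank ℚ K),
      ∀ P P' : Ideal (𝓞 K), Prime P → Prime P' → resChar P = r → resChar P' = r → i P = i P' →
        P = P' := by
    intro r
    by_cases hr : r = 0
    · refine ⟨fun _ => ⟨0, hn⟩, fun P P' hP _ h => ?_⟩
      exact absurd (h.trans hr) (resChar_spec hP).1.ne_zero
    let S := ((normalizedFactors (Ideal.span {((r : ℕ) : 𝓞 K)})).toFinset).filter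
      fun P => Prime P ∧ resChar P = r
    have hS : ∀ P, Prime P → resChar P = r → P ∈ S := by
      intro P hP h
      refine Finset.mem_filter.2 ⟨?_, hP, h⟩
      rw [Multiset.mem_toFinset, mem_normalizedFactors_iff']
      · refine ⟨hP.irreducible, normalize_eq _, ?_⟩
        have := dvd_span_resChar hP
        rwa [h] at this
      · simpa using hr
    have hc : S.card ≤ Module.finrank ℚ K :=
      card_le_finrank_of_resChar_eq S r fun P hP => (Finset.mem_filter.1 hP).2
    refine ⟨fun P => if h : P ∈ S then Fin.castLE hc (S.equivFin ⟨P, h⟩) else ⟨0, hn⟩, ?_⟩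
    intro P P' hP hP' h h' he
    simpa [hS P hP h, hS P' hP' h'] using he
  choose i hi using key
  refine ⟨fun P => i (resChar P) P, fun P P' hP hP' h he => ?_⟩
  refine hi (resChar P) P P' hP hP' rfl h.symm ?_
  simpa [h] using he

/-- A product decomposition of the norm of an ideal into `[K : ℚ]` factors which determines the
ideal. -/
theorem exists_injOn_factorization :
    ∃ φ : Ideal (𝓞 K) → (Fin (Module.finrank ℚ K) → ℕ),
      (∀ I, I ≠ ⊥ → ∏ i, φ I i = absNorm I) ∧ Set.InjOn φ {I | I ≠ ⊥} := by
  obtain ⟨idx, hidx⟩ := exists_index_primes (K := K)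
  let ψ : Ideal (𝓞 K) → (Fin (Module.finrank ℚ K) → ℕ) := fun P =>
    Function.update 1 (idx P) (absNorm P)
  have hψ : ∀ P, ∏ i, ψ P i = absNorm P := by
    intro P
    simp only [ψ]
    rw [Finset.prod_update_of_mem (Finset.mem_univ _)]
    simp
  let φ : Ideal (𝓞 K) → (Fin (Module.finrank ℚ K) → ℕ) := fun I =>
    ((normalizedFactors I).map ψ).prod
  have hφ : ∀ s : Multiset (Ideal (𝓞 K)), ∏ i, ((s.map ψ).prod) i = absNorm s.prod := by
    intro s
    induction s using Multiset.induction_on with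
    | empty => simp
    | cons a s ih =>
      simp only [Multiset.map_cons, Multiset.prod_cons, Pi.mul_apply, Finset.prod_mul_distrib,
        ih, hψ, map_mul]
  have hfac : ∀ (P : Ideal (𝓞 K)) (hP : Prime P) (s : Multiset (Ideal (𝓞 K))),
      (∀ Q ∈ s, Prime Q) →
      ∃ k, 0 < k ∧ (((s.map ψ).prod) (idx P)).factorization (resChar P) = k * s.count P ∧
        ((s.map ψ).prod) (idx P) ≠ 0 ∧ absNorm P = resChar P ^ k := by
    intro P hP s
    obtain ⟨hr, k, hk, h⟩ := resChar_spec hP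
    intro hs
    refine ⟨k, hk, ?_⟩
    induction s using Multiset.induction_on with
    | empty => simp [h]
    | cons a s ih =>
      obtain ⟨h1, h2, -⟩ := ih fun Q hQ => hs Q (Multiset.mem_cons_of_mem hQ)
      have ha : Prime a := hs a (Multiset.mem_cons_self a s)
      obtain ⟨hra, ka, hka, hha⟩ := resChar_spec ha
      have h0 : ψ a (idx P) ≠ 0 := by
        simp only [ψ, Function.update_apply]
        split_ifs
        · rw [hha]; exact pow_ne_zero _ hra.ne_zero
        · simp
      have : (ψ a (idx P)).factorization (resChar P) = k * (if P = a then 1 else 0) := by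
        by_cases hPa : P = a
        · subst hPa
          simp [ψ, h, hr.factorization_pow]
        · simp only [hPa, if_false, mul_zero]
          simp only [ψ, Function.update_apply]
          split_ifs with hi
          · have hne : resChar P ≠ resChar a := fun hh => hPa (hidx P a hP ha hh hi)
            rw [hha, hra.factorization_pow]
            simp [hne.symm]
          · simp
      simp only [Multiset.map_cons, Multiset.prod_cons, Pi.mul_apply]
      refine ⟨?_, mul_ne_zero h0 h2, h⟩
      rw [Nat.factorization_mul h0 h2, Finsupp.add_apply, h1, this, Multiset.count_cons]
      ring
  refine ⟨φ, fun I hI => ?_, fun I hI J hJ hIJ => ?_⟩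
  · simp only [φ, hφ]
    rw [Ideal.prod_normalizedFactors_eq_self hI]
  · have hs : ∀ I : Ideal (𝓞 K), ∀ Q ∈ normalizedFactors I, Prime Q :=
      fun I Q hQ => prime_of_normalized_factor Q hQ
    have : normalizedFactors I = normalizedFactors J := by
      ext P
      by_cases hP : Prime P
      · obtain ⟨k, hk, h1, -, h2⟩ := hfac P hP _ (hs I)
        obtain ⟨k', hk', h1', -, h2'⟩ := hfac P hP _ (hs J)
        have hkk : k = k' := by
          rw [h2] at h2'
          exact Nat.pow_right_injective (resChar_spec hP).1.two_le h2'
        subst hkk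
        have hIJ' : ((normalizedFactors I).map ψ).prod = ((normalizedFactors J).map ψ).prod := hIJ
        rw [hIJ', h1'] at h1
        exact (Nat.eq_of_mul_eq_mul_left hk h1).symm
      · rw [Multiset.count_eq_zero.2 fun h => hP (hs I P h),
          Multiset.count_eq_zero.2 fun h => hP (hs J P h)]
    rw [← Ideal.prod_normalizedFactors_eq_self hI, this, Ideal.prod_normalizedFactors_eq_self hJ]

theorem sum_absNorm_rpow_le (F : Finset (Ideal (𝓞 K))) (X : ℕ) (s : ℝ)
    (hF : ∀ I ∈ F, I ≠ ⊥ ∧ absNorm I ≤ X) :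
    ∑ I ∈ F, (absNorm I : ℝ) ^ (-s) ≤
      (∑ k ∈ Finset.Icc 1 X, (k : ℝ) ^ (-s)) ^ Module.finrank ℚ K := by
  obtain ⟨φ, h1, h2⟩ := exists_injOn_factorization (K := K)
  have e : (∑ k ∈ Finset.Icc 1 X, (k : ℝ) ^ (-s)) ^ Module.finrank ℚ K =
      ∑ x ∈ Fintype.piFinset fun _ : Fin (Module.finrank ℚ K) => Finset.Icc 1 X,
        ∏ i, ((x i : ℕ) : ℝ) ^ (-s) := by
    have := Finset.prod_univ_sum (fun _ : Fin (Module.finrank ℚ K) => Finset.Icc 1 X)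
      (fun _ k => (k : ℝ) ^ (-s))
    rw [← this]
    simp
  rw [e]
  have e2 : ∀ I ∈ F, (absNorm I : ℝ) ^ (-s) = ∏ i, ((φ I i : ℕ) : ℝ) ^ (-s) := by
    intro I hI
    rw [Real.finsetProd_rpow _ _ (fun i _ => Nat.cast_nonneg _), ← h1 I (hF I hI).1]
    push_cast
    rfl
  rw [Finset.sum_congr rfl e2, ← Finset.sum_image (s := F) (g := φ)
    (f := fun x => ∏ i, ((x i : ℕ) : ℝ) ^ (-s))
    (fun I hI J hJ h => h2 (hF I hI).1 (hF J hJ).1 h)]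
  apply Finset.sum_le_sum_of_subset_of_nonneg
  · intro x hx
    obtain ⟨I, hI, rfl⟩ := Finset.mem_image.1 hx
    have hN : absNorm I ≠ 0 := by
      rw [Ne, absNorm_eq_zero_iff]; exact (hF I hI).1
    rw [Fintype.mem_piFinset]
    intro i
    have hd : φ I i ∣ absNorm I := by
      rw [← h1 I (hF I hI).1]; exact Finset.dvd_prod_of_mem _ (Finset.mem_univ i)
    rw [Finset.mem_Icc]
    exact ⟨Nat.pos_of_dvd_of_pos hd (Nat.pos_of_ne_zero hN),
      (Nat.le_of_dvd (Nat.pos_of_ne_zero hN) hd).trans (hF I hI).2⟩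
  · intro x _ _
    positivity

end IdealCount

section EulerProduct

open Filter Topology

variable {R : Type*} [CommRing R] [IsDedekindDomain R]

/-- Removing finitely many Euler factors from a completely multiplicative sum over ideals. -/
theorem tsum_mul_prod_one_sub (w : Ideal R →*₀ ℂ) (hw : Summable fun I => ‖w I‖)
    (T : Finset (Ideal R)) (hT : ∀ P ∈ T, Prime P) :
    (∑' I, w I) * ∏ P ∈ T, (1 - w P) = ∑' I, if ∀ P ∈ T, ¬ P ∣ I then w I else 0 := by
  induction T using Finset.induction_on with
  | empty => simp
  | insert P T hPT ih =>
    have hP : Prime P := hT P (Finset.mem_insert_self _ _)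
    have hT' : ∀ Q ∈ T, Prime Q := fun Q hQ => hT Q (Finset.mem_insert_of_mem hQ)
    rw [Finset.prod_insert hPT, mul_comm (1 - w P), ← mul_assoc, ih hT']
    set g : Ideal R → ℂ := fun I => if ∀ Q ∈ T, ¬ Q ∣ I then w I else 0 with hg
    have hgs : Summable g := by
      refine Summable.of_norm_bounded hw fun I => ?_
      simp only [hg]
      split_ifs
      · exact le_rfl
      · simp
    set g1 : Ideal R → ℂ := fun I => if P ∣ I then g I else 0 with hg1
    have hg1s : Summable g1 := by
      refine Summable.of_norm_bounded hgs.norm fun I => ?_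
      simp only [hg1]
      split_ifs
      · exact le_rfl
      · simp
    have h1 : (∑' I, if ∀ Q ∈ insert P T, ¬ Q ∣ I then w I else 0) = ∑' I, g I - ∑' I, g1 I := by
      rw [← hgs.tsum_sub hg1s]
      refine tsum_congr fun I => ?_
      simp only [hg1, hg, Finset.forall_mem_insert]
      by_cases h : P ∣ I <;> simp [h]
    have hinj : Function.Injective fun J : Ideal R => P * J :=
      fun J J' h => mul_left_cancel₀ hP.ne_zero h
    have h2 : ∑' I, g1 I = w P * ∑' I, g I := by
      rw [← tsum_mul_left, ← hinj.tsum_eq (f := g1)]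
      · refine tsum_congr fun J => ?_
        have : (∀ Q ∈ T, ¬ Q ∣ P * J) ↔ ∀ Q ∈ T, ¬ Q ∣ J := by
          refine forall₂_congr fun Q hQ => not_congr ?_
          refine ⟨fun h => ?_, fun h => h.mul_left P⟩
          refine ((hT' Q hQ).dvd_or_dvd h).resolve_left fun h' => hPT ?_
          have := (hT' Q hQ).associated_of_dvd hP h'
          rwa [← associated_iff_eq.1 this]
        simp only [hg1, hg, this, dvd_mul_right, if_true, map_mul, mul_ite, mul_zero]
      · intro I hI
        have : P ∣ I := by
          by_contra h
          exact hI (by simp [hg1, h])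
        obtain ⟨J, rfl⟩ := this
        exact ⟨J, rfl⟩
    rw [h1, h2]
    ring

theorem exp_tsum_neg_log_one_sub (w : Ideal R →*₀ ℂ) (hw : Summable fun I => ‖w I‖)
    (h1 : ∀ P, Prime P → ‖w P‖ < 1) :
    Complex.exp (∑' P : {P : Ideal R // Prime P}, -Complex.log (1 - w P)) = ∑' I, w I := by
  have hs : Summable fun P : {P : Ideal R // Prime P} => w P :=
    (hw.subtype _).of_norm
  have hlog : Summable fun P : {P : Ideal R // Prime P} => Complex.log (1 - w P) := by
    simpa [sub_eq_add_neg] using Complex.summable_log_one_add_of_summable hs.neg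
  have hprod : Tendsto (fun T : Finset {P : Ideal R // Prime P} => ∏ P ∈ T, (1 - w P)) atTop
      (𝓝 (Complex.exp (∑' P : {P : Ideal R // Prime P}, Complex.log (1 - w P)))) := by
    have := (Complex.continuous_exp.tendsto _).comp hlog.hasSum
    refine this.congr fun T => ?_
    simp only [Function.comp_apply, Complex.exp_sum]
    refine Finset.prod_congr rfl fun P _ => Complex.exp_log ?_
    intro h
    have := h1 P P.2
    rw [← sub_eq_zero.1 h] at this
    simp at this
  have hlim : Tendsto (fun T : Finset {P : Ideal R // Prime P} =>
      ∑' I, if ∀ P ∈ T, ¬ (P : Ideal R) ∣ I then w I else 0) atTop (𝓝 1) := by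
    have : (1 : ℂ) = ∑' I : Ideal R, if I = ⊤ then 1 else 0 := by simp
    rw [this]
    refine tendsto_tsum_of_dominated_convergence hw (fun I => ?_) (Eventually.of_forall fun T I => ?_)
    · by_cases hI : I = ⊤
      · subst hI
        refine tendsto_const_nhds.congr fun T => ?_
        have : ∀ P ∈ T, ¬ (P : Ideal R) ∣ ⊤ := fun P _ h =>
          P.2.not_isUnit (isUnit_of_dvd_one (by rwa [Ideal.one_eq_top]))
        rw [if_pos this, if_pos rfl, ← Ideal.one_eq_top, map_one]
      · rw [if_neg hI]
        by_cases h0 : I = ⊥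
        · subst h0
          refine tendsto_const_nhds.congr fun T => ?_
          rw [← Ideal.zero_eq_bot, map_zero, ite_self]
        · obtain ⟨P, hP, hPI⟩ := Ideal.exists_le_maximal I hI
          have hPp : Prime P := Ideal.prime_of_isPrime
            (fun h => h0 (le_bot_iff.1 (h ▸ hPI))) hP.isPrime
          refine tendsto_const_nhds.congr' ?_
          filter_upwards [eventually_ge_atTop {⟨P, hPp⟩}] with T hT
          rw [if_neg]
          intro h
          exact h ⟨P, hPp⟩ (hT (Finset.mem_singleton_self _)) (Ideal.dvd_iff_le.2 hPI)
    · split_ifs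
      · exact le_rfl
      · simp
  have heq : ∀ T : Finset {P : Ideal R // Prime P}, (∑' I, w I) * ∏ P ∈ T, (1 - w P) =
      ∑' I, if ∀ P ∈ T, ¬ (P : Ideal R) ∣ I then w I else 0 := by
    intro T
    have := tsum_mul_prod_one_sub w hw (T.map (Function.Embedding.subtype _))
      (by simp +contextual)
    simpa using this
  have hmul := hprod.const_mul (∑' I, w I)
  simp only [heq] at hmul
  have := tendsto_nhds_unique hlim hmul
  rw [tsum_neg, Complex.exp_neg, inv_eq_one_div, div_eq_iff (Complex.exp_ne_zero _)]
  exact this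

end EulerProduct

section LatticeCount

open MeasureTheory

/-- Equidistribution of the fibres of a homomorphism `φ : G → A`: if every element of `A` has a
representative moving `ψ` by little, then all fibres carry nearly the same mass. -/
theorem card_mul_tsum_fiber_sub_tsum_le {G A : Type*} [AddCommGroup G] [AddCommGroup A] [Fintype A]
    (φ : G →+ A) (δ : A → G) (hδ : ∀ x, φ (δ x) = x) (ψ η : G → ℝ)
    (hψ : ψ.support.Finite) (hη : η.support.Finite)
    (h : ∀ a x, |ψ a - ψ (a + δ x)| ≤ η (a + δ x)) (x₀ : A) :
    |Fintype.card A * (∑' a, if φ a = x₀ then ψ a else 0) - ∑' a, ψ a| ≤ ∑' a, η a := by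
  have fin : ∀ (ξ : G → ℝ) (hξ : ξ.support.Finite) (x : A),
      Summable fun a => if φ a = x then ξ a else 0 := by
    intro ξ hξ x
    refine summable_of_hasFiniteSupport (hξ.subset fun a ha => ?_)
    rw [Function.mem_support] at ha ⊢
    intro h0
    simp [h0] at ha
  have split : ∀ (ξ : G → ℝ) (hξ : ξ.support.Finite),
      ∑' a, ξ a = ∑ x : A, ∑' a, if φ a = x₀ then ξ (a + δ (x - x₀)) else 0 := by
    intro ξ hξ
    have h1 : ∑' a, ξ a = ∑ x : A, ∑' a, if φ a = x then ξ a else 0 := by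
      rw [← Summable.tsum_finsetSum fun x _ => fin ξ hξ x]
      refine tsum_congr fun a => ?_
      simp
    rw [h1]
    refine Finset.sum_congr rfl fun x _ => ?_
    rw [← (Equiv.addRight (δ (x - x₀))).tsum_eq]
    refine tsum_congr fun a => ?_
    have : φ a + (x - x₀) = x ↔ φ a = x₀ := by
      rw [add_sub, sub_eq_iff_eq_add, add_comm, add_right_inj]
    simp [map_add, hδ, this]
  have shift : ∀ (ξ : G → ℝ) (hξ : ξ.support.Finite) (d : G), (fun a => ξ (a + d)).support.Finite :=
    fun ξ hξ d => hξ.preimage (add_left_injective d).injOn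
  have e : (Fintype.card A : ℝ) * (∑' a, if φ a = x₀ then ψ a else 0) - ∑' a, ψ a =
      ∑ x : A, ∑' a, ((if φ a = x₀ then ψ a else 0) -
        if φ a = x₀ then ψ (a + δ (x - x₀)) else 0) := by
    rw [split ψ hψ]
    rw [Finset.sum_congr rfl fun x _ => (fin ψ hψ x₀).tsum_sub (fin _ (shift ψ hψ _) x₀)]
    simp
  rw [e, split η hη]
  refine (Finset.abs_sum_le_sum_abs _ _).trans (Finset.sum_le_sum fun x _ => ?_)
  have hb : ∀ a, |(if φ a = x₀ then ψ a else 0) - if φ a = x₀ then ψ (a + δ (x - x₀)) else 0| ≤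
      if φ a = x₀ then η (a + δ (x - x₀)) else 0 := by
    intro a
    split_ifs
    · exact h a _
    · simp
  have hs := fin _ (shift η hη (δ (x - x₀))) x₀
  rw [← Real.norm_eq_abs]
  exact tsum_of_norm_bounded hs.hasSum hb

variable {n : ℕ}

/-- The real vector underlying an integer vector. -/
def vecCast (a : Fin n → ℤ) : Fin n → ℝ := fun i => (a i : ℝ)

theorem finite_ncard_vecCast (h : ℝ) (hh : 0 < h) (t : Fin n → ℝ) (r : ℝ) (hr : 0 ≤ r) :
    {a : Fin n → ℤ | ‖h • vecCast a + t‖ ≤ r}.Finite ∧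
      ({a : Fin n → ℤ | ‖h • vecCast a + t‖ ≤ r}.ncard : ℝ) ≤ (2 * r / h + 1) ^ n := by
  let B := Fintype.piFinset fun i : Fin n => Finset.Icc ⌈(-r - t i) / h⌉ ⌊(r - t i) / h⌋
  have hB : {a : Fin n → ℤ | ‖h • vecCast a + t‖ ≤ r} ⊆ B := by
    intro a ha
    rw [Set.mem_ofPred_eq, pi_norm_le_iff_of_nonneg hr] at ha
    rw [Finset.mem_coe, Fintype.mem_piFinset]
    intro i
    have := abs_le.1 (ha i)
    simp only [vecCast, Pi.add_apply, Pi.smul_apply, smul_eq_mul] at this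
    rw [Finset.mem_Icc, Int.ceil_le, Int.le_floor, div_le_iff₀ hh, le_div_iff₀ hh]
    constructor <;> nlinarith
  refine ⟨B.finite_toSet.subset hB, ?_⟩
  have h1 := Set.ncard_le_ncard hB B.finite_toSet
  rw [Set.ncard_coe_finset] at h1
  refine (Nat.cast_le.2 h1).trans ?_
  rw [Fintype.card_piFinset, Nat.cast_prod]
  have : (2 * r / h + 1) ^ n = ∏ i : Fin n, (2 * r / h + 1) := by simp
  rw [this]
  refine Finset.prod_le_prod (fun _ _ => Nat.cast_nonneg _) fun i _ => ?_
  rw [Int.card_Icc]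
  have h2 : (2 * r / h) = (r - t i) / h - (-r - t i) / h := by ring
  have h3 : 0 ≤ 2 * r / h := by positivity
  have h4 := Int.floor_le ((r - t i) / h)
  have h5 := Int.le_ceil ((-r - t i) / h)
  rcases le_total 0 (⌊(r - t i) / h⌋ + 1 - ⌈(-r - t i) / h⌉) with h6 | h6
  · have : (((⌊(r - t i) / h⌋ + 1 - ⌈(-r - t i) / h⌉).toNat : ℕ) : ℝ) =
        ((⌊(r - t i) / h⌋ + 1 - ⌈(-r - t i) / h⌉ : ℤ) : ℝ) := by
      exact_mod_cast congrArg (Int.cast : ℤ → ℝ) (Int.toNat_of_nonneg h6)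
    rw [this]
    push_cast
    linarith
  · rw [Int.toNat_of_nonpos h6]
    simp only [Nat.cast_zero]
    linarith

theorem tsum_indicator_const {G : Type*} (S : Set G) (hS : S.Finite) (ε : ℝ) :
    ∑' a, S.indicator (fun _ => ε) a = S.ncard * ε := by
  rw [tsum_eq_sum (s := hS.toFinset), Finset.sum_congr rfl (g := fun _ => ε), Finset.sum_const,
    nsmul_eq_mul, Set.ncard_eq_toFinset_card S hS]
  · intro a ha
    exact Set.indicator_of_mem (hS.mem_toFinset.1 ha) _
  · intro a ha
    exact Set.indicator_of_notMem (fun h => ha (hS.mem_toFinset.2 h)) _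

/-- Riemann sums over a shifted scaled integer lattice. -/
theorem riemann_sum_sub_integral_le (Ψ : (Fin n → ℝ) → ℝ) (ℓ : ℝ) (hℓ : 0 ≤ ℓ) (z : Fin n → ℝ)
    (hL : ∀ x y, |Ψ x - Ψ y| ≤ ℓ * ‖x - y‖) (hS : ∀ x, 1 < ‖x - z‖ → Ψ x = 0)
    (h : ℝ) (hh : 0 < h) (h1 : h ≤ 1) (t : Fin n → ℝ) :
    |h ^ n * ∑' a : Fin n → ℤ, Ψ (h • vecCast a + t) - ∫ x, Ψ x| ≤ ℓ * h * 5 ^ n := by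
  have hcont : Continuous Ψ := by
    have : LipschitzWith ⟨ℓ, hℓ⟩ Ψ := LipschitzWith.of_dist_le_mul fun x y => by
      rw [Real.dist_eq, dist_eq_norm]; exact hL x y
    exact this.continuous
  have hcs : HasCompactSupport Ψ := by
    refine HasCompactSupport.intro (isCompact_closedBall z 1) fun x hx => hS x ?_
    rw [Metric.mem_closedBall, dist_eq_norm, not_le] at hx
    exact hx
  set Φ : (Fin n → ℝ) → ℝ := fun y => Ψ (h • y + t) with hΦ
  have hint : ∫ y, Φ y = (h ^ n)⁻¹ * ∫ x, Ψ x := by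
    have e1 := Measure.integral_comp_smul_of_nonneg (volume : Measure (Fin n → ℝ))
      (fun x => Ψ (x + t)) h (hR := hh.le)
    rw [integral_add_right_eq_self] at e1
    simpa using e1
  have hΦc : Continuous Φ := hcont.comp (by fun_prop)
  have hΦi : Integrable Φ := by
    have : Integrable fun x => Ψ (x + t) :=
      (hcont.integrable_of_hasCompactSupport hcs).comp_add_right t
    exact this.comp_smul hh.ne'
  let C : (Fin n → ℤ) → Set (Fin n → ℝ) := fun a =>
    Set.univ.pi fun i => Set.Ico (a i : ℝ) (a i + 1)
  have hmemC : ∀ a y, y ∈ C a ↔ ∀ i, ⌊y i⌋ = a i := by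
    intro a y
    simp [C, Set.mem_pi, Int.floor_eq_iff]
  have hCm : ∀ a, MeasurableSet (C a) := fun a =>
    MeasurableSet.univ_pi fun i => measurableSet_Ico
  have hCd : Pairwise (Function.onFun Disjoint C) := by
    intro a b hab
    refine Set.disjoint_left.2 fun y hy hy' => hab ?_
    funext i
    rw [← (hmemC a y).1 hy i, (hmemC b y).1 hy' i]
  have hCu : ⋃ a, C a = Set.univ := by
    refine Set.eq_univ_of_forall fun y => Set.mem_iUnion.2 ⟨fun i => ⌊y i⌋, ?_⟩
    rw [hmemC]
    exact fun i => rfl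
  have hCv : ∀ a, volume.real (C a) = 1 := by
    intro a
    simp [C, Measure.real, Real.volume_pi_Ico]
  have hsum : HasSum (fun a => ∫ y in C a, Φ y) (∫ y, Φ y) := by
    have := hasSum_integral_iUnion hCm hCd (f := Φ) (μ := volume) hΦi.integrableOn
    rwa [hCu, setIntegral_univ] at this
  set S : Set (Fin n → ℤ) := {a | ‖h • vecCast a + (t - z)‖ ≤ 1 + h}
  obtain ⟨hSf, hSc⟩ := finite_ncard_vecCast h hh (t - z) (1 + h) (by linarith)
  have hSc' : (S.ncard : ℝ) ≤ (5 / h) ^ n := by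
    refine hSc.trans (pow_le_pow_left₀ (by positivity) ?_ n)
    rw [div_add_one hh.ne', div_le_div_iff_of_pos_right hh]
    linarith
  have hnear : ∀ a y, y ∈ C a → ‖y - vecCast a‖ ≤ 1 := by
    intro a y hy
    rw [pi_norm_le_iff_of_nonneg zero_le_one]
    intro i
    have h1 : (a i : ℝ) ≤ y i ∧ y i < a i + 1 := by
      have := (hmemC a y).1 hy i
      rwa [Int.floor_eq_iff] at this
    rw [Real.norm_eq_abs, abs_le, Pi.sub_apply, vecCast]
    constructor <;> linarith
  have hout : ∀ a, a ∉ S → ∀ y, ‖y - vecCast a‖ ≤ 1 → Φ y = 0 := by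
    intro a ha y hy
    refine hS _ ?_
    have e : h • vecCast a + (t - z) = (h • y + t - z) - h • (y - vecCast a) := by
      rw [smul_sub]; abel
    have h2 : 1 + h < ‖h • vecCast a + (t - z)‖ := not_le.1 ha
    rw [e] at h2
    have h3 := norm_sub_le (h • y + t - z) (h • (y - vecCast a))
    rw [norm_smul, Real.norm_of_nonneg hh.le] at h3
    nlinarith
  have hterm : ∀ a, ‖Φ (vecCast a) - ∫ y in C a, Φ y‖ ≤ S.indicator (fun _ => ℓ * h) a := by
    intro a
    have e1 : Φ (vecCast a) = ∫ y in C a, Φ (vecCast a) := by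
      rw [setIntegral_const, hCv, one_smul]
    by_cases ha : a ∈ S
    · rw [Set.indicator_of_mem ha, e1, ← integral_sub _ hΦi.integrableOn]
      · have hvol : volume (C a) < ⊤ := by
          by_contra hcon
          have : volume.real (C a) = 0 := by
            simp [Measure.real, top_unique (not_lt.1 hcon)]
          rw [hCv] at this
          exact one_ne_zero this
        have := norm_setIntegral_le_of_norm_le_const (μ := volume) (s := C a)
          (f := fun y => Φ (vecCast a) - Φ y) (C := ℓ * h) hvol (fun y hy => ?_)
        · rwa [hCv, mul_one] at this
        · simp only [hΦ, Real.norm_eq_abs]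
          refine (hL _ _).trans ?_
          refine mul_le_mul_of_nonneg_left ?_ hℓ
          rw [add_sub_add_right_eq_sub, ← smul_sub, norm_smul, Real.norm_of_nonneg hh.le,
            norm_sub_rev]
          have := hnear a y hy
          nlinarith
      · refine (integrableOn_const ?_).integrable
        intro hcon
        have := hCv a
        simp [Measure.real, hcon] at this
    · rw [Set.indicator_of_notMem ha, hout a ha _ (by simp),
        setIntegral_eq_zero_of_forall_eq_zero fun y hy => hout a ha y (hnear a y hy)]
      simp
  have hfs : Summable fun a : Fin n → ℤ => Φ (vecCast a) := by
    refine summable_of_hasFiniteSupport (hSf.subset fun a ha => ?_)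
    by_contra hcon
    exact ha (hout a hcon _ (by simp))
  have hfin : |∑' a : Fin n → ℤ, Φ (vecCast a) - ∫ y, Φ y| ≤ S.ncard * (ℓ * h) := by
    rw [← hsum.tsum_eq, ← hfs.tsum_sub hsum.summable, ← tsum_indicator_const S hSf]
    refine tsum_of_norm_bounded (Summable.hasSum ?_) hterm
    exact summable_of_hasFiniteSupport (hSf.subset Set.support_indicator_subset)
  have hp : 0 < h ^ n := pow_pos hh n
  have e3 : h ^ n * ∑' a : Fin n → ℤ, Ψ (h • vecCast a + t) - ∫ x, Ψ x =
      h ^ n * (∑' a : Fin n → ℤ, Φ (vecCast a) - ∫ y, Φ y) := by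
    rw [hint, mul_sub, mul_inv_cancel_left₀ hp.ne']
  rw [e3, abs_mul, abs_of_pos hp]
  calc h ^ n * |∑' a : Fin n → ℤ, Φ (vecCast a) - ∫ y, Φ y|
      ≤ h ^ n * ((5 / h) ^ n * (ℓ * h)) := by
        refine mul_le_mul_of_nonneg_left (hfin.trans ?_) hp.le
        exact mul_le_mul_of_nonneg_right hSc' (by positivity)
    _ = ℓ * h * 5 ^ n := by
        rw [div_pow]; field_simp

theorem riemann_sum_fiber_sub_integral_le {A : Type*} [AddCommGroup A] [Fintype A]
    (φ : (Fin n → ℤ) →+ A) (δ : A → (Fin n → ℤ)) (hδ : ∀ x, φ (δ x) = x) (ρ : ℝ) (hρ : 1 ≤ ρ)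
    (hδρ : ∀ x, ‖vecCast (δ x)‖ ≤ ρ)
    (Ψ : (Fin n → ℝ) → ℝ) (ℓ : ℝ) (hℓ : 0 ≤ ℓ) (z : Fin n → ℝ)
    (hL : ∀ x y, |Ψ x - Ψ y| ≤ ℓ * ‖x - y‖) (hS : ∀ x, 1 < ‖x - z‖ → Ψ x = 0)
    (h : ℝ) (hh : 0 < h) (h1 : h * ρ ≤ 1) (t : Fin n → ℝ) (x₀ : A) :
    |h ^ n * (Fintype.card A * ∑' a : Fin n → ℤ, if φ a = x₀ then Ψ (h • vecCast a + t) else 0)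
      - ∫ x, Ψ x| ≤ 2 * (ℓ * (h * ρ) * 5 ^ n) := by
  have hhρ : h ≤ h * ρ := le_mul_of_one_le_right hh.le hρ
  have hR := riemann_sum_sub_integral_le Ψ ℓ hℓ z hL hS h hh (hhρ.trans h1) t
  set S : Set (Fin n → ℤ) := {a | ‖h • vecCast a + (t - z)‖ ≤ 1 + h * ρ}
  obtain ⟨hSf, hSc⟩ := finite_ncard_vecCast h hh (t - z) (1 + h * ρ) (by linarith)
  have hSc' : (S.ncard : ℝ) ≤ (5 / h) ^ n := by
    refine hSc.trans (pow_le_pow_left₀ (by positivity) ?_ n)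
    rw [div_add_one hh.ne', div_le_div_iff_of_pos_right hh]
    linarith
  have hcast : ∀ a b : Fin n → ℤ, vecCast (a + b) = vecCast a + vecCast b := by
    intro a b; ext i; simp [vecCast]
  have hA := card_mul_tsum_fiber_sub_tsum_le φ δ hδ (fun a => Ψ (h • vecCast a + t))
    (S.indicator fun _ => ℓ * (h * ρ)) ?_ (hSf.subset Set.support_indicator_subset) ?_ x₀
  · rw [tsum_indicator_const S hSf] at hA
    have hp : 0 < h ^ n := pow_pos hh n
    have e : h ^ n * (Fintype.card A * ∑' a : Fin n → ℤ,
        if φ a = x₀ then Ψ (h • vecCast a + t) else 0) - ∫ x, Ψ x =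
        h ^ n * (Fintype.card A * (∑' a : Fin n → ℤ,
          if φ a = x₀ then Ψ (h • vecCast a + t) else 0) - ∑' a : Fin n → ℤ, Ψ (h • vecCast a + t))
        + (h ^ n * ∑' a : Fin n → ℤ, Ψ (h • vecCast a + t) - ∫ x, Ψ x) := by ring
    rw [e, two_mul]
    refine (abs_add_le _ _).trans (add_le_add ?_ (hR.trans ?_))
    · rw [abs_mul, abs_of_pos hp]
      calc _ ≤ h ^ n * ((5 / h) ^ n * (ℓ * (h * ρ))) := by
            refine mul_le_mul_of_nonneg_left (hA.trans ?_) hp.le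
            exact mul_le_mul_of_nonneg_right hSc' (by positivity)
        _ = ℓ * (h * ρ) * 5 ^ n := by
            rw [div_pow]; field_simp
    · gcongr
  · refine hSf.subset fun a ha => ?_
    by_contra hcon
    refine ha (hS _ ?_)
    have h2 : 1 + h * ρ < ‖h • vecCast a + (t - z)‖ := not_le.1 hcon
    rw [← add_sub_assoc] at h2
    nlinarith
  · intro a x
    have hd : ‖(h • vecCast a + t) - (h • vecCast (a + δ x) + t)‖ ≤ h * ρ := by
      rw [hcast, smul_add]
      have : h • vecCast a + t - (h • vecCast a + h • vecCast (δ x) + t) =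
        -(h • vecCast (δ x)) := by abel
      rw [this, norm_neg, norm_smul, Real.norm_of_nonneg hh.le]
      exact mul_le_mul_of_nonneg_left (hδρ x) hh.le
    by_cases hx : a + δ x ∈ S
    · rw [Set.indicator_of_mem hx]
      exact (hL _ _).trans (mul_le_mul_of_nonneg_left hd hℓ)
    · rw [Set.indicator_of_notMem hx]
      have h2 : 1 + h * ρ < ‖h • vecCast (a + δ x) + (t - z)‖ := not_le.1 hx
      rw [← add_sub_assoc] at h2
      have h3 : 1 < ‖h • vecCast a + t - z‖ := by
        have := norm_sub_norm_le (h • vecCast (a + δ x) + t - z) (h • vecCast a + t - z)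
        rw [norm_sub_rev] at hd
        have e : h • vecCast (a + δ x) + t - z - (h • vecCast a + t - z) =
          h • vecCast (a + δ x) + t - (h • vecCast a + t) := by abel
        rw [e] at this
        linarith
      rw [hS _ h3, hS (h • vecCast (a + δ x) + t) (by nlinarith)]
      simp

end LatticeCount

section IdealSums

open NumberField Ideal

theorem sum_Icc_rpow_neg_one_le (X : ℕ) :
    ∑ k ∈ Finset.Icc 1 X, (k : ℝ) ^ (-(1 : ℝ)) ≤ 1 + Real.log X := by
  have := harmonic_le_one_add_log X
  rw [harmonic_eq_sum_Icc] at this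
  push_cast at this
  refine le_trans (le_of_eq (Finset.sum_congr rfl fun k _ => ?_)) this
  rw [Real.rpow_neg_one]

theorem rpow_neg_one_sub_le {v : ℝ} (hv : 0 < v) {k : ℕ} (hk : 1 ≤ k) :
    ((k + 1 : ℕ) : ℝ) ^ (-(1 + v)) ≤ (1 / v) * ((k : ℝ) ^ (-v) - ((k + 1 : ℕ) : ℝ) ^ (-v)) := by
  have hk0 : (0 : ℝ) < k := by exact_mod_cast hk
  have hk1 : (0 : ℝ) < ((k + 1 : ℕ) : ℝ) := by positivity
  have h1 : Real.log ((k : ℝ) / ((k + 1 : ℕ) : ℝ)) ≤ -(1 / ((k + 1 : ℕ) : ℝ)) := by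
    refine (Real.log_le_sub_one_of_pos (by positivity)).trans (le_of_eq ?_)
    push_cast
    field_simp
    ring
  have h2 : 1 + v / ((k + 1 : ℕ) : ℝ) ≤ ((k : ℝ) / ((k + 1 : ℕ) : ℝ)) ^ (-v) := by
    rw [Real.rpow_def_of_pos (by positivity)]
    refine le_trans ?_ (Real.add_one_le_exp _)
    rw [add_comm]
    gcongr
    calc v / ((k + 1 : ℕ) : ℝ) = -(1 / ((k + 1 : ℕ) : ℝ)) * (-v) := by ring
      _ ≤ _ := mul_le_mul_of_nonpos_right h1 (by linarith)
  rw [Real.div_rpow hk0.le hk1.le, le_div_iff₀ (by positivity)] at h2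
  have h3 : ((k + 1 : ℕ) : ℝ) ^ (-(1 + v)) =
      ((k + 1 : ℕ) : ℝ) ^ (-v) / ((k + 1 : ℕ) : ℝ) := by
    rw [show -(1 + v) = -v - 1 by ring, Real.rpow_sub_one hk1.ne']
  rw [h3, div_mul_eq_mul_div, one_mul, le_div_iff₀ hv]
  linear_combination h2

theorem sum_Icc_rpow_le {v : ℝ} (hv : 0 < v) (X : ℕ) :
    ∑ k ∈ Finset.Icc 1 X, (k : ℝ) ^ (-(1 + v)) ≤ 1 + 1 / v := by
  have key : ∀ X : ℕ, 1 ≤ X →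
      ∑ k ∈ Finset.Icc 1 X, (k : ℝ) ^ (-(1 + v)) ≤ 1 + (1 / v) * (1 - (X : ℝ) ^ (-v)) := by
    intro X hX
    induction X, hX using Nat.le_induction with
    | base => simp
    | succ k hk ih =>
      rw [Finset.sum_Icc_succ_top (by omega)]
      have := rpow_neg_one_sub_le hv hk
      linear_combination ih + this
  rcases Nat.eq_zero_or_pos X with rfl | hX
  · simp; positivity
  · refine (key X hX).trans ?_
    have : (0 : ℝ) ≤ (X : ℝ) ^ (-v) := by positivity
    have h1 : 0 ≤ 1 / v * (X : ℝ) ^ (-v) := by positivity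
    linear_combination h1

variable {K : Type*} [Field K] [NumberField K]

theorem sum_absNorm_rpow_le_pow {v : ℝ} (hv : 0 < v) (F : Finset (Ideal (𝓞 K))) :
    ∑ I ∈ F, (absNorm I : ℝ) ^ (-(1 + v)) ≤ (1 + 1 / v) ^ Module.finrank ℚ K := by
  have e : ∑ I ∈ F, (absNorm I : ℝ) ^ (-(1 + v)) =
      ∑ I ∈ F.filter (fun I => I ≠ ⊥), (absNorm I : ℝ) ^ (-(1 + v)) := by
    rw [Finset.sum_filter]
    refine Finset.sum_congr rfl fun I _ => ?_
    split_ifs with h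
    · rfl
    · rw [not_not.1 h, absNorm_bot, Nat.cast_zero, Real.zero_rpow (by linarith)]
  rw [e]
  refine (sum_absNorm_rpow_le _ (F.sup fun I => absNorm I) (1 + v) fun I hI => ?_).trans ?_
  · rw [Finset.mem_filter] at hI
    exact ⟨hI.2, Finset.le_sup (f := fun I => absNorm I) hI.1⟩
  · exact pow_le_pow_left₀ (Finset.sum_nonneg fun _ _ => by positivity) (sum_Icc_rpow_le hv _) _

theorem summable_absNorm_rpow {v : ℝ} (hv : 0 < v) :
    Summable fun I : Ideal (𝓞 K) => (absNorm I : ℝ) ^ (-(1 + v)) :=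
  summable_of_sum_le (fun _ => by positivity) (sum_absNorm_rpow_le_pow hv)

theorem tsum_absNorm_rpow_le {v : ℝ} (hv : 0 < v) :
    ∑' I : Ideal (𝓞 K), (absNorm I : ℝ) ^ (-(1 + v)) ≤ (1 + 1 / v) ^ Module.finrank ℚ K :=
  (summable_absNorm_rpow hv).tsum_le_of_sum_le (sum_absNorm_rpow_le_pow hv)

theorem sum_inv_absNorm_le (F : Finset (Ideal (𝓞 K))) (X : ℝ) (hX : 1 ≤ X)
    (hF : ∀ I ∈ F, (absNorm I : ℝ) ≤ X) :
    ∑ I ∈ F, (absNorm I : ℝ)⁻¹ ≤ (1 + Real.log X) ^ Module.finrank ℚ K := by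
  have e : ∑ I ∈ F, (absNorm I : ℝ)⁻¹ =
      ∑ I ∈ F.filter (fun I => I ≠ ⊥), (absNorm I : ℝ) ^ (-(1 : ℝ)) := by
    rw [Finset.sum_filter]
    refine Finset.sum_congr rfl fun I _ => ?_
    split_ifs with h
    · rw [Real.rpow_neg_one]
    · rw [not_not.1 h, absNorm_bot, Nat.cast_zero, inv_zero]
  rw [e]
  refine (sum_absNorm_rpow_le _ ⌊X⌋₊ 1 fun I hI => ?_).trans ?_
  · rw [Finset.mem_filter] at hI
    exact ⟨hI.2, Nat.le_floor (hF I hI.1)⟩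
  · refine pow_le_pow_left₀ (Finset.sum_nonneg fun _ _ => by positivity)
      ((sum_Icc_rpow_neg_one_le _).trans ?_) _
    have h1 : 1 ≤ ⌊X⌋₊ := Nat.le_floor (by simpa using hX)
    gcongr
    exact Nat.floor_le (by linarith)

/-- The completely multiplicative function `I ↦ χ(N I) N I ^ (-(1 + v))` on ideals. -/
noncomputable def idealWeight {N : ℕ} (χ : DirichletCharacter ℂ N) (v : ℝ) (hv : 0 < v) :
    Ideal (𝓞 K) →*₀ ℂ where
  toFun I := χ (absNorm I : ZMod N) * (((absNorm I : ℝ) ^ (-(1 + v)) : ℝ) : ℂ)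
  map_zero' := by
    have h : (0 : ℝ) ^ (-(1 + v)) = 0 := Real.zero_rpow (by linarith)
    simp only [Ideal.zero_eq_bot, absNorm_bot, Nat.cast_zero, h, Complex.ofReal_zero, mul_zero]
  map_one' := by simp
  map_mul' I J := by
    simp only [map_mul, Nat.cast_mul]
    rw [Real.mul_rpow (Nat.cast_nonneg _) (Nat.cast_nonneg _)]
    push_cast
    ring

theorem idealWeight_apply {N : ℕ} (χ : DirichletCharacter ℂ N) (v : ℝ) (hv : 0 < v)
    (I : Ideal (𝓞 K)) : idealWeight χ v hv I =
      χ (absNorm I : ZMod N) * (((absNorm I : ℝ) ^ (-(1 + v)) : ℝ) : ℂ) := rfl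

theorem norm_idealWeight_le {N : ℕ} (χ : DirichletCharacter ℂ N) (v : ℝ) (hv : 0 < v)
    (I : Ideal (𝓞 K)) : ‖idealWeight χ v hv I‖ ≤ (absNorm I : ℝ) ^ (-(1 + v)) := by
  rw [idealWeight_apply, norm_mul, Complex.norm_real, Real.norm_of_nonneg (by positivity)]
  exact mul_le_of_le_one_left (by positivity) (χ.norm_le_one _)

theorem summable_norm_idealWeight {N : ℕ} (χ : DirichletCharacter ℂ N) (v : ℝ) (hv : 0 < v) :
    Summable fun I : Ideal (𝓞 K) => ‖idealWeight χ v hv I‖ :=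
  Summable.of_nonneg_of_le (fun _ => norm_nonneg _) (norm_idealWeight_le χ v hv)
    (summable_absNorm_rpow hv)

end IdealSums

section PolyVec

open Polynomial

/-- The integral polynomial in `θ` with coefficient vector `a`. -/
def polyVec {R : Type*} [CommRing R] (θ : R) (n : ℕ) : (Fin n → ℤ) →+ R where
  toFun a := ∑ i, (a i : R) * θ ^ (i : ℕ)
  map_zero' := by simp
  map_add' a b := by simp [add_mul, Finset.sum_add_distrib]

theorem polyVec_apply {R : Type*} [CommRing R] (θ : R) (n : ℕ) (a : Fin n → ℤ) :
    polyVec θ n a = ∑ i, (a i : R) * θ ^ (i : ℕ) := rfl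

/-- Multiplication by `θ ^ i` on coefficient vectors, when `θ ^ n = p`. -/
def rotVec {n : ℕ} (p : ℕ) (i : Fin n) (b : Fin n → ℤ) : Fin n → ℤ :=
  fun k => p ^ (((i : ℕ) + (k - i : Fin n)) / n) * b (k - i)

theorem polyVec_rotVec {R : Type*} [CommRing R] {θ : R} {n p : ℕ} (h : θ ^ n = p)
    (i : Fin n) (b : Fin n → ℤ) : polyVec θ n (rotVec p i b) = θ ^ (i : ℕ) * polyVec θ n b := by
  have hn : NeZero n := ⟨by have := i.2; omega⟩
  rw [polyVec_apply, polyVec_apply, ← Equiv.sum_comp (Equiv.addRight i), Finset.mul_sum]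
  refine Finset.sum_congr rfl fun j _ => ?_
  simp only [Equiv.coe_addRight, rotVec, add_sub_cancel_right]
  have e : (i : ℕ) + (j : ℕ) = n * (((i : ℕ) + j) / n) + ((j + i : Fin n) : ℕ) := by
    rw [Fin.val_add, add_comm (j : ℕ), Nat.div_add_mod]
  have : θ ^ (i : ℕ) * θ ^ (j : ℕ) =
      (p : R) ^ (((i : ℕ) + j) / n) * θ ^ ((j + i : Fin n) : ℕ) := by
    rw [← pow_add, e, pow_add, pow_mul, h, ← e]
  push_cast
  linear_combination (-(b j : R)) * this

theorem abs_rotVec_le {n p : ℕ} (hp : 1 ≤ p) (i : Fin n) (b : Fin n → ℤ) (B : ℤ)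
    (hb : ∀ j, |b j| ≤ B) (k : Fin n) : |rotVec p i b k| ≤ p * B := by
  have h1 : ((i : ℕ) + (k - i : Fin n)) / n ≤ 1 := by
    have h1 := i.2
    have h2 := (k - i : Fin n).2
    rw [Nat.div_le_iff_le_mul_add_pred (by omega)]
    omega
  have h2 : (p : ℤ) ^ (((i : ℕ) + (k - i : Fin n)) / n) ≤ (p : ℤ) ^ 1 :=
    pow_le_pow_right₀ (by exact_mod_cast hp) h1
  rw [rotVec, abs_mul, abs_of_nonneg (by positivity : (0 : ℤ) ≤ _)]
  rw [pow_one] at h2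
  exact mul_le_mul h2 (hb _) (abs_nonneg _) (by positivity)

theorem exists_polyVec_eq_of_mem_adjoin {R : Type*} [CommRing R] [Nontrivial R] {θ : R} {n p : ℕ}
    (hn : n ≠ 0) (h : θ ^ n = p) {z : R} (hz : z ∈ Algebra.adjoin ℤ {θ}) :
    ∃ a, polyVec θ n a = z := by
  rw [Algebra.adjoin_singleton_eq_range_aeval] at hz
  obtain ⟨f, rfl⟩ := hz
  have hm : (X ^ n - C (p : ℤ)).Monic := monic_X_pow_sub_C _ hn
  have h0 : aeval θ (X ^ n - C (p : ℤ)) = 0 := by simp [h]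
  have hd : (f %ₘ (X ^ n - C (p : ℤ))).natDegree < n := by
    have := natDegree_modByMonic_lt f hm (by
      intro h1
      have := congrArg natDegree h1
      rw [natDegree_X_pow_sub_C, natDegree_one] at this
      exact hn this)
    rwa [natDegree_X_pow_sub_C] at this
  refine ⟨fun i => (f %ₘ (X ^ n - C (p : ℤ))).coeff i, ?_⟩
  have e := congrArg (aeval θ) (modByMonic_add_div f (X ^ n - C (p : ℤ)))
  rw [map_add, map_mul, h0, zero_mul, add_zero] at e
  change _ = aeval θ f
  rw [← e, aeval_eq_sum_range' hd, polyVec_apply,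
    ← Fin.sum_univ_eq_sum_range (fun i => (f %ₘ (X ^ n - C (p : ℤ))).coeff i • θ ^ i)]
  simp

end PolyVec

section PureField

open NumberField Ideal Polynomial

variable {K : Type*} [Field K] [NumberField K] (pb : PowerBasis ℚ K) {p : ℕ}

theorem minpoly_gen_eq (hp : pb.gen ^ pb.dim = p) :
    minpoly ℚ pb.gen = X ^ pb.dim - C (p : ℚ) := by
  have hn : pb.dim ≠ 0 := pb.dim_pos.ne'
  have hm : (X ^ pb.dim - C (p : ℚ)).Monic := monic_X_pow_sub_C _ hn
  refine (eq_of_monic_of_associated (minpoly.monic pb.isIntegral_gen) hm ?_)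
  refine associated_of_dvd_of_natDegree_le (minpoly.dvd _ _ (by simp [hp])) hm.ne_zero ?_
  rw [natDegree_X_pow_sub_C, pb.natDegree_minpoly]

theorem discr_gen_mul_mem (hp : pb.gen ^ pb.dim = p) {z : K} (hz : IsIntegral ℤ z) :
    ((pb.dim ^ pb.dim * p ^ (pb.dim - 1) : ℕ) : K) * z ∈ Algebra.adjoin ℤ {pb.gen} := by
  have hn : pb.dim ≠ 0 := pb.dim_pos.ne'
  have hint : IsIntegral ℤ pb.gen := by
    refine ⟨X ^ pb.dim - C (p : ℤ), monic_X_pow_sub_C _ hn, ?_⟩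
    simp [hp]
  have h1 := Algebra.discr_mul_isIntegral_mem_adjoin ℚ hint hz
  have hfr : Module.finrank ℚ K = pb.dim := pb.finrank
  have hN : (Algebra.norm ℚ) pb.gen ^ pb.dim = p ^ pb.dim := by
    rw [← map_pow, hp, ← hfr]
    have := Algebra.norm_algebraMap (S := K) (p : ℚ)
    simpa using this
  have hN' : |(Algebra.norm ℚ) pb.gen| = p := by
    have := congrArg abs hN
    rw [abs_pow, abs_pow, Nat.abs_cast] at this
    exact (pow_left_inj₀ (abs_nonneg _) (Nat.cast_nonneg _) hn).1 this
  have hD : |Algebra.discr ℚ pb.basis| = ((pb.dim ^ pb.dim * p ^ (pb.dim - 1) : ℕ) : ℚ) := by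
    rw [Algebra.discr_powerBasis_eq_norm, minpoly_gen_eq pb hp, abs_mul, abs_pow, abs_neg, abs_one,
      one_pow, one_mul]
    have : aeval pb.gen (derivative (X ^ pb.dim - C (p : ℚ))) =
        algebraMap ℚ K (pb.dim : ℚ) * pb.gen ^ (pb.dim - 1) := by
      simp [derivative_X_pow]
    rw [this, map_mul, Algebra.norm_algebraMap, map_pow, abs_mul, abs_pow, abs_pow, hN', hfr]
    simp
  rcases abs_choice (Algebra.discr ℚ pb.basis) with h | h
  · rw [h] at hD
    rw [hD] at h1
    simpa [Algebra.smul_def] using h1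
  · rw [h] at hD
    rw [neg_eq_iff_eq_neg.1 hD] at h1
    have := neg_mem h1
    simpa [Algebra.smul_def] using this

variable (θ : 𝓞 K)

theorem coe_polyVec (n : ℕ) (a : Fin n → ℤ) :
    ((polyVec θ n a : 𝓞 K) : K) = polyVec (θ : K) n a := by
  simp [polyVec_apply]

theorem isUnit_natCast_quotient {Q : ℕ} {𝔠 : Ideal (𝓞 K)} (h : (absNorm 𝔠).Coprime Q) :
    IsUnit ((Q : ℕ) : 𝓞 K ⧸ 𝔠) := by
  have h0 : ((absNorm 𝔠 : ℕ) : 𝓞 K ⧸ 𝔠) = 0 := by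
    have := Ideal.Quotient.eq_zero_iff_mem.2 (absNorm_mem 𝔠)
    simpa using this
  have h1 := Nat.gcd_eq_gcd_ab (absNorm 𝔠) Q
  rw [h] at h1
  have h2 := congrArg (Int.cast : ℤ → 𝓞 K ⧸ 𝔠) h1
  push_cast at h2
  rw [h0, zero_mul, zero_add] at h2
  exact IsUnit.of_mul_eq_one _ h2.symm

theorem exists_polyVec_mk_eq (hθ : (θ : K) = pb.gen) (hp : pb.gen ^ pb.dim = p) {Q : ℕ}
    (hpQ : p ∣ Q) (hnQ : ∃ k, pb.dim ∣ Q ^ k) {𝔠 : Ideal (𝓞 K)} (h : (absNorm 𝔠).Coprime Q)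
    (x : 𝓞 K ⧸ 𝔠) : ∃ a, Ideal.Quotient.mk 𝔠 (polyVec θ pb.dim a) = x := by
  have hn : pb.dim ≠ 0 := pb.dim_pos.ne'
  obtain ⟨k, hk⟩ := hnQ
  set D := pb.dim ^ pb.dim * p ^ (pb.dim - 1)
  have hD : (absNorm 𝔠).Coprime D :=
    Nat.Coprime.mul_right (Nat.Coprime.pow_right _ (Nat.Coprime.coprime_dvd_right hk (h.pow_right _)))
      (Nat.Coprime.pow_right _ (Nat.Coprime.coprime_dvd_right hpQ h))
  obtain ⟨u, hu⟩ := isUnit_natCast_quotient hD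
  obtain ⟨w, hw⟩ := Ideal.Quotient.mk_surjective (I := 𝔠) (((u⁻¹ : (𝓞 K ⧸ 𝔠)ˣ) : 𝓞 K ⧸ 𝔠) * x)
  have hθp : (θ : K) ^ pb.dim = p := by rw [hθ, hp]
  have h1 : ((D : ℕ) : K) * w ∈ Algebra.adjoin ℤ {(θ : K)} := by
    rw [hθ]; exact discr_gen_mul_mem pb hp w.isIntegral_coe
  obtain ⟨a, ha⟩ := exists_polyVec_eq_of_mem_adjoin hn hθp h1
  refine ⟨a, ?_⟩
  have : polyVec θ pb.dim a = (D : ℕ) * w := by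
    apply RingOfIntegers.ext
    rw [coe_polyVec, ha]
    simp
  rw [this, map_mul, hw, map_natCast, ← hu, Units.mul_inv_cancel_left]

/-- Short representatives modulo an ideal prime to the discriminant. -/
theorem exists_polyVec_mk_eq_norm_le (hθ : (θ : K) = pb.gen) (hp : pb.gen ^ pb.dim = p) {Q : ℕ}
    (hp1 : 1 ≤ p) (hpQ : p ∣ Q) (hnQ : ∃ k, pb.dim ∣ Q ^ k) {𝔠 : Ideal (𝓞 K)} (h0 : 𝔠 ≠ ⊥)
    (h : (absNorm 𝔠).Coprime Q) (x : 𝓞 K ⧸ 𝔠) :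
    ∃ a, Ideal.Quotient.mk 𝔠 (polyVec θ pb.dim a) = x ∧
      ‖vecCast a‖ ≤ pb.dim * p * (absNorm 𝔠 : ℝ) ^ (1 / (pb.dim : ℝ)) := by
  have hn : pb.dim ≠ 0 := pb.dim_pos.ne'
  set n := pb.dim with hndef
  have hθp : (θ : K) ^ n = p := by rw [hθ, hp]
  have hθp' : θ ^ n = p := by
    apply RingOfIntegers.coe_injective
    simpa using hθp
  set M : ℝ := (absNorm 𝔠 : ℝ) ^ (1 / (n : ℝ)) with hM
  have hM0 : 0 ≤ M := by positivity
  set B := ⌊M⌋₊ with hB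
  have hfin : Finite (𝓞 K ⧸ 𝔠) := Ideal.finiteQuotientOfFreeOfNeBot _ h0
  have := Fintype.ofFinite (𝓞 K ⧸ 𝔠)
  have hcard : Fintype.card (𝓞 K ⧸ 𝔠) = absNorm 𝔠 := by
    rw [absNorm_apply, Submodule.cardQuot_apply, Nat.card_eq_fintype_card]
  have hlt : Fintype.card (𝓞 K ⧸ 𝔠) < Fintype.card (Fin n → Fin (B + 1)) := by
    rw [hcard, Fintype.card_pi]
    simp only [Fintype.card_fin, Finset.prod_const, Finset.card_univ]
    have h1 : M < (B + 1 : ℕ) := by push_cast; exact Nat.lt_floor_add_one M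
    have h2 : M ^ n < ((B + 1 : ℕ) : ℝ) ^ n := pow_lt_pow_left₀ h1 hM0 hn
    rw [hM, one_div, Real.rpow_inv_natCast_pow (Nat.cast_nonneg _) hn] at h2
    exact_mod_cast h2
  obtain ⟨s, t, hst, he⟩ := Fintype.exists_ne_map_eq_of_card_lt
    (fun s : Fin n → Fin (B + 1) => Ideal.Quotient.mk 𝔠 (polyVec θ n fun i => ((s i : ℕ) : ℤ))) hlt
  set b : Fin n → ℤ := (fun i => ((s i : ℕ) : ℤ)) - fun i => ((t i : ℕ) : ℤ) with hbdef
  have hb0 : b ≠ 0 := by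
    intro hb
    apply hst
    funext i
    have := congrFun hb i
    simp only [hbdef, Pi.sub_apply, Pi.zero_apply, sub_eq_zero] at this
    exact Fin.ext (by exact_mod_cast this)
  have hbB : ∀ j, |b j| ≤ (B : ℤ) := by
    intro j
    have h1 := (s j).2
    have h2 := (t j).2
    simp only [hbdef, Pi.sub_apply, abs_le]
    constructor <;> omega
  set β := polyVec θ n b with hβ
  have hβc : β ∈ 𝔠 := by
    rw [hβ, hbdef, map_sub]
    exact Ideal.Quotient.eq.1 he
  -- coordinates
  let E : (Fin n → ℚ) ≃ₗ[ℚ] K := pb.basis.equivFun.symm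
  have hE : ∀ c : Fin n → ℚ, E c = ∑ i, (c i : K) * (θ : K) ^ (i : ℕ) := by
    intro c
    simp only [E, Module.Basis.equivFun_symm_apply, pb.basis_eq_pow, hθ]
    exact Finset.sum_congr rfl fun i _ => by rw [Algebra.smul_def]; rfl
  have hEZ : ∀ a : Fin n → ℤ, E (fun i => (a i : ℚ)) = (polyVec θ n a : 𝓞 K) := by
    intro a
    rw [hE, coe_polyVec, polyVec_apply]
    simp
  have hβ0 : (β : K) ≠ 0 := by
    intro h1
    rw [hβ, ← hEZ, map_eq_zero_iff _ E.injective] at h1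
    apply hb0
    funext i
    have h2 : ((b i : ℤ) : ℚ) = 0 := congrFun h1 i
    exact_mod_cast h2
  obtain ⟨a, ha⟩ := exists_polyVec_mk_eq pb θ hθ hp hpQ hnQ h x
  obtain ⟨c, hc⟩ := E.surjective ((polyVec θ n a : 𝓞 K) / (β : K))
  have hac : ∀ k, (a k : ℚ) = ∑ i, c i * (rotVec p i b k : ℚ) := by
    have : (fun k => (a k : ℚ)) = ∑ i, c i • fun k => (rotVec p i b k : ℚ) := by
      apply E.injective
      rw [map_sum, hEZ]
      have h1 : (polyVec θ n a : K) = (β : K) * E c := by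
        rw [hc]; field_simp
      rw [h1, hE, Finset.mul_sum]
      refine Finset.sum_congr rfl fun i _ => ?_
      rw [map_smul, hEZ, polyVec_rotVec hθp' i b, Algebra.smul_def]
      simp only [map_mul, map_pow, eq_ratCast]
      rw [← hβ]
      ring
    intro k
    have := congrFun this k
    simpa using this
  refine ⟨a - ∑ i, ⌊c i⌋ • rotVec p i b, ?_, ?_⟩
  · rw [map_sub, map_sum, ← ha, Ideal.Quotient.eq]
    have : polyVec θ n a - ∑ i, polyVec θ n (⌊c i⌋ • rotVec p i b) - polyVec θ n a =
        -∑ i, ((⌊c i⌋ : ℤ) : 𝓞 K) * θ ^ (i : ℕ) * β := by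
      rw [sub_sub_cancel_left]
      congr 1
      refine Finset.sum_congr rfl fun i _ => ?_
      rw [map_zsmul, polyVec_rotVec hθp' i b, zsmul_eq_mul, mul_assoc]
    rw [this]
    exact neg_mem (sum_mem fun i _ => Ideal.mul_mem_left _ _ hβc)
  · rw [pi_norm_le_iff_of_nonneg (by positivity)]
    intro k
    have e : vecCast (a - ∑ i, ⌊c i⌋ • rotVec p i b) k =
        ((∑ i, Int.fract (c i) * (rotVec p i b k : ℚ) : ℚ) : ℝ) := by
      have h1 : (((a - ∑ i, ⌊c i⌋ • rotVec p i b) k : ℤ) : ℚ) =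
          ∑ i, Int.fract (c i) * (rotVec p i b k : ℚ) := by
        simp only [Pi.sub_apply, Finset.sum_apply, Pi.smul_apply, smul_eq_mul, Int.cast_sub,
          Int.cast_sum, Int.cast_mul, hac k, ← Finset.sum_sub_distrib, ← sub_mul, Int.fract]
      rw [← h1, vecCast]
      simp
    rw [e, Real.norm_eq_abs]
    have h2 : |∑ i, Int.fract (c i) * (rotVec p i b k : ℚ)| ≤ n * (p * B) := by
      refine (Finset.abs_sum_le_sum_abs _ _).trans ?_
      have : ∀ i ∈ Finset.univ, |Int.fract (c i) * (rotVec p i b k : ℚ)| ≤ (p * B : ℚ) := by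
        intro i _
        rw [abs_mul, abs_of_nonneg (Int.fract_nonneg _)]
        have h3 : |(rotVec p i b k : ℚ)| ≤ p * B := by
          exact_mod_cast abs_rotVec_le hp1 i b B hbB k
        exact (mul_le_of_le_one_left (abs_nonneg _) (Int.fract_lt_one _).le).trans h3
      refine (Finset.sum_le_sum this).trans (le_of_eq ?_)
      simp
    have h3 : |((∑ i, Int.fract (c i) * (rotVec p i b k : ℚ) : ℚ) : ℝ)| ≤ n * (p * B) := by
      exact_mod_cast h2
    refine h3.trans ?_
    rw [mul_assoc]
    have : (B : ℝ) ≤ M := Nat.floor_le hM0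
    gcongr

end PureField

section NormForm

open NumberField Ideal

/-- The polynomial with real coefficient vector `u` evaluated at a complex number. -/
noncomputable def embVal {n : ℕ} (z : ℂ) (u : Fin n → ℝ) : ℂ := ∑ i, (u i : ℂ) * z ^ (i : ℕ)

/-- The first standard basis vector. -/
def unitVec (n : ℕ) : Fin n → ℝ := fun i => if (i : ℕ) = 0 then 1 else 0

theorem embVal_add {n : ℕ} (z : ℂ) (u u' : Fin n → ℝ) :
    embVal z (u + u') = embVal z u + embVal z u' := by
  simp [embVal, add_mul, Finset.sum_add_distrib]

theorem embVal_smul {n : ℕ} (z : ℂ) (r : ℝ) (u : Fin n → ℝ) :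
    embVal z (r • u) = r * embVal z u := by
  simp [embVal, Finset.mul_sum, mul_assoc]

theorem embVal_unitVec {n : ℕ} (hn : n ≠ 0) (z : ℂ) : embVal z (unitVec n) = 1 := by
  rw [embVal, Finset.sum_eq_single (⟨0, Nat.pos_of_ne_zero hn⟩ : Fin n)]
  · simp [unitVec]
  · intro i _ hi
    have : (i : ℕ) ≠ 0 := fun h => hi (Fin.ext h)
    simp [unitVec, this]
  · simp

theorem embVal_sub {n : ℕ} (z : ℂ) (u u' : Fin n → ℝ) :
    embVal z (u - u') = embVal z u - embVal z u' := by
  simp [embVal, sub_mul]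

theorem embVal_vecCast {n : ℕ} (z : ℂ) (a : Fin n → ℤ) :
    embVal z (vecCast a) = polyVec z n a := by
  simp [embVal, vecCast, polyVec_apply]

theorem norm_embVal_le {n p : ℕ} (hp : 1 ≤ p) {z : ℂ} (hz : z ^ n = p) (u : Fin n → ℝ) :
    ‖embVal z u‖ ≤ n * p * ‖u‖ := by
  have hpow : ∀ i : Fin n, ‖z‖ ^ (i : ℕ) ≤ p := by
    intro i
    have h1 : ‖z‖ ^ n = p := by rw [← norm_pow, hz, Complex.norm_natCast]
    have h2 : 1 ≤ ‖z‖ := by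
      by_contra h
      have := pow_lt_one₀ (norm_nonneg z) (not_le.1 h) (by have := i.2; omega : n ≠ 0)
      rw [h1] at this
      have : p < 1 := by exact_mod_cast this
      omega
    rw [← h1]
    exact pow_le_pow_right₀ h2 i.2.le
  have h1 : ∀ i ∈ Finset.univ, ‖(u i : ℂ) * z ^ (i : ℕ)‖ ≤ ‖u‖ * p := by
    intro i _
    rw [norm_mul, norm_pow, Complex.norm_real]
    exact mul_le_mul (norm_le_pi_norm u i) (hpow i) (by positivity) (norm_nonneg _)
  refine (norm_sum_le_of_le _ h1).trans (le_of_eq ?_)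
  simp
  ring

variable {K : Type*} [Field K] [NumberField K] (pb : PowerBasis ℚ K) {p : ℕ}

/-- The absolute value of the norm form attached to a power basis. -/
noncomputable def normForm (u : Fin pb.dim → ℝ) : ℝ := ∏ σ : K →ₐ[ℚ] ℂ, ‖embVal (σ pb.gen) u‖

theorem card_algHom_complex : Fintype.card (K →ₐ[ℚ] ℂ) = pb.dim := by
  rw [AlgHom.card, pb.finrank]

/-- The distance of the centre of the cone from the origin. -/
def coneCenter (n p : ℕ) : ℝ := 4 * n ^ 2 * p

theorem coneCenter_pos {n p : ℕ} (hn : n ≠ 0) (hp : 1 ≤ p) : 0 < coneCenter n p := by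
  unfold coneCenter; positivity

theorem norm_embVal_sub_le (hp1 : 1 ≤ p) (hp : pb.gen ^ pb.dim = p) (σ : K →ₐ[ℚ] ℂ)
    {u : Fin pb.dim → ℝ} (hu : ‖u - coneCenter pb.dim p • unitVec pb.dim‖ ≤ 1) :
    ‖embVal (σ pb.gen) u - coneCenter pb.dim p‖ ≤ pb.dim * p := by
  have hn : pb.dim ≠ 0 := pb.dim_pos.ne'
  have hz : (σ pb.gen) ^ pb.dim = p := by rw [← map_pow, hp, map_natCast]
  have h1 := norm_embVal_le hp1 hz (u - coneCenter pb.dim p • unitVec pb.dim)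
  rw [embVal_sub, embVal_smul, embVal_unitVec hn, mul_one] at h1
  refine h1.trans ?_
  exact mul_le_of_le_one_right (by positivity) hu

theorem norm_embVal_mem (hp1 : 1 ≤ p) (hp : pb.gen ^ pb.dim = p) (σ : K →ₐ[ℚ] ℂ)
    {u : Fin pb.dim → ℝ} (hu : ‖u - coneCenter pb.dim p • unitVec pb.dim‖ ≤ 1) :
    (1 - 1 / (4 * pb.dim)) * coneCenter pb.dim p ≤ ‖embVal (σ pb.gen) u‖ ∧
      ‖embVal (σ pb.gen) u‖ ≤ (1 + 1 / (4 * pb.dim)) * coneCenter pb.dim p := by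
  have hn : pb.dim ≠ 0 := pb.dim_pos.ne'
  have hn0 : (pb.dim : ℝ) ≠ 0 := by exact_mod_cast hn
  have h1 := norm_embVal_sub_le pb hp1 hp σ hu
  have h2 : (pb.dim * p : ℝ) = 1 / (4 * pb.dim) * coneCenter pb.dim p := by
    unfold coneCenter
    field_simp
  have h3 : ‖(coneCenter pb.dim p : ℂ)‖ = coneCenter pb.dim p := by
    rw [Complex.norm_real, Real.norm_of_nonneg (coneCenter_pos hn hp1).le]
  have h4 := abs_norm_sub_norm_le (embVal (σ pb.gen) u) (coneCenter pb.dim p : ℂ)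
  rw [h3] at h4
  have h5 := abs_le.1 (h4.trans h1)
  constructor <;> linarith [h5.1, h5.2]

theorem normForm_mem (hp1 : 1 ≤ p) (hp : pb.gen ^ pb.dim = p)
    {u : Fin pb.dim → ℝ} (hu : ‖u - coneCenter pb.dim p • unitVec pb.dim‖ ≤ 1) :
    3 / 4 * coneCenter pb.dim p ^ pb.dim ≤ normForm pb u ∧
      normForm pb u ≤ 3 / 2 * coneCenter pb.dim p ^ pb.dim := by
  have hn : pb.dim ≠ 0 := pb.dim_pos.ne'
  have hn1 : (1 : ℝ) ≤ pb.dim := by exact_mod_cast pb.dim_pos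
  have hc := coneCenter_pos hn hp1
  have hle : 1 / (4 * (pb.dim : ℝ)) ≤ 1 / 4 := by
    apply one_div_le_one_div_of_le (by norm_num); linarith
  constructor
  · have h1 : ((1 - 1 / (4 * pb.dim)) * coneCenter pb.dim p) ^ pb.dim ≤ normForm pb u := by
      rw [← card_algHom_complex pb, ← Finset.card_univ, ← Finset.prod_const, normForm]
      refine Finset.prod_le_prod (fun σ _ => ?_) fun σ _ => ?_
      · rw [Finset.card_univ, card_algHom_complex pb]
        exact mul_nonneg (by linarith) hc.le
      · rw [Finset.card_univ, card_algHom_complex pb]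
        exact (norm_embVal_mem pb hp1 hp σ hu).1
    refine le_trans ?_ h1
    rw [mul_pow]
    gcongr
    have := one_add_mul_le_pow (a := -(1 / (4 * (pb.dim : ℝ)))) (by linarith) pb.dim
    refine le_trans (le_of_eq ?_) (this.trans (le_of_eq ?_))
    · field_simp; norm_num
    · ring
  · have h1 : normForm pb u ≤ ((1 + 1 / (4 * pb.dim)) * coneCenter pb.dim p) ^ pb.dim := by
      have : ((1 + 1 / (4 * pb.dim)) * coneCenter pb.dim p) ^ pb.dim =
          ∏ σ : K →ₐ[ℚ] ℂ, ((1 + 1 / (4 * pb.dim)) * coneCenter pb.dim p) := by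
        rw [Finset.prod_const, Finset.card_univ, card_algHom_complex pb]
      rw [this, normForm]
      exact Finset.prod_le_prod (fun σ _ => norm_nonneg _)
        fun σ _ => (norm_embVal_mem pb hp1 hp σ hu).2
    refine h1.trans ?_
    rw [mul_pow]
    gcongr
    have h2 : 1 + 1 / (4 * (pb.dim : ℝ)) ≤ Real.exp (1 / (4 * pb.dim)) := by
      rw [add_comm]; exact Real.add_one_le_exp _
    refine (pow_le_pow_left₀ (by positivity) h2 _).trans ?_
    rw [← Real.exp_nat_mul]
    have h3 : (pb.dim : ℝ) * (1 / (4 * pb.dim)) = 1 / 4 := by field_simp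
    rw [h3]
    have h4 : Real.exp (1 / 4) ^ 4 = Real.exp 1 := by rw [← Real.exp_nat_mul]; norm_num
    by_contra h5
    have h6 := pow_lt_pow_left₀ (not_le.1 h5) (by norm_num) (by norm_num : (4 : ℕ) ≠ 0)
    rw [h4] at h6
    have := Real.exp_one_lt_d9
    norm_num at h6
    linarith

theorem abs_log_sub_log_le {x y m : ℝ} (hm : 0 < m) (hx : m ≤ x) (hy : m ≤ y) :
    |Real.log x - Real.log y| ≤ |x - y| / m := by
  wlog h : y ≤ x generalizing x y
  · rw [abs_sub_comm, abs_sub_comm x]; exact this hy hx (le_of_not_ge h)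
  have hy0 : 0 < y := hm.trans_le hy
  have hx0 : 0 < x := hm.trans_le hx
  rw [abs_of_nonneg (sub_nonneg.2 (Real.log_le_log hy0 h)), abs_of_nonneg (sub_nonneg.2 h),
    ← Real.log_div hx0.ne' hy0.ne']
  refine (Real.log_le_sub_one_of_pos (by positivity)).trans ?_
  rw [div_sub_one hy0.ne']
  exact div_le_div_of_nonneg_left (sub_nonneg.2 h) hm hy

theorem abs_log_normForm_sub_le (hp1 : 1 ≤ p) (hp : pb.gen ^ pb.dim = p)
    {u u' : Fin pb.dim → ℝ} (hu : ‖u - coneCenter pb.dim p • unitVec pb.dim‖ ≤ 1)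
    (hu' : ‖u' - coneCenter pb.dim p • unitVec pb.dim‖ ≤ 1) :
    |Real.log (normForm pb u) - Real.log (normForm pb u')| ≤ ‖u - u'‖ := by
  have hn : pb.dim ≠ 0 := pb.dim_pos.ne'
  have hn1 : (1 : ℝ) ≤ pb.dim := by exact_mod_cast pb.dim_pos
  have hc := coneCenter_pos hn hp1
  have hle : 1 / (4 * (pb.dim : ℝ)) ≤ 1 / 4 := by
    apply one_div_le_one_div_of_le (by norm_num); linarith
  have hlow : ∀ (σ : K →ₐ[ℚ] ℂ) {w : Fin pb.dim → ℝ},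
      ‖w - coneCenter pb.dim p • unitVec pb.dim‖ ≤ 1 →
      3 / 4 * coneCenter pb.dim p ≤ ‖embVal (σ pb.gen) w‖ := by
    intro σ w hw
    refine le_trans ?_ (norm_embVal_mem pb hp1 hp σ hw).1
    gcongr
    linarith
  have hne : ∀ (σ : K →ₐ[ℚ] ℂ) {w : Fin pb.dim → ℝ},
      ‖w - coneCenter pb.dim p • unitVec pb.dim‖ ≤ 1 → ‖embVal (σ pb.gen) w‖ ≠ 0 := by
    intro σ w hw
    have := hlow σ hw
    have : 0 < ‖embVal (σ pb.gen) w‖ := lt_of_lt_of_le (by positivity) this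
    exact this.ne'
  rw [normForm, normForm, Real.log_prod fun σ _ => hne σ hu, Real.log_prod fun σ _ => hne σ hu',
    ← Finset.sum_sub_distrib]
  have hp0 : (0 : ℝ) < p := by exact_mod_cast hp1
  have hterm : ∀ σ ∈ (Finset.univ : Finset (K →ₐ[ℚ] ℂ)),
      |Real.log ‖embVal (σ pb.gen) u‖ - Real.log ‖embVal (σ pb.gen) u'‖| ≤
        ‖u - u'‖ / (3 * pb.dim) := by
    intro σ _
    have hz : (σ pb.gen) ^ pb.dim = p := by rw [← map_pow, hp, map_natCast]
    refine (abs_log_sub_log_le (by positivity) (hlow σ hu) (hlow σ hu')).trans ?_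
    have h1 := (abs_norm_sub_norm_le (embVal (σ pb.gen) u) (embVal (σ pb.gen) u')).trans
      (le_of_eq_of_le (by rw [embVal_sub]) (norm_embVal_le hp1 hz (u - u')))
    rw [div_le_div_iff₀ (by positivity) (by positivity)]
    have h2 : (3 / 4 * coneCenter pb.dim p) = 3 * pb.dim * (pb.dim * p) := by
      unfold coneCenter; ring
    rw [h2]
    nlinarith [mul_le_mul_of_nonneg_left h1 (by positivity : (0 : ℝ) ≤ 3 * pb.dim)]
  refine (Finset.abs_sum_le_sum_abs _ _).trans ((Finset.sum_le_sum hterm).trans ?_)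
  rw [Finset.sum_const, Finset.card_univ, card_algHom_complex pb, nsmul_eq_mul]
  have : (pb.dim : ℝ) * (‖u - u'‖ / (3 * pb.dim)) = ‖u - u'‖ / 3 := by field_simp
  rw [this]
  linarith [norm_nonneg (u - u')]

theorem norm_prod_one_add_sub_one_lt {ι : Type*} [Fintype ι] (hn : 0 < Fintype.card ι) (z : ι → ℂ)
    (hz : ∀ i, ‖z i - 1‖ ≤ 1 / (4 * Fintype.card ι)) : ‖∏ i, z i - 1‖ < 1 := by
  have key : ∀ (s : Finset ι), ‖∏ i ∈ s, z i - 1‖ ≤ (1 + 1 / (4 * (Fintype.card ι : ℝ))) ^ s.card - 1 := by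
    intro s
    induction s using Finset.induction_on with
    | empty => simp
    | insert i s hi ih =>
      rw [Finset.prod_insert hi, Finset.card_insert_of_notMem hi]
      have e : z i * ∏ j ∈ s, z j - 1 = z i * (∏ j ∈ s, z j - 1) + (z i - 1) := by ring
      rw [e]
      have h1 : ‖z i‖ ≤ 1 + 1 / (4 * (Fintype.card ι : ℝ)) := by
        have := norm_add_le (z i - 1) 1
        rw [sub_add_cancel, norm_one] at this
        linarith [hz i]
      refine (norm_add_le _ _).trans ?_
      rw [norm_mul]
      have h2 := mul_le_mul h1 ih (norm_nonneg _) (by positivity)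
      rw [pow_succ]
      linarith [hz i]
  have hn0 : (0 : ℝ) < Fintype.card ι := by exact_mod_cast hn
  refine (key Finset.univ).trans_lt ?_
  rw [Finset.card_univ]
  have h2 : 1 + 1 / (4 * (Fintype.card ι : ℝ)) ≤ Real.exp (1 / (4 * Fintype.card ι)) := by
    rw [add_comm]; exact Real.add_one_le_exp _
  have h3 := pow_le_pow_left₀ (by positivity) h2 (Fintype.card ι)
  rw [← Real.exp_nat_mul, show (Fintype.card ι : ℝ) * (1 / (4 * Fintype.card ι)) = 1 / 4 by
    field_simp] at h3
  have h4 : Real.exp (1 / 4) ^ 4 = Real.exp 1 := by rw [← Real.exp_nat_mul]; norm_num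
  have h5 : Real.exp (1 / 4) < 2 := by
    by_contra h5
    have h6 := pow_le_pow_left₀ (by norm_num) (not_lt.1 h5) 4
    rw [h4] at h6
    have := Real.exp_one_lt_d9
    linarith
  linarith

variable (θ : 𝓞 K)

theorem norm_one_add_mul_modEq (Q : ℕ) (γ : 𝓞 K) :
    ((Algebra.norm ℤ (1 + (Q : 𝓞 K) * γ) : ℤ) : ZMod Q) = 1 := by
  let b := RingOfIntegers.basis K
  rw [Algebra.norm_eq_matrix_det b, map_add, map_mul, map_one, map_natCast]
  have h1 := RingHom.map_det (Int.castRingHom (ZMod Q))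
    (1 + (Q : Matrix _ _ ℤ) * (Algebra.leftMulMatrix b) γ)
  rw [eq_intCast] at h1
  rw [h1, map_add, map_mul, map_one, map_natCast]
  have : ((Q : ℕ) : Matrix (Module.Free.ChooseBasisIndex ℤ (𝓞 K))
      (Module.Free.ChooseBasisIndex ℤ (𝓞 K)) (ZMod Q)) = 0 := by
    ext i j
    by_cases h : i = j <;> simp [Matrix.natCast_apply, h]
  rw [this, zero_mul, add_zero, Matrix.det_one]

/-- Norms of elements `1 + Q γ` in the cone. -/
theorem absNorm_span_one_add (hθ : (θ : K) = pb.gen) (hp1 : 1 ≤ p) (hp : pb.gen ^ pb.dim = p)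
    (Q : ℕ) {H : ℝ} (hH : 0 < H) (a : Fin pb.dim → ℤ)
    (hu : ‖((Q : ℝ) / H) • vecCast a + (1 / H) • unitVec pb.dim
      - coneCenter pb.dim p • unitVec pb.dim‖ ≤ 1) :
    ((absNorm (Ideal.span {1 + (Q : 𝓞 K) * polyVec θ pb.dim a}) : ℕ) : ZMod Q) = 1 ∧
    (absNorm (Ideal.span {1 + (Q : 𝓞 K) * polyVec θ pb.dim a}) : ℝ) =
      H ^ pb.dim * normForm pb (((Q : ℝ) / H) • vecCast a + (1 / H) • unitVec pb.dim) := by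
  have hn : pb.dim ≠ 0 := pb.dim_pos.ne'
  have hc := coneCenter_pos hn hp1
  set u := ((Q : ℝ) / H) • vecCast a + (1 / H) • unitVec pb.dim with hudef
  set α : 𝓞 K := 1 + (Q : 𝓞 K) * polyVec θ pb.dim a with hα
  have hσ : ∀ σ : K →ₐ[ℚ] ℂ, σ (α : K) = H * embVal (σ pb.gen) u := by
    intro σ
    have hH' : (H : ℂ) ≠ 0 := by exact_mod_cast hH.ne'
    rw [hudef, embVal_add, embVal_smul, embVal_smul, embVal_unitVec hn, embVal_vecCast]
    have : σ ((polyVec θ pb.dim a : 𝓞 K) : K) = polyVec (σ pb.gen) pb.dim a := by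
      rw [coe_polyVec, polyVec_apply, polyVec_apply, map_sum, hθ]
      simp
    have e : (α : K) = 1 + (Q : K) * ((polyVec θ pb.dim a : 𝓞 K) : K) := by simp [hα]
    rw [e, map_add, map_mul, map_one, map_natCast, this]
    push_cast
    field_simp
    ring
  have hN : ((Algebra.norm ℤ α : ℤ) : ℂ) = ∏ σ : K →ₐ[ℚ] ℂ, (H * embVal (σ pb.gen) u) := by
    have h1 := Algebra.norm_eq_prod_embeddings ℚ ℂ (α : K)
    rw [Finset.prod_congr rfl fun σ _ => hσ σ] at h1
    rw [← h1, ← Algebra.coe_norm_int]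
    simp
  have hpos : 0 < Algebra.norm ℤ α := by
    have h1 : ‖∏ σ : K →ₐ[ℚ] ℂ, (embVal (σ pb.gen) u / coneCenter pb.dim p) - 1‖ < 1 := by
      apply norm_prod_one_add_sub_one_lt
      · rw [card_algHom_complex pb]; exact pb.dim_pos
      · intro σ
        have hc' : (coneCenter pb.dim p : ℂ) ≠ 0 := by exact_mod_cast hc.ne'
        rw [card_algHom_complex pb, div_sub_one hc', norm_div, Complex.norm_real,
          Real.norm_of_nonneg hc.le, div_le_iff₀ hc]
        refine (norm_embVal_sub_le pb hp1 hp σ hu).trans (le_of_eq ?_)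
        unfold coneCenter
        have hn0 : (pb.dim : ℝ) ≠ 0 := by exact_mod_cast hn
        field_simp
    have h2 : ∏ σ : K →ₐ[ℚ] ℂ, (embVal (σ pb.gen) u / coneCenter pb.dim p) =
        (((Algebra.norm ℤ α : ℤ) / (H * coneCenter pb.dim p) ^ pb.dim : ℝ) : ℂ) := by
      rw [Finset.prod_div_distrib, Finset.prod_const, Finset.card_univ, card_algHom_complex pb]
      push_cast
      rw [hN, Finset.prod_mul_distrib, Finset.prod_const, Finset.card_univ, card_algHom_complex pb]
      have hc' : (coneCenter pb.dim p : ℂ) ≠ 0 := by exact_mod_cast hc.ne'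
      have hH' : (H : ℂ) ≠ 0 := by exact_mod_cast hH.ne'
      rw [mul_pow]
      field_simp
    rw [h2, ← Complex.ofReal_one, ← Complex.ofReal_sub, Complex.norm_real, Real.norm_eq_abs,
      abs_lt] at h1
    have h3 : (0 : ℝ) < (Algebra.norm ℤ α : ℤ) / (H * coneCenter pb.dim p) ^ pb.dim := by linarith
    have h4 : (0 : ℝ) < (Algebra.norm ℤ α : ℤ) := by
      rwa [div_pos_iff_of_pos_right (by positivity)] at h3
    exact_mod_cast h4
  rw [absNorm_span_singleton]
  constructor
  · have h1 := norm_one_add_mul_modEq Q (polyVec θ pb.dim a)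
    rw [← hα] at h1
    rw [← h1, ← Int.cast_natCast, Int.natAbs_of_nonneg hpos.le]
  · have h1 : (((Algebra.norm ℤ α).natAbs : ℕ) : ℝ) = ‖((Algebra.norm ℤ α : ℤ) : ℂ)‖ := by
      rw [Complex.norm_intCast, Nat.cast_natAbs, Int.cast_abs]
    rw [h1, hN, norm_prod, normForm]
    simp only [norm_mul, Complex.norm_real, Real.norm_of_nonneg hH.le]
    rw [Finset.prod_mul_distrib, Finset.prod_const, Finset.card_univ, card_algHom_complex pb]

end NormForm

section ConeWeight

open MeasureTheory

/-- The tent function of radius one about `z`. -/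
noncomputable def tent {E : Type*} [NormedAddCommGroup E] (z u : E) : ℝ := max 0 (1 - ‖u - z‖)

variable {E : Type*} [NormedAddCommGroup E] (z : E)

theorem tent_nonneg (u : E) : 0 ≤ tent z u := le_max_left _ _

theorem tent_le_one (u : E) : tent z u ≤ 1 :=
  max_le zero_le_one (by linarith [norm_nonneg (u - z)])

theorem tent_eq_zero {u : E} (h : 1 ≤ ‖u - z‖) : tent z u = 0 := max_eq_left (by linarith)

theorem norm_sub_lt_of_tent_ne_zero {u : E} (h : tent z u ≠ 0) : ‖u - z‖ < 1 := by
  by_contra h'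
  exact h (tent_eq_zero z (not_lt.1 h'))

theorem abs_tent_sub_le (u u' : E) : |tent z u - tent z u'| ≤ ‖u - u'‖ := by
  refine (abs_max_sub_max_le_max _ _ _ _).trans ?_
  rw [sub_self, abs_zero]
  refine max_le (norm_nonneg _) ?_
  have h1 : 1 - ‖u - z‖ - (1 - ‖u' - z‖) = -(‖u - z‖ - ‖u' - z‖) := by ring
  rw [h1, abs_neg]
  refine (abs_norm_sub_norm_le _ _).trans ?_
  rw [sub_sub_sub_cancel_right]

/-- A tent times a function which is bounded and Lipschitz on the support of the tent is
Lipschitz. -/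
theorem abs_tent_mul_sub_le {G : E → ℝ} {M Λ : ℝ} (hΛ : 0 ≤ Λ)
    (hM : ∀ u, ‖u - z‖ ≤ 1 → |G u| ≤ M)
    (hL : ∀ u u', ‖u - z‖ ≤ 1 → ‖u' - z‖ ≤ 1 → |G u - G u'| ≤ Λ * ‖u - u'‖) (u u' : E) :
    |tent z u * G u - tent z u' * G u'| ≤ (M + Λ) * ‖u - u'‖ := by
  have hM0 : 0 ≤ M := (abs_nonneg _).trans (hM z (by simp))
  have half : ∀ u u', ‖u - z‖ ≤ 1 → 1 < ‖u' - z‖ →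
      |tent z u * G u - tent z u' * G u'| ≤ (M + Λ) * ‖u - u'‖ := by
    intro u u' hu hu'
    have h0 := tent_eq_zero z hu'.le
    have h1 := abs_tent_sub_le z u u'
    rw [h0, sub_zero, abs_of_nonneg (tent_nonneg z u)] at h1
    rw [h0, zero_mul, sub_zero, abs_mul, abs_of_nonneg (tent_nonneg z u)]
    have := mul_le_mul h1 (hM u hu) (abs_nonneg _) (norm_nonneg _)
    nlinarith [mul_nonneg hΛ (norm_nonneg (u - u'))]
  by_cases hu : ‖u - z‖ ≤ 1 <;> by_cases hu' : ‖u' - z‖ ≤ 1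
  · have e : tent z u * G u - tent z u' * G u' =
        (tent z u - tent z u') * G u + tent z u' * (G u - G u') := by ring
    rw [e]
    refine (abs_add_le _ _).trans ?_
    rw [abs_mul, abs_mul, abs_of_nonneg (tent_nonneg z u')]
    have h1 := mul_le_mul (abs_tent_sub_le z u u') (hM u hu) (abs_nonneg _) (norm_nonneg _)
    have h2 := mul_le_mul (tent_le_one z u') (hL u u' hu hu') (abs_nonneg _) zero_le_one
    linarith
  · exact half u u' hu (not_le.1 hu')
  · rw [abs_sub_comm, norm_sub_rev]
    exact half u' u hu' (not_le.1 hu)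
  · rw [tent_eq_zero z (not_le.1 hu).le, tent_eq_zero z (not_le.1 hu').le, zero_mul, zero_mul,
      sub_zero, abs_zero]
    positivity

theorem half_le_integral_tent {n : ℕ} (z : Fin n → ℝ) : 1 / 2 ≤ ∫ u, tent z u := by
  have hcont : Continuous (tent z) := by unfold tent; fun_prop
  have hint : Integrable (tent z) := by
    refine hcont.integrable_of_hasCompactSupport ?_
    refine HasCompactSupport.intro (isCompact_closedBall z 1) fun x hx => tent_eq_zero z ?_
    rw [Metric.mem_closedBall, dist_eq_norm, not_le] at hx
    exact hx.le
  have hv : volume.real (Metric.closedBall z (1 / 2)) = 1 := by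
    rw [Measure.real, Real.volume_pi_closedBall _ (by norm_num)]
    norm_num
  have h1 : ∫ u in Metric.closedBall z (1 / 2), (1 / 2 : ℝ) ≤ ∫ u, tent z u := by
    refine le_trans (setIntegral_mono_on ?_ hint.integrableOn measurableSet_closedBall ?_)
      (setIntegral_le_integral hint (Filter.Eventually.of_forall fun u => tent_nonneg z u))
    · exact integrableOn_const (isCompact_closedBall z _).measure_lt_top.ne
    · intro u hu
      rw [Metric.mem_closedBall, dist_eq_norm] at hu
      exact le_max_of_le_right (by linarith)
  rw [setIntegral_const, hv] at h1
  simpa using h1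

end ConeWeight

section LatticeIdeal

open NumberField Ideal MeasureTheory

variable {K : Type*} [Field K] [NumberField K] (pb : PowerBasis ℚ K) {p : ℕ} (θ : 𝓞 K)

theorem lattice_sum_mem_ideal_sub_integral_le (hθ : (θ : K) = pb.gen)
    (hp : pb.gen ^ pb.dim = p) {Q : ℕ} (hp1 : 1 ≤ p) (hpQ : p ∣ Q)
    (hnQ : ∃ k, pb.dim ∣ Q ^ k) {𝔠 : Ideal (𝓞 K)} (h0 : 𝔠 ≠ ⊥) (hc : (absNorm 𝔠).Coprime Q)
    (Ψ : (Fin pb.dim → ℝ) → ℝ) (ℓ : ℝ) (hℓ : 0 ≤ ℓ) (z : Fin pb.dim → ℝ)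
    (hL : ∀ x y, |Ψ x - Ψ y| ≤ ℓ * ‖x - y‖) (hS : ∀ x, 1 < ‖x - z‖ → Ψ x = 0)
    (h : ℝ) (hh : 0 < h) (t : Fin pb.dim → ℝ) (T : ℝ) (hT1 : T ≤ 1)
    (hT : h * (pb.dim * p * (absNorm 𝔠 : ℝ) ^ (1 / (pb.dim : ℝ))) ≤ T) :
    |h ^ pb.dim * (absNorm 𝔠 * ∑' a : Fin pb.dim → ℤ,
      if 1 + (Q : 𝓞 K) * polyVec θ pb.dim a ∈ 𝔠 then Ψ (h • vecCast a + t) else 0) - ∫ x, Ψ x| ≤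
      2 * (ℓ * T * 5 ^ pb.dim) := by
  have hn1 : (1 : ℝ) ≤ pb.dim := by exact_mod_cast pb.dim_pos
  have hfin : Finite (𝓞 K ⧸ 𝔠) := Ideal.finiteQuotientOfFreeOfNeBot _ h0
  have := Fintype.ofFinite (𝓞 K ⧸ 𝔠)
  have hcard : Fintype.card (𝓞 K ⧸ 𝔠) = absNorm 𝔠 := by
    rw [absNorm_apply, Submodule.cardQuot_apply, Nat.card_eq_fintype_card]
  have hN1 : (1 : ℝ) ≤ absNorm 𝔠 := by
    have : absNorm 𝔠 ≠ 0 := by rwa [Ne, absNorm_eq_zero_iff]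
    exact_mod_cast Nat.pos_of_ne_zero this
  choose δ hδ1 hδ2 using exists_polyVec_mk_eq_norm_le pb θ hθ hp hp1 hpQ hnQ h0 hc
  let φ : (Fin pb.dim → ℤ) →+ 𝓞 K ⧸ 𝔠 :=
    (Ideal.Quotient.mk 𝔠).toAddMonoidHom.comp (polyVec θ pb.dim)
  have hφ : ∀ a, φ a = Ideal.Quotient.mk 𝔠 (polyVec θ pb.dim a) := fun _ => rfl
  obtain ⟨w, hw⟩ := isUnit_natCast_quotient hc
  have hiff : ∀ a, 1 + (Q : 𝓞 K) * polyVec θ pb.dim a ∈ 𝔠 ↔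
      φ a = -((w⁻¹ : (𝓞 K ⧸ 𝔠)ˣ) : 𝓞 K ⧸ 𝔠) := by
    intro a
    rw [← Ideal.Quotient.eq_zero_iff_mem, map_add, map_mul, map_one, map_natCast, ← hw, hφ]
    constructor
    · intro h1
      have h2 := congrArg (fun x => ((w⁻¹ : (𝓞 K ⧸ 𝔠)ˣ) : 𝓞 K ⧸ 𝔠) * x) h1
      simp only [mul_add, mul_one, mul_zero, Units.inv_mul_cancel_left] at h2
      exact (neg_eq_of_add_eq_zero_right h2).symm
    · intro h1
      rw [h1, mul_neg, Units.mul_inv, add_neg_cancel]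
  have hρ1 : (1 : ℝ) ≤ pb.dim * p * (absNorm 𝔠 : ℝ) ^ (1 / (pb.dim : ℝ)) := by
    have h1 : (1 : ℝ) ≤ (absNorm 𝔠 : ℝ) ^ (1 / (pb.dim : ℝ)) :=
      Real.one_le_rpow hN1 (by positivity)
    have h2 : (1 : ℝ) ≤ p := by exact_mod_cast hp1
    exact one_le_mul_of_one_le_of_one_le (one_le_mul_of_one_le_of_one_le hn1 h2) h1
  have key := riemann_sum_fiber_sub_integral_le φ δ (fun x => by rw [hφ, hδ1]) _ hρ1 hδ2 Ψ ℓ hℓ z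
    hL hS h hh (hT.trans hT1) t (-((w⁻¹ : (𝓞 K ⧸ 𝔠)ˣ) : 𝓞 K ⧸ 𝔠))
  rw [hcard] at key
  simp only [← hiff] at key
  refine key.trans ?_
  gcongr

end LatticeIdeal

section Symmetry

open NumberField Ideal MeasureTheory

variable {K : Type*} [Field K] [NumberField K]

theorem finite_ideals_absNorm_le (X : ℝ) : {I : Ideal (𝓞 K) | I ≠ ⊥ ∧ (absNorm I : ℝ) ≤ X}.Finite :=
  (Ideal.finite_setOfPred_absNorm_le ⌊X⌋₊).subset fun _ hI => Nat.le_floor hI.2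

variable (K) in
/-- The nonzero ideals of norm at most `X`. -/
noncomputable def idealsUpTo (X : ℝ) : Finset (Ideal (𝓞 K)) := (finite_ideals_absNorm_le X).toFinset

theorem mem_idealsUpTo {X : ℝ} {I : Ideal (𝓞 K)} :
    I ∈ idealsUpTo K X ↔ I ≠ ⊥ ∧ (absNorm I : ℝ) ≤ X := by
  simp [idealsUpTo]

theorem sum_dvd_flip {A 𝔟 : Ideal (𝓞 K)} (hA : A ≠ ⊥) (D : Finset (Ideal (𝓞 K)))
    (F G : Ideal (𝓞 K) → ℂ) (h : ∀ 𝔡 𝔢, 𝔟 * 𝔡 * 𝔢 = A → F 𝔡 = G 𝔢)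
    (hF : ∀ 𝔡, 𝔟 * 𝔡 ∣ A → F 𝔡 ≠ 0 → 𝔡 ∈ D) (hG : ∀ 𝔢, 𝔟 * 𝔢 ∣ A → G 𝔢 ≠ 0 → 𝔢 ∈ D) :
    ∑ 𝔡 ∈ D, (if 𝔟 * 𝔡 ∣ A then F 𝔡 else 0) = ∑ 𝔢 ∈ D, (if 𝔟 * 𝔢 ∣ A then G 𝔢 else 0) := by
  have hq : ∀ 𝔡, ∃ 𝔢, 𝔟 * 𝔡 ∣ A → 𝔟 * 𝔡 * 𝔢 = A := by
    intro 𝔡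
    by_cases hd : 𝔟 * 𝔡 ∣ A
    · obtain ⟨𝔢, he⟩ := hd
      exact ⟨𝔢, fun _ => he.symm⟩
    · exact ⟨𝔡, fun h => absurd h hd⟩
  choose q hq using hq
  have hne : ∀ {F : Ideal (𝓞 K) → ℂ} {𝔡}, (if 𝔟 * 𝔡 ∣ A then F 𝔡 else 0) ≠ 0 →
      𝔟 * 𝔡 ∣ A ∧ F 𝔡 ≠ 0 := by
    intro F 𝔡 h
    by_cases hd : 𝔟 * 𝔡 ∣ A
    · rw [if_pos hd] at h; exact ⟨hd, h⟩
    · rw [if_neg hd] at h; exact absurd rfl h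
  have hcomm : ∀ {𝔡 𝔢}, 𝔟 * 𝔡 * 𝔢 = A → 𝔟 * 𝔢 * 𝔡 = A := fun h => by
    rw [← h, mul_right_comm]
  have hcancel : ∀ {𝔡 𝔢 𝔢'}, 𝔟 * 𝔡 * 𝔢 = A → 𝔟 * 𝔡 * 𝔢' = A → 𝔢 = 𝔢' := by
    intro 𝔡 𝔢 𝔢' h1 h2
    refine mul_left_cancel₀ (a := 𝔟 * 𝔡) ?_ (h1.trans h2.symm)
    intro h0
    rw [h0, zero_mul] at h1
    exact hA h1.symm
  refine Finset.sum_bij_ne_zero (fun 𝔡 _ _ => q 𝔡) ?_ ?_ ?_ ?_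
  · intro 𝔡 _ hd
    obtain ⟨h1, h2⟩ := hne hd
    have h3 := hq 𝔡 h1
    refine hG _ (Dvd.intro _ (hcomm h3)) ?_
    rwa [← h _ _ h3]
  · intro 𝔡 _ hd 𝔡' _ hd' he
    have h3 := hq 𝔡 (hne hd).1
    have h3' := hq 𝔡' (hne hd').1
    rw [← he] at h3'
    exact hcancel (hcomm h3) (hcomm h3')
  · intro 𝔢 _ he
    obtain ⟨h1, h2⟩ := hne he
    have h3 := hcomm (hq 𝔢 h1)
    have h4 : F (q 𝔢) ≠ 0 := by rwa [h _ _ h3]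
    have h5 : 𝔟 * q 𝔢 ∣ A := Dvd.intro _ h3
    refine ⟨q 𝔢, hF _ h5 h4, ?_, hcancel (hq _ h5) h3⟩
    rwa [if_pos h5]
  · intro 𝔡 _ hd
    obtain ⟨h1, h2⟩ := hne hd
    have h3 := hq 𝔡 h1
    rw [if_pos h1, if_pos (Dvd.intro _ (hcomm h3)), h _ _ h3]

variable {Q : ℕ} (χ : DirichletCharacter ℂ Q)

/-- The sum of `χ(N𝔡) g(log N𝔡) / N𝔡` over ideals of norm at most `X`. -/
noncomputable def idealSum (K : Type*) [Field K] [NumberField K] {Q : ℕ}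
    (χ : DirichletCharacter ℂ Q) (X : ℝ) (g : ℝ → ℝ) : ℂ :=
  ∑ 𝔡 ∈ idealsUpTo K X, χ (absNorm 𝔡 : ZMod Q) * ((g (Real.log (absNorm 𝔡)) / absNorm 𝔡 : ℝ) : ℂ)

variable (pb : PowerBasis ℚ K) (p : ℕ)

/-- The centre of the cone. -/
noncomputable def coneVec : Fin pb.dim → ℝ := coneCenter pb.dim p • unitVec pb.dim

/-- The sum over ideals dual to `idealSum`. -/
noncomputable def dualSum (X y : ℝ) (g : ℝ → ℝ) : ℂ :=
  ∑ 𝔢 ∈ idealsUpTo K X, (starRingEnd ℂ) (χ (absNorm 𝔢 : ZMod Q)) *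
    (((∫ u, tent (coneVec pb p) u * g (Real.log (normForm pb u) + y - Real.log (absNorm 𝔢)))
      / absNorm 𝔢 : ℝ) : ℂ)

/-- The total mass of the weight on the cone. -/
noncomputable def coneMass : ℝ := ∫ u, tent (coneVec pb p) u

theorem finite_tent_ne_zero {n : ℕ} (z t : Fin n → ℝ) {h : ℝ} (hh : 0 < h) :
    {a : Fin n → ℤ | tent z (h • vecCast a + t) ≠ 0}.Finite := by
  refine (finite_ncard_vecCast h hh (t - z) 1 zero_le_one).1.subset fun a ha => ?_
  have := (norm_sub_lt_of_tent_ne_zero z ha).le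
  rwa [add_sub_assoc] at this

theorem norm_sum_mul_sub_le (D : Finset (Ideal (𝓞 K))) (c : Ideal (𝓞 K) → ℂ)
    (A B : Ideal (𝓞 K) → ℝ) (ε : ℝ) (hD : ∀ 𝔡 ∈ D, 𝔡 ≠ ⊥)
    (h : ∀ 𝔡 ∈ D, c 𝔡 ≠ 0 → ‖c 𝔡‖ * |absNorm 𝔡 * A 𝔡 - B 𝔡| ≤ ε) (hε : 0 ≤ ε) :
    ‖∑ 𝔡 ∈ D, c 𝔡 * (A 𝔡 : ℂ) - ∑ 𝔡 ∈ D, c 𝔡 * ((B 𝔡 / absNorm 𝔡 : ℝ) : ℂ)‖ ≤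
      ε * ∑ 𝔡 ∈ D, (absNorm 𝔡 : ℝ)⁻¹ := by
  rw [← Finset.sum_sub_distrib, Finset.mul_sum]
  refine norm_sum_le_of_le _ fun 𝔡 hd => ?_
  have hN : (0 : ℝ) < absNorm 𝔡 := by
    have : absNorm 𝔡 ≠ 0 := by rw [Ne, absNorm_eq_zero_iff]; exact hD 𝔡 hd
    exact_mod_cast Nat.pos_of_ne_zero this
  have e : c 𝔡 * (A 𝔡 : ℂ) - c 𝔡 * ((B 𝔡 / absNorm 𝔡 : ℝ) : ℂ) =
      c 𝔡 * (((absNorm 𝔡 * A 𝔡 - B 𝔡) * (absNorm 𝔡 : ℝ)⁻¹ : ℝ) : ℂ) := by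
    rw [← mul_sub, ← Complex.ofReal_sub]
    congr 2
    field_simp
  rw [e, norm_mul, Complex.norm_real, Real.norm_eq_abs, abs_mul,
    abs_of_nonneg (inv_nonneg.2 hN.le), ← mul_assoc]
  by_cases hc : c 𝔡 = 0
  · rw [hc, norm_zero, zero_mul, zero_mul]; positivity
  · exact mul_le_mul_of_nonneg_right (h 𝔡 hd hc) (inv_nonneg.2 hN.le)

theorem symmetry_bound {θ : 𝓞 K} (hθ : (θ : K) = pb.gen)
    (hp : pb.gen ^ pb.dim = p) (hp1 : 1 ≤ p) (hpQ : p ∣ Q) (hQ : 1 < Q)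
    (hnQ : ∃ k, pb.dim ∣ Q ^ k) {𝔟 : Ideal (𝓞 K)} (hb : (absNorm 𝔟).Coprime Q)
    {g : ℝ → ℝ} {M κ : ℝ} (hgM : ∀ x, |g x| ≤ M) (hgL : ∀ x y, |g x - g y| ≤ M * |x - y|)
    (hgS : ∀ x, g x ≠ 0 → |x - κ| ≤ 2) {X Y T : ℝ} (hX : 1 ≤ X) (hY : 0 < Y)
    (hX1 : Real.exp (κ + 2) ≤ X)
    (hX2 : 3 / 2 * coneCenter pb.dim p ^ pb.dim * Y * Real.exp (2 - κ) ≤ X)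
    (hT1 : T ≤ 1) (hT : Q * (pb.dim * p * (X / Y) ^ (1 / (pb.dim : ℝ))) ≤ T) :
    ‖χ (absNorm 𝔟 : ZMod Q) * (coneMass pb p * idealSum K χ X g)
        - dualSum χ pb p X (Real.log Y) g‖ ≤
      6 * M * T * 5 ^ pb.dim * (1 + Real.log X) ^ pb.dim := by
  have hn : pb.dim ≠ 0 := pb.dim_pos.ne'
  have hn0 : (pb.dim : ℝ) ≠ 0 := by exact_mod_cast hn
  have hQ0 : (0 : ℝ) < Q := by exact_mod_cast (zero_lt_one.trans hQ)
  have hM0 : 0 ≤ M := (abs_nonneg _).trans (hgM 0)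
  have hb0 : 𝔟 ≠ ⊥ := by
    rintro rfl
    rw [absNorm_bot, Nat.coprime_zero_left] at hb
    omega
  have hNb : (0 : ℝ) < absNorm 𝔟 := by
    have : absNorm 𝔟 ≠ 0 := by rwa [Ne, absNorm_eq_zero_iff]
    exact_mod_cast Nat.pos_of_ne_zero this
  have hT0 : 0 ≤ T := le_trans (by positivity) hT
  set n := pb.dim with hndef
  set z := coneVec pb p with hz
  set D := idealsUpTo K X with hD
  have hDmem : ∀ 𝔡 ∈ D, 𝔡 ≠ ⊥ ∧ (absNorm 𝔡 : ℝ) ≤ X := fun 𝔡 h => mem_idealsUpTo.1 h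
  set H : ℝ := (Y * absNorm 𝔟) ^ (1 / (n : ℝ)) with hHdef
  have hH : 0 < H := by positivity
  have hHn : H ^ n = Y * absNorm 𝔟 := by
    rw [hHdef, one_div, Real.rpow_inv_natCast_pow (by positivity) hn]
  set h : ℝ := Q / H with hh
  have hh0 : 0 < h := by positivity
  set t : Fin n → ℝ := (1 / H) • unitVec n with ht
  set α : (Fin n → ℤ) → 𝓞 K := fun a => 1 + (Q : 𝓞 K) * polyVec θ n a with hα
  set u : (Fin n → ℤ) → (Fin n → ℝ) := fun a => h • vecCast a + t with hu
  set W := tent z with hW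
  have hWfin : {a | W (u a) ≠ 0}.Finite := finite_tent_ne_zero z t hh0
  -- lattice sums
  have hlat : ∀ 𝔡 ∈ D, (absNorm 𝔡).Coprime Q → ∀ (Ψ : (Fin n → ℝ) → ℝ) (ℓ : ℝ), 0 ≤ ℓ →
      (∀ x y, |Ψ x - Ψ y| ≤ ℓ * ‖x - y‖) → (∀ x, 1 < ‖x - z‖ → Ψ x = 0) →
      |absNorm 𝔡 * (h ^ n * absNorm 𝔟 * ∑' a, if α a ∈ 𝔟 * 𝔡 then Ψ (u a) else 0) - ∫ x, Ψ x| ≤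
        2 * (ℓ * T * 5 ^ n) := by
    intro 𝔡 hd hdc Ψ ℓ hℓ hL hS
    obtain ⟨hd0, hdX⟩ := hDmem 𝔡 hd
    have := lattice_sum_mem_ideal_sub_integral_le pb θ hθ hp hp1 hpQ hnQ (𝔠 := 𝔟 * 𝔡)
      (mul_ne_zero hb0 hd0) (by rw [map_mul]; exact Nat.Coprime.mul_left hb hdc) Ψ ℓ hℓ z hL hS
      h hh0 t T hT1 ?_
    · refine le_of_eq_of_le ?_ this
      congr 2
      rw [map_mul]
      push_cast
      ring
    · refine le_trans ?_ hT
      rw [map_mul, hh, div_mul_eq_mul_div]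
      have e : (X / Y : ℝ) ^ (1 / (n : ℝ)) = (X * absNorm 𝔟) ^ (1 / (n : ℝ)) / H := by
        rw [hHdef, ← Real.div_rpow (by positivity) (by positivity)]
        congr 1
        field_simp
      rw [← hndef, e, mul_div_assoc', mul_div_assoc']
      push_cast
      rw [mul_comm (absNorm 𝔟 : ℝ)]
      gcongr
  -- pointwise identity
  have hpt : ∀ a, χ (absNorm 𝔟 : ZMod Q) * ∑ 𝔡 ∈ D,
      (χ (absNorm 𝔡 : ZMod Q) * (g (Real.log (absNorm 𝔡)) : ℂ)) *
        ((if α a ∈ 𝔟 * 𝔡 then W (u a) else 0 : ℝ) : ℂ) =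
      ∑ 𝔢 ∈ D, (starRingEnd ℂ) (χ (absNorm 𝔢 : ZMod Q)) *
        ((if α a ∈ 𝔟 * 𝔢 then
          W (u a) * g (Real.log (normForm pb (u a)) + Real.log Y - Real.log (absNorm 𝔢))
          else 0 : ℝ) : ℂ) := by
    intro a
    by_cases hw : W (u a) = 0
    · simp [hw]
    have hua := (norm_sub_lt_of_tent_ne_zero z hw).le
    obtain ⟨hA1, hA2⟩ := absNorm_span_one_add pb θ hθ hp1 hp Q hH a hua
    change ((absNorm (Ideal.span {α a}) : ℕ) : ZMod Q) = 1 at hA1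
    change (absNorm (Ideal.span {α a}) : ℝ) = H ^ n * normForm pb (u a) at hA2
    set A := Ideal.span {α a} with hAdef
    obtain ⟨hF1, hF2⟩ := normForm_mem pb hp1 hp (u := u a) hua
    have hc := coneCenter_pos (n := pb.dim) hn hp1
    have hF0 : 0 < normForm pb (u a) := lt_of_lt_of_le (by positivity) hF1
    have hA0 : A ≠ ⊥ := by
      intro h0
      rw [h0, absNorm_bot, Nat.cast_zero] at hA2
      have : 0 < H ^ n * normForm pb (u a) := by positivity
      linarith
    have hmem : ∀ I, α a ∈ I ↔ I ∣ A := fun I => by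
      rw [hAdef, Ideal.dvd_span_singleton]
    have hmul : ∀ 𝔡 𝔢, 𝔟 * 𝔡 * 𝔢 = A →
        χ (absNorm 𝔟 : ZMod Q) * χ (absNorm 𝔡 : ZMod Q) = (starRingEnd ℂ) (χ (absNorm 𝔢 : ZMod Q)) ∧
        Real.log (absNorm 𝔡) =
          Real.log (normForm pb (u a)) + Real.log Y - Real.log (absNorm 𝔢) := by
      intro 𝔡 𝔢 hde
      have hprod : absNorm 𝔟 * absNorm 𝔡 * absNorm 𝔢 = absNorm A := by
        rw [← hde, map_mul, map_mul]
      have hχ : χ (absNorm 𝔟 : ZMod Q) * χ (absNorm 𝔡 : ZMod Q) * χ (absNorm 𝔢 : ZMod Q) = 1 := by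
        rw [← map_mul, ← map_mul, ← Nat.cast_mul, ← Nat.cast_mul, hprod, hA1, map_one]
      have hue : IsUnit ((absNorm 𝔢 : ℕ) : ZMod Q) := by
        apply IsUnit.of_mul_eq_one ((absNorm 𝔟 : ZMod Q) * (absNorm 𝔡 : ZMod Q))
        rw [mul_comm, ← Nat.cast_mul, ← Nat.cast_mul, hprod, hA1]
      constructor
      · have h1 : ‖χ (absNorm 𝔢 : ZMod Q)‖ = 1 := by
          obtain ⟨w, hw⟩ := hue
          rw [← hw]; exact χ.unit_norm_eq_one w
        have h2 : χ (absNorm 𝔢 : ZMod Q) * (starRingEnd ℂ) (χ (absNorm 𝔢 : ZMod Q)) = 1 := by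
          rw [Complex.mul_conj, Complex.normSq_eq_norm_sq, h1]; norm_num
        calc χ (absNorm 𝔟 : ZMod Q) * χ (absNorm 𝔡 : ZMod Q) =
            χ (absNorm 𝔟 : ZMod Q) * χ (absNorm 𝔡 : ZMod Q) *
              (χ (absNorm 𝔢 : ZMod Q) * (starRingEnd ℂ) (χ (absNorm 𝔢 : ZMod Q))) := by
              rw [h2, mul_one]
          _ = _ := by rw [← mul_assoc, hχ, one_mul]
      · have hN : ∀ I : Ideal (𝓞 K), I ∣ A → (absNorm I : ℝ) ≠ 0 := by
          intro I hI
          have : absNorm I ≠ 0 := by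
            rw [Ne, absNorm_eq_zero_iff]
            rintro rfl
            exact hA0 (zero_dvd_iff.1 hI)
          exact_mod_cast this
        have hd0 := hN 𝔡 ⟨𝔟 * 𝔢, by rw [← hde]; ring⟩
        have he0 := hN 𝔢 ⟨𝔟 * 𝔡, by rw [← hde]; ring⟩
        have h1 : (absNorm 𝔟 : ℝ) * absNorm 𝔡 * absNorm 𝔢 =
            Y * absNorm 𝔟 * normForm pb (u a) := by
          rw [← hHn, ← hA2, ← hprod]; push_cast; ring
        have h2 : (absNorm 𝔡 : ℝ) * absNorm 𝔢 = normForm pb (u a) * Y :=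
          mul_left_cancel₀ hNb.ne' (by linear_combination h1)
        rw [eq_sub_iff_add_eq, ← Real.log_mul hd0 he0, h2, Real.log_mul hF0.ne' hY.ne']
    have key := sum_dvd_flip hA0 D (𝔟 := 𝔟)
      (fun 𝔡 => χ (absNorm 𝔟 : ZMod Q) * ((χ (absNorm 𝔡 : ZMod Q) *
        (g (Real.log (absNorm 𝔡)) : ℂ)) * (W (u a) : ℂ)))
      (fun 𝔢 => (starRingEnd ℂ) (χ (absNorm 𝔢 : ZMod Q)) * ((W (u a) *
        g (Real.log (normForm pb (u a)) + Real.log Y - Real.log (absNorm 𝔢)) : ℝ) : ℂ)) ?_ ?_ ?_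
    · rw [Finset.mul_sum]
      refine Eq.trans (Finset.sum_congr rfl fun 𝔡 _ => ?_)
        (key.trans (Finset.sum_congr rfl fun 𝔢 _ => ?_))
      · simp only [hmem]
        split_ifs <;> simp
      · simp only [hmem]
        split_ifs <;> simp
    · intro 𝔡 𝔢 hde
      obtain ⟨h1, h2⟩ := hmul 𝔡 𝔢 hde
      simp only [h2]
      rw [← h1]
      push_cast
      ring
    · intro 𝔡 hd hne
      have hd0 : 𝔡 ≠ ⊥ := by
        rintro rfl
        rw [← Ideal.zero_eq_bot, mul_zero] at hd
        exact hA0 (zero_dvd_iff.1 hd)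
      have hg0 : g (Real.log (absNorm 𝔡)) ≠ 0 := by
        intro h0; apply hne; simp [h0]
      have hNd : (0 : ℝ) < absNorm 𝔡 := by
        have : absNorm 𝔡 ≠ 0 := by rwa [Ne, absNorm_eq_zero_iff]
        exact_mod_cast Nat.pos_of_ne_zero this
      refine mem_idealsUpTo.2 ⟨hd0, le_trans ?_ hX1⟩
      rw [← Real.log_le_iff_le_exp hNd]
      linarith [(abs_le.1 (hgS _ hg0)).2]
    · intro 𝔢 he hne
      have he0 : 𝔢 ≠ ⊥ := by
        rintro rfl
        rw [← Ideal.zero_eq_bot, mul_zero] at he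
        exact hA0 (zero_dvd_iff.1 he)
      have hg0 : g (Real.log (normForm pb (u a)) + Real.log Y - Real.log (absNorm 𝔢)) ≠ 0 := by
        intro h0; apply hne; simp [h0]
      have hNe : (0 : ℝ) < absNorm 𝔢 := by
        have : absNorm 𝔢 ≠ 0 := by rwa [Ne, absNorm_eq_zero_iff]
        exact_mod_cast Nat.pos_of_ne_zero this
      refine mem_idealsUpTo.2 ⟨he0, le_trans ?_ hX2⟩
      have h1 := (abs_le.1 (hgS _ hg0)).1
      have h2 : Real.log (absNorm 𝔢) ≤
          Real.log (3 / 2 * coneCenter pb.dim p ^ pb.dim) + Real.log Y + (2 - κ) := by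
        have := Real.log_le_log hF0 hF2
        linarith
      rw [← Real.exp_log hNe]
      refine (Real.exp_le_exp.2 h2).trans (le_of_eq ?_)
      rw [Real.exp_add, Real.exp_add, Real.exp_log (by positivity), Real.exp_log hY]
  -- sum over the lattice
  have hsum : ∀ (c : Ideal (𝓞 K) → ℂ) (Φ : Ideal (𝓞 K) → (Fin n → ℤ) → ℝ),
      (∀ 𝔡 a, W (u a) = 0 → Φ 𝔡 a = 0) →
      ∑' a, ∑ 𝔡 ∈ D, c 𝔡 * (Φ 𝔡 a : ℂ) = ∑ 𝔡 ∈ D, c 𝔡 * ((∑' a, Φ 𝔡 a : ℝ) : ℂ) := by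
    intro c Φ hΦ
    rw [Summable.tsum_finsetSum]
    · refine Finset.sum_congr rfl fun 𝔡 _ => ?_
      rw [tsum_mul_left, Complex.ofReal_tsum]
    · intro 𝔡 _
      refine summable_of_hasFiniteSupport (hWfin.subset fun a ha => ?_)
      intro h0
      apply ha
      simp [hΦ 𝔡 a h0]
  have hid : ∑' a, _ = ∑' a, _ := tsum_congr hpt
  rw [tsum_mul_left, hsum _ (fun 𝔡 a => if α a ∈ 𝔟 * 𝔡 then W (u a) else 0)
    (fun 𝔡 a h0 => by simp [h0]),
    hsum _ (fun 𝔢 a => if α a ∈ 𝔟 * 𝔢 then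
          W (u a) * g (Real.log (normForm pb (u a)) + Real.log Y - Real.log (absNorm 𝔢)) else 0)
    (fun 𝔢 a h0 => by simp [h0])] at hid
  have hχ0 : ∀ 𝔡 : Ideal (𝓞 K), χ (absNorm 𝔡 : ZMod Q) ≠ 0 → (absNorm 𝔡).Coprime Q := by
    intro 𝔡 h0
    by_contra h1
    exact h0 (χ.map_nonunit (by rwa [ZMod.isUnit_iff_coprime]))
  have hS : ∑ 𝔡 ∈ D, (absNorm 𝔡 : ℝ)⁻¹ ≤ (1 + Real.log X) ^ n := by
    have := sum_inv_absNorm_le D X hX fun I hI => (hDmem I hI).2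
    rwa [pb.finrank] at this
  have hWL : ∀ x y, |W x - W y| ≤ 1 * ‖x - y‖ := fun x y => by
    rw [one_mul]; exact abs_tent_sub_le z x y
  have hb1 : ‖∑ 𝔡 ∈ D, (χ (absNorm 𝔡 : ZMod Q) * (g (Real.log (absNorm 𝔡)) : ℂ)) *
      ((h ^ n * absNorm 𝔟 * ∑' a, if α a ∈ 𝔟 * 𝔡 then W (u a) else 0 : ℝ) : ℂ) -
      ∑ 𝔡 ∈ D, (χ (absNorm 𝔡 : ZMod Q) * (g (Real.log (absNorm 𝔡)) : ℂ)) *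
        ((coneMass pb p / absNorm 𝔡 : ℝ) : ℂ)‖ ≤
      (M * (2 * (1 * T * 5 ^ n))) * ∑ 𝔡 ∈ D, (absNorm 𝔡 : ℝ)⁻¹ := by
    refine norm_sum_mul_sub_le D _ _ (fun _ => coneMass pb p) _ (fun 𝔡 hd => (hDmem 𝔡 hd).1) ?_
      (by positivity)
    intro 𝔡 hd hc0
    have h1 : ‖χ (absNorm 𝔡 : ZMod Q) * (g (Real.log (absNorm 𝔡)) : ℂ)‖ ≤ M := by
      rw [norm_mul, Complex.norm_real, Real.norm_eq_abs]
      exact (mul_le_of_le_one_left (abs_nonneg _) (χ.norm_le_one _)).trans (hgM _)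
    exact mul_le_mul h1 (hlat 𝔡 hd (hχ0 _ (left_ne_zero_of_mul hc0)) W 1 zero_le_one hWL
      (fun x hx => tent_eq_zero z hx.le)) (abs_nonneg _) hM0
  have hb2 : ‖∑ 𝔢 ∈ D, (starRingEnd ℂ) (χ (absNorm 𝔢 : ZMod Q)) *
      ((h ^ n * absNorm 𝔟 * ∑' a, if α a ∈ 𝔟 * 𝔢 then
          W (u a) * g (Real.log (normForm pb (u a)) + Real.log Y - Real.log (absNorm 𝔢))
          else 0 : ℝ) : ℂ) - dualSum χ pb p X (Real.log Y) g‖ ≤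
      (1 * (2 * ((M + M) * T * 5 ^ n))) * ∑ 𝔡 ∈ D, (absNorm 𝔡 : ℝ)⁻¹ := by
    refine norm_sum_mul_sub_le D _ _
      (fun 𝔢 => ∫ u, W u * g (Real.log (normForm pb u) + Real.log Y - Real.log (absNorm 𝔢))) _
      (fun 𝔡 hd => (hDmem 𝔡 hd).1) ?_ (by positivity)
    intro 𝔢 he hc0
    have h1 : ‖(starRingEnd ℂ) (χ (absNorm 𝔢 : ZMod Q))‖ ≤ 1 := by
      rw [RCLike.norm_conj]; exact χ.norm_le_one _
    have hcop := hχ0 𝔢 fun h0 => hc0 (by rw [h0, map_zero])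
    refine mul_le_mul h1 (hlat 𝔢 he hcop
      (fun u => W u * g (Real.log (normForm pb u) + Real.log Y - Real.log (absNorm 𝔢)))
      (M + M) (by positivity) ?_ ?_) (abs_nonneg _) zero_le_one
    · refine abs_tent_mul_sub_le z hM0 (fun u _ => hgM _) fun u u' hu hu' => ?_
      refine (hgL _ _).trans ?_
      gcongr
      rw [sub_sub_sub_cancel_right, add_sub_add_right_eq_sub]
      exact abs_log_normForm_sub_le pb hp1 hp hu hu'
    · intro x hx
      show W x * _ = 0
      rw [hW, tent_eq_zero z hx.le, zero_mul]
  have e1 : ∑ 𝔡 ∈ D, (χ (absNorm 𝔡 : ZMod Q) * (g (Real.log (absNorm 𝔡)) : ℂ)) *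
        ((coneMass pb p / absNorm 𝔡 : ℝ) : ℂ) = coneMass pb p * idealSum K χ X g := by
    rw [idealSum, Finset.mul_sum]
    refine Finset.sum_congr rfl fun 𝔡 _ => ?_
    push_cast
    ring
  rw [e1] at hb1
  have e2 : χ (absNorm 𝔟 : ZMod Q) *
      ∑ 𝔡 ∈ D, (χ (absNorm 𝔡 : ZMod Q) * (g (Real.log (absNorm 𝔡)) : ℂ)) *
      ((h ^ n * absNorm 𝔟 * ∑' a, if α a ∈ 𝔟 * 𝔡 then W (u a) else 0 : ℝ) : ℂ) =
      ∑ 𝔢 ∈ D, (starRingEnd ℂ) (χ (absNorm 𝔢 : ZMod Q)) *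
      ((h ^ n * absNorm 𝔟 * ∑' a, if α a ∈ 𝔟 * 𝔢 then
          W (u a) * g (Real.log (normForm pb (u a)) + Real.log Y - Real.log (absNorm 𝔢))
          else 0 : ℝ) : ℂ) := by
    have h1 : ∀ (c : Ideal (𝓞 K) → ℂ) (S : Ideal (𝓞 K) → ℝ),
        ∑ 𝔡 ∈ D, c 𝔡 * ((h ^ n * absNorm 𝔟 * S 𝔡 : ℝ) : ℂ) =
          ((h ^ n * absNorm 𝔟 : ℝ) : ℂ) * ∑ 𝔡 ∈ D, c 𝔡 * (S 𝔡 : ℂ) := by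
      intro c S
      rw [Finset.mul_sum]
      refine Finset.sum_congr rfl fun 𝔡 _ => ?_
      push_cast
      ring
    rw [h1, h1, ← hid]
    ring
  set P1 := ∑ 𝔡 ∈ D, (χ (absNorm 𝔡 : ZMod Q) * (g (Real.log (absNorm 𝔡)) : ℂ)) *
      ((h ^ n * absNorm 𝔟 * ∑' a, if α a ∈ 𝔟 * 𝔡 then W (u a) else 0 : ℝ) : ℂ)
  rw [← e2] at hb2
  have e3 : χ (absNorm 𝔟 : ZMod Q) * (coneMass pb p * idealSum K χ X g) -
      dualSum χ pb p X (Real.log Y) g =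
      (χ (absNorm 𝔟 : ZMod Q) * P1 - dualSum χ pb p X (Real.log Y) g) -
        χ (absNorm 𝔟 : ZMod Q) * (P1 - coneMass pb p * idealSum K χ X g) := by ring
  rw [e3]
  refine (norm_sub_le _ _).trans ?_
  rw [norm_mul]
  have h5 := mul_le_of_le_one_left (norm_nonneg (P1 - coneMass pb p * idealSum K χ X g))
    (χ.norm_le_one (absNorm 𝔟 : ZMod Q))
  calc _ ≤ (1 * (2 * ((M + M) * T * 5 ^ n))) * ∑ 𝔡 ∈ D, (absNorm 𝔡 : ℝ)⁻¹ +
      (M * (2 * (1 * T * 5 ^ n))) * ∑ 𝔡 ∈ D, (absNorm 𝔡 : ℝ)⁻¹ := by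
        exact add_le_add hb2 (h5.trans hb1)
    _ = 6 * M * T * 5 ^ n * ∑ 𝔡 ∈ D, (absNorm 𝔡 : ℝ)⁻¹ := by ring
    _ ≤ _ := by gcongr

end Symmetry

section LocalBound

open NumberField Ideal MeasureTheory

variable {K : Type*} [Field K] [NumberField K] {Q : ℕ} (χ : DirichletCharacter ℂ Q)

variable (K) in
/-- The sum of `χ(N𝔡) g(log N𝔡) / N𝔡` over all ideals. -/
noncomputable def idealTsum (g : ℝ → ℝ) : ℂ :=
  ∑' 𝔡 : Ideal (𝓞 K), χ (absNorm 𝔡 : ZMod Q) * ((g (Real.log (absNorm 𝔡)) / absNorm 𝔡 : ℝ) : ℂ)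

theorem idealTsum_term_eq_zero {g : ℝ → ℝ} {X : ℝ} (hX : 0 < X)
    (hg : ∀ u, g u ≠ 0 → u ≤ Real.log X) {I : Ideal (𝓞 K)} (hI : I ∉ idealsUpTo K X) :
    χ (absNorm I : ZMod Q) * ((g (Real.log (absNorm I)) / absNorm I : ℝ) : ℂ) = 0 := by
  by_cases h0 : absNorm I = 0
  · simp [h0]
  · have hN : (0 : ℝ) < absNorm I := by exact_mod_cast Nat.pos_of_ne_zero h0
    have : g (Real.log (absNorm I)) = 0 := by
      by_contra h
      refine hI (mem_idealsUpTo.2 ⟨fun h1 => h0 (by rw [h1, absNorm_bot]), ?_⟩)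
      exact (Real.log_le_log_iff hN hX).1 (hg _ h)
    simp [this]

theorem idealTsum_eq_idealSum {g : ℝ → ℝ} {X : ℝ} (hX : 0 < X)
    (hg : ∀ u, g u ≠ 0 → u ≤ Real.log X) : idealTsum K χ g = idealSum K χ X g :=
  tsum_eq_sum fun _ hI => idealTsum_term_eq_zero χ hX hg hI

theorem norm_idealSum_le {g : ℝ → ℝ} {X M : ℝ} (hX : 1 ≤ X) (hg : ∀ u, |g u| ≤ M) :
    ‖idealSum K χ X g‖ ≤ M * (1 + Real.log X) ^ Module.finrank ℚ K := by
  have hM : 0 ≤ M := (abs_nonneg _).trans (hg 0)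
  have h := sum_inv_absNorm_le (idealsUpTo K X) X hX fun I hI => (mem_idealsUpTo.1 hI).2
  refine le_trans ?_ (mul_le_mul_of_nonneg_left h hM)
  rw [Finset.mul_sum]
  refine norm_sum_le_of_le _ fun I _ => ?_
  rw [norm_mul, Complex.norm_real, Real.norm_eq_abs, abs_div, Nat.abs_cast, ← div_eq_mul_inv]
  refine (mul_le_of_le_one_left (by positivity) (χ.norm_le_one _)).trans ?_
  gcongr
  exact hg _

theorem exists_one_le_norm_one_sub_pow {ζ : ℂ} {N : ℕ} (hN : 0 < N) (h : ζ ^ N = 1) (h1 : ζ ≠ 1) :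
    ∃ k, 1 ≤ ‖ζ ^ k - 1‖ := by
  by_contra! hc
  have h2 : ∑ k ∈ Finset.range N, (ζ ^ k - 1) = -(N : ℂ) := by
    rw [Finset.sum_sub_distrib, geom_sum_eq h1, h]
    simp
  have h3 : ‖∑ k ∈ Finset.range N, (ζ ^ k - 1)‖ < ∑ k ∈ Finset.range N, (1 : ℝ) := by
    refine (norm_sum_le _ _).trans_lt (Finset.sum_lt_sum_of_nonempty ?_ fun k _ => hc k)
    simpa using hN.ne'
  rw [h2] at h3
  simp at h3

theorem pow_mul_exp_neg_le (j : ℕ) {y : ℝ} (hy : 0 ≤ y) : y ^ j * Real.exp (-y) ≤ (j : ℝ) ^ j := by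
  have h1 : y ^ j / j.factorial ≤ Real.exp y := Real.pow_div_factorial_le_exp y hy j
  have h2 : ((j.factorial : ℕ) : ℝ) ≤ (j : ℝ) ^ j := by exact_mod_cast Nat.factorial_le_pow j
  have h3 : (0 : ℝ) < j.factorial := by exact_mod_cast j.factorial_pos
  rw [div_le_iff₀ h3] at h1
  rw [Real.exp_neg, ← div_eq_mul_inv, div_le_iff₀ (Real.exp_pos _)]
  calc y ^ j ≤ Real.exp y * j.factorial := h1
    _ ≤ Real.exp y * (j : ℝ) ^ j := by gcongr
    _ = _ := mul_comm _ _

variable {n p : ℕ}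

theorem log_scale_le (hQ : 48 ≤ Q) (hn : n ≠ 0) (hnQ : n ≤ Q) (hp1 : 1 ≤ p) (hpQ : p ≤ Q) (k : ℕ) :
    1 + Real.log (3 / 2 * coneCenter n p ^ n * Real.exp (k + 4)) ≤ (k + 1) * (Q : ℝ) ^ 5 := by
  have hc : 0 < coneCenter n p := coneCenter_pos hn hp1
  have hQ' : (48 : ℝ) ≤ Q := by exact_mod_cast hQ
  have hn' : (n : ℝ) ≤ Q := by exact_mod_cast hnQ
  have hp' : (p : ℝ) ≤ Q := by exact_mod_cast hpQ
  rw [Real.log_mul (by positivity) (by positivity), Real.log_mul (by positivity) (by positivity),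
    Real.log_pow, Real.log_exp]
  have h1 : Real.log (3 / 2) ≤ 3 / 2 - 1 := Real.log_le_sub_one_of_pos (by norm_num)
  have h2 : Real.log (coneCenter n p) ≤ coneCenter n p := Real.log_le_self hc.le
  have h3 : (n : ℝ) * Real.log (coneCenter n p) ≤ Q * (4 * Q ^ 2 * Q) := by
    refine (mul_le_mul_of_nonneg_left h2 (Nat.cast_nonneg _)).trans ?_
    unfold coneCenter
    gcongr
  have h4 : (1 : ℝ) ≤ (Q : ℝ) ^ 4 := one_le_pow₀ (by linarith)
  have h5 : (48 : ℝ) * Q ^ 4 ≤ Q ^ 5 := by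
    rw [pow_succ (Q : ℝ) 4, mul_comm]; gcongr
  have hk : (0 : ℝ) ≤ k := Nat.cast_nonneg _
  nlinarith [mul_nonneg hk (by linarith : (0 : ℝ) ≤ (Q : ℝ) ^ 5 - 1)]

theorem tail_numeric_le (hQ : 48 ≤ Q) (hn : n ≠ 0) (hnQ : n ≤ Q) (k : ℕ) :
    24 * ((Q : ℝ) ^ 8 * Real.exp (-(k / n))) * 5 ^ n * ((k + 1) * (Q : ℝ) ^ 5) ^ n ≤
      (Q : ℝ) ^ (29 * n) / (k + 1) ^ 3 := by
  have hQ' : (48 : ℝ) ≤ Q := by exact_mod_cast hQ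
  have hQ1 : (1 : ℝ) ≤ Q := by linarith
  have hn' : (n : ℝ) ≤ Q := by exact_mod_cast hnQ
  have hn1 : (1 : ℝ) ≤ n := by exact_mod_cast Nat.one_le_iff_ne_zero.2 hn
  have hk1 : (0 : ℝ) < (k : ℝ) + 1 := by positivity
  rw [le_div_iff₀ (by positivity)]
  have h1 := pow_mul_exp_neg_le (n + 3) (y := ((k : ℝ) + 1) / n) (by positivity)
  have h2 : Real.exp (-(k / n)) ≤ 3 * Real.exp (-(((k : ℝ) + 1) / n)) := by
    have : -((k : ℝ) / n) = 1 / n + -(((k : ℝ) + 1) / n) := by field_simp; ring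
    rw [this, Real.exp_add]
    gcongr
    refine (Real.exp_le_exp.2 ((div_le_one (by positivity)).2 hn1)).trans ?_
    linarith [Real.exp_one_lt_d9]
  have h3 : ((k : ℝ) + 1) ^ (n + 3) * Real.exp (-(((k : ℝ) + 1) / n)) ≤
      (Q : ℝ) ^ (n + 3) * ((Q : ℝ) ^ 2) ^ (n + 3) := by
    have e : ((k : ℝ) + 1) ^ (n + 3) = (n : ℝ) ^ (n + 3) * (((k : ℝ) + 1) / n) ^ (n + 3) := by
      rw [← mul_pow]; congr 1; field_simp
    rw [e, mul_assoc]
    refine mul_le_mul (by gcongr) (h1.trans ?_) (by positivity) (by positivity)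
    push_cast
    gcongr
    nlinarith
  calc _ = 24 * (Q : ℝ) ^ 8 * 5 ^ n * ((Q : ℝ) ^ 5) ^ n * (((k : ℝ) + 1) ^ (n + 3) *
        Real.exp (-(k / n))) := by rw [mul_pow, pow_add]; ring
    _ ≤ 24 * (Q : ℝ) ^ 8 * 5 ^ n * ((Q : ℝ) ^ 5) ^ n * (((k : ℝ) + 1) ^ (n + 3) *
        (3 * Real.exp (-(((k : ℝ) + 1) / n)))) := by gcongr
    _ = 72 * (Q : ℝ) ^ 8 * 5 ^ n * ((Q : ℝ) ^ 5) ^ n * (((k : ℝ) + 1) ^ (n + 3) *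
        Real.exp (-(((k : ℝ) + 1) / n))) := by ring
    _ ≤ (Q : ℝ) ^ 2 * (Q : ℝ) ^ 8 * Q ^ n * ((Q : ℝ) ^ 5) ^ n *
        ((Q : ℝ) ^ (n + 3) * ((Q : ℝ) ^ 2) ^ (n + 3)) := by
      gcongr
      · nlinarith
      · linarith
    _ = (Q : ℝ) ^ (9 * n + 19) := by ring
    _ ≤ _ := pow_le_pow_right₀ hQ1 (by omega)

theorem head_numeric_le (hQ : 48 ≤ Q) (hn : n ≠ 0) (hnQ : n ≤ Q) (k : ℕ)
    (hk : Real.exp (k / n) < (Q : ℝ) ^ 8) :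
    2 * ((k : ℝ) + 3) ^ n ≤ (Q : ℝ) ^ (29 * n) / (k + 1) ^ 3 := by
  have hQ' : (48 : ℝ) ≤ Q := by exact_mod_cast hQ
  have hQ1 : (1 : ℝ) ≤ Q := by linarith
  have hn' : (n : ℝ) ≤ Q := by exact_mod_cast hnQ
  have hn1 : (1 : ℝ) ≤ n := by exact_mod_cast Nat.one_le_iff_ne_zero.2 hn
  have h1 : (k : ℝ) ≤ n * (8 * Q) := by
    rw [← Real.lt_log_iff_exp_lt (by positivity), Real.log_pow, div_lt_iff₀ (by positivity)] at hk
    have := Real.log_le_self (by positivity : (0 : ℝ) ≤ Q)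
    push_cast at hk
    nlinarith
  have h2 : (k : ℝ) + 3 ≤ Q ^ 3 := by
    have : (k : ℝ) ≤ Q * (8 * Q) := h1.trans (by gcongr)
    nlinarith [pow_pos (by linarith : (0 : ℝ) < Q) 2]
  rw [le_div_iff₀ (by positivity)]
  calc 2 * ((k : ℝ) + 3) ^ n * (k + 1) ^ 3 ≤ Q * (Q ^ 3) ^ n * (Q ^ 3) ^ 3 := by
        gcongr
        · linarith
        · linarith
    _ = (Q : ℝ) ^ (3 * n + 10) := by ring
    _ ≤ _ := pow_le_pow_right₀ hQ1 (by omega)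

theorem error_param_le (hQ : 48 ≤ Q) (hn : n ≠ 0) (hnQ : n ≤ Q) (hp1 : 1 ≤ p) (hpQ : p ≤ Q) (k : ℕ)
    {Y : ℝ} (hY : Real.exp (2 * k) ≤ Y) :
    Q * (n * p * ((3 / 2 * coneCenter n p ^ n * Real.exp (k + 4)) / Y) ^ (1 / (n : ℝ))) ≤
      (Q : ℝ) ^ 8 * Real.exp (-(k / n)) := by
  have hc : 0 < coneCenter n p := coneCenter_pos hn hp1
  have hQ' : (48 : ℝ) ≤ Q := by exact_mod_cast hQ
  have hn' : (n : ℝ) ≤ Q := by exact_mod_cast hnQ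
  have hp' : (p : ℝ) ≤ Q := by exact_mod_cast hpQ
  have hn1 : (1 : ℝ) ≤ n := by exact_mod_cast Nat.one_le_iff_ne_zero.2 hn
  have hY0 : 0 < Y := (Real.exp_pos _).trans_le hY
  have h1 : (3 / 2 * coneCenter n p ^ n * Real.exp (k + 4)) / Y ≤
      (2 * coneCenter n p * 81 * Real.exp (-(k / n))) ^ n := by
    rw [div_le_iff₀ hY0]
    refine le_trans ?_ (mul_le_mul_of_nonneg_left hY (by positivity))
    rw [mul_pow, mul_pow, mul_pow, ← Real.exp_nat_mul, mul_neg, mul_div_cancel₀ _ (by positivity),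
      mul_assoc _ (Real.exp (-k)), ← Real.exp_add, add_comm (k : ℝ) 4,
      show -(k : ℝ) + 2 * k = k by ring, Real.exp_add, ← mul_assoc]
    have e4 : Real.exp 4 ≤ 81 := by
      have : Real.exp 4 = Real.exp 1 ^ 4 := by rw [← Real.exp_nat_mul]; norm_num
      rw [this]
      have := Real.exp_one_lt_d9
      calc Real.exp 1 ^ 4 ≤ 3 ^ 4 := by gcongr; linarith
        _ = 81 := by norm_num
    have a : (2 : ℝ) ≤ 2 ^ n := le_self_pow₀ (by norm_num) hn
    have b : (81 : ℝ) ≤ 81 ^ n := le_self_pow₀ (by norm_num) hn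
    gcongr
    · linarith
    · linarith
  have h2 : ((3 / 2 * coneCenter n p ^ n * Real.exp (k + 4)) / Y) ^ (1 / (n : ℝ)) ≤
      2 * coneCenter n p * 81 * Real.exp (-(k / n)) := by
    refine (Real.rpow_le_rpow (by positivity) h1 (by positivity)).trans (le_of_eq ?_)
    rw [one_div, Real.pow_rpow_inv_natCast (by positivity) hn]
  calc _ ≤ (Q : ℝ) * (Q * Q * (2 * (4 * Q ^ 2 * Q) * 81 * Real.exp (-(k / n)))) := by
        gcongr
        refine h2.trans ?_
        unfold coneCenter
        gcongr
    _ = 648 * (Q : ℝ) ^ 6 * Real.exp (-(k / n)) := by ring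
    _ ≤ (Q : ℝ) ^ 2 * Q ^ 6 * Real.exp (-(k / n)) := by gcongr; nlinarith
    _ = _ := by ring

theorem norm_idealTsum_sub_le {K : Type*} [Field K] [NumberField K] (χ : DirichletCharacter ℂ Q)
    (pb : PowerBasis ℚ K) {θ : 𝓞 K} (hθ : (θ : K) = pb.gen)
    (hp : pb.gen ^ pb.dim = p) (hp1 : 1 ≤ p) (hpQ : p ∣ Q) (hQ : 48 ≤ Q)
    (hnQ : ∃ k, pb.dim ∣ Q ^ k) (hn : pb.dim ≤ Q) {τ : ℝ}
    (hτ : τ = 1 ∨ τ = 0 ∧ ∃ 𝔟 : Ideal (𝓞 K), (absNorm 𝔟).Coprime Q ∧ χ (absNorm 𝔟 : ZMod Q) ≠ 1)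
    (k : ℕ) {g : ℝ → ℝ} {M : ℝ} (hgM : ∀ x, |g x| ≤ M) (hgL : ∀ x y, |g x - g y| ≤ M * |x - y|)
    (hgS : ∀ x, g x ≠ 0 → |x - k| ≤ 1) :
    ‖idealTsum K χ g - τ * idealTsum K χ (fun u => g (u + 1))‖ ≤
      M * ((Q : ℝ) ^ (29 * pb.dim) / (k + 1) ^ 3) := by
  have hn0 : pb.dim ≠ 0 := pb.dim_pos.ne'
  have hM : 0 ≤ M := (abs_nonneg _).trans (hgM 0)
  have hQ0 : 0 < Q := by omega
  have hpQ' : p ≤ Q := Nat.le_of_dvd hQ0 hpQ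
  have hk0 : (0 : ℝ) ≤ k := Nat.cast_nonneg _
  have hg'M : ∀ x, |g (x + 1)| ≤ M := fun x => hgM _
  have hg'L : ∀ x y, |g (x + 1) - g (y + 1)| ≤ M * |x - y| := fun x y => by
    have := hgL (x + 1) (y + 1)
    rwa [add_sub_add_right_eq_sub] at this
  have hgS2 : ∀ x, g x ≠ 0 → |x - k| ≤ 2 := fun x hx => (hgS x hx).trans (by norm_num)
  have hg'S2 : ∀ x, g (x + 1) ≠ 0 → |x - k| ≤ 2 := fun x hx => by
    have := abs_le.1 (hgS _ hx)
    rw [abs_le]; constructor <;> linarith [this.1, this.2]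
  by_cases hk : Real.exp (k / pb.dim) < (Q : ℝ) ^ 8
  · have hX : (1 : ℝ) ≤ Real.exp (k + 2) := Real.one_le_exp (by positivity)
    have hb : ∀ g' : ℝ → ℝ, (∀ x, |g' x| ≤ M) → (∀ x, g' x ≠ 0 → |x - k| ≤ 2) →
        ‖idealTsum K χ g'‖ ≤ M * ((k : ℝ) + 3) ^ pb.dim := by
      intro g' h1 h2
      rw [idealTsum_eq_idealSum χ (Real.exp_pos (k + 2)) (fun u hu => by
        rw [Real.log_exp]; linarith [(abs_le.1 (h2 u hu)).2])]
      refine (norm_idealSum_le χ hX h1).trans (le_of_eq ?_)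
      rw [pb.finrank, Real.log_exp]
      ring
    have hτ1 : ‖(τ : ℂ)‖ ≤ 1 := by
      rcases hτ with rfl | ⟨rfl, _⟩ <;> simp
    refine le_trans ?_ (mul_le_mul_of_nonneg_left (head_numeric_le hQ hn0 hn k hk) hM)
    refine (norm_sub_le _ _).trans ?_
    rw [norm_mul]
    have h1 := hb g hgM hgS2
    have h2 := hb _ hg'M hg'S2
    have h3 := mul_le_of_le_one_left (norm_nonneg (idealTsum K χ (fun u => g (u + 1)))) hτ1
    linarith
  rw [not_lt] at hk
  set n := pb.dim with hndef
  have hc : 0 < coneCenter n p := coneCenter_pos hn0 hp1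
  have hc1 : 1 ≤ coneCenter n p := by
    unfold coneCenter
    have a : (1 : ℝ) ≤ n := by exact_mod_cast Nat.one_le_iff_ne_zero.2 hn0
    have b : (1 : ℝ) ≤ p := by exact_mod_cast hp1
    nlinarith [one_le_pow₀ a (n := 2)]
  have hcn : (1 : ℝ) ≤ coneCenter n p ^ n := one_le_pow₀ hc1
  set X : ℝ := 3 / 2 * coneCenter n p ^ n * Real.exp (k + 4) with hX
  have hXk : Real.exp (k + 4) ≤ X := by
    rw [hX]
    exact le_mul_of_one_le_left (Real.exp_pos _).le (by linarith)
  have hX1 : 1 ≤ X := (Real.one_le_exp (by positivity)).trans hXk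
  have hX2 : Real.exp (k + 2) ≤ X := (Real.exp_le_exp.2 (by linarith)).trans hXk
  set T : ℝ := (Q : ℝ) ^ 8 * Real.exp (-(k / n)) with hT
  have hT1 : T ≤ 1 := by
    rw [hT, Real.exp_neg, ← div_eq_mul_inv]
    exact (div_le_one (Real.exp_pos _)).2 hk
  have hsym : ∀ (g' : ℝ → ℝ) (Y : ℝ) (𝔟 : Ideal (𝓞 K)), (absNorm 𝔟).Coprime Q →
      (∀ x, |g' x| ≤ M) → (∀ x y, |g' x - g' y| ≤ M * |x - y|) → (∀ x, g' x ≠ 0 → |x - k| ≤ 2) →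
      Real.exp (2 * k) ≤ Y → Y ≤ Real.exp (2 * k + 1) →
      ‖χ (absNorm 𝔟 : ZMod Q) * (coneMass pb p * idealTsum K χ g')
        - dualSum χ pb p X (Real.log Y) g'‖ ≤ 6 * M * T * 5 ^ n * (1 + Real.log X) ^ n := by
    intro g' Y 𝔟 hb h1 h2 h3 hY hY'
    rw [idealTsum_eq_idealSum χ (zero_lt_one.trans_le hX1) (X := X) (fun u hu => by
        rw [← Real.exp_le_exp, Real.exp_log (by linarith)]
        refine le_trans (Real.exp_le_exp.2 ?_) hX2
        linarith [(abs_le.1 (h3 u hu)).2])]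
    refine symmetry_bound χ pb p hθ hp hp1 hpQ (by omega) hnQ hb h1 h2 h3 hX1
      ((Real.exp_pos _).trans_le hY) hX2 ?_ hT1 (error_param_le hQ hn0 hn hp1 hpQ' k hY)
    rw [mul_assoc, hX]
    gcongr
    refine (mul_le_mul_of_nonneg_right hY' (Real.exp_pos _).le).trans ?_
    rw [← Real.exp_add]
    exact Real.exp_le_exp.2 (by linarith)
  set E : ℝ := 6 * M * T * 5 ^ n * (1 + Real.log X) ^ n with hE
  have hE4 : 4 * E ≤ M * ((Q : ℝ) ^ (29 * n) / (k + 1) ^ 3) := by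
    refine le_trans ?_ (mul_le_mul_of_nonneg_left (tail_numeric_le hQ hn0 hn k) hM)
    have := log_scale_le hQ hn0 hn hp1 hpQ' k
    have h0 : 0 ≤ 1 + Real.log X := by linarith [Real.log_nonneg hX1]
    calc 4 * E = 24 * M * T * 5 ^ n * (1 + Real.log X) ^ n := by rw [hE]; ring
      _ ≤ 24 * M * T * 5 ^ n * ((k + 1) * (Q : ℝ) ^ 5) ^ n := by gcongr
      _ = _ := by ring
  have hV : 1 / 2 ≤ coneMass pb p := half_le_integral_tent _
  have final : ∀ z w : ℂ, 1 ≤ ‖z‖ → ‖z * (coneMass pb p * w)‖ ≤ 2 * E → ‖w‖ ≤ 4 * E := by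
    intro z w hz h
    rw [norm_mul, norm_mul, Complex.norm_real, Real.norm_of_nonneg (by linarith)] at h
    have h1 : (1 / 2) * ‖w‖ ≤ coneMass pb p * ‖w‖ :=
      mul_le_mul_of_nonneg_right hV (norm_nonneg _)
    have h2 : coneMass pb p * ‖w‖ ≤ ‖z‖ * (coneMass pb p * ‖w‖) :=
      le_mul_of_one_le_left (mul_nonneg (by linarith) (norm_nonneg _)) hz
    linarith
  have htop : (absNorm (⊤ : Ideal (𝓞 K))).Coprime Q := by
    rw [absNorm_top]; exact Nat.coprime_one_left Q
  refine le_trans ?_ hE4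
  rcases hτ with rfl | ⟨rfl, 𝔟, hb, hχ⟩
  · have h1 := hsym g (Real.exp (2 * k + 1)) ⊤ htop hgM hgL hgS2 (Real.exp_le_exp.2 (by linarith))
      le_rfl
    have h2 := hsym (fun u => g (u + 1)) (Real.exp (2 * k)) ⊤ htop hg'M hg'L hg'S2 le_rfl
      (Real.exp_le_exp.2 (by linarith))
    have e : dualSum χ pb p X (Real.log (Real.exp (2 * k))) (fun u => g (u + 1)) =
        dualSum χ pb p X (Real.log (Real.exp (2 * k + 1))) g := by
      unfold dualSum
      simp only [Real.log_exp]
      refine Finset.sum_congr rfl fun 𝔢 _ => ?_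
      congr 4
      ext u
      congr 2
      ring
    rw [e] at h2
    refine final 1 _ (by simp) ?_
    rw [absNorm_top, Nat.cast_one, map_one] at h1 h2
    have h3 := (norm_sub_le _ _).trans (add_le_add h1 h2)
    rw [sub_sub_sub_cancel_right] at h3
    refine le_trans (le_of_eq ?_) (h3.trans (le_of_eq (by ring)))
    congr 1
    push_cast
    ring
  · have hu : IsUnit (absNorm 𝔟 : ZMod Q) := (ZMod.isUnit_iff_coprime _ _).2 hb
    have : NeZero Q := ⟨hQ0.ne'⟩
    obtain ⟨j, hj⟩ := exists_one_le_norm_one_sub_pow (ζ := χ (absNorm 𝔟 : ZMod Q))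
      (N := Fintype.card (ZMod Q)ˣ) Fintype.card_pos (by
        rw [← map_pow]
        obtain ⟨w, hw⟩ := hu
        rw [← hw, ← Units.val_pow_eq_pow_val, pow_card_eq_one, Units.val_one, map_one]) hχ
    have h1 := hsym g (Real.exp (2 * k)) (𝔟 ^ j) (by rw [map_pow]; exact hb.pow_left j)
      hgM hgL hgS2 le_rfl (Real.exp_le_exp.2 (by linarith))
    have h2 := hsym g (Real.exp (2 * k)) ⊤ htop hgM hgL hgS2 le_rfl
      (Real.exp_le_exp.2 (by linarith))
    rw [absNorm_top, Nat.cast_one, map_one] at h2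
    rw [map_pow, Nat.cast_pow, map_pow] at h1
    have h3 := (norm_sub_le _ _).trans (add_le_add h1 h2)
    rw [sub_sub_sub_cancel_right, ← sub_mul] at h3
    rw [Complex.ofReal_zero, zero_mul, sub_zero]
    exact final _ _ hj (h3.trans (le_of_eq (by ring)))

end LocalBound

section Lipschitz

theorem hasSum_tent {u : ℝ} (hu : 0 ≤ u) : HasSum (fun k : ℕ => tent (k : ℝ) u) 1 := by
  have h1 := Nat.floor_le hu
  have h2 := Nat.lt_floor_add_one u
  have : ∑ k ∈ ({⌊u⌋₊, ⌊u⌋₊ + 1} : Finset ℕ), tent (k : ℝ) u = 1 := by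
    rw [Finset.sum_pair (by simp)]
    unfold tent
    rw [Real.norm_of_nonneg (by linarith), Real.norm_of_nonpos (by push_cast; linarith),
      max_eq_right (by linarith), max_eq_right (by push_cast; linarith)]
    push_cast
    ring
  rw [← this]
  refine hasSum_sum_of_ne_finset_zero fun k hk => tent_eq_zero _ ?_
  simp only [Finset.mem_insert, Finset.mem_singleton, not_or] at hk
  rcases lt_or_gt_of_ne hk.1 with h | h
  · have : (k : ℝ) + 1 ≤ ⌊u⌋₊ := by exact_mod_cast h
    rw [Real.norm_of_nonneg (by linarith)]
    linarith
  · have : ((⌊u⌋₊ : ℕ) : ℝ) + 1 + 1 ≤ k := by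
      have : ⌊u⌋₊ + 1 + 1 ≤ k := by omega
      exact_mod_cast this
    rw [Real.norm_of_nonpos (by linarith)]
    linarith

/-- The damping function `exp (-v max(u, 0))`. -/
noncomputable def damp (v u : ℝ) : ℝ := Real.exp (-(v * max u 0))

theorem damp_of_nonneg (v : ℝ) {u : ℝ} (hu : 0 ≤ u) : damp v u = Real.exp (-(v * u)) := by
  rw [damp, max_eq_left hu]

theorem abs_exp_sub_exp_le {v v' u : ℝ} (hv : 0 ≤ v) (hv' : 0 ≤ v') (hu : 0 ≤ u) :
    |Real.exp (-(v * u)) - Real.exp (-(v' * u))| ≤ |v - v'| * u := by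
  wlog h : v ≤ v' generalizing v v'
  · rw [abs_sub_comm, abs_sub_comm v]
    exact this hv' hv (le_of_not_ge h)
  have h1 : Real.exp (-(v' * u)) ≤ Real.exp (-(v * u)) := Real.exp_le_exp.2 (by nlinarith)
  rw [abs_of_nonneg (by linarith), abs_of_nonpos (by linarith)]
  have h2 : Real.exp (-(v' * u)) = Real.exp (-(v * u)) * Real.exp (-((v' - v) * u)) := by
    rw [← Real.exp_add]; congr 1; ring
  have h3 := Real.add_one_le_exp (-((v' - v) * u))
  have h4 : Real.exp (-(v * u)) ≤ 1 := Real.exp_le_one_iff.2 (by nlinarith)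
  rw [h2]
  nlinarith [Real.exp_pos (-(v * u)), mul_nonneg (sub_nonneg.2 h) hu]

theorem abs_mul_exp_sub_le {v u u' : ℝ} (hv : 0 ≤ v) (hu : 0 ≤ u) (hu' : 0 ≤ u') :
    |u * Real.exp (-(v * u)) - u' * Real.exp (-(v * u'))| ≤ |u - u'| := by
  have hd : ∀ x ∈ Set.Ici (0 : ℝ), HasDerivWithinAt (fun x => x * Real.exp (-(v * x)))
      (1 * Real.exp (-(v * x)) + x * (Real.exp (-(v * x)) * (-(v * 1)))) (Set.Ici 0) x := by
    intro x _
    exact (((hasDerivAt_id x).mul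
      (((hasDerivAt_id x).const_mul v).neg.exp))).hasDerivWithinAt
  have hb : ∀ x ∈ Set.Ici (0 : ℝ),
      ‖1 * Real.exp (-(v * x)) + x * (Real.exp (-(v * x)) * (-(v * 1)))‖ ≤ 1 := by
    intro x hx
    have hx : 0 ≤ v * x := mul_nonneg hv hx
    have e : 1 * Real.exp (-(v * x)) + x * (Real.exp (-(v * x)) * (-(v * 1))) =
      (1 - v * x) * Real.exp (-(v * x)) := by ring
    have h1 := Real.add_one_le_exp (v * x)
    have h3 : Real.exp (-(v * x)) * Real.exp (v * x) = 1 := by rw [← Real.exp_add]; simp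
    have h4 := Real.exp_pos (-(v * x))
    rw [e, Real.norm_eq_abs, abs_le]
    constructor <;> nlinarith
  have := Convex.norm_image_sub_le_of_norm_hasDerivWithin_le hd hb (convex_Ici 0) hu' hu
  simpa using this

theorem abs_damp_sub_le {v v' : ℝ} (hv : 0 ≤ v) (hv' : 0 ≤ v') (u : ℝ) :
    |damp v u - damp v' u| ≤ |v - v'| * max u 0 :=
  abs_exp_sub_exp_le hv hv' (le_max_right _ _)

theorem abs_damp_sub_sub_le {v v' : ℝ} (hv : 0 ≤ v) (hv' : 0 ≤ v') (u u' : ℝ) :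
    |(damp v u - damp v' u) - (damp v u' - damp v' u')| ≤ |v - v'| * |u - u'| := by
  set a := max u 0 with ha
  set b := max u' 0 with hb
  have ha0 : 0 ≤ a := le_max_right _ _
  have hb0 : 0 ≤ b := le_max_right _ _
  have hab : |a - b| ≤ |u - u'| := abs_max_sub_max_le_abs u u' 0
  have hd : ∀ x ∈ Set.Ici (0 : ℝ), HasDerivWithinAt
      (fun x => Real.exp (-(x * a)) - Real.exp (-(x * b)))
      (Real.exp (-(x * a)) * (-(1 * a)) - Real.exp (-(x * b)) * (-(1 * b))) (Set.Ici 0) x := by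
    intro x _
    exact (((hasDerivAt_id x).mul_const a).neg.exp.sub
      ((hasDerivAt_id x).mul_const b).neg.exp).hasDerivWithinAt
  have hbd : ∀ x ∈ Set.Ici (0 : ℝ),
      ‖Real.exp (-(x * a)) * (-(1 * a)) - Real.exp (-(x * b)) * (-(1 * b))‖ ≤ |u - u'| := by
    intro x hx
    refine le_trans (le_of_eq ?_) ((abs_mul_exp_sub_le hx ha0 hb0).trans hab)
    rw [Real.norm_eq_abs, abs_sub_comm]
    congr 1
    ring
  have := Convex.norm_image_sub_le_of_norm_hasDerivWithin_le hd hbd (convex_Ici 0) hv' hv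
  rw [Real.norm_eq_abs, Real.norm_eq_abs] at this
  unfold damp
  rw [mul_comm |v - v'|]
  refine le_trans (le_of_eq ?_) this
  congr 1
  ring

open NumberField Ideal

variable {K : Type*} [Field K] [NumberField K] {Q : ℕ} (χ : DirichletCharacter ℂ Q)

theorem idealWeight_eq_damp {v : ℝ} (hv : 0 < v) (I : Ideal (𝓞 K)) :
    idealWeight χ v hv I =
      χ (absNorm I : ZMod Q) * ((damp v (Real.log (absNorm I)) / absNorm I : ℝ) : ℂ) := by
  rw [idealWeight_apply]
  by_cases h0 : absNorm I = 0
  · rw [h0]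
    simp [Real.zero_rpow (show -v + -1 ≠ 0 by linarith)]
  · have hN : (0 : ℝ) < absNorm I := by exact_mod_cast Nat.pos_of_ne_zero h0
    have hN1 : (1 : ℝ) ≤ absNorm I := by exact_mod_cast Nat.pos_of_ne_zero h0
    congr 2
    rw [damp_of_nonneg _ (Real.log_nonneg hN1), Real.rpow_def_of_pos hN, eq_div_iff hN.ne']
    nth_rewrite 2 [← Real.exp_log hN]
    rw [← Real.exp_add]
    congr 1
    ring

theorem damp_add_one (v : ℝ) {u : ℝ} (hu : 0 ≤ u) :
    damp v (u + 1) = Real.exp (-v) * damp v u := by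
  rw [damp_of_nonneg _ hu, damp_of_nonneg _ (by linarith), ← Real.exp_add]
  congr 1
  ring

theorem sum_inv_sq_succ_hasSum_le : Summable (fun k : ℕ => 1 / ((k : ℝ) + 1) ^ 2) ∧
    ∑' k : ℕ, 1 / ((k : ℝ) + 1) ^ 2 ≤ 2 := by
  have h := hasSum_zeta_two
  have h1 := (hasSum_nat_add_iff' 1).2 h
  simp only [Finset.range_one, Finset.sum_singleton, Nat.cast_zero] at h1
  push_cast at h1
  refine ⟨h1.summable, ?_⟩
  rw [h1.tsum_eq]
  have := Real.pi_lt_d2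
  have := Real.pi_pos
  nlinarith

theorem hasSum_tsum_tent {ι : Type*} (w : ι → ℂ) (N u : ι → ℝ) (G : ℝ → ℝ) (hN : ∀ i, 0 ≤ N i)
    (hu : ∀ i, 0 ≤ u i) (hs : Summable fun i => ‖w i‖ * (|G (u i)| / N i)) :
    HasSum (fun k : ℕ => ∑' i, w i * ((tent (k : ℝ) (u i) * G (u i) / N i : ℝ) : ℂ))
      (∑' i, w i * ((G (u i) / N i : ℝ) : ℂ)) := by
  have hn : ∀ i (k : ℕ), ‖w i * ((tent (k : ℝ) (u i) * G (u i) / N i : ℝ) : ℂ)‖ =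
      tent (k : ℝ) (u i) * (‖w i‖ * (|G (u i)| / N i)) := fun i k => by
    rw [norm_mul, Complex.norm_real, Real.norm_eq_abs, abs_div, abs_mul, abs_of_nonneg (hN i),
      abs_of_nonneg (tent_nonneg _ _)]
    ring
  have h2 : ∀ i, HasSum (fun k : ℕ => ‖w i * ((tent (k : ℝ) (u i) * G (u i) / N i : ℝ) : ℂ)‖)
      (‖w i‖ * (|G (u i)| / N i)) := fun i => by
    have := (hasSum_tent (hu i)).mul_right (‖w i‖ * (|G (u i)| / N i))
    rw [one_mul] at this
    exact by simpa only [hn] using this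
  set f : ι → ℕ → ℂ := fun i k => w i * ((tent (k : ℝ) (u i) * G (u i) / N i : ℝ) : ℂ) with hf
  have h : Summable (Function.uncurry f) := by
    refine Summable.of_norm ((summable_prod_of_nonneg fun _ => norm_nonneg _).2
      ⟨fun i => (h2 i).summable, ?_⟩)
    exact hs.congr fun i => (h2 i).tsum_eq.symm
  have e : ∑' i, w i * ((G (u i) / N i : ℝ) : ℂ) = ∑' k : ℕ, ∑' i, f i k := by
    rw [Summable.tsum_comm h]
    refine tsum_congr fun i => ?_
    have h2 := (hasSum_tent (hu i)).mul_right (G (u i) / N i)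
    rw [one_mul] at h2
    rw [← ((Complex.hasSum_ofReal.2 h2).mul_left (w i)).tsum_eq]
    refine tsum_congr fun k => ?_
    simp only [hf, mul_div_assoc]
  rw [e]
  exact Summable.hasSum h.prod_symm.prod

/-- The Dirichlet series `∑ χ(N I) N I^{-1-v}` with its possible pole at `v = 0` removed when
`τ = 1`. -/
noncomputable def regularized (K : Type*) [Field K] [NumberField K] {Q : ℕ}
    (χ : DirichletCharacter ℂ Q) (τ v : ℝ) : ℂ :=
  (1 - τ * Real.exp (-v)) *
    ∑' I : Ideal (𝓞 K), χ (absNorm I : ZMod Q) *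
      ((damp v (Real.log (absNorm I)) / absNorm I : ℝ) : ℂ)

theorem norm_regularized_sub_le {p : ℕ} (pb : PowerBasis ℚ K) {θ : 𝓞 K} (hθ : (θ : K) = pb.gen)
    (hp : pb.gen ^ pb.dim = p) (hp1 : 1 ≤ p) (hpQ : p ∣ Q) (hQ : 48 ≤ Q)
    (hnQ : ∃ k, pb.dim ∣ Q ^ k) (hn : pb.dim ≤ Q) {τ : ℝ}
    (hτ : τ = 1 ∨ τ = 0 ∧ ∃ 𝔟 : Ideal (𝓞 K), (absNorm 𝔟).Coprime Q ∧ χ (absNorm 𝔟 : ZMod Q) ≠ 1)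
    {v v' : ℝ} (hv : 0 < v) (hv' : 0 < v') :
    ‖regularized K χ τ v - regularized K χ τ v'‖ ≤ (Q : ℝ) ^ (30 * pb.dim) * |v - v'| := by
  have hn0 : pb.dim ≠ 0 := pb.dim_pos.ne'
  have hQ1 : (48 : ℝ) ≤ Q := by exact_mod_cast hQ
  have hτ0 : 0 ≤ τ ∧ τ ≤ 1 := by rcases hτ with rfl | ⟨rfl, _⟩ <;> simp
  set G : ℝ → ℝ := fun u => damp v u - damp v' u with hG
  set g : ℕ → ℝ → ℝ := fun k u => tent (k : ℝ) u * G u with hg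
  set B : ℝ := (Q : ℝ) ^ (29 * pb.dim) with hB
  have hB0 : 0 ≤ B := by positivity
  set Λ : ℝ := |v - v'| with hΛ
  have hΛ0 : 0 ≤ Λ := abs_nonneg _
  -- each piece
  have hGM : ∀ (k : ℕ) (u : ℝ), ‖u - k‖ ≤ 1 → |G u| ≤ Λ * (k + 1) := fun k u hu => by
    refine (abs_damp_sub_le hv.le hv'.le u).trans (mul_le_mul_of_nonneg_left ?_ hΛ0)
    have := (abs_le.1 hu).2
    exact max_le (by linarith) (by positivity)
  have hpiece : ∀ k : ℕ, ‖idealTsum K χ (g k) - τ * idealTsum K χ (fun u => g k (u + 1))‖ ≤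
      (3 * Λ * B) * (1 / ((k : ℝ) + 1) ^ 2) := by
    intro k
    have hk : (0 : ℝ) < (k : ℝ) + 1 := by positivity
    have h := norm_idealTsum_sub_le χ pb hθ hp hp1 hpQ hQ hnQ hn hτ k (g := g k)
      (M := Λ * (k + 1) + Λ) ?_ ?_ ?_
    · refine h.trans ?_
      rw [mul_div_assoc', mul_one_div, div_le_div_iff₀ (by positivity) (by positivity)]
      have e : (3 * Λ * B * ((k : ℝ) + 1) ^ 3) - (Λ * (k + 1) + Λ) * B * ((k : ℝ) + 1) ^ 2 =
        Λ * B * (2 * k + 1) * ((k : ℝ) + 1) ^ 2 := by ring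
      have : 0 ≤ Λ * B * (2 * k + 1) * ((k : ℝ) + 1) ^ 2 := by positivity
      linarith
    · intro x
      by_cases hx : tent (k : ℝ) x = 0
      · simp only [hg, hx, zero_mul, abs_zero]; positivity
      · have := hGM k x (norm_sub_lt_of_tent_ne_zero _ hx).le
        simp only [hg, abs_mul, abs_of_nonneg (tent_nonneg (k : ℝ) x)]
        have h2 := mul_le_of_le_one_left (abs_nonneg (G x)) (tent_le_one (k : ℝ) x)
        linarith
    · exact abs_tent_mul_sub_le (k : ℝ) hΛ0 (hGM k) fun u u' _ _ =>
        abs_damp_sub_sub_le hv.le hv'.le u u'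
    · intro x hx
      exact (norm_sub_lt_of_tent_ne_zero _ (left_ne_zero_of_mul hx)).le
  -- interchange
  set w : Ideal (𝓞 K) → ℂ := fun I => χ (absNorm I : ZMod Q) with hw
  set N : Ideal (𝓞 K) → ℝ := fun I => (absNorm I : ℝ) with hN
  have hlog : ∀ I, 0 ≤ Real.log (N I) := fun I => Real.log_natCast_nonneg _
  have hsumv : ∀ {v : ℝ}, 0 < v → Summable fun I => w I * ((damp v (Real.log (N I)) / N I : ℝ) : ℂ) :=
    fun {v} hv => (summable_norm_idealWeight χ v hv).of_norm.congr (idealWeight_eq_damp χ hv)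
  have hsumN : ∀ {v : ℝ}, 0 < v → Summable fun I => ‖w I‖ * (damp v (Real.log (N I)) / N I) :=
    fun {v} hv => (summable_norm_idealWeight χ v hv).congr fun I => by
      rw [idealWeight_eq_damp, norm_mul, Complex.norm_real, Real.norm_of_nonneg]
      unfold damp; positivity
  have hNnn : ∀ I, 0 ≤ N I := fun I => Nat.cast_nonneg _
  have hGs : ∀ c : ℝ, 0 ≤ c → Summable fun I => ‖w I‖ * (|G (Real.log (N I) + c)| / N I) := by
    intro c hc
    refine Summable.of_nonneg_of_le (fun I => mul_nonneg (norm_nonneg _)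
      (div_nonneg (abs_nonneg _) (hNnn I))) (fun I => ?_) ((hsumN hv).add (hsumN hv'))
    rw [← mul_add, ← add_div]
    refine mul_le_mul_of_nonneg_left (div_le_div_of_nonneg_right ?_ (hNnn I)) (norm_nonneg _)
    refine (abs_sub _ _).trans ?_
    have hd : ∀ {v : ℝ}, 0 < v → |damp v (Real.log (N I) + c)| ≤ damp v (Real.log (N I)) := by
      intro v hv
      rw [damp_of_nonneg v (hlog I), damp_of_nonneg v (add_nonneg (hlog I) hc), Real.abs_exp]
      exact Real.exp_le_exp.2 (by nlinarith)
    exact add_le_add (hd hv) (hd hv')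
  have h0 := hasSum_tsum_tent w N (fun I => Real.log (N I)) G hNnn hlog
    (by simpa using hGs 0 le_rfl)
  have h1 := hasSum_tsum_tent w N (fun I => Real.log (N I) + 1) G hNnn
    (fun I => add_nonneg (hlog I) zero_le_one) (hGs 1 zero_le_one)
  have htot := h0.sub (h1.mul_left (τ : ℂ))
  have hid : ∑' I, w I * ((G (Real.log (N I)) / N I : ℝ) : ℂ) -
      τ * ∑' I, w I * ((G (Real.log (N I) + 1) / N I : ℝ) : ℂ) =
      regularized K χ τ v - regularized K χ τ v' := by
    have e0 : ∑' I, w I * ((G (Real.log (N I)) / N I : ℝ) : ℂ) =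
        ∑' I, w I * ((damp v (Real.log (N I)) / N I : ℝ) : ℂ) -
          ∑' I, w I * ((damp v' (Real.log (N I)) / N I : ℝ) : ℂ) := by
      rw [← (hsumv hv).tsum_sub (hsumv hv')]
      refine tsum_congr fun I => ?_
      simp only [hG]
      push_cast
      ring
    have e1 : ∑' I, w I * ((G (Real.log (N I) + 1) / N I : ℝ) : ℂ) =
        Real.exp (-v) * ∑' I, w I * ((damp v (Real.log (N I)) / N I : ℝ) : ℂ) -
          Real.exp (-v') * ∑' I, w I * ((damp v' (Real.log (N I)) / N I : ℝ) : ℂ) := by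
      rw [← tsum_mul_left, ← tsum_mul_left,
        ← ((hsumv hv).mul_left _).tsum_sub ((hsumv hv').mul_left _)]
      refine tsum_congr fun I => ?_
      simp only [hG, damp_add_one _ (hlog I)]
      push_cast
      ring
    rw [e0, e1]
    unfold regularized
    ring
  rw [← hid, ← htot.tsum_eq]
  obtain ⟨hs1, hs2⟩ := sum_inv_sq_succ_hasSum_le
  have := tsum_of_norm_bounded (hs1.mul_left (3 * Λ * B)).hasSum hpiece
  refine this.trans ?_
  rw [tsum_mul_left]
  calc 3 * Λ * B * ∑' k : ℕ, 1 / ((k : ℝ) + 1) ^ 2 ≤ 3 * Λ * B * 2 := by gcongr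
    _ = 6 * B * Λ := by ring
    _ ≤ Q ^ 1 * B * Λ := by gcongr; linarith
    _ ≤ _ := by
      rw [hB, ← pow_add]
      gcongr
      · linarith
      · omega

end Lipschitz

section LogLipschitz

theorem norm_sub_le_of_exp_eq {φ L : ℝ → ℂ} {A B : ℝ} (hB : 0 < B)
    (hφ : ContinuousOn φ (Set.Ioc 0 1)) (hexp : ∀ v ∈ Set.Ioc (0 : ℝ) 1, Complex.exp (φ v) = L v)
    (hL : ∀ v ∈ Set.Ioc (0 : ℝ) 1, ∀ v' ∈ Set.Ioc (0 : ℝ) 1, ‖L v - L v'‖ ≤ A * |v - v'|)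
    (hlow : ∀ v ∈ Set.Ioc (0 : ℝ) 1, B ≤ ‖L v‖) {v v' : ℝ} (hv : v ∈ Set.Ioc (0 : ℝ) 1)
    (hv' : v' ∈ Set.Ioc (0 : ℝ) 1) : ‖φ v - φ v'‖ ≤ 2 * A / B * |v - v'| := by
  wlog h : v' ≤ v generalizing v v'
  · rw [norm_sub_rev, abs_sub_comm]
    exact this hv' hv (le_of_not_ge h)
  have hsub : Set.Icc v' v ⊆ Set.Ioc (0 : ℝ) 1 := fun x hx =>
    ⟨hv'.1.trans_le hx.1, hx.2.trans hv.2⟩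
  have hA : 0 ≤ A := by
    have := (norm_nonneg _).trans (hL (1 / 2) (by norm_num) 1 (by norm_num))
    norm_num at this
    linarith
  have hcont : ContinuousOn φ (Set.Icc v' v) := hφ.mono hsub
  have key := image_le_of_liminf_slope_right_le_deriv_boundary
    (f := fun x => ‖φ x - φ v'‖) (a := v') (b := v) (hcont.sub continuousOn_const).norm
    (B := fun x => 2 * A / B * (x - v')) (B' := fun _ => 2 * A / B) (by simp) (by fun_prop)
    (fun x _ => by
      simpa using (((hasDerivAt_id x).sub_const v').const_mul (2 * A / B)).hasDerivWithinAt)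
    ?_ (x := v) ⟨h, le_rfl⟩
  · rw [abs_of_nonneg (by linarith)]
    exact key
  intro x hx r hr
  refine Filter.Eventually.frequently ?_
  have hx1 := hsub ⟨hx.1, hx.2.le⟩
  have hc : ContinuousWithinAt φ (Set.Ioi x) x := by
    have h1 : ContinuousWithinAt φ (Set.Icc v' v) x := hcont x ⟨hx.1, hx.2.le⟩
    have h2 : Set.Ioo x v ⊆ Set.Icc v' v := fun y hy => ⟨hx.1.trans hy.1.le, hy.2.le⟩
    have h3 := h1.mono h2
    rwa [ContinuousWithinAt, nhdsWithin_Ioo_eq_nhdsGT hx.2] at h3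
  have hclose : ∀ᶠ z in nhdsWithin x (Set.Ioi x), dist (φ z) (φ x) < 1 / 2 :=
    Metric.tendsto_nhds.mp hc _ (by norm_num)
  filter_upwards [hclose, Ioo_mem_nhdsGT hx.2] with z hz hzv
  have hz1 := hsub ⟨hx.1.trans hzv.1.le, hzv.2.le⟩
  have hzx : 0 < z - x := by linarith [hzv.1]
  rw [dist_eq_norm] at hz
  have hw := Complex.norm_exp_sub_one_sub_id_le (x := φ z - φ x) (by linarith)
  have hLx := hlow x hx1
  have h4 : ‖Complex.exp (φ z - φ x) - 1‖ * ‖L x‖ ≤ A * (z - x) := by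
    rw [← norm_mul, sub_mul, ← hexp x hx1, ← Complex.exp_add, sub_add_cancel, hexp z hz1, one_mul,
      hexp x hx1]
    exact (hL z hz1 x hx1).trans_eq (by rw [abs_of_pos hzx])
  have h5 : ‖φ z - φ x‖ ≤ ‖Complex.exp (φ z - φ x) - 1‖ +
      ‖Complex.exp (φ z - φ x) - 1 - (φ z - φ x)‖ := by
    have := norm_sub_le (Complex.exp (φ z - φ x) - 1)
      (Complex.exp (φ z - φ x) - 1 - (φ z - φ x))
    rwa [sub_sub_cancel] at this
  have h6 : ‖φ z - φ x‖ ≤ 2 * ‖Complex.exp (φ z - φ x) - 1‖ := by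
    nlinarith [norm_nonneg (φ z - φ x)]
  have h7 : ‖φ z - φ x‖ * B ≤ 2 * A * (z - x) := by
    calc ‖φ z - φ x‖ * B ≤ 2 * ‖Complex.exp (φ z - φ x) - 1‖ * ‖L x‖ := by gcongr
      _ ≤ 2 * A * (z - x) := by linarith
  have h8 : ‖φ z - φ x‖ ≤ 2 * A / B * (z - x) := by
    rw [div_mul_eq_mul_div, le_div_iff₀ hB]; exact h7
  rw [slope_def_field, div_lt_iff₀ hzx]
  have h9 : ‖φ z - φ v'‖ - ‖φ x - φ v'‖ ≤ ‖φ z - φ x‖ := by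
    have := norm_sub_norm_le (φ z - φ v') (φ x - φ v')
    rwa [sub_sub_sub_cancel_right] at this
  nlinarith

theorem bootstrap_lower_bound {L : ℝ → ℂ} {A c : ℝ} (hA : 1 ≤ A) (hc : 0 < c) (hc1 : c ≤ 1)
    (hL : ∀ v ∈ Set.Ioc (0 : ℝ) 1, ∀ v' ∈ Set.Ioc (0 : ℝ) 1, ‖L v - L v'‖ ≤ A * |v - v'|)
    (hlow : ∀ v ∈ Set.Ioc (0 : ℝ) 1, c * v ^ (3 / 4 : ℝ) ≤ ‖L v‖) {v : ℝ}
    (hv : v ∈ Set.Ioc (0 : ℝ) 1) : (c / (2 * A)) ^ 4 ≤ ‖L v‖ := by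
  set d := c / (2 * A) with hd
  have hd0 : 0 < d := by positivity
  have hd1 : d ≤ 1 := by
    rw [hd, div_le_one (by positivity)]; linarith
  have hcd : c = 2 * A * d := by rw [hd]; field_simp
  have hv0 : d ^ 4 ∈ Set.Ioc (0 : ℝ) 1 := ⟨by positivity, pow_le_one₀ hd0.le hd1⟩
  have e : (d ^ 4 : ℝ) ^ (3 / 4 : ℝ) = d ^ 3 := by
    rw [← Real.rpow_natCast d 4, ← Real.rpow_mul hd0.le, ← Real.rpow_natCast d 3]
    norm_num
  have h4 : (d ^ 4 : ℝ) ≤ A * d ^ 4 := le_mul_of_one_le_left (by positivity) hA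
  rcases le_total (d ^ 4) v with h | h
  · refine le_trans ?_ (hlow v hv)
    have : (d ^ 4 : ℝ) ^ (3 / 4 : ℝ) ≤ v ^ (3 / 4 : ℝ) := Real.rpow_le_rpow hv0.1.le h (by norm_num)
    rw [e] at this
    calc d ^ 4 ≤ 2 * A * d * d ^ 3 := by nlinarith [hv0.1]
      _ ≤ c * v ^ (3 / 4 : ℝ) := by rw [← hcd]; gcongr
  · have h1 := hlow _ hv0
    rw [e] at h1
    have h2 := hL _ hv0 v hv
    have h3 : |d ^ 4 - v| ≤ d ^ 4 := by rw [abs_of_nonneg (by linarith)]; linarith [hv.1]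
    have h5 : ‖L (d ^ 4)‖ ≤ ‖L v‖ + ‖L (d ^ 4) - L v‖ := by
      have := norm_add_le (L v) (L (d ^ 4) - L v)
      rwa [add_sub_cancel] at this
    have h6 : A * |d ^ 4 - v| ≤ A * d ^ 4 := by gcongr
    have h7 : c * d ^ 3 = 2 * (A * d ^ 4) := by rw [hcd]; ring
    linarith

end LogLipschitz

section EulerLog

open NumberField Ideal

/-- The local parameter `χ(N P) / (N P)^(1+v)`. -/
noncomputable def localTerm {N : ℕ} (χ : DirichletCharacter ℂ N) (v : ℝ) (k : ℕ) : ℂ :=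
  χ (k : ZMod N) * (((k : ℝ) ^ (-(1 + v)) : ℝ) : ℂ)

theorem norm_localTerm_le {N : ℕ} (χ : DirichletCharacter ℂ N) (v : ℝ) (k : ℕ) :
    ‖localTerm χ v k‖ ≤ (k : ℝ) ^ (-(1 + v)) := by
  rw [localTerm, norm_mul, Complex.norm_real, Real.norm_of_nonneg (by positivity)]
  exact mul_le_of_le_one_left (by positivity) (χ.norm_le_one _)

theorem norm_localTerm_le_inv {N : ℕ} (χ : DirichletCharacter ℂ N) {v : ℝ} (hv : 0 < v) {k : ℕ}
    (hk : 1 ≤ k) : ‖localTerm χ v k‖ ≤ (k : ℝ)⁻¹ := by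
  refine (norm_localTerm_le χ v k).trans ?_
  rw [← Real.rpow_neg_one]
  exact Real.rpow_le_rpow_of_exponent_le (by exact_mod_cast hk) (by linarith)

theorem norm_localTerm_sub_le {N : ℕ} (χ : DirichletCharacter ℂ N) {v v' : ℝ} (hv : 0 < v)
    (hv' : 0 < v') {k : ℕ} (hk : 1 ≤ k) :
    ‖localTerm χ v k - localTerm χ v' k‖ ≤ (k : ℝ)⁻¹ * Real.log k * |v - v'| := by
  have hk0 : (0 : ℝ) < k := by exact_mod_cast hk
  have hk1 : (1 : ℝ) ≤ k := by exact_mod_cast hk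
  have e : ∀ w : ℝ, (k : ℝ) ^ (-(1 + w)) = (k : ℝ)⁻¹ * Real.exp (-(w * Real.log k)) := fun w => by
    rw [neg_add, Real.rpow_add hk0, Real.rpow_neg_one, Real.rpow_def_of_pos hk0]
    ring_nf
  rw [localTerm, localTerm, ← mul_sub, norm_mul, ← Complex.ofReal_sub, Complex.norm_real, e, e,
    ← mul_sub, Real.norm_eq_abs, abs_mul, abs_of_pos (inv_pos.2 hk0)]
  calc _ ≤ 1 * ((k : ℝ)⁻¹ * (|v - v'| * Real.log k)) := by
        gcongr
        · exact χ.norm_le_one _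
        · exact abs_exp_sub_exp_le hv.le hv'.le (Real.log_nonneg hk1)
    _ = _ := by ring

/-- `-log(1-z)`, minus its linear term when `b` holds. -/
noncomputable def logDefect (b : Prop) [Decidable b] (z : ℂ) : ℂ := -Complex.log (1 - z) - if b then z else 0

theorem norm_logDefect_sub_le (b : Prop) [Decidable b] {R : ℝ} (hR : R ≤ 1 / 2) {z z' : ℂ} (hz : ‖z‖ ≤ R)
    (hz' : ‖z'‖ ≤ R) :
    ‖logDefect b z - logDefect b z'‖ ≤ (if b then 2 * R else 2) * ‖z - z'‖ := by
  have hd : ∀ x ∈ Metric.closedBall (0 : ℂ) R, HasDerivWithinAt (logDefect b)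
      ((1 - x)⁻¹ - if b then 1 else 0) (Metric.closedBall (0 : ℂ) R) x := by
    intro x hx
    rw [mem_closedBall_zero_iff] at hx
    have hslit : 1 - x ∈ Complex.slitPlane := by
      refine Or.inl ?_
      have := Complex.re_le_norm x
      simp only [Complex.sub_re, Complex.one_re]
      linarith
    have h1 : HasDerivAt (fun z : ℂ => 1 - z) (-1) x := (hasDerivAt_id x).const_sub 1
    have h2 := (h1.clog hslit).neg
    have h3 : HasDerivAt (fun z : ℂ => if b then z else 0) (if b then 1 else 0) x := by
      by_cases hb : b
      · simp only [hb, if_true]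
        exact hasDerivAt_id x
      · simpa [hb] using hasDerivAt_const x (0 : ℂ)
    have h4 := h2.sub h3
    have e : -(-1 / (1 - x)) = (1 - x)⁻¹ := by rw [neg_div, neg_neg, one_div]
    rw [e] at h4
    exact h4.hasDerivWithinAt
  refine Convex.norm_image_sub_le_of_norm_hasDerivWithin_le hd ?_ (convex_closedBall _ _)
    (mem_closedBall_zero_iff.2 hz') (mem_closedBall_zero_iff.2 hz)
  intro x hx
  rw [mem_closedBall_zero_iff] at hx
  have h1 : 1 / 2 ≤ ‖1 - x‖ := by
    have := norm_sub_norm_le (1 : ℂ) x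
    rw [norm_one] at this
    linarith
  have h0 : 1 - x ≠ 0 := by
    rw [← norm_pos_iff]; linarith
  have h2 : ‖(1 - x)⁻¹‖ ≤ 2 := by
    rw [norm_inv]
    exact inv_le_of_inv_le₀ (by norm_num) (by linarith)
  by_cases hb : b
  · simp only [hb, if_true]
    have e : (1 - x)⁻¹ - 1 = x * (1 - x)⁻¹ := by field_simp; ring
    rw [e, norm_mul]
    nlinarith [norm_nonneg x, norm_nonneg (1 - x)⁻¹]
  · simpa [hb] using h2

theorem logDefect_zero (b : Prop) [Decidable b] : logDefect b 0 = 0 := by simp [logDefect]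

variable (K : Type*) [Field K] [NumberField K] {N : ℕ} (χ : DirichletCharacter ℂ N)

theorem sum_resChar_rpow_le (F : Finset {P : Ideal (𝓞 K) // Prime P}) :
    ∑ P ∈ F, (resChar P.1 : ℝ) ^ (-(1 + 1 / 2) : ℝ) ≤ 3 * Module.finrank ℚ K := by
  set f : ℕ → ℝ := fun r => (r : ℝ) ^ (-(1 + 1 / 2) : ℝ) with hf
  set X := F.sup (fun P => resChar P.1) with hX
  have hmap : ∀ P ∈ F, resChar P.1 ∈ Finset.Icc 1 X := fun P hP =>
    Finset.mem_Icc.2 ⟨(resChar_spec P.2).1.one_le,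
      Finset.le_sup (f := fun P : {P : Ideal (𝓞 K) // Prime P} => resChar P.1) hP⟩
  rw [← Finset.sum_fiberwise_of_maps_to hmap fun P => f (resChar P.1)]
  calc ∑ r ∈ Finset.Icc 1 X, ∑ P ∈ F with resChar P.1 = r, f (resChar P.1)
      ≤ ∑ r ∈ Finset.Icc 1 X, (Module.finrank ℚ K) * f r := by
        refine Finset.sum_le_sum fun r _ => ?_
        have e : ∀ P ∈ F.filter (fun P => resChar P.1 = r), f (resChar P.1) = f r := fun P hP =>
          congrArg f (Finset.mem_filter.1 hP).2
        rw [Finset.sum_congr rfl e, Finset.sum_const, nsmul_eq_mul]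
        refine mul_le_mul_of_nonneg_right ?_ (by simp only [hf]; positivity)
        have := card_le_finrank_of_resChar_eq
          ((F.filter fun P => resChar P.1 = r).map (Function.Embedding.subtype _)) r (by
            intro P hP
            obtain ⟨P', hP', rfl⟩ := Finset.mem_map.1 hP
            exact ⟨P'.2, (Finset.mem_filter.1 hP').2⟩)
        rw [Finset.card_map] at this
        exact_mod_cast this
    _ ≤ Module.finrank ℚ K * (1 + 1 / (1 / 2)) := by
        rw [← Finset.mul_sum]
        gcongr
        exact sum_Icc_rpow_le (by norm_num) X
    _ = _ := by ring

theorem norm_logDefect_localTerm_sub_le {v v' : ℝ} (hv : 0 < v) (hv' : 0 < v') {P : Ideal (𝓞 K)}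
    (hP : Prime P) :
    ‖logDefect (absNorm P).Prime (localTerm χ v (absNorm P)) -
      logDefect (absNorm P).Prime (localTerm χ v' (absNorm P))‖ ≤
      8 * |v - v'| * (resChar P : ℝ) ^ (-(1 + 1 / 2) : ℝ) := by
  obtain ⟨hr, k, hk, hN⟩ := resChar_spec hP
  set r := resChar P
  set M := absNorm P with hM
  have hr0 : (0 : ℝ) < r := by exact_mod_cast hr.pos
  have hM2 : 2 ≤ M := hN ▸ hr.two_le.trans (Nat.le_self_pow hk.ne' r)
  have hM2' : (2 : ℝ) ≤ M := by exact_mod_cast hM2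
  have hM0 : (0 : ℝ) < M := by linarith
  have h1 := norm_logDefect_sub_le M.Prime (R := (M : ℝ)⁻¹)
    (by rw [one_div]; exact inv_anti₀ (by norm_num) hM2')
    (norm_localTerm_le_inv χ hv (by omega)) (norm_localTerm_le_inv χ hv' (by omega))
  have h2 := norm_localTerm_sub_le χ hv hv' (k := M) (by omega)
  have hΛ := abs_nonneg (v - v')
  refine h1.trans ?_
  by_cases hpr : M.Prime
  · have hk1 : k = 1 := by
      rw [hN] at hpr
      exact (Nat.Prime.eq_one_of_pow hpr)
    rw [if_pos hpr]
    rw [hk1, pow_one] at hN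
    have hlog : Real.log M ≤ (M : ℝ) ^ (1 / 2 : ℝ) / (1 / 2) :=
      Real.log_le_rpow_div hM0.le (by norm_num)
    calc 2 * (M : ℝ)⁻¹ * ‖localTerm χ v M - localTerm χ v' M‖
        ≤ 2 * (M : ℝ)⁻¹ * ((M : ℝ)⁻¹ * ((M : ℝ) ^ (1 / 2 : ℝ) / (1 / 2)) * |v - v'|) := by
          refine mul_le_mul_of_nonneg_left (h2.trans ?_) (by positivity)
          gcongr
      _ = 4 * |v - v'| * ((M : ℝ) ^ (-1 : ℝ) * (M : ℝ) ^ (-1 : ℝ) * (M : ℝ) ^ (1 / 2 : ℝ)) := by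
          rw [Real.rpow_neg_one]; ring
      _ = 4 * |v - v'| * (M : ℝ) ^ (-(1 + 1 / 2) : ℝ) := by
          rw [← Real.rpow_add hM0, ← Real.rpow_add hM0]; norm_num
      _ ≤ 8 * |v - v'| * (r : ℝ) ^ (-(1 + 1 / 2) : ℝ) := by
          rw [hN]; gcongr; norm_num
  · have hk2 : 2 ≤ k := by
      rcases Nat.lt_or_ge 1 k with h | h
      · exact h
      · exfalso
        have : k = 1 := by omega
        rw [this, pow_one] at hN
        exact hpr (hN ▸ hr)
    rw [if_neg hpr]
    have hlog : Real.log M ≤ (M : ℝ) ^ (1 / 4 : ℝ) / (1 / 4) :=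
      Real.log_le_rpow_div hM0.le (by norm_num)
    have hr2 : (r : ℝ) ^ 2 ≤ M := by
      rw [hN, Nat.cast_pow]
      exact pow_le_pow_right₀ (by exact_mod_cast hr.one_le) hk2
    calc 2 * ‖localTerm χ v M - localTerm χ v' M‖
        ≤ 2 * ((M : ℝ)⁻¹ * ((M : ℝ) ^ (1 / 4 : ℝ) / (1 / 4)) * |v - v'|) := by
          refine mul_le_mul_of_nonneg_left (h2.trans ?_) (by positivity)
          gcongr
      _ = 8 * |v - v'| * ((M : ℝ) ^ (-1 : ℝ) * (M : ℝ) ^ (1 / 4 : ℝ)) := by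
          rw [Real.rpow_neg_one]; ring
      _ = 8 * |v - v'| * (M : ℝ) ^ (-(3 / 4) : ℝ) := by
          rw [← Real.rpow_add hM0]; norm_num
      _ ≤ 8 * |v - v'| * ((r : ℝ) ^ 2) ^ (-(3 / 4) : ℝ) := by
          refine mul_le_mul_of_nonneg_left ?_ (by positivity)
          exact Real.rpow_le_rpow_of_nonpos (by positivity) hr2 (by norm_num)
      _ = _ := by
          rw [← Real.rpow_natCast, ← Real.rpow_mul hr0.le]; norm_num

theorem norm_logDefect_localTerm_le {v : ℝ} (hv : 0 < v) {P : Ideal (𝓞 K)} (hP : Prime P) :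
    ‖logDefect (absNorm P).Prime (localTerm χ v (absNorm P))‖ ≤
      8 * (resChar P : ℝ) ^ (-(1 + 1 / 2) : ℝ) := by
  obtain ⟨hr, k, hk, hN⟩ := resChar_spec hP
  set r := resChar P
  set M := absNorm P with hM
  have hr0 : (0 : ℝ) < r := by exact_mod_cast hr.pos
  have hr1 : (1 : ℝ) ≤ r := by exact_mod_cast hr.one_le
  have hM2 : 2 ≤ M := hN ▸ hr.two_le.trans (Nat.le_self_pow hk.ne' r)
  have hM2' : (2 : ℝ) ≤ M := by exact_mod_cast hM2
  have hM0 : (0 : ℝ) < M := by linarith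
  have hMi : (M : ℝ)⁻¹ ≤ 1 / 2 := by rw [one_div]; exact inv_anti₀ (by norm_num) hM2'
  have hz := norm_localTerm_le_inv χ hv (k := M) (by omega)
  have h1 := norm_logDefect_sub_le M.Prime hMi hz (z' := 0) (by simp)
  rw [logDefect_zero, sub_zero, sub_zero] at h1
  have key : (if M.Prime then 2 * (M : ℝ)⁻¹ else 2) * ‖localTerm χ v M‖ ≤
      8 * ((r : ℝ) ^ 2)⁻¹ := by
    by_cases hpr : M.Prime
    · have hk1 : k = 1 := by
        rw [hN] at hpr
        exact (Nat.Prime.eq_one_of_pow hpr)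
      rw [if_pos hpr]
      rw [hk1, pow_one] at hN
      rw [← hN]
      calc 2 * (M : ℝ)⁻¹ * ‖localTerm χ v M‖ ≤ 2 * (M : ℝ)⁻¹ * (M : ℝ)⁻¹ := by gcongr
        _ = 2 * ((M : ℝ) ^ 2)⁻¹ := by rw [pow_two, mul_inv]; ring
        _ ≤ _ := by gcongr; norm_num
    · have hk2 : 2 ≤ k := by
        rcases Nat.lt_or_ge 1 k with h | h
        · exact h
        · exfalso
          have : k = 1 := by omega
          rw [this, pow_one] at hN
          exact hpr (hN ▸ hr)
      rw [if_neg hpr]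
      have hr2 : (r : ℝ) ^ 2 ≤ M := by
        rw [hN, Nat.cast_pow]
        exact pow_le_pow_right₀ hr1 hk2
      calc 2 * ‖localTerm χ v M‖ ≤ 8 * (M : ℝ)⁻¹ := by
            have := norm_nonneg (localTerm χ v M)
            linarith
        _ ≤ _ := by gcongr
  refine h1.trans (key.trans ?_)
  rw [← Real.rpow_natCast, ← Real.rpow_neg hr0.le]
  gcongr 8 * ?_
  exact Real.rpow_le_rpow_of_exponent_le hr1 (by norm_num)

/-- The logarithm of the Euler product over the prime ideals. -/
noncomputable def eulerLog (v : ℝ) : ℂ :=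
  ∑' P : {P : Ideal (𝓞 K) // Prime P}, -Complex.log (1 - localTerm χ v (absNorm P.1))

/-- The number of prime ideals of absolute norm `r`. -/
noncomputable def normCount (r : ℕ) : ℕ :=
  Nat.card {P : {P : Ideal (𝓞 K) // Prime P} // absNorm P.1 = r}

/-- The sum over the prime ideals of prime norm. -/
noncomputable def degOneSum (v : ℝ) : ℂ :=
  ∑' P : {P : Ideal (𝓞 K) // Prime P},
    if (absNorm P.1).Prime then localTerm χ v (absNorm P.1) else 0

variable {K}

theorem exp_eulerLog {v : ℝ} (hv : 0 < v) :
    Complex.exp (eulerLog K χ v) = ∑' I, idealWeight (K := K) χ v hv I := by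
  have h := exp_tsum_neg_log_one_sub (idealWeight (K := K) χ v hv)
    (summable_norm_idealWeight χ v hv) (fun P hP => by
      obtain ⟨hr, k, hk, hN⟩ := resChar_spec hP
      have hM2 : 2 ≤ absNorm P := hN ▸ hr.two_le.trans (Nat.le_self_pow hk.ne' _)
      refine (norm_localTerm_le_inv χ hv (k := absNorm P) (by omega)).trans_lt ?_
      exact inv_lt_one_of_one_lt₀ (by exact_mod_cast hM2))
  exact h

theorem summable_norm_localTerm_absNorm {v : ℝ} (hv : 0 < v) :
    Summable fun P : {P : Ideal (𝓞 K) // Prime P} => (absNorm P.1 : ℝ) ^ (-(1 + v)) :=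
  (summable_absNorm_rpow hv).comp_injective Subtype.val_injective

theorem two_le_absNorm {P : Ideal (𝓞 K)} (hP : Prime P) : 2 ≤ absNorm P := by
  obtain ⟨hr, k, hk, hN⟩ := resChar_spec hP
  exact hN ▸ hr.two_le.trans (Nat.le_self_pow hk.ne' _)

theorem norm_neg_log_localTerm_le {v : ℝ} (hv : 0 < v) {P : Ideal (𝓞 K)} (hP : Prime P) :
    ‖-Complex.log (1 - localTerm χ v (absNorm P))‖ ≤ 2 * (absNorm P : ℝ) ^ (-(1 + v)) := by
  have hM := two_le_absNorm hP
  have hz := norm_localTerm_le_inv χ hv (k := absNorm P) (by omega)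
  have hMi : (absNorm P : ℝ)⁻¹ ≤ 1 / 2 := by
    rw [one_div]; exact inv_anti₀ (by norm_num) (by exact_mod_cast hM)
  have := norm_logDefect_sub_le False hMi hz (z' := 0) (by simp)
  simp only [logDefect, if_false, sub_zero, Complex.log_one, neg_zero] at this
  exact this.trans (mul_le_mul_of_nonneg_left (norm_localTerm_le χ v _) (by norm_num))

theorem continuousOn_eulerLog : ContinuousOn (eulerLog K χ) (Set.Ioi 0) := by
  refine continuousOn_of_forall_continuousAt fun v₀ hv₀ => ?_
  have hv₀' : (0 : ℝ) < v₀ / 2 := half_pos hv₀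
  have key : ContinuousOn (eulerLog K χ) (Set.Ici (v₀ / 2)) := by
    refine continuousOn_tsum (fun P => ?_)
      ((summable_norm_localTerm_absNorm (K := K) hv₀').mul_left 2) (fun P v hv => ?_)
    · have hM := two_le_absNorm P.2
      have hMi : (absNorm P.1 : ℝ)⁻¹ ≤ 1 / 2 := by
        rw [one_div]; exact inv_anti₀ (by norm_num) (by exact_mod_cast hM)
      refine (ContinuousOn.clog ?_ fun v hv => Or.inl ?_).neg
      · unfold localTerm
        refine continuousOn_const.sub (continuousOn_const.mul ?_)
        refine Complex.continuous_ofReal.comp_continuousOn ?_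
        refine ContinuousOn.rpow continuousOn_const (by fun_prop) fun v _ => Or.inl ?_
        have : 0 < absNorm P.1 := by omega
        exact_mod_cast this.ne'
      · have hv' : (0 : ℝ) < v := hv₀'.trans_le hv
        have hz := norm_localTerm_le_inv χ hv' (k := absNorm P.1) (by omega)
        have := Complex.re_le_norm (localTerm χ v (absNorm P.1))
        simp only [Complex.sub_re, Complex.one_re]
        linarith
    · have hv' : (0 : ℝ) < v := hv₀'.trans_le hv
      refine (norm_neg_log_localTerm_le χ hv' P.2).trans ?_
      have hM := two_le_absNorm P.2
      have : (1 : ℝ) ≤ absNorm P.1 := by exact_mod_cast (by omega : 1 ≤ absNorm P.1)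
      have hv2 : v₀ / 2 ≤ v := hv
      gcongr
  exact key.continuousAt (Ici_mem_nhds (by linarith))

theorem summable_degOne {v : ℝ} (hv : 0 < v) :
    Summable fun P : {P : Ideal (𝓞 K) // Prime P} =>
      if (absNorm P.1).Prime then localTerm χ v (absNorm P.1) else 0 := by
  refine Summable.of_norm_bounded (summable_norm_localTerm_absNorm (K := K) hv) fun P => ?_
  split_ifs
  · exact norm_localTerm_le χ v _
  · rw [norm_zero]; positivity

theorem eulerLog_sub_degOneSum {v : ℝ} (hv : 0 < v) :
    eulerLog K χ v - degOneSum K χ v = ∑' P : {P : Ideal (𝓞 K) // Prime P},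
      logDefect (absNorm P.1).Prime (localTerm χ v (absNorm P.1)) := by
  have h1 : Summable fun P : {P : Ideal (𝓞 K) // Prime P} =>
      -Complex.log (1 - localTerm χ v (absNorm P.1)) :=
    Summable.of_norm_bounded ((summable_norm_localTerm_absNorm (K := K) hv).mul_left 2)
      fun P => norm_neg_log_localTerm_le χ hv P.2
  rw [eulerLog, degOneSum, ← h1.tsum_sub (summable_degOne χ hv)]
  rfl

theorem summable_resChar :
    Summable fun P : {P : Ideal (𝓞 K) // Prime P} => (resChar P.1 : ℝ) ^ (-(1 + 1 / 2) : ℝ) :=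
  summable_of_sum_le (fun _ => by positivity) (sum_resChar_rpow_le K)

theorem tsum_resChar_le :
    ∑' P : {P : Ideal (𝓞 K) // Prime P}, (resChar P.1 : ℝ) ^ (-(1 + 1 / 2) : ℝ) ≤
      3 * Module.finrank ℚ K :=
  summable_resChar.tsum_le_of_sum_le (sum_resChar_rpow_le K)

theorem norm_eulerLog_sub_degOneSum_le {v : ℝ} (hv : 0 < v) :
    ‖eulerLog K χ v - degOneSum K χ v‖ ≤ 24 * Module.finrank ℚ K := by
  rw [eulerLog_sub_degOneSum χ hv]
  refine (tsum_of_norm_bounded (summable_resChar.mul_left 8).hasSum fun P =>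
    norm_logDefect_localTerm_le K χ hv P.2).trans ?_
  rw [tsum_mul_left]
  linarith [tsum_resChar_le (K := K)]

theorem norm_eulerLog_sub_degOneSum_sub_le {v v' : ℝ} (hv : 0 < v) (hv' : 0 < v') :
    ‖(eulerLog K χ v - degOneSum K χ v) - (eulerLog K χ v' - degOneSum K χ v')‖ ≤
      24 * Module.finrank ℚ K * |v - v'| := by
  have hs : ∀ {v : ℝ}, 0 < v → Summable fun P : {P : Ideal (𝓞 K) // Prime P} =>
      logDefect (absNorm P.1).Prime (localTerm χ v (absNorm P.1)) := fun hv =>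
    Summable.of_norm_bounded (summable_resChar.mul_left 8) fun P =>
      norm_logDefect_localTerm_le K χ hv P.2
  rw [eulerLog_sub_degOneSum χ hv, eulerLog_sub_degOneSum χ hv', ← (hs hv).tsum_sub (hs hv')]
  refine (tsum_of_norm_bounded (summable_resChar.mul_left (8 * |v - v'|)).hasSum fun P =>
    norm_logDefect_localTerm_sub_le K χ hv hv' P.2).trans ?_
  rw [tsum_mul_left]
  nlinarith [tsum_resChar_le (K := K), abs_nonneg (v - v')]

theorem degOneSum_eq {v : ℝ} (hv : 0 < v) :
    degOneSum K χ v = ∑' r : ℕ, if r.Prime then (normCount K r : ℂ) * localTerm χ v r else 0 := by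
  have hs := summable_degOne (K := K) χ hv
  rw [degOneSum, ← (Equiv.sigmaFiberEquiv
    (fun P : {P : Ideal (𝓞 K) // Prime P} => absNorm P.1)).tsum_eq]
  rw [← (Equiv.sigmaFiberEquiv
    (fun P : {P : Ideal (𝓞 K) // Prime P} => absNorm P.1)).summable_iff] at hs
  have h2 := hs.tsum_sigma
  refine Eq.trans h2 (tsum_congr fun r => ?_)
  have e : ∀ P : {P : {P : Ideal (𝓞 K) // Prime P} // absNorm P.1 = r},
      ((fun P : {P : Ideal (𝓞 K) // Prime P} =>
        if (absNorm P.1).Prime then localTerm χ v (absNorm P.1) else 0) ∘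
        (Equiv.sigmaFiberEquiv (fun P : {P : Ideal (𝓞 K) // Prime P} => absNorm P.1))) ⟨r, P⟩ =
      if r.Prime then localTerm χ v r else 0 := by
    intro P
    simp only [Function.comp_apply, Equiv.sigmaFiberEquiv, Equiv.coe_fn_mk]
    rw [P.2]
  rw [tsum_congr e, tsum_const, nsmul_eq_mul, mul_ite, mul_zero]
  rfl

end EulerLog

section Bootstrap

open NumberField Ideal

theorem log_one_sub_exp_neg_lipschitz {v v' : ℝ} (hv : v ∈ Set.Ioc (0 : ℝ) 1)
    (hv' : v' ∈ Set.Ioc (0 : ℝ) 1) :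
    |(Real.log (1 - Real.exp (-v)) - Real.log v) - (Real.log (1 - Real.exp (-v')) - Real.log v')| ≤
      |v - v'| := by
  have hd : ∀ x ∈ Set.Ioc (0 : ℝ) 1, HasDerivWithinAt
      (fun v => Real.log (1 - Real.exp (-v)) - Real.log v)
      (Real.exp (-x) / (1 - Real.exp (-x)) - x⁻¹) (Set.Ioc 0 1) x := by
    intro x hx
    have h1 : Real.exp (-x) < 1 := by rw [Real.exp_lt_one_iff]; linarith [hx.1]
    have h2 : HasDerivAt (fun v : ℝ => 1 - Real.exp (-v)) (Real.exp (-x)) x := by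
      have := ((hasDerivAt_neg x).exp).const_sub 1
      simpa using this
    exact ((h2.log (by linarith)).sub (Real.hasDerivAt_log hx.1.ne')).hasDerivWithinAt
  have := Convex.norm_image_sub_le_of_norm_hasDerivWithin_le (C := 1) hd ?_ (convex_Ioc 0 1) hv' hv
  · simpa using this
  intro x hx
  have hx0 := hx.1
  have h1 : Real.exp (-x) < 1 := by rw [Real.exp_lt_one_iff]; linarith [hx.1]
  have h2 : 0 < Real.exp (-x) := Real.exp_pos _
  have h3 : 1 - x ≤ Real.exp (-x) := by linarith [Real.add_one_le_exp (-x)]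
  have h4 : Real.exp (-x) * (x + 1) ≤ 1 := by
    have := Real.add_one_le_exp x
    have h5 : Real.exp (-x) * Real.exp x = 1 := by rw [← Real.exp_add]; simp
    nlinarith
  have e : Real.exp (-x) / (1 - Real.exp (-x)) - x⁻¹ =
      (Real.exp (-x) * (x + 1) - 1) / ((1 - Real.exp (-x)) * x) := by
    have : 1 - Real.exp (-x) ≠ 0 := by linarith
    field_simp
    ring
  have hpos : 0 < (1 - Real.exp (-x)) * x := mul_pos (by linarith) hx0
  rw [e, Real.norm_eq_abs, abs_of_nonpos (div_nonpos_of_nonpos_of_nonneg (by linarith) hpos.le),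
    ← neg_div, div_le_one hpos]
  nlinarith

/-- A generator of a pure field `ℚ(p^(1/n))`, together with an admissible modulus `Q`. -/
structure RadicalGen (K : Type*) [Field K] [NumberField K] (p n Q : ℕ) where
  pb : PowerBasis ℚ K
  θ : 𝓞 K
  coe_θ : (θ : K) = pb.gen
  dim_eq : pb.dim = n
  gen_pow : pb.gen ^ pb.dim = p
  one_le : 1 ≤ p
  dvd : p ∣ Q
  le_mod : 48 ≤ Q
  dvd_pow : ∃ k, pb.dim ∣ Q ^ k
  dim_le : pb.dim ≤ Q

/-- Either the pole is removed (`τ = 1`), or `χ ∘ N` is nontrivial (`τ = 0`). -/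
def Admissible (K : Type*) [Field K] [NumberField K] {Q : ℕ} (χ : DirichletCharacter ℂ Q)
    (τ : ℝ) : Prop :=
  τ = 1 ∨ τ = 0 ∧ ∃ 𝔟 : Ideal (𝓞 K), (absNorm 𝔟).Coprime Q ∧ χ (absNorm 𝔟 : ZMod Q) ≠ 1

variable {K : Type*} [Field K] [NumberField K] {p n Q : ℕ} {χ : DirichletCharacter ℂ Q} {τ : ℝ}

theorem RadicalGen.finrank_eq (D : RadicalGen K p n Q) : Module.finrank ℚ K = n := by
  rw [D.pb.finrank, D.dim_eq]

theorem RadicalGen.one_le_dim (D : RadicalGen K p n Q) : 1 ≤ n := by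
  rw [← D.dim_eq]; exact D.pb.dim_pos

theorem RadicalGen.dim_le_mod (D : RadicalGen K p n Q) : n ≤ Q := by
  rw [← D.dim_eq]; exact D.dim_le

theorem RadicalGen.norm_regularized_sub_le (D : RadicalGen K p n Q) (hτ : Admissible K χ τ)
    {v v' : ℝ} (hv : 0 < v) (hv' : 0 < v') :
    ‖regularized K χ τ v - regularized K χ τ v'‖ ≤ (Q : ℝ) ^ (30 * n) * |v - v'| := by
  have := _root_.norm_regularized_sub_le χ D.pb D.coe_θ D.gen_pow D.one_le D.dvd D.le_mod D.dvd_pow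
    D.dim_le hτ hv hv'
  rwa [D.dim_eq] at this

theorem regularized_eq_exp (χ : DirichletCharacter ℂ Q) (τ : ℝ) {v : ℝ} (hv : 0 < v) :
    regularized K χ τ v = (1 - τ * Real.exp (-v)) * Complex.exp (eulerLog K χ v) := by
  rw [exp_eulerLog χ hv, regularized]
  congr 1
  exact tsum_congr fun I => (idealWeight_eq_damp χ hv I).symm

theorem one_sub_exp_neg_bounds {v : ℝ} (hv : v ∈ Set.Ioc (0 : ℝ) 1) :
    v / 2 ≤ 1 - Real.exp (-v) ∧ 1 - Real.exp (-v) ≤ v := by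
  refine ⟨?_, by linarith [Real.add_one_le_exp (-v)]⟩
  have h1 := Real.add_one_le_exp v
  have h2 : Real.exp (-v) * Real.exp v = 1 := by rw [← Real.exp_add]; simp
  have h3 := Real.exp_pos (-v)
  have : Real.exp (-v) * (1 + v) ≤ 1 := by nlinarith
  have hv0 := hv.1
  have hv1 := hv.2
  nlinarith

theorem Admissible.eq (hτ : Admissible K χ τ) : τ = 1 ∨ τ = 0 := hτ.imp_right fun h => h.1

theorem norm_regularized (hτ : τ = 1 ∨ τ = 0) {v : ℝ} (hv : v ∈ Set.Ioc (0 : ℝ) 1) :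
    ‖regularized K χ τ v‖ =
      Real.exp ((eulerLog K χ v).re + τ * Real.log (1 - Real.exp (-v))) := by
  have hb := one_sub_exp_neg_bounds hv
  have hv0 := hv.1
  rw [regularized_eq_exp χ τ hv.1, norm_mul, Complex.norm_exp, Real.exp_add, mul_comm]
  congr 1
  rcases hτ with rfl | rfl
  · rw [one_mul, Real.exp_log (by linarith), Complex.ofReal_one, one_mul, ← Complex.ofReal_one,
      ← Complex.ofReal_sub, Complex.norm_real, Real.norm_of_nonneg (by linarith)]
  · simp

theorem RadicalGen.log_mod (D : RadicalGen K p n Q) : 3 ≤ Real.log Q := by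
  have h : (48 : ℝ) ≤ Q := by exact_mod_cast D.le_mod
  rw [Real.le_log_iff_exp_le (by linarith)]
  refine le_trans ?_ h
  have h1 := Real.exp_one_lt_d9
  have : Real.exp 3 = Real.exp 1 ^ 3 := by rw [← Real.exp_nat_mul]; norm_num
  rw [this]
  calc Real.exp 1 ^ 3 ≤ 3 ^ 3 := by gcongr; linarith
    _ ≤ 48 := by norm_num

theorem re_degOneSum_sub_le (χ : DirichletCharacter ℂ Q) {v : ℝ} (hv : 0 < v) :
    |(eulerLog K χ v).re - (degOneSum K χ v).re| ≤ 24 * Module.finrank ℚ K := by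
  rw [← Complex.sub_re]
  exact (Complex.abs_re_le_norm _).trans (norm_eulerLog_sub_degOneSum_le χ hv)

theorem RadicalGen.norm_regularized_one_le (D : RadicalGen K p n Q) (hτ : τ = 1 ∨ τ = 0) :
    ‖regularized K χ τ 1‖ ≤ 2 ^ n := by
  have h1 : ‖(1 - τ * Real.exp (-1) : ℂ)‖ ≤ 1 := by
    rcases hτ with rfl | rfl
    · have h2 : Real.exp (-1) ≤ 1 := Real.exp_le_one_iff.2 (by norm_num)
      have h3 := Real.exp_pos (-1)
      rw [Complex.ofReal_one, one_mul, ← Complex.ofReal_one, ← Complex.ofReal_sub,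
        Complex.norm_real, Real.norm_of_nonneg (by linarith)]
      linarith
    · simp
  rw [regularized_eq_exp χ τ one_pos, exp_eulerLog χ one_pos, norm_mul]
  have h2 : ‖∑' I, idealWeight (K := K) χ 1 one_pos I‖ ≤ 2 ^ n := by
    refine (tsum_of_norm_bounded (summable_absNorm_rpow one_pos).hasSum
      (norm_idealWeight_le χ 1 one_pos)).trans ?_
    refine (tsum_absNorm_rpow_le one_pos).trans ?_
    rw [D.finrank_eq]
    norm_num
  exact (mul_le_mul h1 h2 (norm_nonneg _) zero_le_one).trans_eq (one_mul _)

theorem RadicalGen.re_degOneSum_le (D : RadicalGen K p n Q) (hτ : Admissible K χ τ) {v : ℝ}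
    (hv : v ∈ Set.Ioc (0 : ℝ) 1) :
    (degOneSum K χ v).re ≤ -(τ * Real.log v) + 60 * n * Real.log Q := by
  have hQ : (48 : ℝ) ≤ Q := by exact_mod_cast D.le_mod
  have hn : (1 : ℝ) ≤ n := by exact_mod_cast D.one_le_dim
  have hlQ := D.log_mod
  have h1 : ‖regularized K χ τ v‖ ≤ (Q : ℝ) ^ (31 * n) := by
    have h2 := D.norm_regularized_sub_le hτ hv.1 one_pos
    have h3 := D.norm_regularized_one_le (χ := χ) hτ.eq
    have h4 : ‖regularized K χ τ v‖ ≤ ‖regularized K χ τ 1‖ +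
        ‖regularized K χ τ v - regularized K χ τ 1‖ := by
      have := norm_add_le (regularized K χ τ 1) (regularized K χ τ v - regularized K χ τ 1)
      rwa [add_sub_cancel] at this
    have h5 : |v - 1| ≤ 1 := by
      have h6 := hv.1
      have h7 := hv.2
      rw [abs_le]; constructor <;> linarith
    have h8 : (2 : ℝ) ^ n ≤ Q ^ (30 * n) := by
      calc (2 : ℝ) ^ n ≤ Q ^ n := by gcongr; linarith
        _ ≤ _ := pow_le_pow_right₀ (by linarith) (by omega)
    calc ‖regularized K χ τ v‖ ≤ 2 ^ n + Q ^ (30 * n) * 1 := by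
          refine h4.trans (add_le_add h3 (h2.trans (by gcongr)))
      _ ≤ 2 * Q ^ (30 * n) := by linarith
      _ ≤ Q ^ n * Q ^ (30 * n) := by
          gcongr
          calc (2 : ℝ) ≤ Q ^ 1 := by linarith
            _ ≤ _ := pow_le_pow_right₀ (by linarith) D.one_le_dim
      _ = _ := by rw [← pow_add]; congr 1; ring
  rw [norm_regularized hτ.eq hv] at h1
  have hb := one_sub_exp_neg_bounds hv
  have hv0 := hv.1
  have h6 : Real.log v - Real.log 2 ≤ Real.log (1 - Real.exp (-v)) := by
    rw [← Real.log_div hv0.ne' two_ne_zero]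
    exact Real.log_le_log (by linarith) hb.1
  have h7 := (Real.le_log_iff_exp_le (by positivity)).2 h1
  rw [Real.log_pow] at h7
  push_cast at h7
  have h8 := re_degOneSum_sub_le (K := K) χ hv0
  rw [D.finrank_eq] at h8
  have h9 := (abs_le.1 h8).1
  have h10 : Real.log 2 ≤ 1 := by linarith [Real.log_two_lt_d9]
  have h11 : τ * (Real.log v - 1) ≤ τ * Real.log (1 - Real.exp (-v)) := by
    refine mul_le_mul_of_nonneg_left (by linarith) ?_
    rcases hτ.eq with rfl | rfl <;> norm_num
  have h12 : τ ≤ 1 := by rcases hτ.eq with rfl | rfl <;> norm_num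
  nlinarith

/-- A weak lower bound for `Re h` self-improves, and makes `h` Lipschitz up to the pole. -/
theorem RadicalGen.bootstrap (D : RadicalGen K p n Q) (hτ : Admissible K χ τ) {C : ℕ}
    (hlow : ∀ v ∈ Set.Ioc (0 : ℝ) 1,
      (3 / 4 - τ) * Real.log v - C * n * Real.log Q ≤ (degOneSum K χ v).re) :
    (∀ v ∈ Set.Ioc (0 : ℝ) 1,
      -(τ * Real.log v) - (4 * C + 250) * n * Real.log Q ≤ (degOneSum K χ v).re) ∧
    ∀ v ∈ Set.Ioc (0 : ℝ) 1, ∀ v' ∈ Set.Ioc (0 : ℝ) 1,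
      ‖degOneSum K χ v - degOneSum K χ v' + ((τ * (Real.log v - Real.log v') : ℝ) : ℂ)‖ ≤
        (Q : ℝ) ^ ((4 * C + 250) * n) * |v - v'| := by
  have hQ : (48 : ℝ) ≤ Q := by exact_mod_cast D.le_mod
  have hn : (1 : ℝ) ≤ n := by exact_mod_cast D.one_le_dim
  have hn1 := D.one_le_dim
  have hnQ : (n : ℝ) ≤ Q := by exact_mod_cast D.dim_le_mod
  have hlQ := D.log_mod
  have hτ1 : 0 ≤ τ ∧ τ ≤ 1 := by rcases hτ.eq with rfl | rfl <;> norm_num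
  set A : ℝ := (Q : ℝ) ^ (30 * n) with hA
  have hA1 : 1 ≤ A := one_le_pow₀ (by linarith)
  set c : ℝ := Real.exp (-((C + 24) * n * Real.log Q)) / 2 with hc
  have hc0 : 0 < c := by positivity
  have hcn : c = ((Q : ℝ) ^ ((C + 24) * n))⁻¹ / 2 := by
    rw [hc, ← Real.exp_log (show (0 : ℝ) < Q by linarith), ← Real.exp_nat_mul, ← Real.exp_neg,
      Real.log_exp]
    push_cast
    rfl
  have hc1 : c ≤ 1 := by
    have : Real.exp (-((C + 24) * n * Real.log Q)) ≤ 1 :=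
      Real.exp_le_one_iff.2 (by simp only [Left.neg_nonpos_iff]; positivity)
    rw [hc]; linarith
  have hL : ∀ v ∈ Set.Ioc (0 : ℝ) 1, ∀ v' ∈ Set.Ioc (0 : ℝ) 1,
      ‖regularized K χ τ v - regularized K χ τ v'‖ ≤ A * |v - v'| := fun v hv v' hv' =>
    D.norm_regularized_sub_le hτ hv.1 hv'.1
  have hweak : ∀ v ∈ Set.Ioc (0 : ℝ) 1, c * v ^ (3 / 4 : ℝ) ≤ ‖regularized K χ τ v‖ := by
    intro v hv
    have hv0 := hv.1
    have hb := one_sub_exp_neg_bounds hv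
    rw [norm_regularized hτ.eq hv, Real.rpow_def_of_pos hv0, hc, div_mul_eq_mul_div, ← Real.exp_add,
      div_eq_mul_inv, ← Real.exp_log (show (0 : ℝ) < 2⁻¹ by norm_num), ← Real.exp_add,
      Real.log_inv]
    refine Real.exp_le_exp.2 ?_
    have h6 : Real.log v - Real.log 2 ≤ Real.log (1 - Real.exp (-v)) := by
      rw [← Real.log_div hv0.ne' two_ne_zero]
      exact Real.log_le_log (by linarith) hb.1
    have h7 := mul_le_mul_of_nonneg_left h6 hτ1.1
    have h8 := re_degOneSum_sub_le (K := K) χ hv0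
    rw [D.finrank_eq] at h8
    have h9 := (abs_le.1 h8).1
    have h10 := hlow v hv
    have h11 : τ * Real.log 2 ≤ Real.log 2 :=
      mul_le_of_le_one_left (Real.log_nonneg (by norm_num)) hτ1.2
    nlinarith
  have hlb : ∀ v ∈ Set.Ioc (0 : ℝ) 1, (c / (2 * A)) ^ 4 ≤ ‖regularized K χ τ v‖ := fun v hv =>
    bootstrap_lower_bound hA1 hc0 hc1 hL hweak hv
  have hBeq : ((c / (2 * A)) ^ 4)⁻¹ = 256 * (Q : ℝ) ^ ((4 * C + 216) * n) := by
    have hQ0 : (Q : ℝ) ≠ 0 := by linarith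
    rw [hcn, hA, div_div, div_pow, inv_div, inv_pow, div_inv_eq_mul, mul_pow, mul_pow,
      ← pow_mul, ← pow_mul]
    calc _ = 256 * ((Q : ℝ) ^ (30 * n * 4) * Q ^ ((C + 24) * n * 4)) := by ring
      _ = _ := by rw [← pow_add]; congr 2; ring
  have hBle : ((c / (2 * A)) ^ 4)⁻¹ ≤ (Q : ℝ) ^ ((4 * C + 218) * n) := by
    rw [hBeq]
    calc _ ≤ (Q : ℝ) ^ (2 * n) * (Q : ℝ) ^ ((4 * C + 216) * n) := by
          gcongr
          calc (256 : ℝ) ≤ Q ^ 2 := by nlinarith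
            _ ≤ _ := pow_le_pow_right₀ (by linarith) (by omega)
      _ = _ := by rw [← pow_add]; congr 1; ring
  have hB0 : 0 < (c / (2 * A)) ^ 4 := by positivity
  refine ⟨fun v hv => ?_, fun v hv v' hv' => ?_⟩
  · have hv0 := hv.1
    have hb := one_sub_exp_neg_bounds hv
    have h1 := hlb v hv
    rw [norm_regularized hτ.eq hv] at h1
    have h2 := (Real.log_le_iff_le_exp hB0).2 h1
    have h3 := Real.log_le_log (inv_pos.2 hB0) hBle
    rw [Real.log_inv, Real.log_pow (Q : ℝ)] at h3
    push_cast at h3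
    have h6 : Real.log (1 - Real.exp (-v)) ≤ Real.log v :=
      Real.log_le_log (by linarith) hb.2
    have h7 := mul_le_mul_of_nonneg_left h6 hτ1.1
    have h8 := re_degOneSum_sub_le (K := K) χ hv0
    rw [D.finrank_eq] at h8
    have h9 := (abs_le.1 h8).2
    have h10 : (n : ℝ) * 3 ≤ n * Real.log Q := by gcongr
    nlinarith
  · have hcontφ : ContinuousOn (fun v => eulerLog K χ v +
        ((τ * Real.log (1 - Real.exp (-v)) : ℝ) : ℂ)) (Set.Ioc 0 1) := by
      refine ((continuousOn_eulerLog χ).mono fun v hv => hv.1).add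
        (Complex.continuous_ofReal.comp_continuousOn (continuousOn_const.mul
          (ContinuousOn.log (by fun_prop) fun v hv => ?_)))
      have := one_sub_exp_neg_bounds hv
      have := hv.1
      linarith
    have hexp : ∀ v ∈ Set.Ioc (0 : ℝ) 1, Complex.exp (eulerLog K χ v +
        ((τ * Real.log (1 - Real.exp (-v)) : ℝ) : ℂ)) = regularized K χ τ v := by
      intro v hv
      have hb := one_sub_exp_neg_bounds hv
      have hv0 := hv.1
      rw [regularized_eq_exp χ τ hv.1, Complex.exp_add, mul_comm, ← Complex.ofReal_exp]
      congr 1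
      rcases hτ.eq with rfl | rfl
      · rw [one_mul, Real.exp_log (by linarith)]; push_cast; ring
      · simp
    have h1 := norm_sub_le_of_exp_eq hB0 hcontφ hexp hL hlb hv hv'
    have h2 := norm_eulerLog_sub_degOneSum_sub_le (K := K) χ hv.1 hv'.1
    rw [D.finrank_eq] at h2
    have h3 : ‖((τ * ((Real.log (1 - Real.exp (-v)) - Real.log v) -
        (Real.log (1 - Real.exp (-v')) - Real.log v')) : ℝ) : ℂ)‖ ≤ |v - v'| := by
      rw [Complex.norm_real, Real.norm_eq_abs, abs_mul, abs_of_nonneg hτ1.1]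
      exact (mul_le_of_le_one_left (abs_nonneg _) hτ1.2).trans
        (log_one_sub_exp_neg_lipschitz hv hv')
    have e : degOneSum K χ v - degOneSum K χ v' + ((τ * (Real.log v - Real.log v') : ℝ) : ℂ) =
        ((eulerLog K χ v + ((τ * Real.log (1 - Real.exp (-v)) : ℝ) : ℂ)) -
          (eulerLog K χ v' + ((τ * Real.log (1 - Real.exp (-v')) : ℝ) : ℂ))) -
        ((eulerLog K χ v - degOneSum K χ v) - (eulerLog K χ v' - degOneSum K χ v')) -
        ((τ * ((Real.log (1 - Real.exp (-v)) - Real.log v) -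
        (Real.log (1 - Real.exp (-v')) - Real.log v')) : ℝ) : ℂ) := by
      push_cast
      ring
    rw [e]
    refine (norm_sub_le _ _).trans ((add_le_add ((norm_sub_le _ _).trans (add_le_add h1 h2))
      h3).trans ?_)
    rw [← add_mul, ← add_one_mul]
    refine mul_le_mul_of_nonneg_right ?_ (abs_nonneg _)
    have h4 : 2 * A / (c / (2 * A)) ^ 4 ≤ (Q : ℝ) ^ ((4 * C + 249) * n) := by
      rw [div_eq_mul_inv]
      calc 2 * A * ((c / (2 * A)) ^ 4)⁻¹ ≤
            (Q ^ n * (Q : ℝ) ^ (30 * n)) * (Q : ℝ) ^ ((4 * C + 218) * n) := by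
            gcongr
            calc (2 : ℝ) ≤ Q ^ 1 := by linarith
              _ ≤ _ := pow_le_pow_right₀ (by linarith) D.one_le_dim
        _ = _ := by rw [← pow_add, ← pow_add]; congr 1; ring
    have h5 : (24 : ℝ) * n + 1 ≤ Q ^ ((4 * C + 249) * n) := by
      calc (24 : ℝ) * n + 1 ≤ Q ^ 2 := by nlinarith
        _ ≤ _ := pow_le_pow_right₀ (by linarith) (by nlinarith)
    calc _ ≤ 2 * (Q : ℝ) ^ ((4 * C + 249) * n) := by linarith
      _ ≤ Q ^ n * (Q : ℝ) ^ ((4 * C + 249) * n) := by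
          gcongr
          calc (2 : ℝ) ≤ Q ^ 1 := by linarith
            _ ≤ _ := pow_le_pow_right₀ (by linarith) D.one_le_dim
      _ = _ := by rw [← pow_add]; congr 1; ring

end Bootstrap

section DegreeOnePrimes

open NumberField Ideal Polynomial

variable {K : Type*} [Field K] [NumberField K] {p n Q : ℕ}

theorem RadicalGen.exists_aeval_eq (D : RadicalGen K p n Q) (z : 𝓞 K) :
    ∃ f : ℤ[X], aeval D.θ f = ((n ^ n * p ^ (n - 1) : ℕ) : 𝓞 K) * z := by
  have h := discr_gen_mul_mem D.pb D.gen_pow (NumberField.RingOfIntegers.isIntegral_coe z)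
  rw [Algebra.adjoin_singleton_eq_range_aeval, D.dim_eq] at h
  obtain ⟨f, hf⟩ := h
  refine ⟨f, RingOfIntegers.ext ?_⟩
  have h1 : ((aeval D.θ f : 𝓞 K) : K) = aeval D.pb.gen f := by
    rw [← D.coe_θ]
    exact (aeval_algebraMap_apply K D.θ f).symm
  rw [h1]
  simpa using hf

theorem RadicalGen.eval₂_eq_zero (D : RadicalGen K p n Q) {S : Type*} [CommRing S] {a : S}
    (ha : a ^ n = p) {F : ℤ[X]} (hF : aeval D.θ F = 0) : eval₂ (Int.castRingHom S) a F = 0 := by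
  have hn : n ≠ 0 := Nat.one_le_iff_ne_zero.1 D.one_le_dim
  have hm : (X ^ n - C (p : ℤ)).Monic := monic_X_pow_sub_C _ hn
  have h0 : aeval D.pb.gen (F.map (Int.castRingHom ℚ)) = 0 := by
    have h1 : ((aeval D.θ F : 𝓞 K) : K) = aeval D.pb.gen F := by
      rw [← D.coe_θ]
      exact (aeval_algebraMap_apply K D.θ F).symm
    rw [hF] at h1
    have h2 := aeval_map_algebraMap ℚ D.pb.gen F
    rw [algebraMap_int_eq] at h2
    rw [h2, ← h1]
    simp
  have h1 := minpoly.dvd ℚ D.pb.gen h0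
  rw [minpoly_gen_eq D.pb D.gen_pow, D.dim_eq] at h1
  have h2 : (X ^ n - C (p : ℤ)).map (Int.castRingHom ℚ) ∣ F.map (Int.castRingHom ℚ) := by
    simpa using h1
  rw [map_dvd_map _ Int.cast_injective hm] at h2
  obtain ⟨G, rfl⟩ := h2
  rw [eval₂_mul]
  simp [ha]

theorem RadicalGen.coprime_discr (D : RadicalGen K p n Q) {r : ℕ} (hr : r.Prime) (hrQ : ¬ r ∣ Q) :
    r.Coprime (n ^ n * p ^ (n - 1)) := by
  obtain ⟨k, hk⟩ := D.dvd_pow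
  rw [D.dim_eq] at hk
  have h := (Nat.Prime.coprime_iff_not_dvd hr).2 hrQ
  exact Nat.Coprime.mul_right
    (Nat.Coprime.pow_right _ (Nat.Coprime.coprime_dvd_right hk (h.pow_right _)))
    (Nat.Coprime.pow_right _ (Nat.Coprime.coprime_dvd_right D.dvd h))

theorem RadicalGen.card_ringHom (D : RadicalGen K p n Q) {r : ℕ} [hr : Fact r.Prime]
    (hrQ : ¬ r ∣ Q) : Nat.card (𝓞 K →+* ZMod r) = Nat.card {x : ZMod r // x ^ n = p} := by
  set d : ℕ := n ^ n * p ^ (n - 1) with hd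
  have hd0 : (d : ZMod r) ≠ 0 := by
    rw [Ne, ZMod.natCast_eq_zero_iff]
    exact (Nat.Prime.coprime_iff_not_dvd hr.out).1 (D.coprime_discr hr.out hrQ)
  have hθ : D.θ ^ n = p := by
    refine RingOfIntegers.ext ?_
    have := D.gen_pow
    rw [D.dim_eq, ← D.coe_θ] at this
    simpa using this
  choose f hf' using D.exists_aeval_eq
  have hf : ∀ z, aeval D.θ (f z) = (d : 𝓞 K) * z := hf'
  have haC : ∀ c : ℕ, aeval D.θ (C (c : ℤ)) = (c : 𝓞 K) := fun c => by
    rw [aeval_C, algebraMap_int_eq, eq_intCast, Int.cast_natCast]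
  have hom_eval : ∀ (φ : 𝓞 K →+* ZMod r) (F : ℤ[X]),
      φ (aeval D.θ F) = eval₂ (Int.castRingHom _) (φ D.θ) F := by
    intro φ F
    rw [aeval_def, hom_eval₂]
    congr 1
    exact RingHom.ext_int _ _
  refine Nat.card_congr (Equiv.ofBijective
    (fun φ => ⟨φ D.θ, by rw [← map_pow, hθ, map_natCast]⟩) ⟨fun φ ψ h => ?_, fun ⟨a, ha⟩ => ?_⟩)
  · have h' : φ D.θ = ψ D.θ := by simpa using h
    refine RingHom.ext fun z => ?_
    have h1 := hom_eval φ (f z)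
    have h2 := hom_eval ψ (f z)
    rw [hf, map_mul, map_natCast] at h1 h2
    rw [← h', ← h1] at h2
    exact (mul_left_cancel₀ hd0 h2).symm
  · set e : ℤ[X] → ZMod r := fun F => eval₂ (Int.castRingHom _) a F with he
    have key : ∀ F G : ℤ[X], aeval D.θ F = aeval D.θ G → e F = e G := by
      intro F G h
      have := D.eval₂_eq_zero ha (F := F - G) (by rw [map_sub, h, sub_self])
      rw [eval₂_sub, sub_eq_zero] at this
      exact this
    have hec : ∀ c : ℕ, e (C (c : ℤ)) = c := fun c => by simp [he]
    have emul : ∀ F G, e (F * G) = e F * e G := fun F G => eval₂_mul _ _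
    have eadd : ∀ F G, e (F + G) = e F + e G := fun F G => eval₂_add _ _
    refine ⟨⟨⟨⟨fun z => (d : ZMod r)⁻¹ * e (f z), ?_⟩, ?_⟩, ?_, ?_⟩, ?_⟩
    · have h1 : e (f 1) = e (C (d : ℤ)) := key _ _ (by rw [hf, haC, mul_one])
      rw [h1, hec, inv_mul_cancel₀ hd0]
    · intro z w
      have h1 : e (C (d : ℤ) * f (z * w)) = e (f z * f w) :=
        key _ _ (by rw [map_mul, map_mul, hf, hf, hf, haC]; ring)
      rw [emul, emul, hec] at h1
      change (d : ZMod r)⁻¹ * e (f (z * w)) = (d : ZMod r)⁻¹ * e (f z) * ((d : ZMod r)⁻¹ * e (f w))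
      field_simp
      exact h1
    · have h1 : e (f 0) = e (C ((0 : ℕ) : ℤ)) := key _ _ (by rw [hf, haC, Nat.cast_zero, mul_zero])
      change (d : ZMod r)⁻¹ * e (f 0) = 0
      rw [h1, hec]
      simp
    · intro z w
      have h1 : e (f (z + w)) = e (f z + f w) := key _ _ (by rw [map_add, hf, hf, hf]; ring)
      change (d : ZMod r)⁻¹ * e (f (z + w)) = (d : ZMod r)⁻¹ * e (f z) + (d : ZMod r)⁻¹ * e (f w)
      rw [h1, eadd, mul_add]
    · have h1 : e (f D.θ) = e (C (d : ℤ) * X) := key _ _ (by rw [hf, map_mul, haC, aeval_X])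
      refine Subtype.ext ?_
      change (d : ZMod r)⁻¹ * e (f D.θ) = a
      rw [h1, emul, hec]
      simp [he, hd0]

theorem card_ringHom_eq_normCount {r : ℕ} [hr : Fact r.Prime] :
    Nat.card (𝓞 K →+* ZMod r) = normCount K r := by
  have hcard : ∀ φ : 𝓞 K →+* ZMod r, absNorm (RingHom.ker φ) = r := by
    intro φ
    rw [absNorm_apply, Submodule.cardQuot_apply]
    exact (Nat.card_congr (RingHom.quotientKerEquivOfSurjective
      (ZMod.ringHom_surjective φ)).toEquiv).trans (Nat.card_zmod r)
  have hprime : ∀ φ : 𝓞 K →+* ZMod r, Prime (RingHom.ker φ) := by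
    intro φ
    refine (Ideal.prime_iff_isPrime fun h => ?_).2 (RingHom.ker_isPrime φ)
    have := hcard φ
    rw [h, absNorm_bot] at this
    exact hr.out.ne_zero this.symm
  refine Nat.card_congr (Equiv.ofBijective (fun φ => ⟨⟨RingHom.ker φ, hprime φ⟩, hcard φ⟩)
    ⟨fun φ ψ h => ?_, fun ⟨⟨P, hP⟩, hN⟩ => ?_⟩)
  · have h' : RingHom.ker φ = RingHom.ker ψ := by simpa [Subtype.ext_iff] using h
    refine RingHom.ext fun z => ?_
    have h1 : z - ((φ z).val : 𝓞 K) ∈ RingHom.ker φ := by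
      rw [RingHom.mem_ker, map_sub, map_natCast, ZMod.natCast_zmod_val, sub_self]
    rw [h', RingHom.mem_ker, map_sub, map_natCast, ZMod.natCast_zmod_val, sub_eq_zero] at h1
    exact h1.symm
  · change absNorm P = r at hN
    have hPf : Nat.card (𝓞 K ⧸ P) = r := by
      rw [absNorm_apply, Submodule.cardQuot_apply] at hN
      exact hN
    have : Finite (𝓞 K ⧸ P) := Nat.finite_of_card_ne_zero (by rw [hPf]; exact hr.out.ne_zero)
    have := Fintype.ofFinite (𝓞 K ⧸ P)
    rw [Nat.card_eq_fintype_card] at hPf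
    set e := ZMod.ringEquivOfPrime (𝓞 K ⧸ P) hr.out hPf
    refine ⟨(e.symm : (𝓞 K ⧸ P) →+* ZMod r).comp (Ideal.Quotient.mk P), ?_⟩
    refine Subtype.ext (Subtype.ext ?_)
    change RingHom.ker ((e.symm : (𝓞 K ⧸ P) →+* ZMod r).comp (Ideal.Quotient.mk P)) = P
    ext z
    rw [RingHom.mem_ker, RingHom.comp_apply]
    simp [Ideal.Quotient.eq_zero_iff_mem]

/-- The number of `n`-th roots of `p` modulo `r`. -/
noncomputable def rootCount (p n r : ℕ) : ℕ := Nat.card {x : ZMod r // x ^ n = p}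

theorem RadicalGen.normCount_eq (D : RadicalGen K p n Q) {r : ℕ} (hr : r.Prime)
    (hrQ : ¬ r ∣ Q) : normCount K r = rootCount p n r := by
  have := Fact.mk hr
  rw [← card_ringHom_eq_normCount, D.card_ringHom hrQ, rootCount]

/-- The sum over primes `r` of `χ(r) N(r) r^(-1-v)`, with `N(r)` the number of roots of
`x^n = p` modulo `r`. -/
noncomputable def rootSum {Q : ℕ} (p n : ℕ) (χ : DirichletCharacter ℂ Q) (v : ℝ) : ℂ :=
  ∑' r : ℕ, if r.Prime then (rootCount p n r : ℂ) * localTerm χ v r else 0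

theorem RadicalGen.degOneSum_eq_rootSum (D : RadicalGen K p n Q) (χ : DirichletCharacter ℂ Q)
    {v : ℝ} (hv : 0 < v) : degOneSum K χ v = rootSum p n χ v := by
  rw [degOneSum_eq χ hv, rootSum]
  refine tsum_congr fun r => ?_
  by_cases hr : r.Prime
  · rw [if_pos hr, if_pos hr]
    by_cases hrQ : r ∣ Q
    · have : localTerm χ v r = 0 := by
        rw [localTerm, χ.map_nonunit, zero_mul]
        rw [ZMod.isUnit_iff_coprime]
        exact fun h => (Nat.Prime.coprime_iff_not_dvd hr).1 h hrQ
      rw [this, mul_zero, mul_zero]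
    · rw [D.normCount_eq hr hrQ]
  · rw [if_neg hr, if_neg hr]

/-- A pure radical extension generated by a `2^m`-th root of a prime. -/
theorem exists_radicalGen {p : ℕ} (hp : p.Prime) (m : ℕ) {Q : ℕ} (hpQ : p ∣ Q) (h2Q : 2 ∣ Q)
    (hQ : 48 ≤ Q) (hm : 2 ^ m ≤ Q) :
    ∃ (K : Type) (_ : Field K) (_ : NumberField K), Nonempty (RadicalGen K p (2 ^ m) Q) := by
  set n := 2 ^ m with hn
  have hn0 : n ≠ 0 := by positivity
  set f : ℤ[X] := X ^ n - C (p : ℤ) with hf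
  have hfm : f.Monic := monic_X_pow_sub_C _ hn0
  have hfd : f.natDegree = n := natDegree_X_pow_sub_C
  have hpp : Prime (p : ℤ) := Nat.prime_iff_prime_int.1 hp
  have hfirr : Irreducible f := by
    have hE : f.IsEisensteinAt (Ideal.span {(p : ℤ)}) := by
      refine ⟨?_, ?_, ?_⟩
      · rw [hfm.leadingCoeff, Ideal.mem_span_singleton]
        exact hpp.not_dvd_one
      · intro i hi
        rw [hfd] at hi
        rw [hf, coeff_sub, coeff_X_pow, if_neg hi.ne, coeff_C, zero_sub, Ideal.mem_span_singleton]
        split_ifs <;> simp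
      · rw [hf, coeff_sub, coeff_X_pow, if_neg hn0.symm, coeff_C_zero, zero_sub,
          Ideal.span_singleton_pow, Ideal.mem_span_singleton, dvd_neg]
        intro h
        rw [pow_two] at h
        have := hpp.irreducible.1
        exact this (isUnit_of_dvd_one ((mul_dvd_mul_iff_left hpp.ne_zero).1 (by simpa using h)))
    exact hE.irreducible ((Ideal.span_singleton_prime hpp.ne_zero).2 hpp) hfm.isPrimitive
      (by rw [hfd]; exact Nat.pos_of_ne_zero hn0)
  set g : ℚ[X] := X ^ n - C (p : ℚ) with hg
  have hgf : f.map (Int.castRingHom ℚ) = g := by simp [hf, hg]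
  have hgirr : Irreducible g := by
    rw [← hgf]
    exact (hfm.irreducible_iff_irreducible_map_fraction_map (K := ℚ)).1 hfirr
  have hgd : g.natDegree = n := natDegree_X_pow_sub_C
  have := Fact.mk hgirr
  set pb := AdjoinRoot.powerBasis hgirr.ne_zero with hpb
  have hfin : FiniteDimensional ℚ (AdjoinRoot g) := pb.finite
  have hNF : NumberField (AdjoinRoot g) :=
    { to_charZero := charZero_of_injective_algebraMap (algebraMap ℚ _).injective
      to_finiteDimensional := hfin }
  have hpow : (AdjoinRoot.root g) ^ n = (p : AdjoinRoot g) := by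
    have := AdjoinRoot.eval₂_root g
    rw [hg] at this
    simpa [sub_eq_zero] using this
  have hint : IsIntegral ℤ (AdjoinRoot.root g) := ⟨f, hfm, by simp [hf, hpow]⟩
  have hdim : pb.dim = n := by rw [hpb, AdjoinRoot.powerBasis_dim, hgd]
  have hgen : pb.gen = AdjoinRoot.root g := by rw [hpb, AdjoinRoot.powerBasis_gen]
  exact ⟨AdjoinRoot g, inferInstance, hNF, ⟨{
    pb := pb
    θ := ⟨AdjoinRoot.root g, hint⟩
    coe_θ := hgen.symm
    dim_eq := hdim
    gen_pow := by rw [hdim, hgen, hpow]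
    one_le := hp.one_le
    dvd := hpQ
    le_mod := hQ
    dvd_pow := ⟨m, by rw [hdim]; exact pow_dvd_pow_of_dvd h2Q m⟩
    dim_le := by rw [hdim]; exact hm }⟩⟩

end DegreeOnePrimes

section RealCharacter

theorem abs_sum_mul_le_of_antitone {a g : ℕ → ℝ} {B : ℝ} (ha : Antitone a) (ha0 : ∀ n, 0 ≤ a n)
    (hB : ∀ N, |∑ n ∈ Finset.range N, g n| ≤ B) (N : ℕ) :
    |∑ n ∈ Finset.range N, a n * g n| ≤ B * a 0 := by
  set Z : ℕ → ℝ := fun N => ∑ n ∈ Finset.range N, g n with hZ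
  have h1 : ∀ N, ∑ n ∈ Finset.range N, a n * g n =
      a N * Z N + ∑ n ∈ Finset.range N, (a n - a (n + 1)) * Z (n + 1) := by
    intro N
    induction N with
    | zero => simp [hZ]
    | succ N ih =>
      have : Z (N + 1) = Z N + g N := Finset.sum_range_succ _ _
      rw [Finset.sum_range_succ, Finset.sum_range_succ, ih, this]
      ring
  rw [h1]
  calc |a N * Z N + ∑ n ∈ Finset.range N, (a n - a (n + 1)) * Z (n + 1)|
      ≤ a N * B + ∑ n ∈ Finset.range N, (a n - a (n + 1)) * B := by
        refine (abs_add_le _ _).trans (add_le_add ?_ ((Finset.abs_sum_le_sum_abs _ _).trans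
          (Finset.sum_le_sum fun n _ => ?_)))
        · rw [abs_mul, abs_of_nonneg (ha0 N)]
          exact mul_le_mul_of_nonneg_left (hB N) (ha0 N)
        · have : 0 ≤ a n - a (n + 1) := sub_nonneg.2 (ha n.le_succ)
          rw [abs_mul, abs_of_nonneg this]
          exact mul_le_mul_of_nonneg_left (hB _) this
    _ = B * a 0 := by
        rw [← Finset.sum_mul, Finset.sum_range_sub']
        ring

theorem geom_sum_mul_geom_sum_ge {x : ℝ} (hx0 : 0 ≤ x) (hx1 : x ≤ 1) (d : ℕ) :
    (d : ℝ) * (d + 1) * x ^ d ≤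
      (∑ i ∈ Finset.range d, x ^ i) * ∑ i ∈ Finset.range (d + 1), x ^ i := by
  have key : ∀ d : ℕ, ((d + 1 : ℕ) : ℝ) ^ 2 * x ^ d ≤ (∑ i ∈ Finset.range (d + 1), x ^ i) ^ 2 := by
    intro d
    have h1 : ∑ i ∈ Finset.range (d + 1), x ^ (d - i) = ∑ i ∈ Finset.range (d + 1), x ^ i := by
      rw [← Finset.sum_range_reflect]
      refine Finset.sum_congr rfl fun i hi => ?_
      congr 1
      have := Finset.mem_range.1 hi
      omega
    have h2 := Real.sum_sqrt_mul_sqrt_le (Finset.range (d + 1)) (f := fun i => x ^ i)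
      (g := fun i => x ^ (d - i)) (fun i => by positivity) (fun i => by positivity)
    have h3 : ∑ i ∈ Finset.range (d + 1), √(x ^ i) * √(x ^ (d - i)) = (d + 1 : ℕ) * √(x ^ d) := by
      rw [Finset.sum_congr rfl (g := fun _ => √(x ^ d)), Finset.sum_const, Finset.card_range,
        nsmul_eq_mul]
      intro i hi
      rw [← Real.sqrt_mul (by positivity), ← pow_add]
      congr 2
      have := Finset.mem_range.1 hi
      omega
    rw [h1, h3, Real.mul_self_sqrt (Finset.sum_nonneg fun i _ => by positivity)] at h2
    calc ((d + 1 : ℕ) : ℝ) ^ 2 * x ^ d = ((d + 1 : ℕ) * √(x ^ d)) ^ 2 := by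
          rw [mul_pow, Real.sq_sqrt (by positivity)]
      _ ≤ _ := by gcongr
  rcases d with _ | d
  · simp
  have hA := key d
  have hB := key (d + 1)
  set A := ∑ i ∈ Finset.range (d + 1), x ^ i
  set B := ∑ i ∈ Finset.range (d + 1 + 1), x ^ i
  have hA0 : 0 ≤ A := Finset.sum_nonneg fun i _ => by positivity
  have hB0 : 0 ≤ B := Finset.sum_nonneg fun i _ => by positivity
  refine le_of_sq_le_sq ?_ (by positivity) 
  calc (((d + 1 : ℕ) : ℝ) * (((d + 1 : ℕ) : ℝ) + 1) * x ^ (d + 1)) ^ 2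
      = ((d + 1 : ℕ) : ℝ) ^ 2 * (((d + 1 + 1 : ℕ) : ℝ) ^ 2) * (x ^ (d + 1) * (x ^ d * x)) := by
        push_cast; ring
    _ ≤ ((d + 1 : ℕ) : ℝ) ^ 2 * (((d + 1 + 1 : ℕ) : ℝ) ^ 2) * (x ^ (d + 1) * (x ^ d * 1)) := by
        gcongr
    _ = (((d + 1 : ℕ) : ℝ) ^ 2 * x ^ d) * (((d + 1 + 1 : ℕ) : ℝ) ^ 2 * x ^ (d + 1)) := by ring
    _ ≤ A ^ 2 * B ^ 2 := by gcongr
    _ = (A * B) ^ 2 := by ring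

/-- The monotone weights comparing a Lambert series with its main term. -/
noncomputable def lambertWeight (x : ℝ) (d : ℕ) : ℝ :=
  1 / (((d : ℝ) + 1) * (1 - x)) - x ^ (d + 1) / (1 - x ^ (d + 1))

theorem lambertWeight_zero {x : ℝ} (hx1 : x < 1) : lambertWeight x 0 = 1 := by
  have : (1 - x) ≠ 0 := by linarith
  simp only [lambertWeight, Nat.cast_zero, zero_add, one_mul, pow_one]
  field_simp

theorem lambertWeight_nonneg {x : ℝ} (hx0 : 0 ≤ x) (hx1 : x < 1) (d : ℕ) :
    0 ≤ lambertWeight x d := by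
  have h1 : (0 : ℝ) < 1 - x := by linarith
  have h2 : 0 < 1 - x ^ (d + 1) := by
    have : x ^ (d + 1) < 1 := pow_lt_one₀ hx0 hx1 d.succ_ne_zero
    linarith
  rw [lambertWeight, sub_nonneg, div_le_div_iff₀ h2 (by positivity)]
  have h3 : (1 - x) * ∑ i ∈ Finset.range (d + 1), x ^ i = 1 - x ^ (d + 1) := by
    rw [mul_comm, geom_sum_mul_neg]
  have h4 : ((d : ℝ) + 1) * x ^ (d + 1) ≤ ∑ i ∈ Finset.range (d + 1), x ^ i := by
    have : ∑ i ∈ Finset.range (d + 1), x ^ (d + 1) ≤ ∑ i ∈ Finset.range (d + 1), x ^ i :=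
      Finset.sum_le_sum fun i hi =>
        pow_le_pow_of_le_one hx0 hx1.le (Finset.mem_range.1 hi).le
    simpa using this
  nlinarith

theorem lambertWeight_antitone {x : ℝ} (hx0 : 0 ≤ x) (hx1 : x < 1) :
    Antitone (lambertWeight x) := by
  refine antitone_nat_of_succ_le fun e => ?_
  have h1 : (0 : ℝ) < 1 - x := by linarith
  have hG : ∀ d : ℕ, (1 - x) * ∑ i ∈ Finset.range d, x ^ i = 1 - x ^ d := fun d => by
    rw [mul_comm, geom_sum_mul_neg]
  have key := geom_sum_mul_geom_sum_ge hx0 hx1.le (e + 1)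
  set A := ∑ i ∈ Finset.range (e + 1), x ^ i
  set B := ∑ i ∈ Finset.range (e + 1 + 1), x ^ i
  have hA : 0 < A := Finset.sum_pos' (fun i _ => by positivity) ⟨0, by simp, by simp⟩
  have hB : 0 < B := Finset.sum_pos' (fun i _ => by positivity) ⟨0, by simp, by simp⟩
  have e1 : x ^ (e + 1) / (1 - x ^ (e + 1)) - x ^ (e + 1 + 1) / (1 - x ^ (e + 1 + 1)) =
      x ^ (e + 1) / ((1 - x) * (A * B)) := by
    rw [← hG, ← hG, div_sub_div _ _ (by positivity) (by positivity), div_eq_div_iff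
      (by positivity) (by positivity)]
    have hA' := hG (e + 1)
    have hB' := hG (e + 1 + 1)
    have : x ^ (e + 1) * ((1 - x) * B) - (1 - x) * A * x ^ (e + 1 + 1) = x ^ (e + 1) * (1 - x) := by
      change (1 - x) * A = _ at hA'
      change (1 - x) * B = _ at hB'
      rw [hA', hB']
      ring
    change (x ^ (e + 1) * ((1 - x) * B) - (1 - x) * A * x ^ (e + 1 + 1)) * _ = _
    rw [this]
    ring
  have e2 : 1 / (((e : ℝ) + 1) * (1 - x)) - 1 / (((e + 1 : ℕ) + 1 : ℝ) * (1 - x)) =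
      1 / ((1 - x) * (((e : ℝ) + 1) * (e + 1 + 1))) := by
    push_cast
    field_simp
    ring
  have e3 : x ^ (e + 1) / ((1 - x) * (A * B)) ≤ 1 / ((1 - x) * (((e : ℝ) + 1) * (e + 1 + 1))) := by
    rw [div_le_div_iff₀ (by positivity) (by positivity)]
    push_cast at key
    nlinarith
  simp only [lambertWeight]
  linarith

theorem lambert_tsum {a : ℕ → ℝ} (ha : ∀ n, |a n| ≤ 1) {x : ℝ} (hx0 : 0 ≤ x) (hx1 : x < 1) :
    (Summable fun n : ℕ+ => (∑ d ∈ (n : ℕ).divisors, a d) * x ^ (n : ℕ)) ∧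
    (Summable fun d : ℕ+ => a d * (x ^ (d : ℕ) / (1 - x ^ (d : ℕ)))) ∧
    ∑' d : ℕ+, a d * (x ^ (d : ℕ) / (1 - x ^ (d : ℕ))) =
      ∑' n : ℕ+, (∑ d ∈ (n : ℕ).divisors, a d) * x ^ (n : ℕ) := by
  have hs : Summable fun c : ℕ+ × ℕ+ => a c.1 * x ^ (c.1 * c.2 : ℕ) := by
    have h := summable_prod_mul_pow (𝕜 := ℝ) 0 (r := x) (by rwa [Real.norm_of_nonneg hx0])
    refine h.of_norm_bounded fun c => ?_
    simp only [pow_zero, one_mul, norm_mul, Real.norm_eq_abs, abs_pow, abs_of_nonneg hx0]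
    exact mul_le_of_le_one_left (by positivity) (ha _)
  have h1 : ∀ d : ℕ+, ∑' k : ℕ+, a d * x ^ (d * k : ℕ) = a d * (x ^ (d : ℕ) / (1 - x ^ (d : ℕ))) := by
    intro d
    rw [tsum_mul_left]
    congr 1
    have h2 : |x ^ (d : ℕ)| < 1 := by
      rw [abs_of_nonneg (by positivity)]
      exact pow_lt_one₀ hx0 hx1 d.ne_zero
    simp_rw [pow_mul]
    rw [tsum_pnat_eq_tsum_succ (f := fun k => (x ^ (d : ℕ)) ^ k)]
    simp_rw [pow_succ]
    rw [tsum_mul_right, tsum_geometric_of_abs_lt_one h2]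
    ring
  have hs' := (sigmaAntidiagonalEquivProd.summable_iff).2 hs
  have h3 : ∀ n : ℕ+, ∑' c : Nat.divisorsAntidiagonal n,
      ((fun c : ℕ+ × ℕ+ => a c.1 * x ^ (c.1 * c.2 : ℕ)) ∘ sigmaAntidiagonalEquivProd) ⟨n, c⟩ =
      (∑ d ∈ (n : ℕ).divisors, a d) * x ^ (n : ℕ) := by
    intro n
    rw [tsum_fintype]
    simp only [Function.comp_apply, sigmaAntidiagonalEquivProd, divisorsAntidiagonalFactors,
      PNat.mk_coe, Equiv.coe_fn_mk, Finset.univ_eq_attach]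
    rw [(n : ℕ).divisorsAntidiagonal.sum_attach fun c : ℕ × ℕ => a c.1 * x ^ (c.1 * c.2),
      Nat.sum_divisorsAntidiagonal fun i j => a i * x ^ (i * j), Finset.sum_mul]
    refine Finset.sum_congr rfl fun i hi => ?_
    rw [Nat.mul_div_cancel' (Nat.dvd_of_mem_divisors hi)]
  refine ⟨?_, ?_, ?_⟩
  · simpa only [h3] using hs'.sigma
  · simpa only [h1] using hs.prod
  · simp_rw [← h1, ← h3]
    rw [← hs.tsum_prod, ← hs'.tsum_sigma]
    exact (sigmaAntidiagonalEquivProd.tsum_eq _).symm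

end RealCharacter

section RealCharacter

theorem sum_divisors_mul_of_coprime {a : ℕ → ℝ} (hm : ∀ m n, a (m * n) = a m * a n)
    {m n : ℕ} (h : m.Coprime n) :
    ∑ d ∈ (m * n).divisors, a d = (∑ d ∈ m.divisors, a d) * ∑ d ∈ n.divisors, a d := by
  rw [Nat.Coprime.divisors_mul h, Finset.sum_map, Finset.sum_mul_sum, ← Finset.sum_product']
  exact (Finset.sum_congr rfl fun p _ => hm p.1.1 p.1.2).trans
    (Finset.sum_attach (m.divisors ×ˢ n.divisors) fun p => a p.1 * a p.2)

theorem sum_range_neg_pow_nonneg {t : ℝ} (ht0 : 0 ≤ t) (ht1 : t ≤ 1) (j : ℕ) :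
    0 ≤ ∑ i ∈ Finset.range (2 * j), (-t) ^ i := by
  induction j with
  | zero => simp
  | succ j ih =>
    rw [show 2 * (j + 1) = 2 * j + 1 + 1 by ring, Finset.sum_range_succ, Finset.sum_range_succ]
    have h1 : (-t) ^ (2 * j) = t ^ (2 * j) := (even_two_mul j).neg_pow t
    have h2 : (-t) ^ (2 * j + 1) = -(t ^ (2 * j) * t) := by rw [pow_succ, h1]; ring
    have h3 : t ^ (2 * j) * t ≤ t ^ (2 * j) := mul_le_of_le_one_right (by positivity) ht1
    rw [h1, h2]
    linarith

variable {g : ℕ → ℝ}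

theorem sum_divisors_real_char (hg1 : g 1 = 1) (hgm : ∀ m n, g (m * n) = g m * g n)
    (hg : ∀ n, g n = 0 ∨ g n = 1 ∨ g n = -1) {v : ℝ} (hv : 0 ≤ v) {n : ℕ} (hn : n ≠ 0) :
    0 ≤ ∑ d ∈ n.divisors, g d * (d : ℝ) ^ (-v) ∧
    (∀ k, n = k ^ 2 → (n : ℝ) ^ (-v) ≤ ∑ d ∈ n.divisors, g d * (d : ℝ) ^ (-v)) := by
  have ham : ∀ m n : ℕ, g (m * n) * ((m * n : ℕ) : ℝ) ^ (-v) =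
      (g m * (m : ℝ) ^ (-v)) * (g n * (n : ℝ) ^ (-v)) := fun m n => by
    rw [hgm]; push_cast; rw [Real.mul_rpow (by positivity) (by positivity)]; ring
  induction n using Nat.recOnPosPrimePosCoprime with
  | zero => exact absurd rfl hn
  | one => simp [hg1]
  | prime_pow r k hr hk =>
    set t : ℝ := (r : ℝ) ^ (-v) with ht
    have ht0 : 0 ≤ t := by positivity
    have hr1 : (1 : ℝ) ≤ r := by exact_mod_cast hr.one_lt.le
    have ht1 : t ≤ 1 := Real.rpow_le_one_of_one_le_of_nonpos hr1 (by linarith)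
    have hpow : ∀ i : ℕ, ((r ^ i : ℕ) : ℝ) ^ (-v) = t ^ i := fun i => by
      rw [ht, Nat.cast_pow, ← Real.rpow_natCast, ← Real.rpow_mul (by positivity), mul_comm,
        Real.rpow_mul (by positivity), Real.rpow_natCast]
    have hgp : ∀ i : ℕ, g (r ^ i) = g r ^ i := fun i => by
      induction i with
      | zero => simpa using hg1
      | succ i ih => rw [pow_succ, hgm, ih, pow_succ]
    have e : ∑ d ∈ (r ^ k).divisors, g d * (d : ℝ) ^ (-v) =
        ∑ i ∈ Finset.range (k + 1), (g r * t) ^ i := by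
      rw [Nat.sum_divisors_prime_pow hr]
      exact Finset.sum_congr rfl fun i _ => by rw [hpow, hgp, mul_pow]
    rw [e, hpow]
    have htk : t ^ k ≤ 1 := pow_le_one₀ ht0 ht1
    rcases hg r with h | h | h
    · rw [h, zero_mul, Finset.sum_range_succ']
      simp only [pow_succ, mul_zero, Finset.sum_const_zero, pow_zero, zero_add]
      exact ⟨zero_le_one, fun _ _ => htk⟩
    · rw [h, one_mul]
      have h0 : (1 : ℝ) ≤ ∑ i ∈ Finset.range (k + 1), t ^ i := by
        rw [Finset.sum_range_succ', pow_zero]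
        linarith [Finset.sum_nonneg fun i (_ : i ∈ Finset.range k) => pow_nonneg ht0 (i + 1)]
      exact ⟨by linarith, fun _ _ => by linarith⟩
    · rw [h, neg_one_mul]
      rcases Nat.even_or_odd' k with ⟨j, hj | hj⟩
      · have h1 := sum_range_neg_pow_nonneg ht0 ht1 j
        have h2 : (-t) ^ (2 * j) = t ^ (2 * j) := (even_two_mul j).neg_pow t
        rw [hj, Finset.sum_range_succ, h2]
        have h3 : 0 ≤ t ^ (2 * j) := by positivity
        exact ⟨by linarith, fun _ _ => by linarith⟩
      · have h1 := sum_range_neg_pow_nonneg ht0 ht1 (j + 1)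
        rw [hj, show 2 * j + 1 + 1 = 2 * (j + 1) by ring]
        refine ⟨h1, fun c hc => ?_⟩
        exfalso
        have h2 := congrArg (fun n => n.factorization r) hc
        simp only [Nat.factorization_pow, Finsupp.smul_apply, smul_eq_mul,
          Nat.Prime.factorization_self hr, mul_one] at h2
        omega
  | coprime m n hm hn' hmn ihm ihn =>
    obtain ⟨hm1, hm2⟩ := ihm (by omega)
    obtain ⟨hn1, hn2⟩ := ihn (by omega)
    rw [sum_divisors_mul_of_coprime (a := fun d : ℕ => g d * (d : ℝ) ^ (-v)) ham hmn]
    refine ⟨mul_nonneg hm1 hn1, fun k hk => ?_⟩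
    obtain ⟨c, hc⟩ := exists_eq_pow_of_mul_eq_pow (a := m) (b := n)
      (by rw [Nat.isUnit_iff]; exact hmn) hk
    obtain ⟨d, hd⟩ := exists_eq_pow_of_mul_eq_pow (a := n) (b := m)
      (by rw [Nat.isUnit_iff]; exact hmn.symm) ((mul_comm n m).trans hk)
    rw [Nat.cast_mul, Real.mul_rpow (by positivity) (by positivity)]
    exact mul_le_mul (hm2 c hc) (hn2 d hd) (by positivity) hm1

theorem real_char_lower (hg1 : g 1 = 1) (hgm : ∀ m n, g (m * n) = g m * g n)
    (hg : ∀ n, g n = 0 ∨ g n = 1 ∨ g n = -1) {Q : ℕ} (hQ : 1 ≤ Q)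
    (hB : ∀ N, |∑ n ∈ Finset.range N, g (n + 1)| ≤ Q) {v : ℝ} (hv0 : 0 < v) (hv1 : v ≤ 1 / 4) :
    1 / (512 * (Q : ℝ) ^ 3) ≤ ∑' n : ℕ+, g n * (n : ℝ) ^ (-(1 + v)) := by
  set N : ℕ := 16 * Q ^ 2 with hN
  have hN1 : 1 ≤ N := by rw [hN]; nlinarith
  have hNR : (1 : ℝ) ≤ N := by exact_mod_cast hN1
  have hQR : (1 : ℝ) ≤ Q := by exact_mod_cast hQ
  set y : ℝ := 1 / (2 * (N : ℝ) ^ 2) with hy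
  have hy0 : 0 < y := by positivity
  have hy1 : y ≤ 1 / 2 := by
    rw [hy]; gcongr; nlinarith
  set x : ℝ := 1 - y with hx
  have hx0 : 0 ≤ x := by linarith
  have hx1 : x < 1 := by linarith
  set a : ℕ → ℝ := fun d => g d * (d : ℝ) ^ (-v) with ha
  have hgb : ∀ n, |g n| ≤ 1 := fun n => by rcases hg n with h | h | h <;> simp [h]
  have ha1 : ∀ n, |a n| ≤ 1 := fun n => by
    rw [ha, abs_mul]
    refine mul_le_one₀ (hgb n) (abs_nonneg _) ?_
    rcases Nat.eq_zero_or_pos n with rfl | hn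
    · rw [Nat.cast_zero, Real.zero_rpow (by linarith)]; simp
    · rw [abs_of_nonneg (by positivity)]
      exact Real.rpow_le_one_of_one_le_of_nonpos (by exact_mod_cast hn) (by linarith)
  obtain ⟨hs1, hs2, he⟩ := lambert_tsum ha1 hx0 hx1
  have hlow : 2 * (Q : ℝ) ≤ ∑' n : ℕ+, (∑ d ∈ (n : ℕ).divisors, a d) * x ^ (n : ℕ) := by
    have hnn : ∀ n : ℕ+, 0 ≤ (∑ d ∈ (n : ℕ).divisors, a d) * x ^ (n : ℕ) := fun n =>
      mul_nonneg (sum_divisors_real_char hg1 hgm hg hv0.le n.ne_zero).1 (by positivity)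
    have hinj : Function.Injective fun k : ℕ => ((k.succPNat ^ 2 : ℕ+)) := by
      intro i j hij
      have : ((i + 1) ^ 2 : ℕ) = (j + 1) ^ 2 := by
        simpa using congrArg (fun n : ℕ+ => (n : ℕ)) hij
      have := Nat.pow_left_injective (n := 2) (by norm_num) this
      omega
    have h1 := hs1.sum_le_tsum ((Finset.range N).map ⟨_, hinj⟩) (fun n _ => hnn n)
    refine le_trans ?_ h1
    rw [Finset.sum_map]
    have h2 : ∀ k ∈ Finset.range N, (N : ℝ) ^ (-(1 / 2) : ℝ) * (1 / 2) ≤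
        (∑ d ∈ (((k.succPNat ^ 2 : ℕ+)) : ℕ).divisors, a d) * x ^ ((k.succPNat ^ 2 : ℕ+) : ℕ) := by
      intro k hk
      have hk' : k + 1 ≤ N := Finset.mem_range.1 hk
      have e1 : ((k.succPNat ^ 2 : ℕ+) : ℕ) = (k + 1) ^ 2 := by simp
      rw [e1]
      have h3 := (sum_divisors_real_char hg1 hgm hg hv0.le (n := (k + 1) ^ 2) (by positivity)).2
        (k + 1) rfl
      refine mul_le_mul (le_trans ?_ h3) ?_ (by norm_num) (le_trans (by positivity) h3)
      · have hk1 : (1 : ℝ) ≤ ((k + 1) ^ 2 : ℕ) := by exact_mod_cast Nat.one_le_pow _ _ (by omega)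
        calc (N : ℝ) ^ (-(1 / 2) : ℝ) = ((N : ℝ) ^ 2) ^ (-(1 / 4) : ℝ) := by
              rw [← Real.rpow_natCast, ← Real.rpow_mul (by positivity)]; norm_num
          _ ≤ (((k + 1) ^ 2 : ℕ) : ℝ) ^ (-(1 / 4) : ℝ) := by
              refine Real.rpow_le_rpow_of_nonpos (by positivity) ?_ (by norm_num)
              exact_mod_cast Nat.pow_le_pow_left hk' 2
          _ ≤ _ := Real.rpow_le_rpow_of_exponent_le hk1 (by linarith)
      · calc (1 / 2 : ℝ) = 1 + ((N ^ 2 : ℕ) : ℝ) * (-y) := by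
              rw [hy]; push_cast; field_simp; ring
          _ ≤ (1 + -y) ^ (N ^ 2) := one_add_mul_le_pow (by linarith) _
          _ = x ^ (N ^ 2) := by rw [hx]; ring
          _ ≤ x ^ ((k + 1) ^ 2) :=
              pow_le_pow_of_le_one hx0 hx1.le (Nat.pow_le_pow_left hk' 2)
    refine le_trans ?_ (Finset.sum_le_sum h2)
    rw [Finset.sum_const, Finset.card_range, nsmul_eq_mul]
    have h4 : (N : ℝ) * (N : ℝ) ^ (-(1 / 2) : ℝ) = 4 * Q := by
      have : (N : ℝ) = (4 * Q) ^ 2 := by rw [hN]; push_cast; ring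
      rw [this, ← Real.rpow_natCast, ← Real.rpow_mul (by positivity),
        ← Real.rpow_add (by positivity)]
      norm_num
    rw [← mul_assoc, h4]
    linarith
  have hsL : Summable fun n : ℕ+ => g n * (n : ℝ) ^ (-(1 + v)) := by
    have h : Summable fun n : ℕ => (n : ℝ) ^ (-(1 + v)) := Real.summable_nat_rpow.2 (by linarith)
    have h' := h.comp_injective PNat.coe_injective
    refine h'.of_norm_bounded fun n => ?_
    rw [norm_mul, Real.norm_eq_abs, Real.norm_of_nonneg (by positivity)]
    exact mul_le_of_le_one_left (by positivity) (hgb n)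
  have hsplit : ∀ n : ℕ+, g n * (n : ℝ) ^ (-(1 + v)) * y⁻¹ -
      a n * (x ^ (n : ℕ) / (1 - x ^ (n : ℕ))) =
      (fun k : ℕ => ((k + 1 : ℕ) : ℝ) ^ (-v) * lambertWeight x k * g (k + 1)) (n.natPred) := by
    intro n
    have hn0 : (0 : ℝ) < n := by exact_mod_cast n.pos
    simp only [PNat.natPred_add_one, lambertWeight, ha]
    have e1 : ((n.natPred : ℝ) + 1) = n := by
      exact_mod_cast congrArg (Nat.cast (R := ℝ)) n.natPred_add_one
    have e2 : (n : ℝ) ^ (-(1 + v)) = (n : ℝ) ^ (-v) * (n : ℝ)⁻¹ := by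
      rw [neg_add_rev, Real.rpow_add hn0, Real.rpow_neg_one]
    rw [e1, e2, show 1 - x = y by rw [hx]; ring]
    field_simp
  have hsd := (hsL.mul_right y⁻¹).sub hs2
  have hupp : -(Q : ℝ) ≤ ∑' n : ℕ+, (g n * (n : ℝ) ^ (-(1 + v)) * y⁻¹ -
      a n * (x ^ (n : ℕ) / (1 - x ^ (n : ℕ)))) := by
    simp_rw [hsplit] at hsd ⊢
    have hsN : Summable fun k : ℕ => ((k + 1 : ℕ) : ℝ) ^ (-v) * lambertWeight x k * g (k + 1) :=
      (Equiv.pnatEquivNat.summable_iff).1 hsd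
    have e1 := Equiv.pnatEquivNat.tsum_eq
      (fun k : ℕ => ((k + 1 : ℕ) : ℝ) ^ (-v) * lambertWeight x k * g (k + 1))
    refine le_of_le_of_eq ?_ e1.symm
    refine ge_of_tendsto' hsN.hasSum.tendsto_sum_nat fun M => ?_
    have hanti : Antitone fun k : ℕ => ((k + 1 : ℕ) : ℝ) ^ (-v) * lambertWeight x k := by
      intro i j hij
      refine mul_le_mul ?_ (lambertWeight_antitone hx0 hx1 hij) (lambertWeight_nonneg hx0 hx1 j)
        (by positivity)
      exact Real.rpow_le_rpow_of_nonpos (by positivity) (by exact_mod_cast Nat.succ_le_succ hij)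
        (by linarith)
    have h := abs_sum_mul_le_of_antitone hanti
      (fun k => mul_nonneg (by positivity) (lambertWeight_nonneg hx0 hx1 k)) hB M
    rw [lambertWeight_zero hx1] at h
    simp only [zero_add, Nat.cast_one, Real.one_rpow, mul_one] at h
    exact (abs_le.1 h).1
  rw [(hsL.mul_right y⁻¹).tsum_sub hs2, he, tsum_mul_right] at hupp
  have hfin : (Q : ℝ) ≤ (∑' n : ℕ+, g n * (n : ℝ) ^ (-(1 + v))) * y⁻¹ := by linarith
  have h5 : (Q : ℝ) * y ≤ ∑' n : ℕ+, g n * (n : ℝ) ^ (-(1 + v)) := by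
    rwa [← div_eq_mul_inv, le_div_iff₀ hy0] at hfin
  refine le_of_eq_of_le ?_ h5
  rw [hy, hN]
  push_cast
  field_simp
  norm_num

end RealCharacter

section PrimeSums

variable {Q : ℕ}

/-- The Dirichlet series of `χ` over the primes. -/
noncomputable def primeSum (χ : DirichletCharacter ℂ Q) (v : ℝ) : ℂ :=
  ∑' r : ℕ, if r.Prime then localTerm χ v r else 0

theorem rootCount_one (p r : ℕ) : rootCount p 1 r = 1 := by
  rw [rootCount, Nat.card_eq_one_iff_unique]
  simp only [pow_one]
  exact ⟨⟨fun a b => Subtype.ext (a.2.trans b.2.symm)⟩, ⟨⟨p, rfl⟩⟩⟩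

theorem rootSum_one (p : ℕ) (χ : DirichletCharacter ℂ Q) (v : ℝ) : rootSum p 1 χ v = primeSum χ v := by
  simp only [rootSum, primeSum, rootCount_one, Nat.cast_one, one_mul]

theorem summable_localTerm (χ : DirichletCharacter ℂ Q) {v : ℝ} (hv : 0 < v) :
    Summable fun n => ‖localTerm χ v n‖ :=
  (Real.summable_nat_rpow.2 (by linarith : -(1 + v) < -1)).of_nonneg_of_le (fun _ => norm_nonneg _)
    fun _ => norm_localTerm_le χ v _

theorem summable_primeTerm (χ : DirichletCharacter ℂ Q) {v : ℝ} (hv : 0 < v) :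
    Summable fun r : ℕ => if r.Prime then localTerm χ v r else 0 := by
  refine (summable_localTerm χ hv).of_norm_bounded fun r => ?_
  split_ifs <;> simp

theorem primeSum_eq_tsum_primes (χ : DirichletCharacter ℂ Q) (v : ℝ) :
    primeSum χ v = ∑' r : Nat.Primes, localTerm χ v r := by
  rw [primeSum]
  refine Eq.trans (tsum_congr fun r => ?_) (tsum_subtype {r : ℕ | r.Prime} (localTerm χ v)).symm
  rw [Set.indicator_apply]
  rfl

/-- The summand of a Dirichlet `L`-series as a multiplicative map. -/
noncomputable def localTermHom (χ : DirichletCharacter ℂ Q) {v : ℝ} (hv : 0 < v) : ℕ →*₀ ℂ where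
  toFun := localTerm χ v
  map_zero' := by
    rw [localTerm, Nat.cast_zero, Nat.cast_zero, Real.zero_rpow (by linarith)]
    simp
  map_one' := by simp [localTerm]
  map_mul' m n := by
    simp only [localTerm, Nat.cast_mul, map_mul]
    rw [Real.mul_rpow (by positivity) (by positivity)]
    push_cast
    ring

theorem log_norm_tsum_le_re_primeSum (χ : DirichletCharacter ℂ Q) {v : ℝ} (hv : 0 < v) :
    Real.log ‖∑' n : ℕ, localTerm χ v n‖ ≤ (primeSum χ v).re + 2 := by
  have hz : ∀ r : Nat.Primes, ‖localTerm χ v r‖ ≤ ((r : ℕ) : ℝ)⁻¹ := fun r =>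
    norm_localTerm_le_inv χ hv r.2.one_lt.le
  have hz2 : ∀ r : Nat.Primes, ‖localTerm χ v r‖ ≤ 1 / 2 := fun r => (hz r).trans (by
    rw [one_div]
    exact inv_anti₀ (by norm_num) (by exact_mod_cast r.2.two_le))
  have hE : ∀ r : Nat.Primes, ‖-Complex.log (1 - localTerm χ v r) - localTerm χ v r‖ ≤
      1 / ((r : ℕ) : ℝ) ^ 2 := fun r => by
    have h1 := hz2 r
    have h2 := Complex.norm_log_one_add_sub_self_le (z := -localTerm χ v r)
      (by rw [norm_neg]; linarith)
    rw [norm_neg, ← sub_eq_add_neg] at h2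
    have e : -Complex.log (1 - localTerm χ v r) - localTerm χ v r =
        -(Complex.log (1 - localTerm χ v r) - -localTerm χ v r) := by ring
    rw [e, norm_neg]
    refine h2.trans ?_
    have h3 : (1 - ‖localTerm χ v r‖)⁻¹ ≤ 2 := by
      rw [inv_le_comm₀ (by linarith) (by norm_num)]; linarith
    have h4 : ‖localTerm χ v r‖ ^ 2 ≤ (((r : ℕ) : ℝ)⁻¹) ^ 2 :=
      pow_le_pow_left₀ (norm_nonneg _) (hz r) 2
    have h5 : 0 ≤ ‖localTerm χ v r‖ ^ 2 := by positivity
    rw [one_div, ← inv_pow]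
    nlinarith
  have hs2 : Summable fun r : Nat.Primes => 1 / ((r : ℕ) : ℝ) ^ 2 :=
    hasSum_zeta_two.summable.comp_injective Nat.Primes.coe_nat_injective
  have hsE : Summable fun r : Nat.Primes =>
      -Complex.log (1 - localTerm χ v r) - localTerm χ v r := hs2.of_norm_bounded hE
  have hsz : Summable fun r : Nat.Primes => localTerm χ v r :=
    (summable_localTerm χ hv).of_norm.comp_injective Nat.Primes.coe_nat_injective
  have h1 := EulerProduct.exp_tsum_primes_log_eq_tsum (f := localTermHom χ hv)
    (summable_localTerm χ hv)
  change Complex.exp (∑' r : Nat.Primes, -Complex.log (1 - localTerm χ v r)) =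
    ∑' n : ℕ, localTerm χ v n at h1
  have h2 : ∑' r : Nat.Primes, -Complex.log (1 - localTerm χ v r) = primeSum χ v +
      ∑' r : Nat.Primes, (-Complex.log (1 - localTerm χ v r) - localTerm χ v r) := by
    rw [primeSum_eq_tsum_primes, ← hsz.tsum_add hsE]
    exact tsum_congr fun r => by ring
  have h3 : ‖∑' r : Nat.Primes, (-Complex.log (1 - localTerm χ v r) - localTerm χ v r)‖ ≤ 2 := by
    refine (tsum_of_norm_bounded hs2.hasSum hE).trans ?_
    have h4 : ∑' r : Nat.Primes, 1 / ((r : ℕ) : ℝ) ^ 2 ≤ Real.pi ^ 2 / 6 := by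
      rw [← hasSum_zeta_two.tsum_eq]
      exact tsum_comp_le_tsum_of_inj hasSum_zeta_two.summable (fun _ => by positivity)
        Nat.Primes.coe_nat_injective
    have h5 : Real.pi < 3.15 := Real.pi_lt_d2
    have h6 : 0 < Real.pi := Real.pi_pos
    nlinarith
  rw [← h1, Complex.norm_exp, Real.log_exp, h2, Complex.add_re]
  linarith [Complex.re_le_norm (∑' r : Nat.Primes,
    (-Complex.log (1 - localTerm χ v r) - localTerm χ v r))]

theorem one_div_le_tsum_rpow {v : ℝ} (hv : 0 < v) :
    1 / v ≤ ∑' k : ℕ, (k : ℝ) ^ (-(1 + v)) := by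
  have hs : Summable fun k : ℕ => (k : ℝ) ^ (-(1 + v)) := Real.summable_nat_rpow.2 (by linarith)
  have hstep : ∀ k : ℕ, ((k + 1 : ℕ) : ℝ) ^ (-v) - ((k + 1 + 1 : ℕ) : ℝ) ^ (-v) ≤
      v * ((k + 1 : ℕ) : ℝ) ^ (-(1 + v)) := by
    intro k
    have hk : (0 : ℝ) < (k + 1 : ℕ) := by positivity
    have h1 : ((k + 1 + 1 : ℕ) : ℝ) ^ (-v) =
        ((k + 1 : ℕ) : ℝ) ^ (-v) * (1 + ((k + 1 : ℕ) : ℝ)⁻¹) ^ (-v) := by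
      rw [← Real.mul_rpow (by positivity) (by positivity)]
      congr 1
      push_cast
      field_simp
    have h2 : 1 - v * ((k + 1 : ℕ) : ℝ)⁻¹ ≤ (1 + ((k + 1 : ℕ) : ℝ)⁻¹) ^ (-v) := by
      have hpos : 0 < 1 + ((k + 1 : ℕ) : ℝ)⁻¹ := by positivity
      rw [Real.rpow_def_of_pos hpos]
      have h3 := Real.add_one_le_exp (Real.log (1 + ((k + 1 : ℕ) : ℝ)⁻¹) * -v)
      have h4 := Real.log_le_sub_one_of_pos hpos
      nlinarith
    have h5 : ((k + 1 : ℕ) : ℝ) ^ (-(1 + v)) = ((k + 1 : ℕ) : ℝ) ^ (-v) * ((k + 1 : ℕ) : ℝ)⁻¹ := by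
      rw [neg_add_rev, Real.rpow_add hk, Real.rpow_neg_one]
    rw [h1, h5]
    have h6 : 0 < ((k + 1 : ℕ) : ℝ) ^ (-v) := by positivity
    nlinarith
  have hlim : Filter.Tendsto (fun N : ℕ => 1 - ((N + 1 : ℕ) : ℝ) ^ (-v)) Filter.atTop (nhds 1) := by
    have h1 := (tendsto_rpow_neg_atTop hv).comp
      ((Filter.tendsto_add_atTop_iff_nat 1).2 tendsto_natCast_atTop_atTop)
    simpa using h1.const_sub 1
  rw [div_le_iff₀ hv]
  refine le_of_tendsto' hlim fun N => ?_
  have h1 : ∑ k ∈ Finset.range N, (((k + 1 : ℕ) : ℝ) ^ (-v) - ((k + 1 + 1 : ℕ) : ℝ) ^ (-v)) =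
      1 - ((N + 1 : ℕ) : ℝ) ^ (-v) := by
    rw [Finset.sum_range_sub' fun k : ℕ => ((k + 1 : ℕ) : ℝ) ^ (-v)]
    simp
  rw [← h1]
  refine (Finset.sum_le_sum fun k _ => hstep k).trans ?_
  rw [← Finset.mul_sum, mul_comm]
  refine mul_le_mul_of_nonneg_right ?_ hv.le
  have h2 := hs.sum_le_tsum (Finset.range (N + 1)) (fun k _ => by positivity)
  rw [Finset.sum_range_succ'] at h2
  refine le_trans ?_ h2
  simp only [le_add_iff_nonneg_right]
  positivity

theorem three_le_log (hQ : 48 ≤ Q) : 3 ≤ Real.log Q := by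
  have hQR : (48 : ℝ) ≤ Q := by exact_mod_cast hQ
  rw [Real.le_log_iff_exp_le (by linarith)]
  have := Real.exp_one_lt_d9
  calc Real.exp 3 = Real.exp 1 ^ 3 := by rw [← Real.exp_nat_mul]; norm_num
    _ ≤ 2.7182818286 ^ 3 := by gcongr
    _ ≤ Q := by norm_num; linarith

theorem re_primeSum_one_ge (hQ : 48 ≤ Q) {v : ℝ} (hv : v ∈ Set.Ioc (0 : ℝ) 1) :
    -Real.log v - 5 * Real.log Q ≤ (primeSum (1 : DirichletCharacter ℂ Q) v).re := by
  have hQR : (48 : ℝ) ≤ Q := by exact_mod_cast hQ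
  have hv0 := hv.1
  have hsum := (summable_localTerm (1 : DirichletCharacter ℂ Q) hv0)
  have h0 : ∀ n, (localTerm (1 : DirichletCharacter ℂ Q) v n).re =
      ‖localTerm (1 : DirichletCharacter ℂ Q) v n‖ := by
    intro n
    rw [localTerm]
    by_cases h : IsUnit ((n : ZMod Q))
    · rw [MulChar.one_apply h, one_mul, Complex.ofReal_re, Complex.norm_real, Real.norm_of_nonneg]
      positivity
    · rw [MulChar.map_nonunit _ h]; simp
  have h1 : (2 * (Q : ℝ)) ^ (-2 : ℝ) * (1 / v) ≤
      ∑' n : ℕ, ‖localTerm (1 : DirichletCharacter ℂ Q) v n‖ := by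
    have hinj : Function.Injective fun k : ℕ => 1 + Q * k := fun a b h => by
      simpa [show Q ≠ 0 by omega] using h
    refine le_trans ?_ (tsum_comp_le_tsum_of_inj hsum (fun _ => norm_nonneg _) hinj)
    refine le_trans (mul_le_mul_of_nonneg_left (one_div_le_tsum_rpow hv0) (by positivity)) ?_
    rw [← tsum_mul_left]
    refine Summable.tsum_le_tsum (fun k => ?_)
      ((Real.summable_nat_rpow.2 (by linarith : -(1 + v) < -1)).mul_left _)
      (hsum.comp_injective hinj)
    have e1 : ((1 + Q * k : ℕ) : ZMod Q) = 1 := by simp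
    simp only [Function.comp_apply]
    rw [localTerm, e1, map_one, one_mul, Complex.norm_real, Real.norm_of_nonneg (by positivity)]
    rcases Nat.eq_zero_or_pos k with rfl | hk
    · rw [Nat.cast_zero, Real.zero_rpow (by linarith)]
      simp
    · have hk1 : (1 : ℝ) ≤ k := by exact_mod_cast hk
      calc (2 * (Q : ℝ)) ^ (-2 : ℝ) * (k : ℝ) ^ (-(1 + v))
          ≤ (2 * (Q : ℝ)) ^ (-(1 + v)) * (k : ℝ) ^ (-(1 + v)) := by
            gcongr ?_ * _
            exact Real.rpow_le_rpow_of_exponent_le (by linarith) (by linarith [hv.2])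
        _ = (2 * Q * k : ℝ) ^ (-(1 + v)) := by
            rw [← Real.mul_rpow (by positivity) (by positivity)]
        _ ≤ _ := by
            refine Real.rpow_le_rpow_of_nonpos (by positivity) ?_ (by linarith)
            push_cast
            nlinarith
  have h2 : (2 * (Q : ℝ)) ^ (-2 : ℝ) * (1 / v) ≤ ‖∑' n : ℕ, localTerm (1 : DirichletCharacter ℂ Q) v n‖ := by
    refine h1.trans ?_
    simp_rw [← h0]
    rw [← Complex.re_tsum hsum.of_norm]
    exact Complex.re_le_norm _
  have h3 := log_norm_tsum_le_re_primeSum (1 : DirichletCharacter ℂ Q) hv0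
  have h4 := Real.log_le_log (by positivity) h2
  rw [Real.log_mul (by positivity) (by positivity), Real.log_rpow (by positivity),
    Real.log_mul (by norm_num) (by positivity), one_div, Real.log_inv] at h4
  have h5 : Real.log 2 < 1 := by linarith [Real.log_two_lt_d9]
  have h6 := three_le_log hQ
  linarith

end PrimeSums

section PrimeSums

open NumberField Ideal

variable {Q : ℕ}

theorem sum_range_zmod [NeZero Q] (f : ZMod Q → ℂ) : ∑ n ∈ Finset.range Q, f n = ∑ a, f a := by
  refine Finset.sum_bij' (fun n _ => (n : ZMod Q)) (fun a _ => a.val) (fun _ _ => Finset.mem_univ _)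
    (fun a _ => Finset.mem_range.2 (ZMod.val_lt a)) (fun n hn => ?_) (fun a _ => ?_) fun _ _ => rfl
  · exact ZMod.val_cast_of_lt (Finset.mem_range.1 hn)
  · exact ZMod.natCast_zmod_val a

theorem norm_sum_range_char_le [NeZero Q] {χ : DirichletCharacter ℂ Q} (hχ : χ ≠ 1) (N : ℕ) :
    ‖∑ n ∈ Finset.range N, χ ((n + 1 : ℕ) : ZMod Q)‖ ≤ Q := by
  induction N using Nat.strong_induction_on with
  | _ N ih =>
    rcases lt_or_ge N Q with h | h
    · refine (norm_sum_le_of_le _ fun n _ => χ.norm_le_one _).trans ?_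
      simpa using h.le
    · obtain ⟨M, rfl⟩ := Nat.exists_eq_add_of_le h
      have h1 : ∑ n ∈ Finset.range Q, χ ((n + 1 : ℕ) : ZMod Q) = 0 := by
        have h2 := sum_range_zmod (Q := Q) fun a => χ (a + 1)
        push_cast
        rw [h2]
        refine (Equiv.sum_comp (Equiv.addRight (1 : ZMod Q)) χ).trans ?_
        exact MulChar.sum_eq_zero_of_ne_one hχ
      rw [Finset.sum_range_add, h1, zero_add]
      have h3 : ∀ x, ((Q + x + 1 : ℕ) : ZMod Q) = ((x + 1 : ℕ) : ZMod Q) := fun x => by simp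
      simp_rw [h3]
      exact ih M (by have := NeZero.pos Q; omega)

theorem re_primeSum_real_ge (hQ : 48 ≤ Q) {χ : DirichletCharacter ℂ Q} (hχ : χ ≠ 1)
    (hχ2 : χ ^ 2 = 1) {v : ℝ} (hv : v ∈ Set.Ioc (0 : ℝ) 1) :
    -(6 * Real.log Q) ≤ (primeSum χ v).re := by
  have hv0 := hv.1
  have hlog := three_le_log hQ
  have hQR : (48 : ℝ) ≤ Q := by exact_mod_cast hQ
  have : NeZero Q := ⟨by omega⟩
  have hquad := MulChar.isQuadratic_iff_sq_eq_one.mpr hχ2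
  rcases le_total v (1 / 4) with h4 | h4
  · set g : ℕ → ℝ := fun n => (χ n).re with hg
    have hcoe : ∀ n : ℕ, χ n = (g n : ℂ) := fun n => by
      rcases hquad n with h | h | h <;> simp [hg, h]
    have h1 := real_char_lower (g := g) (by simp [hg])
      (fun m n => by
        have h : ((g (m * n) : ℝ) : ℂ) = (g m : ℂ) * (g n : ℂ) := by
          rw [← hcoe, ← hcoe, ← hcoe, Nat.cast_mul, map_mul]
        exact_mod_cast h)
      (fun n => by rcases hquad n with h | h | h <;> simp [hg, h]) (Q := Q) (by omega)
      (fun N => by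
        refine le_trans ?_ (norm_sum_range_char_le hχ N)
        rw [hg, ← Complex.re_sum]
        exact Complex.abs_re_le_norm _) hv0 h4
    have h2 : ((∑' n : ℕ+, g n * (n : ℝ) ^ (-(1 + v)) : ℝ) : ℂ) = ∑' n : ℕ, localTerm χ v n := by
      have hz : localTerm χ v 0 = 0 := map_zero (localTermHom χ hv0)
      rw [← tsum_zero_pnat_eq_tsum_nat (summable_localTerm χ hv0).of_norm, hz, zero_add,
        Complex.ofReal_tsum]
      exact tsum_congr fun n => by rw [localTerm, hcoe]; push_cast; rfl
    have h3 := log_norm_tsum_le_re_primeSum χ hv0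
    rw [← h2, Complex.norm_real] at h3
    have h5 := Real.log_le_log (by positivity) (h1.trans (Real.le_norm_self _))
    rw [one_div, Real.log_inv, Real.log_mul (by norm_num) (by positivity), Real.log_pow] at h5
    have h6 : Real.log 512 ≤ 2 * Real.log Q := by
      rw [← Real.log_rpow (by linarith)]
      refine Real.log_le_log (by norm_num) ?_
      norm_num
      nlinarith
    push_cast at h5
    linarith
  · have h1 : ‖primeSum χ v‖ ≤ 5 := by
      have hs : Summable fun k : ℕ => (k : ℝ) ^ (-(1 + v)) :=
        Real.summable_nat_rpow.2 (by linarith)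
      refine (tsum_of_norm_bounded hs.hasSum fun r => ?_).trans
        (hs.tsum_le_of_sum_range_le fun N => ?_)
      · split_ifs
        · exact norm_localTerm_le χ v r
        · rw [norm_zero]; positivity
      · have h2 := sum_Icc_rpow_le hv0 N
        have h3 : ∑ k ∈ Finset.range N, (k : ℝ) ^ (-(1 + v)) ≤
            ∑ k ∈ Finset.Icc 1 N, (k : ℝ) ^ (-(1 + v)) := by
          rw [← Finset.sum_subset (s₁ := (Finset.range N).filter (1 ≤ ·))
            (Finset.filter_subset _ _) fun k hk hk' => ?_]
          · refine Finset.sum_le_sum_of_subset_of_nonneg (fun k hk => ?_) fun _ _ _ => by positivity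
            simp only [Finset.mem_filter, Finset.mem_range] at hk
            exact Finset.mem_Icc.2 ⟨hk.2, hk.1.le⟩
          · have : k = 0 := by
              by_contra h0
              exact hk' (Finset.mem_filter.2 ⟨hk, Nat.one_le_iff_ne_zero.2 h0⟩)
            rw [this, Nat.cast_zero, Real.zero_rpow (by linarith)]
        have h5 : 1 / v ≤ 4 := by
          rw [div_le_iff₀ hv0]; linarith
        linarith
    have h2 := (abs_le.1 ((Complex.abs_re_le_norm _).trans h1)).1
    linarith

/-- The order of the pole at `0` of the logarithm of the `L`-function of `χ`. -/
noncomputable def poleOrder (χ : DirichletCharacter ℂ Q) : ℝ := if χ = 1 then 1 else 0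

theorem exists_nat_char_ne_one (hQ : Q ≠ 0) {χ : DirichletCharacter ℂ Q} (hχ : χ ≠ 1) :
    ∃ g : ℕ, g.Coprime Q ∧ χ g ≠ 1 := by
  have : NeZero Q := ⟨hQ⟩
  obtain ⟨a, ha⟩ := MulChar.ne_one_iff.1 hχ
  refine ⟨(a : ZMod Q).val, ZMod.val_coe_unit_coprime a, ?_⟩
  rwa [ZMod.natCast_zmod_val]

theorem admissible_of_finrank_eq_one {K : Type*} [Field K] [NumberField K]
    (hK : Module.finrank ℚ K = 1) (hQ : Q ≠ 0) (χ : DirichletCharacter ℂ Q) :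
    Admissible K χ (poleOrder χ) := by
  by_cases hχ : χ = 1
  · exact Or.inl (if_pos hχ)
  · obtain ⟨g, hg, hgχ⟩ := exists_nat_char_ne_one hQ hχ
    have : absNorm (span {(g : 𝓞 K)}) = g := by
      rw [absNorm_span_natCast, RingOfIntegers.rank, hK, pow_one]
    exact Or.inr ⟨if_neg hχ, span {(g : 𝓞 K)}, by rwa [this], by rwa [this]⟩

theorem re_primeSum_le (h2Q : 2 ∣ Q) (hQ : 48 ≤ Q) (χ : DirichletCharacter ℂ Q) {v : ℝ}
    (hv : v ∈ Set.Ioc (0 : ℝ) 1) :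
    (primeSum χ v).re ≤ -(poleOrder χ * Real.log v) + 60 * Real.log Q := by
  obtain ⟨K, _, _, ⟨D⟩⟩ := exists_radicalGen Nat.prime_two 0 h2Q h2Q hQ (by rw [pow_zero]; omega)
  have h := D.re_degOneSum_le
    (admissible_of_finrank_eq_one (by rw [D.finrank_eq, pow_zero]) (by omega) χ) hv
  rw [D.degOneSum_eq_rootSum χ hv.1] at h
  simpa [rootSum_one] using h

theorem three_four_one (χ : DirichletCharacter ℂ Q) {v : ℝ} (hv : 0 < v) :
    0 ≤ 3 * (primeSum (1 : DirichletCharacter ℂ Q) v).re + 4 * (primeSum χ v).re +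
      (primeSum (χ ^ 2) v).re := by
  have h1 := summable_primeTerm (1 : DirichletCharacter ℂ Q) hv
  have h2 := summable_primeTerm χ hv
  have h3 := summable_primeTerm (χ ^ 2) hv
  have e := (((Complex.hasSum_re h1.hasSum).mul_left 3).add
    ((Complex.hasSum_re h2.hasSum).mul_left 4)).add (Complex.hasSum_re h3.hasSum)
  refine e.nonneg fun r => ?_
  split_ifs with hr
  · simp only [localTerm]
    set t : ℝ := (r : ℝ) ^ (-(1 + v))
    have ht : 0 ≤ t := by positivity
    by_cases hu : IsUnit ((r : ZMod Q))
    · have hn : ‖χ r‖ = 1 := by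
        obtain ⟨u, hu⟩ := hu
        rw [← hu]
        exact χ.unit_norm_eq_one u
      rw [MulChar.one_apply hu, MulChar.pow_apply' _ two_ne_zero]
      set z := χ r
      have hz : z.re ^ 2 + z.im ^ 2 = 1 := by
        have := Complex.sq_norm z
        rw [hn, Complex.normSq_apply] at this
        linarith
      have e : 3 * (1 * (t : ℂ)).re + 4 * (z * t).re + (z ^ 2 * t).re =
          t * (2 * (1 + z.re) ^ 2 + (1 - z.re ^ 2 - z.im ^ 2)) := by
        simp [pow_two]
        ring
      rw [e]
      exact mul_nonneg ht (by nlinarith [sq_nonneg (1 + z.re)])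
    · rw [MulChar.map_nonunit _ hu, MulChar.map_nonunit _ hu, MulChar.map_nonunit _ hu]
      simp
  · simp

theorem re_primeSum_ge (h2Q : 2 ∣ Q) (hQ : 48 ≤ Q) (χ : DirichletCharacter ℂ Q) {v : ℝ}
    (hv : v ∈ Set.Ioc (0 : ℝ) 1) :
    (3 / 4 - poleOrder χ) * Real.log v - 60 * Real.log Q ≤ (primeSum χ v).re := by
  have hlv : Real.log v ≤ 0 := Real.log_nonpos hv.1.le hv.2
  have hlog := three_le_log hQ
  by_cases h1 : χ = 1
  · rw [poleOrder, if_pos h1, h1]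
    have := re_primeSum_one_ge hQ hv
    linarith
  rw [poleOrder, if_neg h1]
  by_cases h2 : χ ^ 2 = 1
  · have := re_primeSum_real_ge hQ h1 h2 hv
    linarith
  have ha := three_four_one χ hv.1
  have hb := re_primeSum_le h2Q hQ (1 : DirichletCharacter ℂ Q) hv
  have hc := re_primeSum_le h2Q hQ (χ ^ 2) hv
  rw [poleOrder, if_pos rfl] at hb
  rw [poleOrder, if_neg h2] at hc
  linarith

theorem abs_re_primeSum_add_le (h2Q : 2 ∣ Q) (hQ : 48 ≤ Q) (χ : DirichletCharacter ℂ Q) {v : ℝ}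
    (hv : v ∈ Set.Ioc (0 : ℝ) 1) :
    |(primeSum χ v).re + poleOrder χ * Real.log v| ≤ 490 * Real.log Q := by
  obtain ⟨K, _, _, ⟨D⟩⟩ := exists_radicalGen Nat.prime_two 0 h2Q h2Q hQ (by rw [pow_zero]; omega)
  have h := (D.bootstrap
    (admissible_of_finrank_eq_one (by rw [D.finrank_eq, pow_zero]) (by omega) χ) (C := 60)
    fun v hv => by
      rw [D.degOneSum_eq_rootSum χ hv.1]
      have := re_primeSum_ge h2Q hQ χ hv
      simpa [rootSum_one] using this).1 v hv
  rw [D.degOneSum_eq_rootSum χ hv.1] at h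
  have h1 := re_primeSum_le h2Q hQ χ hv
  have hlog := three_le_log hQ
  simp only [rootSum_one, pow_zero, Nat.cast_one, Nat.cast_ofNat] at h
  rw [abs_le]
  constructor <;> linarith

end PrimeSums

section RootSums

open NumberField Ideal

variable {p n Q : ℕ}

theorem rootCount_le (hn : 0 < n) {r : ℕ} (hr : r.Prime) : rootCount p n r ≤ n := by
  have := Fact.mk hr
  have e : {x : ZMod r | x ^ n = p} = (Polynomial.nthRoots n (p : ZMod r)).toFinset := by
    ext x
    simp [Polynomial.mem_nthRoots hn]
  have h : rootCount p n r = ({x : ZMod r | x ^ n = p} : Set (ZMod r)).ncard := rfl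
  rw [h, e, Set.ncard_coe_finset]
  exact (Multiset.toFinset_card_le _).trans (Polynomial.card_nthRoots n _)

theorem summable_rootTerm (p : ℕ) (hn : 0 < n) (χ : DirichletCharacter ℂ Q) {v : ℝ} (hv : 0 < v) :
    Summable fun r : ℕ => if r.Prime then (rootCount p n r : ℂ) * localTerm χ v r else 0 := by
  refine Summable.of_norm_bounded ((summable_localTerm χ hv).mul_left (n : ℝ)) fun r => ?_
  split_ifs with hr
  · rw [norm_mul, Complex.norm_natCast]
    exact mul_le_mul_of_nonneg_right (by exact_mod_cast rootCount_le hn hr) (norm_nonneg _)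
  · rw [norm_zero]
    positivity

/-- Two independent real characters which detect the primes where `X ^ n - p` has exactly two
roots, or none. -/
structure SplittingChars (p n : ℕ) {Q : ℕ} (ψ ω : DirichletCharacter ℂ Q) : Prop where
  sq_left : ψ ^ 2 = 1
  sq_right : ω ^ 2 = 1
  left_ne : ψ ≠ 1
  right_ne : ω ≠ 1
  mul_ne : ψ * ω ≠ 1
  rootCount_zero : ∀ r : ℕ, r.Prime → ¬ r ∣ Q → ω r ≠ 1 → rootCount p n r = 0
  rootCount_two : ∀ r : ℕ, r.Prime → ¬ r ∣ Q → ψ r = -1 → ω r = 1 → rootCount p n r = 2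

/-- The sum over the primes `r` with `ψ r = -1` and `ω r = 1`. -/
noncomputable def twoRootSum (ψ ω χ : DirichletCharacter ℂ Q) (v : ℝ) : ℂ :=
  ∑' r : ℕ, if r.Prime ∧ ψ r = -1 ∧ ω r = 1 then localTerm χ v r else 0

theorem summable_twoRootTerm (ψ ω χ : DirichletCharacter ℂ Q) {v : ℝ} (hv : 0 < v) :
    Summable fun r : ℕ => if r.Prime ∧ ψ r = -1 ∧ ω r = 1 then localTerm χ v r else 0 := by
  refine Summable.of_norm_bounded (summable_localTerm χ hv) fun r => ?_
  split_ifs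
  · exact le_rfl
  · rw [norm_zero]
    positivity

theorem DirichletCharacter.apply_eq_of_sq_eq_one {ψ : DirichletCharacter ℂ Q} (h : ψ ^ 2 = 1)
    {r : ℕ} (hr : r.Prime) (hrQ : ¬ r ∣ Q) : ψ r = 1 ∨ ψ r = -1 := by
  have hu : IsUnit (r : ZMod Q) :=
    (ZMod.isUnit_iff_coprime r Q).2 ((Nat.Prime.coprime_iff_not_dvd hr).2 hrQ)
  have : ψ r ^ 2 = 1 := by
    rw [← MulChar.pow_apply' _ two_ne_zero, h, MulChar.one_apply hu]
  exact sq_eq_one_iff.1 this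

theorem localTerm_eq_zero (χ : DirichletCharacter ℂ Q) (v : ℝ) {r : ℕ} (hr : r.Prime)
    (hrQ : r ∣ Q) : localTerm χ v r = 0 := by
  have hu : ¬ IsUnit (r : ZMod Q) := by
    rw [ZMod.isUnit_iff_coprime, Nat.Prime.coprime_iff_not_dvd hr]
    exact not_not.2 hrQ
  rw [localTerm, MulChar.map_nonunit _ hu, zero_mul]

variable {ψ ω : DirichletCharacter ℂ Q}

theorem SplittingChars.twoRootSum_eq (S : SplittingChars p n ψ ω) (χ : DirichletCharacter ℂ Q)
    {v : ℝ} (hv : 0 < v) :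
    4 * twoRootSum ψ ω χ v = primeSum χ v - primeSum (χ * ψ) v + primeSum (χ * ω) v -
      primeSum (χ * (ψ * ω)) v := by
  have s := fun χ : DirichletCharacter ℂ Q => summable_primeTerm χ hv
  rw [twoRootSum, ← tsum_mul_left]
  simp only [primeSum]
  rw [← (s χ).tsum_sub (s _), ← ((s χ).sub (s _)).tsum_add (s _),
    ← (((s χ).sub (s _)).add (s _)).tsum_sub (s _)]
  refine tsum_congr fun r => ?_
  by_cases hr : r.Prime
  · simp only [hr, true_and, if_true]
    by_cases hrQ : r ∣ Q
    · simp [localTerm_eq_zero _ v hr hrQ]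
    simp only [localTerm, MulChar.mul_apply]
    rcases DirichletCharacter.apply_eq_of_sq_eq_one S.sq_left hr hrQ with h1 | h1 <;>
    rcases DirichletCharacter.apply_eq_of_sq_eq_one S.sq_right hr hrQ with h2 | h2 <;>
    · rw [h1, h2]
      norm_num
      try ring
  · simp [hr]

theorem SplittingChars.rootSum_mul_right (S : SplittingChars p n ψ ω)
    (χ : DirichletCharacter ℂ Q) (v : ℝ) : rootSum p n (χ * ω) v = rootSum p n χ v := by
  refine tsum_congr fun r => ?_
  by_cases hr : r.Prime
  · by_cases hrQ : r ∣ Q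
    · simp [localTerm_eq_zero _ v hr hrQ]
    by_cases h : ω r = 1
    · simp [localTerm, h]
    · simp [S.rootCount_zero r hr hrQ h]
  · simp [hr]

theorem SplittingChars.rootSum_mul_left (S : SplittingChars p n ψ ω) (hn : 0 < n) {v : ℝ}
    (hv : 0 < v) : rootSum p n ψ v = rootSum p n (1 : DirichletCharacter ℂ Q) v - 4 * twoRootSum ψ ω 1 v := by
  rw [twoRootSum, ← tsum_mul_left, rootSum, rootSum,
    ← (summable_rootTerm p hn 1 hv).tsum_sub ((summable_twoRootTerm ψ ω 1 hv).mul_left 4)]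
  refine tsum_congr fun r => ?_
  by_cases hr : r.Prime
  · by_cases hrQ : r ∣ Q
    · simp [hr, localTerm_eq_zero _ v hr hrQ]
    have hu : IsUnit (r : ZMod Q) :=
      (ZMod.isUnit_iff_coprime r Q).2 ((Nat.Prime.coprime_iff_not_dvd hr).2 hrQ)
    have h11 : (1 : DirichletCharacter ℂ Q) r = 1 := MulChar.one_apply hu
    by_cases h2 : ω r = 1
    · rcases DirichletCharacter.apply_eq_of_sq_eq_one S.sq_left hr hrQ with h1 | h1
      · have : ¬ (1 : ℂ) = -1 := by norm_num
        simp only [hr, if_true, localTerm, h1, h2, h11, this, false_and,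
          and_false, if_false, mul_zero, sub_zero]
      · simp only [hr, if_true, localTerm, h1, h2, h11, and_self,
          S.rootCount_two r hr hrQ h1 h2]
        push_cast
        ring
    · simp [S.rootCount_zero r hr hrQ h2, h2]
  · simp [hr]

theorem localTerm_one_re_nonneg (v : ℝ) (r : ℕ) :
    0 ≤ (localTerm (1 : DirichletCharacter ℂ Q) v r).re := by
  rw [localTerm]
  by_cases hu : IsUnit (r : ZMod Q)
  · rw [MulChar.one_apply hu, one_mul, Complex.ofReal_re]
    positivity
  · simp [MulChar.map_nonunit _ hu]

theorem neg_localTerm_one_re_le (χ : DirichletCharacter ℂ Q) (v : ℝ) (r : ℕ) :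
    -(localTerm (1 : DirichletCharacter ℂ Q) v r).re ≤ (localTerm χ v r).re := by
  by_cases hu : IsUnit (r : ZMod Q)
  · have h : |(χ r).re| ≤ 1 := by
      obtain ⟨u, hu⟩ := hu
      rw [← hu]
      exact (Complex.abs_re_le_norm _).trans (χ.unit_norm_eq_one u).le
    have hr : (0 : ℝ) ≤ (r : ℝ) ^ (-(1 + v)) := by positivity
    rw [localTerm, localTerm, MulChar.one_apply hu, one_mul, Complex.ofReal_re, Complex.re_mul_ofReal]
    nlinarith [(abs_le.1 h).1]
  · simp [localTerm, MulChar.map_nonunit _ hu]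

theorem SplittingChars.re_rootSum_one_ge (S : SplittingChars p n ψ ω) (hn : 0 < n) {v : ℝ}
    (hv : 0 < v) :
    2 * (twoRootSum ψ ω 1 v).re ≤ (rootSum p n (1 : DirichletCharacter ℂ Q) v).re := by
  have s1 := summable_rootTerm p hn (1 : DirichletCharacter ℂ Q) hv
  have s2 := summable_twoRootTerm ψ ω 1 hv
  have e : (rootSum p n (1 : DirichletCharacter ℂ Q) v - 2 * twoRootSum ψ ω 1 v).re =
      (rootSum p n (1 : DirichletCharacter ℂ Q) v).re - 2 * (twoRootSum ψ ω 1 v).re := by simp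
  rw [← sub_nonneg, ← e, twoRootSum, rootSum, ← tsum_mul_left, ← s1.tsum_sub (s2.mul_left 2),
    Complex.re_tsum (s1.sub (s2.mul_left 2))]
  refine tsum_nonneg fun r => ?_
  by_cases hr : r.Prime
  · by_cases hrQ : r ∣ Q
    · simp [localTerm_eq_zero _ v hr hrQ]
    have := localTerm_one_re_nonneg (Q := Q) v r
    by_cases h : ψ r = -1 ∧ ω r = 1
    · simp [hr, h, S.rootCount_two r hr hrQ h.1 h.2]
    · simp only [hr, if_true, true_and, h, if_false, mul_zero, sub_zero, ← Complex.ofReal_natCast,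
        Complex.re_ofReal_mul]
      positivity
  · simp [hr]

theorem SplittingChars.re_rootSum_ge (S : SplittingChars p n ψ ω) (hn : 0 < n)
    (χ : DirichletCharacter ℂ Q) {v : ℝ} (hv : 0 < v) :
    -(rootSum p n (1 : DirichletCharacter ℂ Q) v).re + 2 * (twoRootSum ψ ω 1 v).re +
      2 * (twoRootSum ψ ω χ v).re ≤ (rootSum p n χ v).re := by
  have s := fun χ : DirichletCharacter ℂ Q => summable_rootTerm p hn χ hv
  have t := fun χ : DirichletCharacter ℂ Q => summable_twoRootTerm ψ ω χ hv
  have e : ((rootSum p n (1 : DirichletCharacter ℂ Q) v - 2 * twoRootSum ψ ω 1 v) +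
      (rootSum p n χ v - 2 * twoRootSum ψ ω χ v)).re =
      (rootSum p n χ v).re - (-(rootSum p n (1 : DirichletCharacter ℂ Q) v).re +
        2 * (twoRootSum ψ ω 1 v).re + 2 * (twoRootSum ψ ω χ v).re) := by
    simp
    ring
  rw [← sub_nonneg, ← e]
  simp only [twoRootSum, rootSum]
  rw [← tsum_mul_left, ← tsum_mul_left, ← (s 1).tsum_sub ((t 1).mul_left 2),
    ← (s χ).tsum_sub ((t χ).mul_left 2),
    ← ((s 1).sub ((t 1).mul_left 2)).tsum_add ((s χ).sub ((t χ).mul_left 2)),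
    Complex.re_tsum (((s 1).sub ((t 1).mul_left 2)).add ((s χ).sub ((t χ).mul_left 2)))]
  refine tsum_nonneg fun r => ?_
  by_cases hr : r.Prime
  · by_cases hrQ : r ∣ Q
    · simp [localTerm_eq_zero _ v hr hrQ]
    have := neg_localTerm_one_re_le χ v r
    by_cases h : ψ r = -1 ∧ ω r = 1
    · simp [hr, h, S.rootCount_two r hr hrQ h.1 h.2]
    · simp only [hr, if_true, true_and, h, if_false, mul_zero, sub_zero, ← Complex.ofReal_natCast,
        Complex.re_ofReal_mul, Complex.add_re]
      rw [← mul_add]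
      exact mul_nonneg (Nat.cast_nonneg _) (by linarith)
  · simp [hr]

end RootSums

section RootSums

open NumberField Ideal

variable {p n Q : ℕ} {ψ ω : DirichletCharacter ℂ Q}

theorem SplittingChars.mul_left_ne_one (S : SplittingChars p n ψ ω) {χ : DirichletCharacter ℂ Q}
    (h : χ ≠ ψ) : χ * ψ ≠ 1 := fun e => h <| by
  rw [mul_eq_one_iff_eq_inv.1 e, inv_eq_iff_mul_eq_one, ← pow_two, S.sq_left]

theorem SplittingChars.mul_right_ne_one (S : SplittingChars p n ψ ω) {χ : DirichletCharacter ℂ Q}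
    (h : χ ≠ ω) : χ * ω ≠ 1 := fun e => h <| by
  rw [mul_eq_one_iff_eq_inv.1 e, inv_eq_iff_mul_eq_one, ← pow_two, S.sq_right]

theorem SplittingChars.mul_mul_ne_one (S : SplittingChars p n ψ ω) {χ : DirichletCharacter ℂ Q}
    (h : χ ≠ ψ * ω) : χ * (ψ * ω) ≠ 1 := fun e => h <| by
  rw [mul_eq_one_iff_eq_inv.1 e, inv_eq_iff_mul_eq_one, ← pow_two, mul_pow, S.sq_left,
    S.sq_right, one_mul]

theorem re_primeSum_one_bounds (h2Q : 2 ∣ Q) (hQ : 48 ≤ Q) {v : ℝ} (hv : v ∈ Set.Ioc (0 : ℝ) 1) :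
    |(primeSum (1 : DirichletCharacter ℂ Q) v).re + Real.log v| ≤ 490 * Real.log Q := by
  simpa [poleOrder] using abs_re_primeSum_add_le h2Q hQ 1 hv

theorem abs_re_primeSum_le (h2Q : 2 ∣ Q) (hQ : 48 ≤ Q) {χ : DirichletCharacter ℂ Q} (hχ : χ ≠ 1)
    {v : ℝ} (hv : v ∈ Set.Ioc (0 : ℝ) 1) : |(primeSum χ v).re| ≤ 490 * Real.log Q := by
  simpa [poleOrder, hχ] using abs_re_primeSum_add_le h2Q hQ χ hv

theorem SplittingChars.abs_re_twoRootSum_one (S : SplittingChars p n ψ ω) (h2Q : 2 ∣ Q)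
    (hQ : 48 ≤ Q) {v : ℝ} (hv : v ∈ Set.Ioc (0 : ℝ) 1) :
    |4 * (twoRootSum ψ ω 1 v).re + Real.log v| ≤ 1960 * Real.log Q := by
  have h := congrArg Complex.re (S.twoRootSum_eq 1 hv.1)
  simp only [one_mul, Complex.add_re, Complex.sub_re, Complex.mul_re, Complex.re_ofNat,
    Complex.im_ofNat, zero_mul, sub_zero] at h
  have h1 := abs_le.1 (re_primeSum_one_bounds h2Q hQ hv)
  have h2 := abs_le.1 (abs_re_primeSum_le h2Q hQ S.left_ne hv)
  have h3 := abs_le.1 (abs_re_primeSum_le h2Q hQ S.right_ne hv)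
  have h4 := abs_le.1 (abs_re_primeSum_le h2Q hQ S.mul_ne hv)
  rw [h, abs_le]
  constructor <;> linarith

theorem SplittingChars.abs_re_twoRootSum (S : SplittingChars p n ψ ω) (h2Q : 2 ∣ Q)
    (hQ : 48 ≤ Q) {χ : DirichletCharacter ℂ Q} (h1 : χ ≠ 1) (hψ : χ ≠ ψ) (hω : χ ≠ ω)
    (hψω : χ ≠ ψ * ω) {v : ℝ} (hv : v ∈ Set.Ioc (0 : ℝ) 1) :
    |4 * (twoRootSum ψ ω χ v).re| ≤ 1960 * Real.log Q := by
  have h := congrArg Complex.re (S.twoRootSum_eq χ hv.1)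
  simp only [Complex.add_re, Complex.sub_re, Complex.mul_re, Complex.re_ofNat,
    Complex.im_ofNat, zero_mul, sub_zero] at h
  have h1 := abs_le.1 (abs_re_primeSum_le h2Q hQ h1 hv)
  have h2 := abs_le.1 (abs_re_primeSum_le h2Q hQ (S.mul_left_ne_one hψ) hv)
  have h3 := abs_le.1 (abs_re_primeSum_le h2Q hQ (S.mul_right_ne_one hω) hv)
  have h4 := abs_le.1 (abs_re_primeSum_le h2Q hQ (S.mul_mul_ne_one hψω) hv)
  rw [h, abs_le]
  constructor <;> linarith

variable {K : Type*} [Field K] [NumberField K]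

theorem SplittingChars.admissible_of_prime (S : SplittingChars p n ψ ω) (D : RadicalGen K p n Q)
    {χ : DirichletCharacter ℂ Q} {r : ℕ} (hr : r.Prime) (hrQ : ¬ r ∣ Q) (h1 : ψ r = -1)
    (h2 : ω r = 1) (h3 : χ r ≠ 1) : Admissible K χ 0 := by
  refine Or.inr ⟨rfl, ?_⟩
  have h : normCount K r ≠ 0 := by
    rw [D.normCount_eq hr hrQ, S.rootCount_two r hr hrQ h1 h2]
    exact two_ne_zero
  rw [normCount] at h
  obtain ⟨⟨P, hP⟩⟩ := (Nat.card_ne_zero.1 h).1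
  rw [← hP] at h3
  exact ⟨P.1, by rw [hP]; exact (Nat.Prime.coprime_iff_not_dvd hr).2 hrQ, h3⟩

theorem SplittingChars.admissible (S : SplittingChars p n ψ ω) (D : RadicalGen K p n Q)
    (h2Q : 2 ∣ Q) {χ : DirichletCharacter ℂ Q} (h1 : χ ≠ 1) (hω : χ ≠ ω) : Admissible K χ 0 := by
  have hQ := D.le_mod
  have hlog := three_le_log hQ
  by_contra hc
  have key : ∀ r : ℕ, r.Prime → ¬ r ∣ Q → ψ r = -1 → ω r = 1 → χ r = 1 := fun r hr hrQ a b => by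
    by_contra h
    exact hc (S.admissible_of_prime D hr hrQ a b h)
  set v := Real.exp (-4000 * Real.log Q) with hvdef
  have hv : v ∈ Set.Ioc (0 : ℝ) 1 := ⟨Real.exp_pos _, Real.exp_le_one_iff.2 (by linarith)⟩
  have hlv : Real.log v = -4000 * Real.log Q := Real.log_exp _
  have hT := abs_le.1 (S.abs_re_twoRootSum_one h2Q hQ hv)
  have e : ∀ θ : DirichletCharacter ℂ Q, (∀ r : ℕ, r.Prime → ¬ r ∣ Q → ψ r = -1 → ω r = 1 →
      θ r = 1) → twoRootSum ψ ω θ v = twoRootSum ψ ω 1 v := fun θ hθ => by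
    refine tsum_congr fun r => ?_
    by_cases hr : r.Prime
    · by_cases hrQ : r ∣ Q
      · simp [localTerm_eq_zero _ v hr hrQ]
      by_cases h : ψ r = -1 ∧ ω r = 1
      · have hu : IsUnit (r : ZMod Q) :=
          (ZMod.isUnit_iff_coprime r Q).2 ((Nat.Prime.coprime_iff_not_dvd hr).2 hrQ)
        have h11 : (1 : DirichletCharacter ℂ Q) r = 1 := MulChar.one_apply hu
        simp only [hr, h, localTerm, h11, hθ r hr hrQ h.1 h.2]
      · simp [hr, h]
    · simp [hr]
  have e1 := e χ key
  by_cases hψ : χ = ψ ∨ χ = ψ * ω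
  · have : (∀ r : ℕ, r.Prime → ¬ (ψ r = -1 ∧ ω r = 1)) := fun r hr h => by
      by_cases hrQ : r ∣ Q
      · have hu : ¬ IsUnit (r : ZMod Q) := by
          rw [ZMod.isUnit_iff_coprime, Nat.Prime.coprime_iff_not_dvd hr]
          exact not_not.2 hrQ
        rw [MulChar.map_nonunit _ hu] at h
        norm_num at h
      · have := key r hr hrQ h.1 h.2
        rcases hψ with hψ | hψ
        · rw [hψ, h.1] at this
          norm_num at this
        · rw [hψ, MulChar.mul_apply, h.1, h.2] at this
          norm_num at this
    have h0 : twoRootSum ψ ω 1 v = 0 := by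
      rw [twoRootSum]
      refine (tsum_congr fun r => ?_).trans tsum_zero
      rw [if_neg]
      exact fun h => this r h.1 h.2
    rw [h0, hlv] at hT
    simp only [Complex.zero_re] at hT
    linarith
  push Not at hψ
  have hX := abs_le.1 (S.abs_re_twoRootSum h2Q hQ h1 hψ.1 hω hψ.2 hv)
  rw [e1] at hX
  rw [hlv] at hT
  linarith

theorem SplittingChars.re_rootSum_one_pole (S : SplittingChars p n ψ ω) (D : RadicalGen K p n Q)
    (h2Q : 2 ∣ Q) {v : ℝ} (hv : v ∈ Set.Ioc (0 : ℝ) 1) :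
    -Real.log v - 4170 * n * Real.log Q ≤ (rootSum p n (1 : DirichletCharacter ℂ Q) v).re := by
  have hlog := D.log_mod
  have hn : (1 : ℝ) ≤ n := by exact_mod_cast D.one_le_dim
  have h := (D.bootstrap (χ := 1) (τ := 1) (Or.inl rfl) (C := 980) fun v hv => by
    rw [D.degOneSum_eq_rootSum _ hv.1]
    have h1 := S.re_rootSum_one_ge D.one_le_dim hv.1
    have h2 := abs_le.1 (S.abs_re_twoRootSum_one h2Q D.le_mod hv)
    have h3 : Real.log v ≤ 0 := Real.log_nonpos hv.1.le hv.2
    push_cast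
    nlinarith).1 v hv
  rw [D.degOneSum_eq_rootSum _ hv.1] at h
  push_cast at h
  linarith

theorem SplittingChars.re_rootSum_lower (S : SplittingChars p n ψ ω) (D : RadicalGen K p n Q)
    (h2Q : 2 ∣ Q) (χ : DirichletCharacter ℂ Q) {v : ℝ} (hv : v ∈ Set.Ioc (0 : ℝ) 1) :
    (3 / 4 - if χ = 1 ∨ χ = ω then 1 else 0) * Real.log v - 6130 * n * Real.log Q ≤
      (rootSum p n χ v).re := by
  have hlog := D.log_mod
  have hn : (1 : ℝ) ≤ n := by exact_mod_cast D.one_le_dim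
  have hlv : Real.log v ≤ 0 := Real.log_nonpos hv.1.le hv.2
  have h1 := S.re_rootSum_one_pole D h2Q hv
  have hT := abs_le.1 (S.abs_re_twoRootSum_one h2Q D.le_mod hv)
  have eψ := congrArg Complex.re (S.rootSum_mul_left D.one_le_dim hv.1)
  simp only [Complex.sub_re, Complex.mul_re, Complex.re_ofNat,
    Complex.im_ofNat, zero_mul, sub_zero] at eψ
  have hnl : Real.log Q ≤ n * Real.log Q := by nlinarith
  by_cases hp : χ = 1 ∨ χ = ω
  · rw [if_pos hp]
    have e : rootSum p n χ v = rootSum p n (1 : DirichletCharacter ℂ Q) v := by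
      rcases hp with hp | hp
      · rw [hp]
      · rw [hp, ← S.rootSum_mul_right 1, one_mul]
    rw [e]
    linarith
  rw [if_neg hp]
  push Not at hp
  by_cases hψ : χ = ψ ∨ χ = ψ * ω
  · have e : rootSum p n χ v = rootSum p n ψ v := by
      rcases hψ with hp | hp
      · rw [hp]
      · rw [hp, S.rootSum_mul_right]
    rw [e, eψ]
    linarith
  push Not at hψ
  have hχ := S.re_rootSum_ge D.one_le_dim χ hv.1
  have hX := abs_le.1 (S.abs_re_twoRootSum h2Q D.le_mod hp.1 hψ.1 hp.2 hψ.2 hv)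
  have hU := D.re_degOneSum_le (χ := 1) (τ := 1) (Or.inl rfl) hv
  rw [D.degOneSum_eq_rootSum _ hv.1] at hU
  linarith

theorem SplittingChars.norm_rootSum_sub_le (S : SplittingChars p n ψ ω) (D : RadicalGen K p n Q)
    (h2Q : 2 ∣ Q) (χ : DirichletCharacter ℂ Q) {v v' : ℝ} (hv : v ∈ Set.Ioc (0 : ℝ) 1)
    (hv' : v' ∈ Set.Ioc (0 : ℝ) 1) :
    ‖rootSum p n χ v - rootSum p n χ v' +
        (((if χ = 1 ∨ χ = ω then 1 else 0) * (Real.log v - Real.log v') : ℝ) : ℂ)‖ ≤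
      (Q : ℝ) ^ (24770 * n) * |v - v'| := by
  have ha : Admissible K χ (if χ = 1 ∨ χ = ω then 1 else 0) := by
    split_ifs with h
    · exact Or.inl rfl
    · push Not at h
      exact S.admissible D h2Q h.1 h.2
  have h := (D.bootstrap ha (C := 6130) fun v hv => by
    rw [D.degOneSum_eq_rootSum _ hv.1]
    exact_mod_cast S.re_rootSum_lower D h2Q χ hv).2 v hv v' hv'
  rw [D.degOneSum_eq_rootSum _ hv.1, D.degOneSum_eq_rootSum _ hv'.1] at h
  exact h

theorem norm_primeSum_sub_le (h2Q : 2 ∣ Q) (hQ : 48 ≤ Q) (χ : DirichletCharacter ℂ Q) {v v' : ℝ}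
    (hv : v ∈ Set.Ioc (0 : ℝ) 1) (hv' : v' ∈ Set.Ioc (0 : ℝ) 1) :
    ‖primeSum χ v - primeSum χ v' + ((poleOrder χ * (Real.log v - Real.log v') : ℝ) : ℂ)‖ ≤
      (Q : ℝ) ^ 24770 * |v - v'| := by
  obtain ⟨K, _, _, ⟨D⟩⟩ := exists_radicalGen Nat.prime_two 0 h2Q h2Q hQ (by rw [pow_zero]; omega)
  have h := (D.bootstrap
    (admissible_of_finrank_eq_one (by rw [D.finrank_eq, pow_zero]) (by omega) χ) (C := 6130)
    fun v hv => by
      rw [D.degOneSum_eq_rootSum χ hv.1]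
      have := re_primeSum_ge h2Q hQ χ hv
      have hlog := three_le_log hQ
      simp only [rootSum_one, pow_zero]
      push_cast
      linarith).2 v hv v' hv'
  rw [D.degOneSum_eq_rootSum χ hv.1, D.degOneSum_eq_rootSum χ hv'.1] at h
  simpa only [rootSum_one, pow_zero, mul_one] using h

end RootSums

section PowerRoots

theorem IsCyclic.range_powMonoidHom {G : Type*} [CommGroup G] [IsCyclic G] [Finite G] (n : ℕ) :
    (powMonoidHom n : G →* G).range =
      (powMonoidHom (Nat.card G / (Nat.card G).gcd n) : G →* G).ker := by
  have hdvd := Nat.gcd_dvd_left (Nat.card G) n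
  refine Subgroup.eq_of_le_of_card_ge ?_ ?_
  · rintro _ ⟨b, rfl⟩
    obtain ⟨k, hk⟩ := Nat.gcd_dvd_right (Nat.card G) n
    rw [MonoidHom.mem_ker, powMonoidHom_apply, powMonoidHom_apply, ← pow_mul]
    have : n * (Nat.card G / (Nat.card G).gcd n) = Nat.card G * k := by
      obtain ⟨e, he⟩ := hdvd
      have hg : 0 < (Nat.card G).gcd n := Nat.gcd_pos_of_pos_left _ Nat.card_pos
      have h2 : Nat.card G / (Nat.card G).gcd n = e := Nat.div_eq_of_eq_mul_right hg he
      rw [h2]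
      conv_lhs => rw [hk]
      conv_rhs => rw [he]
      ring
    rw [this, pow_mul, pow_card_eq_one', one_pow]
  · rw [IsCyclic.card_powMonoidHom_ker, IsCyclic.card_powMonoidHom_range,
      Nat.gcd_eq_right (Nat.div_dvd_of_dvd hdvd)]

theorem IsCyclic.card_pow_eq {G : Type*} [CommGroup G] [IsCyclic G] [Finite G] (n : ℕ) (a : G) :
    Nat.card {x : G // x ^ n = a} =
      if a ^ (Nat.card G / (Nat.card G).gcd n) = 1 then (Nat.card G).gcd n else 0 := by
  have hr : a ^ (Nat.card G / (Nat.card G).gcd n) = 1 ↔ a ∈ (powMonoidHom n : G →* G).range := by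
    rw [IsCyclic.range_powMonoidHom, MonoidHom.mem_ker, powMonoidHom_apply]
  split_ifs with h
  · obtain ⟨b, rfl⟩ := hr.1 h
    rw [← IsCyclic.card_powMonoidHom_ker G n]
    refine Nat.card_congr ⟨fun x => ⟨x.1 * b⁻¹, ?_⟩, fun x => ⟨x.1 * b, ?_⟩, fun x => ?_, fun x => ?_⟩
    · have : x.1 ^ n = b ^ n := x.2
      rw [MonoidHom.mem_ker, powMonoidHom_apply, mul_pow, this, inv_pow, mul_inv_cancel]
    · have := x.2
      rw [MonoidHom.mem_ker, powMonoidHom_apply] at this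
      rw [powMonoidHom_apply, mul_pow, this, one_mul]
    · simp
    · simp
  · have : IsEmpty {x : G // x ^ n = a} := ⟨fun x => h (hr.2 ⟨x.1, x.2⟩)⟩
    exact Nat.card_of_isEmpty

theorem rootCount_eq {p n r : ℕ} (hn : n ≠ 0) (hr : r.Prime) (hrp : ¬ r ∣ p) :
    rootCount p n r =
      if (p : ZMod r) ^ ((r - 1) / (r - 1).gcd n) = 1 then (r - 1).gcd n else 0 := by
  have := Fact.mk hr
  have hp : (p : ZMod r) ≠ 0 := by rwa [Ne, ZMod.natCast_eq_zero_iff]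
  have hc : Nat.card (ZMod r)ˣ = r - 1 := by
    rw [Nat.card_eq_fintype_card, ZMod.card_units]
  have h := IsCyclic.card_pow_eq n (Units.mk0 (p : ZMod r) hp)
  rw [hc] at h
  have e : (Units.mk0 (p : ZMod r) hp) ^ ((r - 1) / (r - 1).gcd n) = 1 ↔
      (p : ZMod r) ^ ((r - 1) / (r - 1).gcd n) = 1 := by
    rw [Units.ext_iff, Units.val_pow_eq_pow_val, Units.val_mk0, Units.val_one]
  simp only [e] at h
  rw [← h, rootCount]
  refine Nat.card_congr ⟨fun x => ⟨Units.mk0 x.1 fun h0 => hp ?_, ?_⟩, fun x => ⟨x.1, ?_⟩,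
    fun x => ?_, fun x => ?_⟩
  · rw [← x.2, h0, zero_pow hn]
  · rw [Units.ext_iff, Units.val_pow_eq_pow_val, Units.val_mk0, Units.val_mk0, x.2]
  · have := x.2
    rwa [Units.ext_iff, Units.val_pow_eq_pow_val, Units.val_mk0] at this
  · rfl
  · exact Subtype.ext (Units.ext rfl)

end PowerRoots

section JacobiChars

open scoped NumberTheorySymbols

theorem jacobiSym_mod {a : ℤ} {Q : ℕ} (ha : 4 * a.natAbs ∣ Q) {b : ℕ} (hb : Odd b) :
    J(a | b % Q) = J(a | b) := by
  have hQ : 2 ∣ Q := (Dvd.intro _ (by ring : 2 * (2 * a.natAbs) = 4 * a.natAbs)).trans ha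
  have hb' : Odd (b % Q) := by
    rw [Nat.odd_iff, Nat.mod_mod_of_dvd _ hQ]
    exact Nat.odd_iff.1 hb
  rw [jacobiSym.mod_right a hb, jacobiSym.mod_right a hb', Nat.mod_mod_of_dvd _ ha]

/-- The Jacobi symbol `b ↦ J(a | b)` as a Dirichlet character modulo a multiple of `4 * a`. -/
noncomputable def jacobiChar (a : ℤ) (Q : ℕ) (hQ : Q ≠ 0) (ha : 4 * a.natAbs ∣ Q) :
    DirichletCharacter ℂ Q where
  toFun z := if IsUnit z then (J(a | z.val) : ℂ) else 0
  map_one' := by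
    have := NeZero.mk hQ
    rw [if_pos isUnit_one, ZMod.val_one_eq_one_mod, jacobiSym_mod ha odd_one,
      jacobiSym.one_right, Int.cast_one]
  map_mul' z w := by
    have := NeZero.mk hQ
    have h2Q : 2 ∣ Q := (Dvd.intro _ (by ring : 2 * (2 * a.natAbs) = 4 * a.natAbs)).trans ha
    have odd : ∀ z : ZMod Q, IsUnit z → Odd z.val := fun z hz => by
      have h := (ZMod.isUnit_iff_coprime z.val Q).1 (by rwa [ZMod.natCast_zmod_val])
      exact (Nat.Coprime.coprime_dvd_right h2Q h).odd_of_right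
    by_cases hz : IsUnit z
    · by_cases hw : IsUnit w
      · have n1 := NeZero.mk (odd z hz).pos.ne'
        have n2 := NeZero.mk (odd w hw).pos.ne'
        rw [if_pos hz, if_pos hw, if_pos (hz.mul hw), ZMod.val_mul,
          jacobiSym_mod ha ((odd z hz).mul (odd w hw)), jacobiSym.mul_right, Int.cast_mul]
      · rw [if_neg hw, if_neg (fun h => hw (isUnit_of_mul_isUnit_right h)), mul_zero]
    · rw [if_neg hz, if_neg (fun h => hz (isUnit_of_mul_isUnit_left h)), zero_mul]
  map_nonunit' z hz := if_neg hz

variable {a : ℤ} {Q : ℕ} (hQ : Q ≠ 0) (ha : 4 * a.natAbs ∣ Q)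

theorem odd_of_coprime_mod (ha : 4 * a.natAbs ∣ Q) {b : ℕ} (hb : b.Coprime Q) : Odd b := by
  have h2Q : 2 ∣ Q := (Dvd.intro _ (by ring : 2 * (2 * a.natAbs) = 4 * a.natAbs)).trans ha
  exact (Nat.Coprime.coprime_dvd_right h2Q hb).odd_of_right

theorem jacobiChar_natCast {b : ℕ} (hb : b.Coprime Q) : jacobiChar a Q hQ ha b = J(a | b) := by
  have h : jacobiChar a Q hQ ha b =
    if IsUnit (b : ZMod Q) then (J(a | (b : ZMod Q).val) : ℂ) else 0 := rfl
  rw [h, if_pos ((ZMod.isUnit_iff_coprime b Q).2 hb), ZMod.val_natCast,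
    jacobiSym_mod ha (odd_of_coprime_mod ha hb)]

theorem jacobiChar_sq : jacobiChar a Q hQ ha ^ 2 = 1 := by
  have := NeZero.mk hQ
  refine MulChar.ext fun u => ?_
  have hc := ZMod.val_coe_unit_coprime u
  have e : ((u : ZMod Q).val : ZMod Q) = u := ZMod.natCast_zmod_val _
  rw [MulChar.pow_apply' _ two_ne_zero, MulChar.one_apply_coe, ← e, jacobiChar_natCast hQ ha hc]
  have hg : a.gcd ((u : ZMod Q).val : ℕ) = 1 := by
    rw [Int.gcd, Int.natAbs_natCast]
    exact Nat.Coprime.coprime_dvd_left ((Dvd.intro_left 4 rfl).trans ha) hc.symm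
  exact_mod_cast jacobiSym.sq_one hg

end JacobiChars

section Splitting

open scoped NumberTheorySymbols

theorem exists_prime_jacobiSym_eq_neg_one {p : ℕ} (hp : p.Prime) (N : ℕ) :
    ∃ b > N, b.Prime ∧ b % 4 = 1 ∧ J(p | b) = -1 := by
  rcases hp.eq_two_or_odd' with rfl | hodd
  · have hu : IsUnit ((5 : ℕ) : ZMod 8) := (ZMod.isUnit_iff_coprime 5 8).2 (by norm_num)
    obtain ⟨b, hb, hbp, he⟩ := Nat.forall_exists_prime_gt_and_eq_mod hu N
    have h8 : b % 8 = 5 := (ZMod.natCast_eq_natCast_iff b 5 8).1 he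
    refine ⟨b, hb, hbp, by omega, ?_⟩
    have h2 : Odd b := Nat.odd_iff.2 (by omega)
    rw [Nat.cast_ofNat, jacobiSym.at_two h2, ZMod.χ₈_nat_eq_if_mod_eight, if_neg (by omega),
      if_neg (by omega)]
  · have := Fact.mk hp
    have hp2 : p ≠ 2 := by rintro rfl; exact absurd hodd (by decide)
    obtain ⟨c, hc⟩ := FiniteField.exists_nonsquare (F := ZMod p)
      (by rwa [ZMod.ringChar_zmod_n])
    have hc0 : c ≠ 0 := by rintro rfl; exact hc ⟨0, by simp⟩
    have hcop : Nat.Coprime p 4 := by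
      rw [show (4 : ℕ) = 2 ^ 2 by norm_num]
      exact Nat.Coprime.pow_right 2 hodd.coprime_two_right
    obtain ⟨k, hk1, hk2⟩ := Nat.chineseRemainder hcop.symm 1 c.val
    have hkc : (k : ZMod p) = c := by
      rw [(ZMod.natCast_eq_natCast_iff k c.val p).2 hk2, ZMod.natCast_zmod_val]
    have hkp : k.Coprime p := (ZMod.isUnit_iff_coprime k p).1 (by rw [hkc]; exact hc0.isUnit)
    have hk4 : k.Coprime 4 := by
      have : k % 4 = 1 := hk1
      rw [Nat.coprime_comm, Nat.Coprime, Nat.gcd_rec, this]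
      norm_num
    have := NeZero.mk (mul_ne_zero hp.ne_zero (four_ne_zero (α := ℕ)))
    obtain ⟨b, hb, hbp, he⟩ := Nat.forall_exists_prime_gt_and_eq_mod
      ((ZMod.isUnit_iff_coprime k (p * 4)).2 (hkp.mul_right hk4)) N
    have he' : b ≡ k [MOD p * 4] := (ZMod.natCast_eq_natCast_iff b k _).1 he
    have hb4 : b % 4 = 1 := (he'.of_mul_left p).trans hk1
    refine ⟨b, hb, hbp, hb4, ?_⟩
    rw [jacobiSym.quadratic_reciprocity_one_mod_four' hodd hb4, ← jacobiSym.legendreSym.to_jacobiSym,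
      legendreSym.eq_neg_one_iff]
    have : ((b : ℤ) : ZMod p) = c := by
      rw [Int.cast_natCast, (ZMod.natCast_eq_natCast_iff b k p).2 (he'.of_mul_right 4), hkc]
    rwa [this]

/-- The quadratic character of the prime `p`, to a modulus divisible by `8 * p`. -/
noncomputable def primeChar (p Q : ℕ) (hQ : Q ≠ 0) (h8 : 8 * p ∣ Q) : DirichletCharacter ℂ Q :=
  jacobiChar p Q hQ (by
    rw [Int.natAbs_natCast]
    exact (mul_dvd_mul_right (by norm_num : 4 ∣ 8) p).trans h8)

theorem primeChar_natCast {p Q : ℕ} (hQ : Q ≠ 0) (h8 : 8 * p ∣ Q) {b : ℕ} (hb : b.Coprime Q) :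
    primeChar p Q hQ h8 b = J(p | b) := jacobiChar_natCast hQ _ hb

theorem splittingChars_jacobiChar {p Q : ℕ} (hp : p.Prime) (hQ : Q ≠ 0) (h8 : 8 * p ∣ Q) {m : ℕ}
    (hm : m ≠ 0) (h4 : 4 * (-1 : ℤ).natAbs ∣ Q) :
    SplittingChars p (2 ^ m) (jacobiChar (-1) Q hQ h4) (primeChar p Q hQ h8) := by
  obtain ⟨b, hbQ, hbp, hb4, hJ⟩ := exists_prime_jacobiSym_eq_neg_one hp Q
  have hbc : b.Coprime Q := (Nat.Prime.coprime_iff_not_dvd hbp).2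
    fun h => absurd (Nat.le_of_dvd (Nat.pos_of_ne_zero hQ) h) (by omega)
  have hbu : IsUnit (b : ZMod Q) := (ZMod.isUnit_iff_coprime b Q).2 hbc
  have hω : primeChar p Q hQ h8 b = -1 := by
    rw [primeChar_natCast hQ h8 hbc, hJ]
    norm_num
  have hodd : ∀ c : ℕ, c.Coprime Q → Odd c := fun c hc => odd_of_coprime_mod h4 hc
  have hψ : ∀ c : ℕ, c.Coprime Q → jacobiChar (-1) Q hQ h4 c = ((ZMod.χ₄ (c : ZMod 4) : ℤ) : ℂ) :=
    fun c hc => by rw [jacobiChar_natCast hQ h4 hc, jacobiSym.at_neg_one (hodd c hc)]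
  have hψb : jacobiChar (-1) Q hQ h4 b = 1 := by
    rw [hψ b hbc, ZMod.χ₄_nat_one_mod_four hb4, Int.cast_one]
  have hne : (1 : ℂ) ≠ -1 := by norm_num
  have h4' : 4 ∣ Q := (by simpa using h4)
  have hQ4 : (Q - 1).Coprime Q := by
    rw [Nat.coprime_comm]
    exact (Nat.coprime_self_sub_right (Nat.pos_of_ne_zero hQ)).2 (Nat.coprime_one_right Q)
  have hleg : ∀ r : ℕ, r.Prime → ¬ r ∣ Q →
      (primeChar p Q hQ h8 r = 1 ↔ (p : ZMod r) ^ (r / 2) = 1) := fun r hr hrQ => by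
    have := Fact.mk hr
    have hc := (Nat.Prime.coprime_iff_not_dvd hr).2 hrQ
    have hr2 : 2 < r := lt_of_le_of_ne hr.two_le fun h => by
      have := hodd r hc
      rw [← h] at this
      exact absurd this (by decide)
    have := Fact.mk hr2
    have hp0 : ((p : ℤ) : ZMod r) ≠ 0 := by
      rw [Int.cast_natCast, Ne, ZMod.natCast_eq_zero_iff]
      exact fun h => hrQ (h.trans ((Dvd.intro_left 8 rfl).trans h8))
    rw [primeChar_natCast hQ h8 hc, ← jacobiSym.legendreSym.to_jacobiSym, Int.cast_eq_one,
      ← Int.cast_natCast (R := ZMod r) p, ← legendreSym.eq_pow]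
    rcases legendreSym.eq_one_or_neg_one r hp0 with h | h <;> rw [h]
    · simp
    · have : (-1 : ZMod r) ≠ 1 := ZMod.neg_one_ne_one
      simpa using this
  have hrp : ∀ r : ℕ, ¬ r ∣ Q → ¬ r ∣ p := fun r hrQ h =>
    hrQ (h.trans ((Dvd.intro_left 8 rfl).trans h8))
  refine ⟨jacobiChar_sq hQ _, jacobiChar_sq hQ _, fun h => ?_, fun h => ?_, fun h => ?_, ?_, ?_⟩
  · have h1 := hψ _ hQ4
    rw [h, MulChar.one_apply ((ZMod.isUnit_iff_coprime _ Q).2 hQ4),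
      ZMod.χ₄_nat_three_mod_four (by omega)] at h1
    norm_num at h1
  · rw [h, MulChar.one_apply hbu] at hω
    exact hne hω
  · have h1 : (jacobiChar (-1) Q hQ h4 * primeChar p Q hQ h8) b = -1 := by
      rw [MulChar.mul_apply, hψb, hω, one_mul]
    rw [h, MulChar.one_apply hbu] at h1
    exact hne h1
  · intro r hr hrQ h
    rw [rootCount]
    have hne := (not_congr (hleg r hr hrQ)).1 h
    refine @Nat.card_of_isEmpty _ ⟨fun x => hne ?_⟩
    have := Fact.mk hr
    have hc := (Nat.Prime.coprime_iff_not_dvd hr).2 hrQ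
    have hro := Nat.odd_iff.1 (hodd r hc)
    obtain ⟨x, hx⟩ := x
    have hx0 : x ≠ 0 := fun h0 => hrp r hrQ <| by
      rw [← ZMod.natCast_eq_zero_iff, ← hx, h0, zero_pow (by positivity)]
    obtain ⟨k, hk⟩ := Nat.exists_eq_succ_of_ne_zero hm
    rw [← hx, hk, ← pow_mul, show 2 ^ k.succ * (r / 2) = (r - 1) * 2 ^ k by
      rw [show r - 1 = 2 * (r / 2) by omega, Nat.pow_succ]; ring, pow_mul,
      ZMod.pow_card_sub_one_eq_one hx0, one_pow]
  · intro r hr hrQ h1 h2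
    have hc := (Nat.Prime.coprime_iff_not_dvd hr).2 hrQ
    have hro := Nat.odd_iff.1 (hodd r hc)
    have hr4 : r % 4 = 3 := by
      by_contra h3
      rw [hψ r hc, ZMod.χ₄_nat_one_mod_four (by omega)] at h1
      norm_num at h1
    have hg : (r - 1).gcd (2 ^ m) = 2 := by
      obtain ⟨k, hk⟩ : ∃ k, r - 1 = 2 * (2 * k + 1) := ⟨(r - 3) / 4, by omega⟩
      obtain ⟨m, rfl⟩ := Nat.exists_eq_succ_of_ne_zero hm
      rw [hk, Nat.pow_succ', Nat.gcd_mul_left]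
      have : (2 * k + 1).Coprime (2 ^ m) :=
        Nat.Coprime.pow_right m (Nat.odd_iff.2 (by omega)).coprime_two_right
      rw [this, mul_one]
    rw [rootCount_eq (by positivity) hr (hrp r hrQ), hg, show (r - 1) / 2 = r / 2 by omega,
      if_pos ((hleg r hr hrQ).1 h2)]

end Splitting

section RootSumContinuity

/-- The order of the pole at `v = 0` of `rootSum p (2 ^ m) χ`. -/
noncomputable def rootPole (p m : ℕ) {Q : ℕ} (hQ : Q ≠ 0) (h8 : 8 * p ∣ Q)
    (χ : DirichletCharacter ℂ Q) : ℝ :=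
  if χ = 1 ∨ (m ≠ 0 ∧ χ = primeChar p Q hQ h8) then 1 else 0

theorem norm_rootSum_sub_le {p Q : ℕ} (hp : p.Prime) (hQ0 : Q ≠ 0) (hQ : 48 ≤ Q) (h8 : 8 * p ∣ Q)
    (m : ℕ) (hm : 2 ^ m ≤ Q) (χ : DirichletCharacter ℂ Q) {v v' : ℝ}
    (hv : v ∈ Set.Ioc (0 : ℝ) 1) (hv' : v' ∈ Set.Ioc (0 : ℝ) 1) :
    ‖rootSum p (2 ^ m) χ v - rootSum p (2 ^ m) χ v' +
        ((rootPole p m hQ0 h8 χ * (Real.log v - Real.log v') : ℝ) : ℂ)‖ ≤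
      (Q : ℝ) ^ (24770 * 2 ^ m) * |v - v'| := by
  have h2Q : 2 ∣ Q := (Dvd.intro _ (by ring : 2 * (4 * p) = 8 * p)).trans h8
  rcases eq_or_ne m 0 with rfl | hm0
  · have := norm_primeSum_sub_le h2Q hQ χ hv hv'
    simpa [rootSum_one, rootPole, poleOrder] using this
  · obtain ⟨K, _, _, ⟨D⟩⟩ := exists_radicalGen hp m ((Dvd.intro_left 8 rfl).trans h8) h2Q hQ hm
    have h4 : 4 * (-1 : ℤ).natAbs ∣ Q := by
      simpa using (Dvd.intro _ (by ring : 4 * (2 * p) = 8 * p)).trans h8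
    have := (splittingChars_jacobiChar hp hQ0 h8 hm0 h4).norm_rootSum_sub_le D h2Q χ hv hv'
    rw [rootPole]
    simp only [ne_eq, hm0, not_false_eq_true, true_and]
    exact_mod_cast this

end RootSumContinuity

section Sieve

open ArithmeticFunction
open scoped ArithmeticFunction.Moebius

theorem sum_moebius_filter_dvd {e : ℕ} (he : Squarefree e) (f : ℕ) :
    ∑ d ∈ e.divisors.filter (f ∣ ·), μ d = if f = e then μ e else 0 := by
  have he0 := he.ne_zero
  by_cases hf : f ∣ e
  · obtain ⟨k, rfl⟩ := hf
    have hf0 : f ≠ 0 := left_ne_zero_of_mul he0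
    have hk0 : k ≠ 0 := right_ne_zero_of_mul he0
    have h1 : ∑ d ∈ (f * k).divisors.filter (f ∣ ·), μ d = ∑ d ∈ k.divisors, μ (f * d) := by
      symm
      refine Finset.sum_bij (fun d _ => f * d) (fun d hd => ?_) (fun a _ b _ h => ?_)
        (fun d hd => ?_) (fun _ _ => rfl)
      · rw [Finset.mem_filter, Nat.mem_divisors]
        exact ⟨⟨mul_dvd_mul_left f (Nat.dvd_of_mem_divisors hd), he0⟩, Dvd.intro _ rfl⟩
      · exact Nat.eq_of_mul_eq_mul_left (Nat.pos_of_ne_zero hf0) h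
      · rw [Finset.mem_filter, Nat.mem_divisors] at hd
        obtain ⟨c, rfl⟩ := hd.2
        exact ⟨c, Nat.mem_divisors.2 ⟨Nat.dvd_of_mul_dvd_mul_left (Nat.pos_of_ne_zero hf0) hd.1.1,
          hk0⟩, rfl⟩
    have hc : f.Coprime k := Nat.coprime_of_squarefree_mul he
    have h2 : ∑ d ∈ k.divisors, μ (f * d) = μ f * ∑ d ∈ k.divisors, μ d := by
      rw [Finset.mul_sum]
      refine Finset.sum_congr rfl fun d hd => ?_
      exact isMultiplicative_moebius.map_mul_of_coprime
        (hc.coprime_dvd_right (Nat.dvd_of_mem_divisors hd))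
    rw [h1, h2, ← coe_mul_zeta_apply, moebius_mul_coe_zeta, one_apply]
    by_cases hk : k = 1
    · simp [hk]
    · rw [if_neg hk, if_neg, mul_zero]
      intro h
      exact hk (Nat.eq_of_mul_eq_mul_left (Nat.pos_of_ne_zero hf0) (by rw [← h, mul_one]))
  · rw [if_neg (fun h : f = e => hf (h ▸ dvd_rfl)), Finset.filter_false_of_mem, Finset.sum_empty]
    exact fun d hd h => hf (h.trans (Nat.dvd_of_mem_divisors hd))

theorem sum_moebius_mul_gcd {e e' : ℕ} (he : Squarefree e) (he' : Squarefree e') :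
    ∑ d ∈ e.divisors, ∑ d' ∈ e'.divisors, μ d * μ d' * (d.gcd d' : ℤ) =
      if e = e' then (Nat.totient e : ℤ) else 0 := by
  have h0 : ∀ d ∈ e.divisors, ∀ d' ∈ e'.divisors, (d.gcd d' : ℤ) =
      ∑ f ∈ e.divisors, if f ∣ d ∧ f ∣ d' then (Nat.totient f : ℤ) else 0 := fun d hd d' hd' => by
    rw [← Finset.sum_filter]
    have : e.divisors.filter (fun f => f ∣ d ∧ f ∣ d') = (d.gcd d').divisors := by
      ext f
      rw [Finset.mem_filter, Nat.mem_divisors, Nat.mem_divisors, Nat.dvd_gcd_iff]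
      have h1 := Nat.dvd_of_mem_divisors hd
      have h2 := Nat.pos_of_mem_divisors hd
      exact ⟨fun h => ⟨h.2, (Nat.gcd_pos_of_pos_left _ h2).ne'⟩,
        fun h => ⟨⟨h.1.1.trans h1, he.ne_zero⟩, h.1⟩⟩
    rw [this]
    exact_mod_cast (Nat.sum_totient (d.gcd d')).symm
  have h1 : ∑ d ∈ e.divisors, ∑ d' ∈ e'.divisors, μ d * μ d' * (d.gcd d' : ℤ) =
      ∑ f ∈ e.divisors, (Nat.totient f : ℤ) * ((∑ d ∈ e.divisors.filter (f ∣ ·), μ d) *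
        ∑ d' ∈ e'.divisors.filter (f ∣ ·), μ d') := by
    rw [Finset.sum_congr rfl fun d hd => Finset.sum_congr rfl fun d' hd' => by
      rw [h0 d hd d' hd', Finset.mul_sum]]
    rw [Finset.sum_congr rfl fun d _ => Finset.sum_comm, Finset.sum_comm]
    refine Finset.sum_congr rfl fun f _ => ?_
    rw [Finset.sum_filter (s := e.divisors), Finset.sum_filter (s := e'.divisors),
      Finset.sum_mul_sum, Finset.mul_sum]
    refine Finset.sum_congr rfl fun d _ => ?_
    rw [Finset.mul_sum]
    refine Finset.sum_congr rfl fun d' _ => ?_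
    by_cases h : f ∣ d <;> by_cases h' : f ∣ d' <;> simp [h, h']
    ring
  rw [h1]
  simp only [sum_moebius_filter_dvd he, sum_moebius_filter_dvd he']
  rw [Finset.sum_eq_single_of_mem e (Nat.mem_divisors_self e he.ne_zero)]
  · rw [if_pos rfl]
    split_ifs with h
    · subst h
      have := moebius_sq_eq_one_of_squarefree he
      rw [← pow_two, this, mul_one]
    · simp
  · intro f _ hf
    rw [if_neg hf, zero_mul, mul_zero]

theorem card_filter_dvd_linear {w D : ℕ} (hD : D ≠ 0) (hw : w.Coprime D) (T : ℕ) :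
    |(((Finset.Ioc T (2 * T)).filter fun t => D ∣ w * t + 1).card : ℝ) - T / D| ≤ 1 := by
  have := NeZero.mk hD
  obtain ⟨u, hu⟩ := (ZMod.isUnit_iff_coprime w D).2 hw
  set v : ℕ := (-(u⁻¹ : (ZMod D)ˣ) : ZMod D).val with hv
  have hvu : (v : ZMod D) = -(u⁻¹ : (ZMod D)ˣ) := by rw [hv, ZMod.natCast_zmod_val]
  have e : (Finset.Ioc T (2 * T)).filter (fun t => D ∣ w * t + 1) =
      (Finset.Ioc T (2 * T)).filter (fun t => t ≡ v [MOD D]) := by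
    refine Finset.filter_congr fun t _ => ?_
    rw [← ZMod.natCast_eq_natCast_iff, ← ZMod.natCast_eq_zero_iff, hvu]
    push_cast
    rw [← hu]
    constructor
    · intro h
      calc (t : ZMod D) = (u⁻¹ : (ZMod D)ˣ) * (u * t) := by rw [Units.inv_mul_cancel_left]
        _ = _ := by rw [eq_neg_of_add_eq_zero_left h, mul_neg, mul_one]
    · intro h
      rw [h, mul_neg, Units.mul_inv, neg_add_cancel]
  have hDp : (0 : ℤ) < D := by exact_mod_cast Nat.pos_of_ne_zero hD
  have hc := Nat.Ioc_filter_modEq_card T (2 * T) (Nat.pos_of_ne_zero hD) v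
  rw [e]
  set N := ((Finset.Ioc T (2 * T)).filter fun t => t ≡ v [MOD D]).card
  have hDq : (0 : ℚ) < D := by exact_mod_cast Nat.pos_of_ne_zero hD
  set a : ℚ := (((2 * T : ℕ) : ℚ) - v) / D with ha
  set b : ℚ := ((T : ℚ) - v) / D with hb
  have hab : a - b = T / D := by
    rw [ha, hb]
    push_cast
    ring
  have hle : ⌊b⌋ ≤ ⌊a⌋ := Int.floor_le_floor (by
    have : (0 : ℚ) ≤ T / D := by positivity
    linarith)
  rw [max_eq_left (by linarith)] at hc
  have hN : (N : ℚ) = ⌊a⌋ - ⌊b⌋ := by exact_mod_cast hc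
  have key : |(N : ℚ) - T / D| ≤ 1 := by
    rw [hN, ← hab, abs_le]
    have h1 := Int.floor_le a
    have h2 := Int.lt_floor_add_one a
    have h3 := Int.floor_le b
    have h4 := Int.lt_floor_add_one b
    constructor <;> linarith
  have := (Rat.cast_le (K := ℝ)).2 key
  push_cast at this
  exact this

end Sieve

section Sieve

open ArithmeticFunction
open scoped ArithmeticFunction.Moebius

variable {w z : ℕ} {E : Finset ℕ}

theorem sieve_quadratic_form (hE : ∀ e ∈ E, Squarefree e ∧ w.Coprime e ∧ e ≤ z) (T : ℕ) :
    ∑ t ∈ Finset.Ioc T (2 * T), (∑ e ∈ E, (1 / e : ℝ) *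
      ∑ d ∈ e.divisors, if d ∣ w * t + 1 then (μ d : ℝ) * d else 0) ^ 2 ≤
      T * ∑ e ∈ E, (1 / e : ℝ) + (z : ℝ) ^ 4 := by
  have hE1 : ∀ e ∈ E, 0 < e := fun e he => Nat.pos_of_ne_zero (hE e he).1.ne_zero
  set N : ℕ → ℕ → ℝ := fun d d' =>
    ((Finset.Ioc T (2 * T)).filter fun t => d.lcm d' ∣ w * t + 1).card with hN
  have expand : ∑ t ∈ Finset.Ioc T (2 * T), (∑ e ∈ E, (1 / e : ℝ) *
      ∑ d ∈ e.divisors, if d ∣ w * t + 1 then (μ d : ℝ) * d else 0) ^ 2 =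
      ∑ e ∈ E, ∑ e' ∈ E, (1 / e : ℝ) * (1 / e') *
        ∑ d ∈ e.divisors, ∑ d' ∈ e'.divisors, (μ d : ℝ) * d * (μ d' * d') * N d d' := by
    have h1 : ∀ t, (∑ e ∈ E, (1 / e : ℝ) *
      ∑ d ∈ e.divisors, if d ∣ w * t + 1 then (μ d : ℝ) * d else 0) ^ 2 =
      ∑ e ∈ E, ∑ e' ∈ E, (1 / e : ℝ) * (1 / e') * ∑ d ∈ e.divisors, ∑ d' ∈ e'.divisors,
        (μ d : ℝ) * d * (μ d' * d') * if d.lcm d' ∣ w * t + 1 then 1 else 0 := fun t => by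
      rw [pow_two, Finset.sum_mul_sum]
      refine Finset.sum_congr rfl fun e _ => Finset.sum_congr rfl fun e' _ => ?_
      rw [mul_mul_mul_comm, Finset.sum_mul_sum]
      congr 1
      refine Finset.sum_congr rfl fun d _ => Finset.sum_congr rfl fun d' _ => ?_
      by_cases h : d ∣ w * t + 1 <;> by_cases h' : d' ∣ w * t + 1 <;> simp [Nat.lcm_dvd_iff, h, h']
    rw [Finset.sum_congr rfl fun t _ => h1 t, Finset.sum_comm]
    refine Finset.sum_congr rfl fun e _ => ?_
    rw [Finset.sum_comm]
    refine Finset.sum_congr rfl fun e' _ => ?_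
    rw [← Finset.mul_sum, Finset.sum_comm]
    congr 1
    refine Finset.sum_congr rfl fun d _ => ?_
    rw [Finset.sum_comm]
    refine Finset.sum_congr rfl fun d' _ => ?_
    rw [← Finset.mul_sum, Finset.sum_boole]
  have hterm : ∀ e ∈ E, ∀ e' ∈ E, ∑ d ∈ e.divisors, ∑ d' ∈ e'.divisors,
      (μ d : ℝ) * d * (μ d' * d') * N d d' ≤
      T * (if e = e' then (e : ℝ) else 0) + (e : ℝ) ^ 2 * (e' : ℝ) ^ 2 := by
    intro e he e' he'
    have hle : ∀ d ∈ e.divisors, ∀ d' ∈ e'.divisors, (μ d : ℝ) * d * (μ d' * d') * N d d' ≤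
        T * ((μ d : ℝ) * μ d' * (d.gcd d' : ℕ)) + (e : ℝ) * e' := by
      intro d hd d' hd'
      have hd1 := Nat.pos_of_mem_divisors hd
      have hd1' := Nat.pos_of_mem_divisors hd'
      have hde : (d : ℝ) ≤ e := by exact_mod_cast Nat.divisor_le hd
      have hde' : (d' : ℝ) ≤ e' := by exact_mod_cast Nat.divisor_le hd'
      have hco : w.Coprime (d.lcm d') :=
        Nat.Coprime.coprime_dvd_right (Nat.lcm_dvd_mul d d')
          (((hE e he).2.1.coprime_dvd_right (Nat.dvd_of_mem_divisors hd)).mul_right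
          ((hE e' he').2.1.coprime_dvd_right (Nat.dvd_of_mem_divisors hd')))
      have hl0 : d.lcm d' ≠ 0 := Nat.lcm_ne_zero hd1.ne' hd1'.ne'
      have hc : |N d d' - T / (d.lcm d' : ℕ)| ≤ 1 := card_filter_dvd_linear hl0 hco T
      have hg : (d : ℝ) * d' / (d.lcm d' : ℕ) = (d.gcd d' : ℕ) := by
        rw [div_eq_iff (by exact_mod_cast hl0)]
        exact_mod_cast (Nat.gcd_mul_lcm d d').symm
      have hμ : |(μ d : ℝ) * d * (μ d' * d')| ≤ (e : ℝ) * e' := by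
        have h1 : |(μ d : ℝ)| ≤ 1 := by exact_mod_cast abs_moebius_le_one
        have h2 : |(μ d' : ℝ)| ≤ 1 := by exact_mod_cast abs_moebius_le_one
        rw [abs_mul, abs_mul, abs_mul, Nat.abs_cast, Nat.abs_cast]
        refine mul_le_mul ?_ ?_ (by positivity) (by positivity)
        · exact (mul_le_of_le_one_left (Nat.cast_nonneg d) h1).trans hde
        · exact (mul_le_of_le_one_left (Nat.cast_nonneg d') h2).trans hde'
      have e1 : (μ d : ℝ) * d * (μ d' * d') * N d d' = T * ((μ d : ℝ) * μ d' * (d.gcd d' : ℕ)) +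
          (μ d : ℝ) * d * (μ d' * d') * (N d d' - T / (d.lcm d' : ℕ)) := by
        rw [← hg]
        ring
      rw [e1]
      have := (le_abs_self ((μ d : ℝ) * d * (μ d' * d') * (N d d' - T / (d.lcm d' : ℕ)))).trans
        ((abs_mul _ _).le.trans (mul_le_mul hμ hc (abs_nonneg _) (by positivity)))
      linarith
    refine (Finset.sum_le_sum fun d hd => Finset.sum_le_sum fun d' hd' => hle d hd d' hd').trans ?_
    have hphi : ∑ d ∈ e.divisors, ∑ d' ∈ e'.divisors, (T : ℝ) * ((μ d : ℝ) * μ d' * (d.gcd d' : ℕ)) =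
        T * (if e = e' then (Nat.totient e : ℝ) else 0) := by
      simp_rw [← Finset.mul_sum]
      congr 1
      have := sum_moebius_mul_gcd (hE e he).1 (hE e' he').1
      exact_mod_cast congrArg (Int.cast (R := ℝ)) this
    simp only [Finset.sum_add_distrib, hphi, Finset.sum_const, nsmul_eq_mul]
    refine add_le_add (mul_le_mul_of_nonneg_left ?_ (Nat.cast_nonneg T)) ?_
    · split_ifs
      · exact_mod_cast Nat.totient_le e
      · exact le_rfl
    · have h1 : (e.divisors.card : ℝ) ≤ e := by exact_mod_cast Nat.card_divisors_le_self e
      have h2 : (e'.divisors.card : ℝ) ≤ e' := by exact_mod_cast Nat.card_divisors_le_self e'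
      calc (e.divisors.card : ℝ) * (e'.divisors.card * ((e : ℝ) * e')) ≤ e * (e' * ((e : ℝ) * e')) := by
            gcongr
        _ = _ := by ring
  rw [expand]
  have hS : ∑ e ∈ E, (e : ℝ) ≤ (z : ℝ) ^ 2 := by
    have hsub : E ⊆ Finset.Icc 1 z := fun e he => Finset.mem_Icc.2 ⟨hE1 e he, (hE e he).2.2⟩
    calc ∑ e ∈ E, (e : ℝ) ≤ ∑ e ∈ E, (z : ℝ) :=
          Finset.sum_le_sum fun e he => by exact_mod_cast (hE e he).2.2
      _ = E.card * z := by rw [Finset.sum_const, nsmul_eq_mul]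
      _ ≤ z * z := by
          have := Finset.card_le_card hsub
          rw [Nat.card_Icc, Nat.add_sub_cancel] at this
          gcongr
      _ = _ := by ring
  have hS0 : 0 ≤ ∑ e ∈ E, (e : ℝ) := Finset.sum_nonneg fun e _ => Nat.cast_nonneg e
  calc _ ≤ ∑ e ∈ E, ∑ e' ∈ E, (1 / e : ℝ) * (1 / e') *
        (T * (if e = e' then (e : ℝ) else 0) + (e : ℝ) ^ 2 * (e' : ℝ) ^ 2) :=
        Finset.sum_le_sum fun e he => Finset.sum_le_sum fun e' he' =>
          mul_le_mul_of_nonneg_left (hterm e he e' he') (by positivity)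
    _ = ∑ e ∈ E, ∑ e' ∈ E, ((if e = e' then T * (1 / e : ℝ) else 0) + (e : ℝ) * e') := by
        refine Finset.sum_congr rfl fun e he => Finset.sum_congr rfl fun e' he' => ?_
        have h1 : (e : ℝ) ≠ 0 := by exact_mod_cast (hE1 e he).ne'
        have h2 : (e' : ℝ) ≠ 0 := by exact_mod_cast (hE1 e' he').ne'
        split_ifs with h
        · subst h
          field_simp
        · field_simp
          ring
    _ = T * ∑ e ∈ E, (1 / e : ℝ) + (∑ e ∈ E, (e : ℝ)) ^ 2 := by
        simp only [Finset.sum_add_distrib, Finset.sum_ite_eq]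
        rw [pow_two, Finset.sum_mul_sum, Finset.mul_sum]
        congr 1
        exact Finset.sum_congr rfl fun e he => if_pos he
    _ ≤ _ := by
        have := pow_le_pow_left₀ hS0 hS 2
        rw [← pow_mul] at this
        norm_num at this ⊢
        linarith

theorem card_prime_linear_le (hE : ∀ e ∈ E, Squarefree e ∧ w.Coprime e ∧ e ≤ z) (h1 : 1 ∈ E)
    (hw : w ≠ 0) {T : ℕ} (hzT : z ≤ T) :
    (((Finset.Ioc T (2 * T)).filter fun t => (w * t + 1).Prime).card : ℝ) ≤
      T / (∑ e ∈ E, (1 / e : ℝ)) + (z : ℝ) ^ 4 := by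
  set S := ∑ e ∈ E, (1 / e : ℝ) with hS
  have hS1 : 1 ≤ S := by
    have := Finset.single_le_sum (f := fun e : ℕ => (1 / e : ℝ)) (fun e _ => by positivity) h1
    rw [hS]
    refine le_trans ?_ this
    simp
  have hval : ∀ t ∈ (Finset.Ioc T (2 * T)).filter (fun t => (w * t + 1).Prime),
      S ^ 2 = (∑ e ∈ E, (1 / e : ℝ) *
        ∑ d ∈ e.divisors, if d ∣ w * t + 1 then (μ d : ℝ) * d else 0) ^ 2 := by
    intro t ht
    rw [Finset.mem_filter, Finset.mem_Ioc] at ht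
    congr 1
    refine Finset.sum_congr rfl fun e he => ?_
    have : ∑ d ∈ e.divisors, (if d ∣ w * t + 1 then (μ d : ℝ) * d else 0) = 1 := by
      rw [Finset.sum_eq_single_of_mem 1 (Nat.one_mem_divisors.2 (hE e he).1.ne_zero)]
      · simp
      · intro d hd hd1
        rw [if_neg]
        intro hdvd
        have h2 := (Nat.dvd_prime ht.2).1 hdvd
        have h3 := Nat.divisor_le hd
        have h4 := (hE e he).2.2
        have h5 : t ≤ w * t := Nat.le_mul_of_pos_left t (Nat.pos_of_ne_zero hw)
        omega
    rw [this, mul_one]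
  have hq := sieve_quadratic_form hE T
  have hle : (((Finset.Ioc T (2 * T)).filter fun t => (w * t + 1).Prime).card : ℝ) * S ^ 2 ≤
      T * S + (z : ℝ) ^ 4 := by
    refine le_trans ?_ hq
    rw [← nsmul_eq_mul, ← Finset.sum_const, Finset.sum_congr rfl hval]
    exact Finset.sum_le_sum_of_subset_of_nonneg (Finset.filter_subset _ _)
      fun _ _ _ => sq_nonneg _
  have hS0 : 0 < S := by linarith
  have h2 : (((Finset.Ioc T (2 * T)).filter fun t => (w * t + 1).Prime).card : ℝ) ≤
      (T * S + (z : ℝ) ^ 4) / S ^ 2 := by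
    rwa [le_div_iff₀ (by positivity)]
  refine h2.trans ?_
  rw [add_div]
  refine add_le_add (le_of_eq ?_) (div_le_self (by positivity) (one_le_pow₀ hS1))
  field_simp

end Sieve

section BrunTitchmarsh

theorem sum_Icc_inv_sq_le_two (z : ℕ) : ∑ f ∈ Finset.Icc 1 z, (1 / (f : ℝ) ^ 2) ≤ 2 := by
  rcases Nat.eq_zero_or_pos z with rfl | hz
  · simp
  have h : Finset.Icc 1 z = insert 1 (Finset.Ioc 1 z) := by
    ext a
    simp only [Finset.mem_Icc, Finset.mem_insert, Finset.mem_Ioc]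
    omega
  rw [h, Finset.sum_insert (by simp)]
  have := sum_Ioc_inv_sq_le_sub (α := ℝ) one_ne_zero hz
  simp only [one_div]
  have h0 : (0 : ℝ) ≤ (z : ℝ)⁻¹ := by positivity
  norm_num at this ⊢
  linarith

theorem log_le_mul_sum_squarefree {j l : ℕ} (hl : l.Prime) (z : ℕ) :
    Real.log (z + 1) ≤ 8 * ∑ e ∈ (Finset.Icc 1 z).filter
      (fun e => Squarefree e ∧ (2 ^ j * l).Coprime e), (1 / e : ℝ) := by
  set E := (Finset.Icc 1 z).filter (fun e => Squarefree e ∧ (2 ^ j * l).Coprime e) with hE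
  set D : Finset ℕ := {1, 2, l, 2 * l} with hD
  set P := (Finset.Icc 1 z ×ˢ D) ×ˢ E with hP
  have hl0 := hl.pos
  have hsub : Finset.Icc 1 z ⊆ P.image fun a => a.1.1 ^ 2 * a.1.2 * a.2 := by
    intro n hn
    rw [Finset.mem_Icc] at hn
    obtain ⟨b, a, hb, ha, hab, hsq⟩ := Nat.sq_mul_squarefree_of_pos (show 0 < n by omega)
    obtain ⟨c, hc⟩ := Nat.gcd_dvd_left b (2 * l)
    have hc0 : 0 < c := Nat.pos_of_ne_zero (by rintro rfl; omega)
    have hg : (b.gcd (2 * l)).Coprime c := Nat.coprime_of_squarefree_mul (hc ▸ hsq)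
    have hcop : ∀ s : ℕ, s.Prime → s ∣ 2 * l → s.Coprime c := by
      intro s hs hsl
      rw [hs.coprime_iff_not_dvd]
      intro hsc
      have : s ∣ b.gcd (2 * l) := Nat.dvd_gcd (hsc.trans (Dvd.intro_left _ hc.symm)) hsl
      exact hs.not_dvd_one (hg ▸ Nat.dvd_gcd this hsc)
    have hcn : c ∣ n := (Dvd.intro_left _ hc.symm : c ∣ b).trans (Dvd.intro_left _ hab)
    have han : a ∣ n := (dvd_pow_self a two_ne_zero).trans (Dvd.intro _ hab)
    rw [Finset.mem_image]
    refine ⟨((a, b.gcd (2 * l)), c), ?_, ?_⟩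
    · rw [hP, Finset.mem_product, Finset.mem_product, Finset.mem_Icc, hE, Finset.mem_filter,
        Finset.mem_Icc]
      refine ⟨⟨⟨ha, (Nat.le_of_dvd (by omega) han).trans hn.2⟩, ?_⟩,
        ⟨hc0, (Nat.le_of_dvd (by omega) hcn).trans hn.2⟩,
        hsq.squarefree_of_dvd (Dvd.intro_left _ hc.symm),
        ((hcop 2 Nat.prime_two (Dvd.intro _ rfl)).pow_left j).mul_left
          (hcop l hl (Dvd.intro_left _ rfl))⟩
      obtain ⟨u, v, hu, hv, huv⟩ := (Nat.dvd_mul).1 (Nat.gcd_dvd_right b (2 * l))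
      show b.gcd (2 * l) ∈ D
      rw [← huv, hD]
      rcases (Nat.dvd_prime Nat.prime_two).1 hu with rfl | rfl <;>
        rcases (Nat.dvd_prime hl).1 hv with rfl | rfl <;> simp
    · show a ^ 2 * b.gcd (2 * l) * c = n
      rw [mul_assoc, ← hc, hab]
  have h1 : ∑ n ∈ Finset.Icc 1 z, (1 / n : ℝ) ≤
      ∑ a ∈ P, (1 / ((a.1.1 ^ 2 * a.1.2 * a.2 : ℕ) : ℝ)) :=
    (Finset.sum_le_sum_of_subset_of_nonneg hsub fun _ _ _ => by positivity).trans
      (Finset.sum_image_le_of_nonneg fun _ _ => by positivity)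
  have h2 : ∑ a ∈ P, (1 / ((a.1.1 ^ 2 * a.1.2 * a.2 : ℕ) : ℝ)) =
      (∑ f ∈ Finset.Icc 1 z, (1 / (f : ℝ) ^ 2)) * (∑ d ∈ D, (1 / d : ℝ)) *
        ∑ e ∈ E, (1 / e : ℝ) := by
    rw [hP, Finset.sum_mul_sum, ← Finset.sum_product', Finset.sum_mul_sum, ← Finset.sum_product']
    refine Finset.sum_congr rfl fun a _ => ?_
    push_cast
    field_simp
  have h3 : ∑ d ∈ D, (1 / d : ℝ) ≤ 4 := by
    calc ∑ d ∈ D, (1 / d : ℝ) ≤ ∑ d ∈ D, 1 := by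
          refine Finset.sum_le_sum fun d hd => ?_
          have : 1 ≤ d := by
            simp only [hD, Finset.mem_insert, Finset.mem_singleton] at hd
            omega
          rw [div_le_one (by positivity)]
          exact_mod_cast this
      _ ≤ 4 := by
          rw [Finset.sum_const, nsmul_eq_mul, mul_one]
          exact_mod_cast Finset.card_le_four
  have h4 : Real.log (z + 1) ≤ ∑ n ∈ Finset.Icc 1 z, (1 / n : ℝ) := by
    have := log_add_one_le_harmonic z
    rw [harmonic_eq_sum_Icc] at this
    push_cast at this
    simpa [one_div] using this
  refine h4.trans (h1.trans (h2.le.trans ?_))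
  have h5 : (∑ f ∈ Finset.Icc 1 z, (1 / (f : ℝ) ^ 2)) * (∑ d ∈ D, (1 / d : ℝ)) ≤ 2 * 4 :=
    mul_le_mul (sum_Icc_inv_sq_le_two z) h3 (Finset.sum_nonneg fun _ _ => by positivity)
      (by norm_num)
  have h6 : 0 ≤ ∑ e ∈ E, (1 / e : ℝ) := Finset.sum_nonneg fun _ _ => by positivity
  nlinarith

theorem card_prime_dyadic_le {j l : ℕ} (hl : l.Prime) (i : ℕ) :
    (((Finset.Ioc (2 ^ i) (2 * 2 ^ i)).filter fun t => (2 ^ j * l * t + 1).Prime).card : ℝ) ≤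
      2 ^ 9 * 2 ^ i / (i + 1) := by
  set k := i / 8 with hk
  set z : ℕ := 2 ^ k with hz
  set E := (Finset.Icc 1 z).filter (fun e => Squarefree e ∧ (2 ^ j * l).Coprime e) with hE
  have hz1 : 1 ≤ z := Nat.one_le_two_pow
  have h1E : 1 ∈ E := by
    rw [hE, Finset.mem_filter, Finset.mem_Icc]
    exact ⟨⟨le_rfl, hz1⟩, squarefree_one, Nat.coprime_one_right _⟩
  have hki : k ≤ i := Nat.div_le_self _ _
  have h := card_prime_linear_le (w := 2 ^ j * l) (z := z) (E := E)
    (fun e he => by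
      rw [hE, Finset.mem_filter, Finset.mem_Icc] at he
      exact ⟨he.2.1, he.2.2, he.1.2⟩) h1E (by have := hl.pos; positivity) (T := 2 ^ i)
    (Nat.pow_le_pow_right (by norm_num) hki)
  have hlog := log_le_mul_sum_squarefree (j := j) hl z
  set S := ∑ e ∈ E, (1 / e : ℝ) with hS
  have hik : (i : ℝ) + 1 ≤ 8 * (k + 1) := by
    have : i + 1 ≤ 8 * (k + 1) := by omega
    exact_mod_cast this
  have hk1 : ((k : ℝ) + 1) / 2 * (1 / 2) ≤ Real.log (z + 1) := by
    have hl2 : (1 : ℝ) / 2 ≤ Real.log 2 := by linarith [Real.log_two_gt_d9]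
    rcases Nat.eq_zero_or_pos k with h0 | h0
    · rw [hz, h0]
      norm_num
      linarith
    · have h2 : Real.log z ≤ Real.log (z + 1) :=
        Real.log_le_log (by exact_mod_cast hz1) (by linarith)
      rw [hz] at h2 ⊢
      push_cast at h2 ⊢
      rw [Real.log_pow] at h2
      have : (1 : ℝ) ≤ k := by exact_mod_cast h0
      nlinarith
  have hSi : ((i : ℝ) + 1) ≤ 256 * S := by linarith
  have hi0 : (0 : ℝ) < i + 1 := by positivity
  have hS0 : 0 < S := by linarith
  have h1 : ((2 ^ i : ℕ) : ℝ) / S ≤ 256 * 2 ^ i / (i + 1) := by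
    rw [div_le_div_iff₀ hS0 hi0]
    push_cast
    have : (0 : ℝ) < 2 ^ i := by positivity
    nlinarith
  have h2 : (z : ℝ) ^ 4 ≤ 8 * 2 ^ i / (i + 1) := by
    rw [le_div_iff₀ hi0, hz]
    push_cast
    have h3 : ((k : ℝ) + 1) ≤ 2 ^ k := by exact_mod_cast Nat.lt_two_pow_self (n := k)
    have h4 : ((2 : ℝ) ^ k) ^ 4 * 2 ^ k ≤ 2 ^ i := by
      rw [← pow_mul, ← pow_add]
      exact pow_le_pow_right₀ (by norm_num) (by omega)
    have h5 : (0 : ℝ) ≤ ((2 : ℝ) ^ k) ^ 4 := by positivity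
    calc ((2 : ℝ) ^ k) ^ 4 * (i + 1) ≤ ((2 : ℝ) ^ k) ^ 4 * (8 * 2 ^ k) := by gcongr; linarith
      _ ≤ _ := by linarith
  have h6 : (0 : ℝ) ≤ 2 ^ i / (i + 1) := by positivity
  calc _ ≤ _ := h
    _ ≤ 256 * 2 ^ i / (i + 1) + 8 * 2 ^ i / (i + 1) := add_le_add h1 h2
    _ = 264 * (2 ^ i / (i + 1)) := by ring
    _ ≤ 512 * (2 ^ i / (i + 1)) := by gcongr; norm_num
    _ = _ := by ring

theorem sum_inv_prime_le_aux {j l : ℕ} (hl : l.Prime) (L : ℕ) :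
    ∑ t ∈ (Finset.Ioc 1 (2 ^ L)).filter (fun t => (2 ^ j * l * t + 1).Prime),
      (1 / (t : ℝ)) ≤ 2 ^ 9 * (1 + Real.log (L + 1)) := by
  have h1 : ∑ t ∈ (Finset.Ioc 1 (2 ^ L)).filter (fun t => (2 ^ j * l * t + 1).Prime),
      (1 / (t : ℝ)) ≤ 2 ^ 9 * ∑ i ∈ Finset.range L, (1 / ((i : ℝ) + 1)) := by
    induction L with
    | zero => simp
    | succ L ih =>
      have hu : Finset.Ioc 1 (2 ^ (L + 1)) = Finset.Ioc 1 (2 ^ L) ∪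
          Finset.Ioc (2 ^ L) (2 * 2 ^ L) := by
        rw [pow_succ', Finset.Ioc_union_Ioc_eq_Ioc Nat.one_le_two_pow (by omega)]
      rw [hu, Finset.filter_union, Finset.sum_range_succ, mul_add]
      rw [Finset.sum_union (Finset.disjoint_filter_filter (Finset.Ioc_disjoint_Ioc_of_le le_rfl))]
      refine add_le_add ih ?_
      · have hc := card_prime_dyadic_le (j := j) hl L
        calc _ ≤ ∑ t ∈ (Finset.Ioc (2 ^ L) (2 * 2 ^ L)).filter
              (fun t => (2 ^ j * l * t + 1).Prime), (1 / (2 : ℝ) ^ L) := by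
              refine Finset.sum_le_sum fun t ht => ?_
              rw [Finset.mem_filter, Finset.mem_Ioc] at ht
              have : (2 : ℝ) ^ L ≤ t := by exact_mod_cast ht.1.1.le
              gcongr
          _ = _ * (1 / (2 : ℝ) ^ L) := by rw [Finset.sum_const, nsmul_eq_mul]
          _ ≤ (2 ^ 9 * 2 ^ L / (L + 1)) * (1 / (2 : ℝ) ^ L) := by gcongr
          _ = _ := by field_simp
  refine h1.trans (mul_le_mul_of_nonneg_left ?_ (by norm_num))
  rcases Nat.eq_zero_or_pos L with rfl | hL
  · simp
  have := harmonic_le_one_add_log L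
  rw [harmonic] at this
  push_cast at this
  have h2 : Real.log L ≤ Real.log (L + 1) :=
    Real.log_le_log (by exact_mod_cast hL) (by linarith)
  simp only [one_div]
  linarith

theorem sum_inv_prime_le {j l : ℕ} (hl : l.Prime) {x : ℝ} {X : ℝ} (hX : 1 ≤ X)
    (hx : x ≤ Real.exp X) :
    ∑ r ∈ (Finset.range (⌊x⌋₊ + 1)).filter (fun r => r.Prime ∧ 2 ^ j * l ∣ r - 1),
      (1 / (r : ℝ)) ≤ 2 ^ 13 * (1 + Real.log X) / (2 ^ j * l) := by
  set w := 2 ^ j * l with hw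
  have hw0 : 0 < w := by have := hl.pos; positivity
  set L := ⌊2 * X⌋₊ with hL
  have hxL : ⌊x⌋₊ ≤ 2 ^ (L + 1) := by
    have h1 : X ≤ ((L + 1 : ℕ) : ℝ) * Real.log 2 := by
      have h2 := Nat.lt_floor_add_one (2 * X)
      have h3 : (1 : ℝ) / 2 ≤ Real.log 2 := by linarith [Real.log_two_gt_d9]
      rw [← hL] at h2
      push_cast
      nlinarith
    have h2 : x ≤ ((2 ^ (L + 1) : ℕ) : ℝ) := by
      refine hx.trans ((Real.exp_le_exp.2 h1).trans ?_)
      rw [← Real.log_pow, Real.exp_log (by positivity)]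
      push_cast
      exact le_rfl
    exact Nat.floor_le_of_le h2
  set A := (Finset.Ioc 0 (2 ^ (L + 1))).filter (fun t => (w * t + 1).Prime) with hA
  have hsub : (Finset.range (⌊x⌋₊ + 1)).filter (fun r => r.Prime ∧ w ∣ r - 1) ⊆
      A.image fun t => w * t + 1 := by
    intro r hr
    rw [Finset.mem_filter, Finset.mem_range] at hr
    obtain ⟨t, ht⟩ := hr.2.2
    have h2 := hr.2.1.two_le
    rw [Finset.mem_image]
    refine ⟨t, ?_, by omega⟩
    rw [hA, Finset.mem_filter, Finset.mem_Ioc]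
    have h3 : t ≤ w * t := Nat.le_mul_of_pos_left t hw0
    refine ⟨⟨Nat.pos_of_ne_zero ?_, by omega⟩, by rw [← ht]; convert hr.2.1 using 1; omega⟩
    rintro rfl
    omega
  have h1 : ∑ r ∈ (Finset.range (⌊x⌋₊ + 1)).filter (fun r => r.Prime ∧ w ∣ r - 1),
      (1 / (r : ℝ)) ≤ ∑ t ∈ A, (1 / ((w * t + 1 : ℕ) : ℝ)) :=
    (Finset.sum_le_sum_of_subset_of_nonneg hsub fun _ _ _ => by positivity).trans
      (Finset.sum_image_le_of_nonneg fun _ _ => by positivity)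
  have h2 : ∑ t ∈ A, (1 / ((w * t + 1 : ℕ) : ℝ)) ≤ (1 / w : ℝ) * ∑ t ∈ A, (1 / (t : ℝ)) := by
    rw [Finset.mul_sum]
    refine Finset.sum_le_sum fun t ht => ?_
    rw [hA, Finset.mem_filter, Finset.mem_Ioc] at ht
    have h0 : (0 : ℝ) < t := by exact_mod_cast ht.1.1
    have h00 : (0 : ℝ) < w := by exact_mod_cast hw0
    rw [one_div_mul_one_div]
    push_cast
    gcongr
    linarith
  have h3 : ∑ t ∈ A, (1 / (t : ℝ)) ≤ 1 + 2 ^ 9 * (1 + Real.log ((L + 1 : ℕ) + 1)) := by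
    refine le_trans ?_ (add_le_add_right (sum_inv_prime_le_aux (j := j) hl (L + 1)) 1)
    have hsub' : A ⊆ insert 1 ((Finset.Ioc 1 (2 ^ (L + 1))).filter
        (fun t => (2 ^ j * l * t + 1).Prime)) := by
      intro t ht
      rw [hA, Finset.mem_filter, Finset.mem_Ioc] at ht
      rw [Finset.mem_insert, Finset.mem_filter, Finset.mem_Ioc]
      rcases eq_or_ne t 1 with h | h
      · exact Or.inl h
      · exact Or.inr ⟨⟨by omega, ht.1.2⟩, ht.2⟩
    refine (Finset.sum_le_sum_of_subset_of_nonneg hsub' fun _ _ _ => by positivity).trans ?_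
    rw [Finset.sum_insert (by simp)]
    simp
  have h4 : Real.log ((L + 1 : ℕ) + 1) ≤ 2 + Real.log X := by
    have h5 : (L : ℝ) ≤ 2 * X := Nat.floor_le (by linarith)
    have h6 : Real.log ((L + 1 : ℕ) + 1) ≤ Real.log (4 * X) := by
      refine Real.log_le_log (by positivity) ?_
      push_cast
      linarith
    have h7 : Real.log 4 ≤ 2 := by
      rw [show (4 : ℝ) = 2 ^ 2 by norm_num, Real.log_pow]
      have := Real.log_two_lt_d9
      push_cast
      linarith
    rw [Real.log_mul (by norm_num) (by linarith)] at h6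
    linarith
  have hX0 := Real.log_nonneg hX
  calc _ ≤ (1 / w : ℝ) * (1 + 2 ^ 9 * (1 + (2 + Real.log X))) :=
        h1.trans (h2.trans (mul_le_mul_of_nonneg_left (h3.trans (by linarith)) (by positivity)))
    _ ≤ (1 / w : ℝ) * (2 ^ 13 * (1 + Real.log X)) := by
        gcongr
        linarith
    _ = _ := by
        rw [hw]
        push_cast
        ring

end BrunTitchmarsh

section Orthogonality

variable {p q Q : ℕ} {g : ZMod q}

/-- The number of `2 ^ m`-th roots of `p` modulo the primes `r ≠ p` in the class `g` modulo `q`. -/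
noncomputable def classWeight (p : ℕ) {q : ℕ} (g : ZMod q) (m r : ℕ) : ℝ :=
  if r.Prime ∧ r ≠ p ∧ (r : ZMod q) = g then rootCount p (2 ^ m) r else 0

theorem classWeight_nonneg (p : ℕ) (g : ZMod q) (m r : ℕ) : 0 ≤ classWeight p g m r := by
  rw [classWeight]
  split_ifs <;> positivity

theorem classWeight_le (p : ℕ) (g : ZMod q) (m r : ℕ) : classWeight p g m r ≤ 2 ^ m := by
  rw [classWeight]
  split_ifs with h
  · exact_mod_cast rootCount_le (by positivity) h.1
  · positivity

theorem summable_classWeight (p : ℕ) (g : ZMod q) (m : ℕ) {v : ℝ} (hv : 0 < v) :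
    Summable fun r : ℕ => classWeight p g m r * (r : ℝ) ^ (-(1 + v)) := by
  refine ((Real.summable_nat_rpow.2 (by linarith : -(1 + v) < -1)).mul_left (2 ^ m)).of_nonneg_of_le
    (fun r => mul_nonneg (classWeight_nonneg p g m r) (by positivity)) fun r => ?_
  exact mul_le_mul_of_nonneg_right (classWeight_le p g m r) (by positivity)

theorem sum_char_mul_localTerm [NeZero q] (hqQ : q ∣ Q) (hpr : ∀ r : ℕ, r.Prime → r ∣ Q → r = p ∨ r ∣ q)
    (hpQ : p ∣ Q) (hg : IsUnit g) (v : ℝ) {r : ℕ} (hr : r.Prime) :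
    ∑ χ : DirichletCharacter ℂ q, χ g⁻¹ * localTerm (DirichletCharacter.changeLevel hqQ χ) v r =
      if r ≠ p ∧ (r : ZMod q) = g then
        (q.totient : ℂ) * (((r : ℝ) ^ (-(1 + v)) : ℝ) : ℂ) else 0 := by
  by_cases hrQ : r ∣ Q
  · rw [Finset.sum_eq_zero fun χ _ => by rw [localTerm_eq_zero _ _ hr hrQ, mul_zero], if_neg]
    rintro ⟨hrp, he⟩
    have hu : IsUnit (r : ZMod q) := he ▸ hg
    rw [ZMod.isUnit_iff_coprime, Nat.Prime.coprime_iff_not_dvd hr] at hu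
    exact (hpr r hr hrQ).elim hrp hu
  · have hrp : r ≠ p := by rintro rfl; exact hrQ hpQ
    have hu : IsUnit (r : ZMod Q) := by
      rwa [ZMod.isUnit_iff_coprime, Nat.Prime.coprime_iff_not_dvd hr]
    have h1 : ∀ χ : DirichletCharacter ℂ q,
        χ g⁻¹ * localTerm (DirichletCharacter.changeLevel hqQ χ) v r =
        χ g⁻¹ * χ r * (((r : ℝ) ^ (-(1 + v)) : ℝ) : ℂ) := by
      intro χ
      have h2 := DirichletCharacter.changeLevel_eq_cast_of_dvd χ hqQ hu.unit
      rw [IsUnit.unit_spec, ZMod.cast_natCast hqQ] at h2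
      rw [localTerm, h2, mul_assoc]
    rw [Finset.sum_congr rfl fun χ _ => h1 χ, ← Finset.sum_mul,
      DirichletCharacter.sum_char_inv_mul_char_eq ℂ hg]
    by_cases h : g = r
    · rw [if_pos h, if_pos ⟨hrp, h.symm⟩]
    · rw [if_neg h, if_neg fun h' => h h'.2.symm, zero_mul]

theorem sum_char_mul_rootSum [NeZero q] (hqQ : q ∣ Q)
    (hpr : ∀ r : ℕ, r.Prime → r ∣ Q → r = p ∨ r ∣ q) (hpQ : p ∣ Q) (hg : IsUnit g) (m : ℕ)
    {v : ℝ} (hv : 0 < v) :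
    ∑ χ : DirichletCharacter ℂ q,
        χ g⁻¹ * rootSum p (2 ^ m) (DirichletCharacter.changeLevel hqQ χ) v =
      q.totient * ((∑' r : ℕ, classWeight p g m r * (r : ℝ) ^ (-(1 + v)) : ℝ) : ℂ) := by
  have hs := fun χ : DirichletCharacter ℂ q =>
    (summable_rootTerm p (n := 2 ^ m) (by positivity)
      (DirichletCharacter.changeLevel hqQ χ) hv).mul_left (χ g⁻¹)
  simp only [rootSum]
  rw [Finset.sum_congr rfl fun χ _ => (tsum_mul_left).symm,
    ← Summable.tsum_finsetSum fun χ _ => hs χ, Complex.ofReal_tsum, ← tsum_mul_left]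
  refine tsum_congr fun r => ?_
  by_cases hr : r.Prime
  · have h1 := sum_char_mul_localTerm hqQ hpr hpQ hg v hr
    simp only [if_pos hr]
    rw [Finset.sum_congr rfl fun χ _ => mul_left_comm _ _ _, ← Finset.mul_sum, h1, classWeight]
    by_cases h : r ≠ p ∧ (r : ZMod q) = g
    · rw [if_pos h, if_pos ⟨hr, h⟩]
      push_cast
      ring
    · rw [if_neg h, if_neg fun h' => h h'.2]
      simp
  · simp [hr, classWeight]

theorem abs_classSeries_sub_le [NeZero q] (hp : p.Prime) (hQ0 : Q ≠ 0) (hQ : 48 ≤ Q)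
    (h8 : 8 * p ∣ Q) (hqQ : q ∣ Q)
    (hpr : ∀ r : ℕ, r.Prime → r ∣ Q → r = p ∨ r ∣ q) (hg : IsUnit g) {m : ℕ} (hm : 2 ^ m ≤ Q)
    {τ : ℝ} (hτ : ∑ χ : DirichletCharacter ℂ q, χ g⁻¹ *
      (rootPole p m hQ0 h8 (DirichletCharacter.changeLevel hqQ χ) : ℂ) = τ) {v v' : ℝ}
    (hv : v ∈ Set.Ioc (0 : ℝ) 1) (hv' : v' ∈ Set.Ioc (0 : ℝ) 1) :
    |(∑' r : ℕ, classWeight p g m r * (r : ℝ) ^ (-(1 + v))) -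
        (∑' r : ℕ, classWeight p g m r * (r : ℝ) ^ (-(1 + v'))) +
        τ / q.totient * (Real.log v - Real.log v')| ≤ (Q : ℝ) ^ (24770 * 2 ^ m) * |v - v'| := by
  set F := fun v : ℝ => ∑' r : ℕ, classWeight p g m r * (r : ℝ) ^ (-(1 + v)) with hF
  have hpQ : p ∣ Q := (Dvd.intro_left 8 rfl).trans h8
  have hφ : (0 : ℝ) < q.totient := by exact_mod_cast Nat.totient_pos.2 (NeZero.pos q)
  have hsum : ∀ v : ℝ, 0 < v → ∑ χ : DirichletCharacter ℂ q,
      χ g⁻¹ * rootSum p (2 ^ m) (DirichletCharacter.changeLevel hqQ χ) v =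
      q.totient * (F v : ℂ) := fun v hv => sum_char_mul_rootSum hqQ hpr hpQ hg m hv
  have hcard : (Fintype.card (DirichletCharacter ℂ q) : ℝ) = q.totient := by
    have := DirichletCharacter.sum_char_inv_mul_char_eq ℂ (isUnit_one (M := ZMod q)) 1
    simp only [ZMod.inv_one, map_one, mul_one, if_true, Finset.sum_const, Finset.card_univ,
      nsmul_eq_mul] at this
    exact_mod_cast this
  have key : (((q.totient : ℝ) * (F v - F v' + τ / q.totient * (Real.log v - Real.log v')) : ℝ) : ℂ) =
      ∑ χ : DirichletCharacter ℂ q, χ g⁻¹ *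
        (rootSum p (2 ^ m) (DirichletCharacter.changeLevel hqQ χ) v -
          rootSum p (2 ^ m) (DirichletCharacter.changeLevel hqQ χ) v' +
          ((rootPole p m hQ0 h8 (DirichletCharacter.changeLevel hqQ χ) *
            (Real.log v - Real.log v') : ℝ) : ℂ)) := by
    simp only [mul_add, mul_sub, Finset.sum_add_distrib, Finset.sum_sub_distrib]
    rw [hsum v hv.1, hsum v' hv'.1]
    push_cast
    simp only [mul_sub, Finset.sum_sub_distrib, ← mul_assoc]
    rw [← Finset.sum_mul, ← Finset.sum_mul, hτ, mul_div_cancel₀ _ (by exact_mod_cast hφ.ne')]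
  have h1 : |(q.totient : ℝ) * (F v - F v' + τ / q.totient * (Real.log v - Real.log v'))| ≤
      q.totient * ((Q : ℝ) ^ (24770 * 2 ^ m) * |v - v'|) := by
    rw [← Real.norm_eq_abs, ← Complex.norm_real, key, ← hcard, ← nsmul_eq_mul,
      ← Finset.card_univ]
    refine (norm_sum_le _ _).trans (Finset.sum_le_card_nsmul _ _ _ fun χ _ => ?_)
    rw [norm_mul]
    exact (mul_le_of_le_one_left (norm_nonneg _) (χ.norm_le_one _)).trans
      (norm_rootSum_sub_le hp hQ0 hQ h8 m hm _ hv hv')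
  rw [abs_mul, abs_of_pos hφ] at h1
  exact le_of_mul_le_mul_left h1 hφ

end Orthogonality

section PoleSum

open scoped NumberTheorySymbols

variable {p q Q : ℕ}

theorem exists_prime_jacobiSym_eq_neg_one_of_coprime {p : ℕ} (hp : p.Prime) (hodd : Odd p) {M : ℕ}
    (hM0 : M ≠ 0) (hM : 4 ∣ M) (hpM : p.Coprime M) (N : ℕ) :
    ∃ b > N, b.Prime ∧ b ≡ 1 [MOD M] ∧ J(p | b) = -1 := by
  have := Fact.mk hp
  have hp2 : p ≠ 2 := by rintro rfl; exact absurd hodd (by decide)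
  obtain ⟨c, hc⟩ := FiniteField.exists_nonsquare (F := ZMod p)
    (by rwa [ZMod.ringChar_zmod_n])
  have hc0 : c ≠ 0 := by rintro rfl; exact hc ⟨0, by simp⟩
  obtain ⟨k, hk1, hk2⟩ := Nat.chineseRemainder hpM.symm 1 c.val
  have hkc : (k : ZMod p) = c := by
    rw [(ZMod.natCast_eq_natCast_iff k c.val p).2 hk2, ZMod.natCast_zmod_val]
  have hkp : k.Coprime p := (ZMod.isUnit_iff_coprime k p).1 (by rw [hkc]; exact hc0.isUnit)
  have hkM : k.Coprime M := by
    rw [Nat.Coprime, hk1.gcd_eq, Nat.gcd_one_left]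
  have := NeZero.mk (mul_ne_zero hp.ne_zero hM0)
  obtain ⟨b, hb, hbp, he⟩ := Nat.forall_exists_prime_gt_and_eq_mod
    ((ZMod.isUnit_iff_coprime k (p * M)).2 (hkp.mul_right hkM)) N
  have he' : b ≡ k [MOD p * M] := (ZMod.natCast_eq_natCast_iff b k _).1 he
  have hbM : b ≡ 1 [MOD M] := (he'.of_mul_left p).trans hk1
  refine ⟨b, hb, hbp, hbM, ?_⟩
  rw [jacobiSym.quadratic_reciprocity_one_mod_four' hodd (hbM.of_dvd hM),
    ← jacobiSym.legendreSym.to_jacobiSym, legendreSym.eq_neg_one_iff]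
  have : ((b : ℤ) : ZMod p) = c := by
    rw [Int.cast_natCast, (ZMod.natCast_eq_natCast_iff b k p).2 (he'.of_mul_right M), hkc]
  rwa [this]

theorem changeLevel_natCast (hqQ : q ∣ Q) (χ : DirichletCharacter ℂ q) {b : ℕ} (hb : b.Coprime Q) :
    DirichletCharacter.changeLevel hqQ χ b = χ b := by
  have hu : IsUnit (b : ZMod Q) := (ZMod.isUnit_iff_coprime b Q).2 hb
  have h2 := DirichletCharacter.changeLevel_eq_cast_of_dvd χ hqQ hu.unit
  rwa [IsUnit.unit_spec, ZMod.cast_natCast hqQ] at h2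

theorem changeLevel_ne_primeChar (hp : p.Prime) (hodd : Odd p) (hQ0 : Q ≠ 0) (h8 : 8 * p ∣ Q)
    (hqQ : q ∣ Q) (hpq : p.Coprime q) (χ : DirichletCharacter ℂ q) :
    DirichletCharacter.changeLevel hqQ χ ≠ primeChar p Q hQ0 h8 := by
  intro h
  have hq0 : q ≠ 0 := ne_zero_of_dvd_ne_zero hQ0 hqQ
  have hp4 : p.Coprime 4 := by
    rw [show (4 : ℕ) = 2 ^ 2 by norm_num]
    exact Nat.Coprime.pow_right 2 hodd.coprime_two_right
  obtain ⟨b, hbQ, hbp, hb, hJ⟩ := exists_prime_jacobiSym_eq_neg_one_of_coprime hp hodd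
    (mul_ne_zero four_ne_zero hq0) (Dvd.intro _ rfl) (hp4.mul_right hpq) Q
  have hbc : b.Coprime Q := (Nat.Prime.coprime_iff_not_dvd hbp).2
    fun h => absurd (Nat.le_of_dvd (Nat.pos_of_ne_zero hQ0) h) (by omega)
  have h1 := changeLevel_natCast hqQ χ hbc
  have hb1 : (b : ZMod q) = 1 := by
    exact_mod_cast (ZMod.natCast_eq_natCast_iff b 1 q).2 (hb.of_mul_left 4)
  rw [h, primeChar_natCast hQ0 h8 hbc, hJ, hb1, map_one] at h1
  norm_num at h1

theorem sum_rootPole_eq_one [NeZero q] (hQ0 : Q ≠ 0) (h8 : 8 * p ∣ Q) (hqQ : q ∣ Q) {g : ZMod q}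
    (hg : IsUnit g) {m : ℕ}
    (h : m = 0 ∨ ∀ χ : DirichletCharacter ℂ q,
      DirichletCharacter.changeLevel hqQ χ ≠ primeChar p Q hQ0 h8) :
    ∑ χ : DirichletCharacter ℂ q, χ g⁻¹ *
      (rootPole p m hQ0 h8 (DirichletCharacter.changeLevel hqQ χ) : ℂ) = (1 : ℝ) := by
  have := NeZero.mk hQ0
  have hg' : IsUnit g⁻¹ := IsUnit.of_mul_eq_one g (ZMod.inv_mul_of_unit g hg)
  rw [Finset.sum_eq_single_of_mem 1 (Finset.mem_univ _)]
  · simp [rootPole, MulChar.one_apply hg']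
  · intro χ _ hχ
    rw [rootPole, if_neg, Complex.ofReal_zero, mul_zero]
    rintro (h1 | ⟨hm, h1⟩)
    · exact hχ (DirichletCharacter.changeLevel_injective hqQ (h1.trans (map_one _).symm))
    · exact h.elim hm fun h => h χ h1

theorem sum_rootPole_two [NeZero q] (hQ0 : Q ≠ 0) (h8 : 8 * 2 ∣ Q) (hqQ : q ∣ Q) (h8q : 8 ∣ q)
    {c : ℕ} (hc : c.Coprime q) {m : ℕ} (hm : m ≠ 0) :
    ∑ χ : DirichletCharacter ℂ q, χ (c : ZMod q)⁻¹ *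
      (rootPole 2 m hQ0 h8 (DirichletCharacter.changeLevel hqQ χ) : ℂ) =
        ((1 + ZMod.χ₈ (c : ZMod 8) : ℤ) : ℝ) := by
  have := NeZero.mk hQ0
  set η : DirichletCharacter ℂ 8 := ZMod.χ₈.ringHomComp (Int.castRingHom ℂ) with hη
  set ψ : DirichletCharacter ℂ q := DirichletCharacter.changeLevel h8q η with hψ
  have hodd : ∀ b : ℕ, b.Coprime Q → Odd b := fun b hb =>
    (Nat.coprime_two_right (n := b)).1 (hb.coprime_dvd_right ((by norm_num : 2 ∣ 8 * 2).trans h8))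
  have hψQ : DirichletCharacter.changeLevel hqQ ψ = primeChar 2 Q hQ0 h8 := by
    refine MulChar.ext fun u => ?_
    have hb := ZMod.val_coe_unit_coprime u
    have e : ((u : ZMod Q).val : ZMod Q) = u := ZMod.natCast_zmod_val _
    rw [← e, changeLevel_natCast hqQ ψ hb, primeChar_natCast hQ0 h8 hb, hψ,
      changeLevel_natCast h8q η (hb.coprime_dvd_right hqQ), Nat.cast_ofNat,
      jacobiSym.at_two (hodd _ hb)]
    rfl
  have hψ1 : ψ ≠ 1 := by
    intro h
    obtain ⟨b, hb, hbp, he⟩ := Nat.forall_exists_prime_gt_and_eq_mod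
      ((ZMod.isUnit_iff_coprime 5 8).2 (by norm_num)) Q
    have hbc : b.Coprime Q := (Nat.Prime.coprime_iff_not_dvd hbp).2
      fun h => absurd (Nat.le_of_dvd (Nat.pos_of_ne_zero hQ0) h) (by omega)
    have h1 := changeLevel_natCast h8q η (hbc.coprime_dvd_right hqQ)
    rw [← hψ, h, MulChar.one_apply
      ((ZMod.isUnit_iff_coprime b q).2 (hbc.coprime_dvd_right hqQ)), he] at h1
    have h2 : η ((5 : ℕ) : ZMod 8) = ((ZMod.χ₈ ((5 : ℕ) : ZMod 8) : ℤ) : ℂ) := rfl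
    rw [h2, show ZMod.χ₈ ((5 : ℕ) : ZMod 8) = -1 by decide] at h1
    norm_num at h1
  have hcu : IsUnit (c : ZMod q) := (ZMod.isUnit_iff_coprime c q).2 hc
  have hcu' : IsUnit (c : ZMod q)⁻¹ := IsUnit.of_mul_eq_one _ (ZMod.inv_mul_of_unit _ hcu)
  have hψc : ψ (c : ZMod q) = ((ZMod.χ₈ (c : ZMod 8) : ℤ) : ℂ) := by
    rw [hψ, changeLevel_natCast h8q η hc]
    rfl
  have hψc' : ψ (c : ZMod q)⁻¹ = ((ZMod.χ₈ (c : ZMod 8) : ℤ) : ℂ) := by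
    have h1 : ψ (c : ZMod q)⁻¹ * ψ c = 1 := by
      rw [← map_mul, ZMod.inv_mul_of_unit _ hcu, map_one]
    rw [hψc] at h1
    have h3 : ZMod.χ₈ (c : ZMod 8) = 1 ∨ ZMod.χ₈ (c : ZMod 8) = -1 := by
      have := ZMod.isQuadratic_χ₈ (c : ZMod 8)
      rcases this with h | h | h
      · rw [h] at h1
        simp at h1
      · exact Or.inl h
      · exact Or.inr h
    rcases h3 with h | h <;> rw [h] at h1 ⊢ <;> push_cast at h1 ⊢
    · simpa using h1
    · linear_combination -h1
  rw [Finset.sum_eq_add 1 ψ hψ1.symm]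
  · rw [rootPole, rootPole, if_pos (Or.inl (map_one _)), if_pos (Or.inr ⟨hm, hψQ⟩), hψc',
      MulChar.one_apply hcu']
    push_cast
    ring
  · intro χ _ hχ
    rw [rootPole, if_neg, Complex.ofReal_zero, mul_zero]
    rintro (h1 | ⟨_, h1⟩)
    · exact hχ.1 (DirichletCharacter.changeLevel_injective hqQ (h1.trans (map_one _).symm))
    · exact hχ.2 (DirichletCharacter.changeLevel_injective hqQ (h1.trans hψQ.symm))
  · exact fun h => absurd (Finset.mem_univ _) h
  · exact fun h => absurd (Finset.mem_univ _) h

end PoleSum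

section Tauberian

variable {a : ℕ → ℝ}

theorem abs_indicator_sub_exp_le {u : ℝ} (hu : 0 ≤ u) :
    |(if u ≤ 1 then 1 else 0) - Real.exp (-u)| ≤ 3 * (Real.exp (-u) - Real.exp (-(2 * u))) := by
  have h2 : Real.exp (-(2 * u)) = Real.exp (-u) * Real.exp (-u) := by
    rw [← Real.exp_add]
    congr 1
    ring
  have h1 : Real.exp (-u) ≤ 1 := Real.exp_le_one_iff.2 (by linarith)
  have h0 := Real.exp_pos (-u)
  have he := Real.exp_one_lt_d9
  have he' := Real.exp_one_gt_d9
  have hinv : Real.exp 1 * Real.exp (-1) = 1 := by rw [← Real.exp_add]; simp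
  rw [h2]
  split_ifs with h
  · have h3 : Real.exp (-1) ≤ Real.exp (-u) := Real.exp_le_exp.2 (by linarith)
    rw [abs_of_nonneg (by linarith)]
    have h4 : 1 ≤ 3 * Real.exp (-u) := by nlinarith
    nlinarith
  · have h3 : Real.exp (-u) ≤ Real.exp (-1) := Real.exp_le_exp.2 (by linarith)
    rw [zero_sub, abs_neg, abs_of_pos h0]
    have h4 : 3 * Real.exp (-1) ≤ 2 := by nlinarith [Real.exp_pos (-1)]
    nlinarith

theorem abs_partialSum_sub_tsum_le (ha : ∀ r, 0 ≤ a r) (ha0 : a 0 = 0)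
    (hs : ∀ v : ℝ, 0 < v → Summable fun r : ℕ => a r * (r : ℝ) ^ (-(1 + v))) {X : ℝ} (hX : 0 < X) :
    |(∑ r ∈ Finset.range (⌊Real.exp X⌋₊ + 1), a r / r) - ∑' r : ℕ, a r * (r : ℝ) ^ (-(1 + 1 / X))| ≤
      3 * ((∑' r : ℕ, a r * (r : ℝ) ^ (-(1 + 1 / X))) -
        ∑' r : ℕ, a r * (r : ℝ) ^ (-(1 + 2 / X))) := by
  have s1 := hs (1 / X) (by positivity)
  have s2 := hs (2 / X) (by positivity)
  set b : ℕ → ℝ := fun r => if r ∈ Finset.range (⌊Real.exp X⌋₊ + 1) then a r / r else 0 with hb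
  have hbs : Summable b := summable_of_ne_finset_zero (s := Finset.range (⌊Real.exp X⌋₊ + 1))
    fun r hr => if_neg hr
  have h1 : ∑ r ∈ Finset.range (⌊Real.exp X⌋₊ + 1), a r / r = ∑' r, b r := by
    rw [tsum_eq_sum (s := Finset.range (⌊Real.exp X⌋₊ + 1)) fun r hr => if_neg hr]
    exact Finset.sum_congr rfl fun r hr => (if_pos hr).symm
  rw [h1, ← hbs.tsum_sub s1, ← s1.tsum_sub s2, ← tsum_mul_left]
  have hterm : ∀ r : ℕ, |b r - a r * (r : ℝ) ^ (-(1 + 1 / X))| ≤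
      3 * (a r * (r : ℝ) ^ (-(1 + 1 / X)) - a r * (r : ℝ) ^ (-(1 + 2 / X))) := by
    intro r
    rcases Nat.eq_zero_or_pos r with rfl | hr
    · simp [hb, ha0]
    have hr0 : (0 : ℝ) < r := by exact_mod_cast hr
    have hr1 : (1 : ℝ) ≤ r := by exact_mod_cast hr
    set u := Real.log r / X with hu
    have hu0 : 0 ≤ u := div_nonneg (Real.log_nonneg hr1) hX.le
    have e1 : (r : ℝ) ^ (-(1 + 1 / X)) = 1 / r * Real.exp (-u) := by
      rw [neg_add, Real.rpow_add hr0, Real.rpow_neg_one, Real.rpow_def_of_pos hr0,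
        one_div (r : ℝ), show Real.log r * -(1 / X) = -u by rw [hu]; ring]
    have e2 : (r : ℝ) ^ (-(1 + 2 / X)) = 1 / r * Real.exp (-(2 * u)) := by
      rw [neg_add, Real.rpow_add hr0, Real.rpow_neg_one, Real.rpow_def_of_pos hr0,
        one_div (r : ℝ), show Real.log r * -(2 / X) = -(2 * u) by rw [hu]; ring]
    have e3 : b r = a r * (1 / r) * (if u ≤ 1 then 1 else 0) := by
      have hiff : r ∈ Finset.range (⌊Real.exp X⌋₊ + 1) ↔ u ≤ 1 := by
        rw [Finset.mem_range, Nat.lt_succ_iff, Nat.le_floor_iff (Real.exp_pos X).le, hu,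
          div_le_one hX, Real.log_le_iff_le_exp hr0]
      rw [hb]
      by_cases h : u ≤ 1
      · simp only [if_pos h, if_pos (hiff.2 h)]
        ring
      · simp only [if_neg h, if_neg (mt hiff.1 h)]
        ring
    have h4 := abs_indicator_sub_exp_le hu0
    have h5 : 0 ≤ a r * (1 / r : ℝ) := mul_nonneg (ha r) (by positivity)
    rw [e1, e2, e3]
    calc _ = a r * (1 / r) * |(if u ≤ 1 then 1 else 0) - Real.exp (-u)| := by
          rw [← abs_of_nonneg h5, ← abs_mul, abs_of_nonneg h5]
          congr 1
          ring
      _ ≤ a r * (1 / r) * (3 * (Real.exp (-u) - Real.exp (-(2 * u)))) := by gcongr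
      _ = _ := by ring
  have s3 := ((s1.sub s2).mul_left 3)
  have s4 : Summable fun r : ℕ => ‖b r - a r * (r : ℝ) ^ (-(1 + 1 / X))‖ :=
    s3.of_nonneg_of_le (fun _ => norm_nonneg _) hterm
  exact (norm_tsum_le_tsum_norm s4).trans (s4.tsum_le_tsum hterm s3)

theorem abs_partialSum_sub_log_le (ha : ∀ r, 0 ≤ a r) (ha0 : a 0 = 0)
    (hs : ∀ v : ℝ, 0 < v → Summable fun r : ℕ => a r * (r : ℝ) ^ (-(1 + v))) {κ B : ℝ}
    (hκ : 0 ≤ κ) (hB : 0 ≤ B)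
    (h : ∀ v ∈ Set.Ioc (0 : ℝ) 1, ∀ v' ∈ Set.Ioc (0 : ℝ) 1,
      |(∑' r : ℕ, a r * (r : ℝ) ^ (-(1 + v))) - (∑' r : ℕ, a r * (r : ℝ) ^ (-(1 + v'))) +
        κ * (Real.log v - Real.log v')| ≤ B * |v - v'|) {X Y : ℝ} (hY : 2 ≤ Y) (hYX : Y ≤ X) :
    |(∑ r ∈ Finset.range (⌊Real.exp X⌋₊ + 1), a r / r) -
      (∑ r ∈ Finset.range (⌊Real.exp Y⌋₊ + 1), a r / r) - κ * (Real.log X - Real.log Y)| ≤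
      6 * κ + 7 * B / Y := by
  set F := fun v : ℝ => ∑' r : ℕ, a r * (r : ℝ) ^ (-(1 + v)) with hF
  set S := fun X : ℝ => ∑ r ∈ Finset.range (⌊Real.exp X⌋₊ + 1), a r / r with hS
  have hY0 : 0 < Y := by linarith
  have hmem : ∀ Z : ℝ, Y ≤ Z → ∀ c : ℝ, 0 < c → c ≤ 2 → c / Z ∈ Set.Ioc (0 : ℝ) 1 :=
    fun Z hZ c hc hc2 => ⟨div_pos hc (by linarith), (div_le_one (by linarith)).2 (by linarith)⟩
  have hpt : ∀ Z : ℝ, Y ≤ Z → |S Z - F (1 / Z)| ≤ 3 * (κ + B / Y) := by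
    intro Z hZ
    have hZ0 : 0 < Z := by linarith
    refine (abs_partialSum_sub_tsum_le ha ha0 hs hZ0).trans ?_
    have h1 := (abs_le.1 (h (1 / Z) (hmem Z hZ 1 one_pos one_le_two) (2 / Z)
      (hmem Z hZ 2 two_pos le_rfl))).2
    have h2 : Real.log (1 / Z) - Real.log (2 / Z) = - Real.log 2 := by
      rw [Real.log_div one_ne_zero hZ0.ne', Real.log_div two_ne_zero hZ0.ne', Real.log_one]
      ring
    have h3 : |1 / Z - 2 / Z| = 1 / Z := by
      rw [← sub_div, abs_div, abs_of_pos hZ0]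
      norm_num
    rw [h2, h3] at h1
    have h4 : B * (1 / Z) ≤ B / Y := by
      rw [mul_one_div]
      gcongr
    have h5 := Real.log_two_lt_d9
    have h6 : κ * Real.log 2 ≤ κ * 1 := by gcongr; linarith
    change 3 * (F (1 / Z) - F (2 / Z)) ≤ _
    change F (1 / Z) - F (2 / Z) + _ ≤ _ at h1
    linarith
  have hX0 : 0 < X := by linarith
  have h1 := h (1 / X) (hmem X hYX 1 one_pos one_le_two) (1 / Y)
    (hmem Y le_rfl 1 one_pos one_le_two)
  change |F (1 / X) - F (1 / Y) + _| ≤ _ at h1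
  have h2 : Real.log (1 / X) - Real.log (1 / Y) = -(Real.log X - Real.log Y) := by
    rw [one_div, one_div, Real.log_inv, Real.log_inv]
    ring
  have h3 : B * |1 / X - 1 / Y| ≤ B / Y := by
    rw [div_eq_mul_one_div B Y]
    gcongr
    have h4 : 1 / X ≤ 1 / Y := one_div_le_one_div_of_le hY0 hYX
    have h5 : 0 < 1 / X := by positivity
    rw [abs_of_nonpos (by linarith)]
    linarith
  rw [h2] at h1
  have h1' := abs_le.1 (h1.trans h3)
  have hx := abs_le.1 (hpt X hYX)
  have hy := abs_le.1 (hpt Y le_rfl)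
  change |S X - S Y - _| ≤ _
  have e : 7 * B / Y = 7 * (B / Y) := by ring
  rw [abs_le, e]
  constructor <;> nlinarith [h1'.1, h1'.2, hx.1, hx.2, hy.1, hy.2]

end Tauberian

section Interpolation

/-- Interpolates between the sieve bound, the asymptotics of `S (m / 2)` and those of `S m`. -/
theorem abs_sub_log_le_of_interpolation {S : ℕ → ℝ → ℝ} {τ : ℕ → ℝ} {Q φ l : ℝ} {j : ℕ}
    (hQ : 3 ≤ Real.log Q) (hQ1 : 1 ≤ Q) (hl : 2 ≤ l) (hφ : φ = 2 ^ j * (l - 1))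
    (hτ : ∀ m, 0 ≤ τ m ∧ τ m ≤ 2) (hS0 : ∀ m X, 0 ≤ S m X) (hmono : ∀ m, Monotone (S m))
    (hsieve : ∀ m ≤ j, ∀ X, 1 ≤ X → S m X / 2 ^ m ≤ 2 ^ 13 * (1 + Real.log X) / (2 ^ j * l))
    (hinc : ∀ m ≤ j, ∀ m₁ ≤ m, ∀ Y X, Y ≤ X →
      (S m X - S m Y) / 2 ^ m ≤ (S m₁ X - S m₁ Y) / 2 ^ m₁)
    (has : ∀ m ≤ j, ∀ Y X, Q ^ (24771 * 2 ^ m) ≤ Y → Y ≤ X →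
      |S m X - S m Y - τ m / φ * (Real.log X - Real.log Y)| ≤ 19 / φ)
    {m : ℕ} (hm : m ≤ j) {X : ℝ} (hX : 1 ≤ X) :
    |S m X / 2 ^ m - τ m / (2 ^ m * φ) * Real.log X| ≤
      2 ^ 30 * Real.log Q * (2 ^ (j / 2) / 2 ^ j) / l := by
  set lam := Real.log Q with hlam
  set Y : ℕ → ℝ := fun m => Q ^ (24771 * 2 ^ m) with hY
  have hY1 : ∀ m, 1 ≤ Y m := fun m => one_le_pow₀ hQ1
  have hlogY : ∀ m, Real.log (Y m) = 24771 * 2 ^ m * lam := fun m => by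
    rw [hY]
    simp only [Real.log_pow]
    push_cast
    rfl
  set W : ℝ := 2 ^ j * l with hW
  have hj0 : (0 : ℝ) < 2 ^ j := by positivity
  have hW0 : 0 < W := by positivity
  have hφ0 : 0 < φ := by rw [hφ]; exact mul_pos hj0 (by linarith)
  have hφW : 1 / φ ≤ 2 / W := by
    rw [div_le_div_iff₀ hφ0 hW0, hφ, hW]
    nlinarith
  set n := m / 2 with hn
  have hnm : n ≤ m := Nat.div_le_self _ _
  have hYmono : Y n ≤ Y m := pow_le_pow_right₀ hQ1
    (Nat.mul_le_mul_left _ (Nat.pow_le_pow_right two_pos hnm))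
  set H : ℝ := 2 ^ (j / 2) with hH
  have hH1 : 1 ≤ H := one_le_pow₀ one_le_two
  have h2n : (2 : ℝ) ^ n ≤ H := pow_le_pow_right₀ one_le_two (Nat.div_le_div_right hm)
  have h2mn : (2 : ℝ) ^ m / 2 ^ n ≤ 2 * H := by
    rw [div_le_iff₀ (by positivity), hH, mul_assoc, ← pow_add, ← pow_succ']
    exact pow_le_pow_right₀ one_le_two (by omega)
  have hm0 : (0 : ℝ) < 2 ^ m := by positivity
  have hn0 : (0 : ℝ) < 2 ^ n := by positivity
  have hlam0 : 0 < lam := by linarith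
  -- the range up to `Y n`
  have ha : S m (Y n) / 2 ^ m ≤ 2 ^ 28 * lam * H / W := by
    refine (hsieve m hm (Y n) (hY1 n)).trans ?_
    rw [hlogY, div_le_div_iff_of_pos_right hW0]
    nlinarith
  -- the range from `Y n` to `Y m`
  have hb : (S m (Y m) - S m (Y n)) / 2 ^ m ≤ 2 ^ 18 * lam * H / W := by
    refine (hinc m hm n hnm _ _ hYmono).trans ?_
    have h1 := (abs_le.1 (has n (hnm.trans hm) (Y n) (Y m) le_rfl hYmono)).2
    have h2 : τ n / φ * (Real.log (Y m) - Real.log (Y n)) ≤ 2 / φ * (24771 * 2 ^ m * lam) := by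
      rw [hlogY, hlogY]
      have h3 : 0 ≤ 24771 * 2 ^ n * lam := by positivity
      have h4 : 24771 * 2 ^ n * lam ≤ 24771 * 2 ^ m * lam := by
        gcongr
        exact one_le_two
      exact mul_le_mul (div_le_div_of_nonneg_right (hτ n).2 hφ0.le) (by linarith) (by linarith)
        (by positivity)
    have h5 : (1 : ℝ) ≤ 2 ^ m := one_le_pow₀ one_le_two
    have h6 : S n (Y m) - S n (Y n) ≤ 1 / φ * (49561 * 2 ^ m * lam) := by
      have h7 : 19 / φ = 1 / φ * 19 := by ring
      have h8 : 2 / φ * (24771 * 2 ^ m * lam) = 1 / φ * (49542 * 2 ^ m * lam) := by ring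
      have h9 : 1 / φ * 19 ≤ 1 / φ * (19 * (2 ^ m * lam)) := by
        gcongr
        nlinarith
      nlinarith
    calc (S n (Y m) - S n (Y n)) / 2 ^ n ≤ 1 / φ * (49561 * 2 ^ m * lam) / 2 ^ n := by gcongr
      _ = 1 / φ * (49561 * lam * (2 ^ m / 2 ^ n)) := by ring
      _ ≤ 2 / W * (49561 * lam * (2 * H)) := by gcongr
      _ = 198244 * (lam * H) / W := by ring
      _ ≤ 2 ^ 18 * (lam * H) / W := by gcongr; norm_num
      _ = _ := by ring
  have hd : τ m / (2 ^ m * φ) * Real.log (Y m) ≤ 2 ^ 18 * lam * H / W := by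
    rw [hlogY]
    calc τ m / (2 ^ m * φ) * (24771 * 2 ^ m * lam) = τ m * (1 / φ) * (24771 * lam) := by
          field_simp
      _ ≤ 2 * (2 / W) * (24771 * lam) := by
          gcongr
          exact (hτ m).2
      _ = 99084 * lam * 1 / W := by ring
      _ ≤ 2 ^ 18 * lam * H / W := by gcongr; norm_num
  have hfin : 2 ^ 30 * lam * (H / 2 ^ j) / l = 2 ^ 30 * (lam * H / W) := by
    rw [hW]
    field_simp
  have hE : 0 ≤ lam * H / W := by positivity
  rw [mul_assoc, mul_div_assoc] at ha hb hd
  rw [hfin]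
  have hτ0 : 0 ≤ τ m / (2 ^ m * φ) := div_nonneg (hτ m).1 (by positivity)
  have hTm : S m (Y m) / 2 ^ m ≤ (2 ^ 28 + 2 ^ 18) * (lam * H / W) := by
    rw [sub_div] at hb
    linarith
  have hT0 : 0 ≤ S m (Y m) / 2 ^ m := div_nonneg (hS0 m _) hm0.le
  have hlogY0 := Real.log_nonneg (hY1 m)
  rcases le_total X (Y m) with h | h
  · have h1 : S m X / 2 ^ m ≤ S m (Y m) / 2 ^ m := by
      gcongr
      exact hmono m h
    have h2 : τ m / (2 ^ m * φ) * Real.log X ≤ τ m / (2 ^ m * φ) * Real.log (Y m) := by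
      gcongr
    have h3 : 0 ≤ S m X / 2 ^ m := div_nonneg (hS0 m _) hm0.le
    have h4 : 0 ≤ τ m / (2 ^ m * φ) * Real.log X := mul_nonneg hτ0 (Real.log_nonneg hX)
    rw [abs_le]
    constructor <;> linarith
  · have h1 := has m hm (Y m) X le_rfl h
    have h2 : |(S m X - S m (Y m)) / 2 ^ m - τ m / (2 ^ m * φ) *
        (Real.log X - Real.log (Y m))| ≤ 38 * (lam * H / W) := by
      have h3 : (S m X - S m (Y m)) / 2 ^ m - τ m / (2 ^ m * φ) * (Real.log X - Real.log (Y m)) =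
          (S m X - S m (Y m) - τ m / φ * (Real.log X - Real.log (Y m))) / 2 ^ m := by
        field_simp
      rw [h3, abs_div, abs_of_pos hm0, div_le_iff₀ hm0]
      refine h1.trans ?_
      have h5 : (1 : ℝ) ≤ 2 ^ m := one_le_pow₀ one_le_two
      have h6 : 1 ≤ lam * H := by nlinarith
      calc 19 / φ = 19 * (1 / φ) := by ring
        _ ≤ 19 * (2 / W) := by gcongr
        _ = 38 * (1 / W) * 1 := by ring
        _ ≤ 38 * (lam * H / W) * 2 ^ m := by gcongr
    have h7 := abs_le.1 h2
    have h8 : 0 ≤ τ m / (2 ^ m * φ) * Real.log (Y m) := mul_nonneg hτ0 hlogY0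
    rw [sub_div, mul_sub] at h7
    rw [abs_le]
    constructor <;> linarith [h7.1, h7.2]

end Interpolation

section ClassSum

variable {p j l : ℕ}

theorem natCast_zmod_eq_iff (hl : 2 ≤ l) (r : ℕ) :
    (r : ZMod (2 ^ (j + 1) * l)) = ((1 + 2 ^ j * l : ℕ) : ZMod (2 ^ (j + 1) * l)) ↔
      ∃ t, r = 2 ^ j * (l * (2 * t + 1)) + 1 := by
  rw [ZMod.natCast_eq_natCast_iff]
  have hw : 1 < 2 ^ j * l := lt_of_lt_of_le (by omega : 1 < l)
    (Nat.le_mul_of_pos_left l (by positivity))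
  have hq : 2 ^ (j + 1) * l = 2 * (2 ^ j * l) := by ring
  rw [hq]
  constructor
  · intro h
    refine ⟨r / (2 * (2 ^ j * l)), ?_⟩
    have h1 : r % (2 * (2 ^ j * l)) = 1 + 2 ^ j * l := by
      rw [h, Nat.mod_eq_of_lt (by omega)]
    have h2 := Nat.div_add_mod r (2 * (2 ^ j * l))
    rw [h1] at h2
    conv_lhs => rw [← h2]
    ring
  · rintro ⟨t, rfl⟩
    have : 2 ^ j * (l * (2 * t + 1)) + 1 = 1 + 2 ^ j * l + 2 * (2 ^ j * l) * t := by ring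
    rw [this]
    simp [Nat.ModEq]

/-- The class of `1 + 2 ^ j * l` modulo `2 ^ (j + 1) * l`; it consists of the `r ≡ 1 (mod l)` such
that `r - 1` is exactly divisible by `2 ^ j`. -/
abbrev exactClass (j l : ℕ) : ZMod (2 ^ (j + 1) * l) := ((1 + 2 ^ j * l : ℕ) : ZMod (2 ^ (j + 1) * l))

theorem classWeight_exactClass (hl : 2 ≤ l) (hp : p.Prime) {m : ℕ} (hm : m ≤ j) (r : ℕ) :
    classWeight p (exactClass j l) m r =
      if (r.Prime ∧ r ≠ p ∧ (r : ZMod (2 ^ (j + 1) * l)) = exactClass j l) ∧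
        (p : ZMod r) ^ ((r - 1) / 2 ^ m) = 1 then 2 ^ m else 0 := by
  rw [classWeight]
  by_cases h : r.Prime ∧ r ≠ p ∧ (r : ZMod (2 ^ (j + 1) * l)) = exactClass j l
  · obtain ⟨hr, hrp, hc⟩ := h
    obtain ⟨t, ht⟩ := (natCast_zmod_eq_iff hl r).1 hc
    have hg : (r - 1).gcd (2 ^ m) = 2 ^ m := by
      refine Nat.gcd_eq_right ((pow_dvd_pow 2 hm).trans ?_)
      rw [ht, Nat.add_sub_cancel]
      exact Dvd.intro _ rfl
    rw [if_pos ⟨hr, hrp, hc⟩, rootCount_eq (by positivity) hr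
      (fun h => hrp ((Nat.prime_dvd_prime_iff_eq hr hp).1 h)), hg]
    simp only [hr, hrp, hc, ne_eq, not_false_eq_true, true_and]
    split_ifs <;> simp
  · rw [if_neg h, if_neg fun h' => h h'.1]

theorem classWeight_div_anti (hl : 2 ≤ l) (hp : p.Prime) {m m₁ : ℕ} (hm : m ≤ j) (hm₁ : m₁ ≤ m)
    (r : ℕ) : classWeight p (exactClass j l) m r / 2 ^ m ≤
      classWeight p (exactClass j l) m₁ r / 2 ^ m₁ := by
  rw [classWeight_exactClass hl hp hm, classWeight_exactClass hl hp (hm₁.trans hm)]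
  by_cases h : (r.Prime ∧ r ≠ p ∧ (r : ZMod (2 ^ (j + 1) * l)) = exactClass j l) ∧
        (p : ZMod r) ^ ((r - 1) / 2 ^ m) = 1
  · rw [if_pos h, if_pos, div_self (by positivity), div_self (by positivity)]
    refine ⟨h.1, ?_⟩
    obtain ⟨t, ht⟩ := (natCast_zmod_eq_iff hl r).1 h.1.2.2
    have hd : 2 ^ m ∣ r - 1 := by
      rw [ht, Nat.add_sub_cancel]
      exact (pow_dvd_pow 2 hm).mul_right _
    obtain ⟨c, hc⟩ := hd
    have h2 := h.2
    rw [hc, Nat.mul_div_cancel_left _ (by positivity)] at h2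
    rw [hc, ← Nat.sub_add_cancel hm₁, pow_add, mul_right_comm,
      Nat.mul_div_cancel _ (by positivity), mul_comm, pow_mul, h2, one_pow]
  · rw [if_neg h, zero_div]
    split_ifs <;> positivity

/-- The sum of `classWeight p g m r / r` over `r ≤ exp X`. -/
noncomputable def classSum (p : ℕ) {q : ℕ} (g : ZMod q) (m : ℕ) (X : ℝ) : ℝ :=
  ∑ r ∈ Finset.range (⌊Real.exp X⌋₊ + 1), classWeight p g m r / r

theorem classSum_sub {q : ℕ} (g : ZMod q) (m : ℕ) {Y X : ℝ} (h : Y ≤ X) :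
    classSum p g m X - classSum p g m Y =
      ∑ r ∈ Finset.Ico (⌊Real.exp Y⌋₊ + 1) (⌊Real.exp X⌋₊ + 1), classWeight p g m r / r := by
  rw [classSum, classSum, Finset.sum_Ico_eq_sub]
  gcongr

theorem classSum_div_sub_le (hl : 2 ≤ l) (hp : p.Prime) {m m₁ : ℕ} (hm : m ≤ j) (hm₁ : m₁ ≤ m)
    {Y X : ℝ} (h : Y ≤ X) :
    (classSum p (exactClass j l) m X - classSum p (exactClass j l) m Y) / 2 ^ m ≤
      (classSum p (exactClass j l) m₁ X - classSum p (exactClass j l) m₁ Y) / 2 ^ m₁ := by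
  rw [classSum_sub _ _ h, classSum_sub _ _ h, Finset.sum_div, Finset.sum_div]
  refine Finset.sum_le_sum fun r _ => ?_
  rw [div_right_comm, div_right_comm _ (r : ℝ)]
  gcongr ?_ / _
  exact classWeight_div_anti hl hp hm hm₁ r

theorem classSum_div_le (hl : l.Prime) (hp : p.Prime) {m : ℕ} (hm : m ≤ j) {X : ℝ} (hX : 1 ≤ X) :
    classSum p (exactClass j l) m X / 2 ^ m ≤ 2 ^ 13 * (1 + Real.log X) / (2 ^ j * l) := by
  refine le_trans ?_ (sum_inv_prime_le hl hX le_rfl)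
  rw [classSum, Finset.sum_div, Finset.sum_filter]
  refine Finset.sum_le_sum fun r _ => ?_
  rw [classWeight_exactClass hl.two_le hp hm]
  by_cases h : (r.Prime ∧ r ≠ p ∧ (r : ZMod (2 ^ (j + 1) * l)) = exactClass j l) ∧
        (p : ZMod r) ^ ((r - 1) / 2 ^ m) = 1
  · obtain ⟨t, ht⟩ := (natCast_zmod_eq_iff hl.two_le r).1 h.1.2.2
    rw [if_pos h, if_pos ⟨h.1.1, by rw [ht, Nat.add_sub_cancel, ← mul_assoc]; exact Dvd.intro _ rfl⟩,
      div_right_comm, div_self (by positivity)]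
  · rw [if_neg h, zero_div, zero_div]
    split_ifs <;> positivity

/-- The density `τ` of the class sums, relative to the class. -/
noncomputable def classDensity (p j l m : ℕ) : ℝ :=
  if p = 2 ∧ m ≠ 0 then ((1 + ZMod.χ₈ ((1 + 2 ^ j * l : ℕ) : ZMod 8) : ℤ) : ℝ) else 1

theorem classDensity_mem (p j l m : ℕ) : 0 ≤ classDensity p j l m ∧ classDensity p j l m ≤ 2 := by
  rw [classDensity]
  split_ifs
  · have : ∀ z : ZMod 8, 0 ≤ 1 + ZMod.χ₈ z ∧ 1 + ZMod.χ₈ z ≤ 2 := by decide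
    exact_mod_cast this _
  · norm_num

theorem totient_two_pow_succ_mul (hl : l.Prime) (hodd : Odd l) :
    (2 ^ (j + 1) * l).totient = 2 ^ j * (l - 1) := by
  rw [Nat.totient_mul (Nat.Coprime.pow_left _ hodd.coprime_two_left),
    Nat.totient_prime_pow_succ Nat.prime_two, Nat.totient_prime hl]
  simp

theorem classSum_sub_log_le (hp : p.Prime) (hl : l.Prime) (hodd : Odd l) (hlp : l ≠ p)
    (hj : 1 ≤ j) (hj2 : p = 2 → 2 ≤ j) {m : ℕ} (hm : m ≤ j) {Y X : ℝ}
    (hY : ((8 * p * (2 ^ (j + 1) * l) : ℕ) : ℝ) ^ (24771 * 2 ^ m) ≤ Y) (hYX : Y ≤ X) :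
    |classSum p (exactClass j l) m X - classSum p (exactClass j l) m Y -
      classDensity p j l m / (2 ^ j * (l - 1)) * (Real.log X - Real.log Y)| ≤
      19 / (2 ^ j * (l - 1)) := by
  set q := 2 ^ (j + 1) * l with hq
  set Q := 8 * p * q with hQdef
  have hl2 := hl.two_le
  have hp2 := hp.two_le
  have hj2' : 2 ^ 2 ≤ 2 ^ (j + 1) := Nat.pow_le_pow_right two_pos (by omega)
  have hq8 : 8 ≤ q := by rw [hq]; nlinarith
  have := NeZero.mk (show q ≠ 0 by omega)
  have hQq : 16 * q ≤ Q := by rw [hQdef]; nlinarith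
  have hQ : 48 ≤ Q := by omega
  have hQ0 : Q ≠ 0 := by omega
  have h8 : 8 * p ∣ Q := Dvd.intro _ rfl
  have hqQ : q ∣ Q := Dvd.intro_left _ rfl
  have h2q : 2 ∣ q := (dvd_pow_self 2 (by omega)).mul_right l
  have hpr : ∀ r : ℕ, r.Prime → r ∣ Q → r = p ∨ r ∣ q := by
    intro r hr hrQ
    rcases (hr.dvd_mul).1 hrQ with h | h
    · rcases (hr.dvd_mul).1 h with h | h
      · have : r ∣ 2 := hr.dvd_of_dvd_pow (show r ∣ 2 ^ 3 from h)
        exact Or.inr (this.trans h2q)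
      · exact Or.inl ((Nat.prime_dvd_prime_iff_eq hr hp).1 h)
    · exact Or.inr h
  have hc : (1 + 2 ^ j * l).Coprime q := by
    have h1 : (1 + 2 ^ j * l).Coprime (2 ^ j * l) := by simp
    have h2 : (1 + 2 ^ j * l).Coprime 2 :=
      h1.coprime_dvd_right ((dvd_pow_self 2 (by omega)).mul_right l)
    rw [hq, pow_succ, mul_right_comm]
    exact h1.mul_right h2
  have hg : IsUnit (exactClass j l) := (ZMod.isUnit_iff_coprime _ _).2 hc
  have hmQ : 2 ^ m ≤ Q := by
    have h1 : 2 ^ m ≤ 2 ^ (j + 1) := Nat.pow_le_pow_right two_pos (by omega)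
    have h2 : 2 ^ (j + 1) ≤ q := Nat.le_mul_of_pos_right _ hl.pos
    omega
  have hτ : ∑ χ : DirichletCharacter ℂ q, χ (exactClass j l)⁻¹ *
      (rootPole p m hQ0 h8 (DirichletCharacter.changeLevel hqQ χ) : ℂ) =
        (classDensity p j l m : ℝ) := by
    rw [classDensity]
    split_ifs with h
    · obtain ⟨rfl, hm0⟩ := h
      have h8q : 8 ∣ q := (pow_dvd_pow 2 (show 3 ≤ j + 1 by have := hj2 rfl; omega)).mul_right l
      exact sum_rootPole_two hQ0 h8 hqQ h8q hc hm0
    · refine sum_rootPole_eq_one hQ0 h8 hqQ hg ?_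
      by_cases hm0 : m = 0
      · exact Or.inl hm0
      · have hp2 : p ≠ 2 := fun h' => h ⟨h', hm0⟩
        have hpodd := hp.odd_of_ne_two hp2
        refine Or.inr (changeLevel_ne_primeChar hp hpodd hQ0 h8 hqQ ?_)
        exact (Nat.Coprime.pow_right _ hpodd.coprime_two_right).mul_right
          ((Nat.coprime_primes hp hl).2 hlp.symm)
  have hφ : (q.totient : ℝ) = 2 ^ j * (l - 1) := by
    rw [hq, totient_two_pow_succ_mul hl hodd]
    push_cast [Nat.cast_sub hl.one_le]
    rfl
  have hφ0 : (0 : ℝ) < q.totient := by exact_mod_cast Nat.totient_pos.2 (NeZero.pos q)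
  have hQ1 : (1 : ℝ) ≤ Q := by exact_mod_cast (by omega : 1 ≤ Q)
  have hB : (Q : ℝ) ^ (24770 * 2 ^ m) * q.totient ≤ Y := by
    refine le_trans ?_ hY
    rw [show 24771 * 2 ^ m = 24770 * 2 ^ m + 2 ^ m by ring, pow_add]
    gcongr
    have h1 : (q.totient : ℝ) ≤ Q := by
      exact_mod_cast (Nat.totient_le q).trans (by omega)
    exact h1.trans (le_self_pow₀ hQ1 (by positivity))
  have hY2 : 2 ≤ Y := by
    refine le_trans ?_ hY
    have : (2 : ℝ) ≤ Q := by exact_mod_cast (by omega : 2 ≤ Q)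
    exact this.trans (le_self_pow₀ hQ1 (by positivity))
  obtain ⟨hd0, hd2⟩ := classDensity_mem p j l m
  have key := abs_partialSum_sub_log_le (a := classWeight p (exactClass j l) m)
    (fun r => classWeight_nonneg _ _ _ r)
    (by rw [classWeight, if_neg fun h => Nat.not_prime_zero h.1])
    (fun v hv => summable_classWeight p _ m hv) (div_nonneg hd0 hφ0.le)
    (by positivity : (0 : ℝ) ≤ (Q : ℝ) ^ (24770 * 2 ^ m))
    (fun v hv v' hv' => abs_classSeries_sub_le hp hQ0 hQ h8 hqQ hpr hg hmQ hτ hv hv') hY2 hYX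
  rw [← hφ]
  refine key.trans ?_
  have h1 : 7 * (Q : ℝ) ^ (24770 * 2 ^ m) / Y ≤ 7 / q.totient := by
    rw [div_le_div_iff₀ (by linarith) hφ0]
    linarith
  have h2 : 6 * (classDensity p j l m / q.totient) ≤ 12 / q.totient := by
    rw [← mul_div_assoc]
    gcongr
    linarith
  have h3 : (19 : ℝ) / q.totient = 12 / q.totient + 7 / q.totient := by ring
  linarith

theorem classSum_asymptotic (hp : p.Prime) (hl : l.Prime) (hodd : Odd l) (hlp : l ≠ p)
    (hj : 1 ≤ j) (hj2 : p = 2 → 2 ≤ j) {m : ℕ} (hm : m ≤ j) {X : ℝ} (hX : 1 ≤ X) :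
    |classSum p (exactClass j l) m X / 2 ^ m -
      classDensity p j l m / (2 ^ m * (2 ^ j * (l - 1))) * Real.log X| ≤
      2 ^ 30 * Real.log ((8 * p * (2 ^ (j + 1) * l) : ℕ) : ℝ) * (2 ^ (j / 2) / 2 ^ j) / l := by
  have hl2 := hl.two_le
  have hp2 := hp.two_le
  have hj2' : 2 ^ 2 ≤ 2 ^ (j + 1) := Nat.pow_le_pow_right two_pos (by omega)
  have hq8 : 8 ≤ 2 ^ (j + 1) * l := by nlinarith
  have hQ : 48 ≤ 8 * p * (2 ^ (j + 1) * l) := by nlinarith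
  have hterm : ∀ m r, 0 ≤ classWeight p (exactClass j l) m r / r := fun m r =>
    div_nonneg (classWeight_nonneg _ _ _ _) (by positivity)
  refine abs_sub_log_le_of_interpolation (S := classSum p (exactClass j l))
    (τ := classDensity p j l) (three_le_log hQ) (by exact_mod_cast (by omega : 1 ≤ 8 * p * (2 ^ (j + 1) * l))) (by exact_mod_cast hl2) rfl
    (classDensity_mem p j l) (fun m X => Finset.sum_nonneg fun r _ => hterm m r)
    (fun m Y X h => ?_) (fun m hm X hX => classSum_div_le hl hp hm hX)
    (fun m hm m₁ hm₁ Y X h => classSum_div_sub_le hl2 hp hm hm₁ h)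
    (fun m hm Y X hY hYX => classSum_sub_log_le hp hl hodd hlp hj hj2 hm hY hYX) hm hX
  have := classSum_sub (p := p) (exactClass j l) m h
  have h0 : 0 ≤ classSum p (exactClass j l) m X - classSum p (exactClass j l) m Y := by
    rw [this]
    exact Finset.sum_nonneg fun r _ => hterm m r
  linarith

end ClassSum

section Assembly

variable {p j l : ℕ}

theorem dvd_two_pow_mul_iff_padicValNat_le {d j m n : ℕ} (hn : Odd n) (hd : d ∣ 2 ^ j * n) :
    d ∣ 2 ^ m * n ↔ padicValNat 2 d ≤ m := by
  have hn0 : n ≠ 0 := hn.pos.ne'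
  have hd0 : d ≠ 0 := by
    rintro rfl
    have : 2 ^ j * n ≠ 0 := by positivity
    exact this (Nat.eq_zero_of_zero_dvd hd)
  constructor
  · intro h
    have h1 : 2 ^ padicValNat 2 d ∣ 2 ^ m * n := pow_padicValNat_dvd.trans h
    have h2 : 2 ^ padicValNat 2 d ∣ 2 ^ m :=
      (Nat.Coprime.pow_left _ hn.coprime_two_left).dvd_of_dvd_mul_right h1
    exact (Nat.pow_dvd_pow_iff_le_right (by norm_num)).1 h2
  · intro h
    obtain ⟨v, b, hb, rfl⟩ := Nat.exists_eq_two_pow_mul_odd hd0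
    have hv : padicValNat 2 (2 ^ v * b) = v := by
      rw [padicValNat.mul (by positivity) hb.pos.ne', padicValNat.prime_pow,
        padicValNat.eq_zero_of_not_dvd (fun h => (Nat.not_even_iff_odd.2 hb) (even_iff_two_dvd.2 h))]
      rfl
    rw [hv] at h
    have hbn : b ∣ n := by
      have : b ∣ 2 ^ j * n := (Dvd.intro_left _ rfl).trans hd
      exact (Nat.Coprime.pow_right _ hb.coprime_two_right).dvd_of_dvd_mul_left this
    exact Nat.mul_dvd_mul (pow_dvd_pow _ h) hbn

theorem padicValNat_two_pow_mul_odd {j n : ℕ} (hn : Odd n) : padicValNat 2 (2 ^ j * n) = j := by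
  rw [padicValNat.mul (by positivity) hn.pos.ne', padicValNat.prime_pow,
    padicValNat.eq_zero_of_not_dvd (fun h => (Nat.not_even_iff_odd.2 hn) (even_iff_two_dvd.2 h))]
  rfl

theorem natCast_eq_exactClass_iff (hl : 2 ≤ l) (hodd : Odd l) {r : ℕ} (hr : r.Prime) :
    (r : ZMod (2 ^ (j + 1) * l)) = exactClass j l ↔
      (r : ZMod l) = 1 ∧ padicValNat 2 (r - 1) = j := by
  rw [natCast_zmod_eq_iff hl]
  have hr1 : 1 ≤ r := hr.one_lt.le
  have hmod : (r : ZMod l) = 1 ↔ l ∣ r - 1 := by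
    rw [← ZMod.natCast_eq_zero_iff, Nat.cast_sub hr1, sub_eq_zero, Nat.cast_one]
  rw [hmod]
  constructor
  · rintro ⟨t, rfl⟩
    have ho : Odd (l * (2 * t + 1)) := hodd.mul (odd_two_mul_add_one t)
    rw [Nat.add_sub_cancel, padicValNat_two_pow_mul_odd ho]
    exact ⟨Dvd.intro (2 ^ j * (2 * t + 1)) (by ring), rfl⟩
  · rintro ⟨hd, hv⟩
    have h0 : r - 1 ≠ 0 := by have := hr.two_le; omega
    obtain ⟨v, b, hb, hvb⟩ := Nat.exists_eq_two_pow_mul_odd h0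
    rw [hvb, padicValNat_two_pow_mul_odd hb] at hv
    subst hv
    rw [hvb] at hd
    have : l ∣ b := (Nat.Coprime.pow_right _ hodd.coprime_two_right).dvd_of_dvd_mul_left hd
    obtain ⟨c, rfl⟩ := this
    obtain ⟨t, rfl⟩ := (Nat.odd_mul.1 hb).2
    exact ⟨t, by omega⟩

/-- The exponent of two that defines `memRp`. -/
def rankExponent (p : ℕ) : ℕ := if p = 2 then 2 else 1

theorem rankExponent_pos (p : ℕ) : 1 ≤ rankExponent p := by
  unfold rankExponent; split_ifs <;> norm_num

theorem memRp_iff (p r : ℕ) : memRp p r ↔ memR p (rankExponent p) r := by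
  unfold memRp rankExponent
  split_ifs with h
  · subst h; rfl
  · rfl

theorem orderOf_natCast_dvd (hp : p.Prime) {r : ℕ} (hr : r.Prime) (hrp : r ≠ p) :
    orderOf (p : ZMod r) ∣ r - 1 := by
  have := Fact.mk hr
  refine orderOf_dvd_of_pow_eq_one (ZMod.pow_card_sub_one_eq_one ?_)
  rw [Ne, ZMod.natCast_eq_zero_iff, Nat.prime_dvd_prime_iff_eq hr hp]
  exact hrp

theorem classWeight_sub_eq (hl : 2 ≤ l) (hodd : Odd l) (hp : p.Prime) (hj : rankExponent p ≤ j)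
    (r : ℕ) :
    classWeight p (exactClass j l) (j - rankExponent p) r / 2 ^ (j - rankExponent p) -
      classWeight p (exactClass j l) (j - rankExponent p + 1) r / 2 ^ (j - rankExponent p + 1) =
      if (memRp p r ∧ (r : ZMod l) = 1) ∧ padicValNat 2 (r - 1) = j then 1 else 0 := by
  have hk := rankExponent_pos p
  rw [memRp_iff]
  set k := rankExponent p with hkdef
  rw [classWeight_exactClass hl hp (by omega : j - k ≤ j),
    classWeight_exactClass hl hp (by omega : j - k + 1 ≤ j)]
  by_cases hb : r.Prime ∧ r ≠ p ∧ (r : ZMod (2 ^ (j + 1) * l)) = exactClass j l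
  · obtain ⟨hr, hrp, hc⟩ := hb
    have hc2 := (natCast_eq_exactClass_iff hl hodd hr).1 hc
    obtain ⟨t, ht⟩ := (natCast_zmod_eq_iff hl r).1 hc
    have ho : Odd (l * (2 * t + 1)) := hodd.mul (odd_two_mul_add_one t)
    set n := l * (2 * t + 1) with hn
    have hr1 : r - 1 = 2 ^ j * n := by omega
    have hdvd := orderOf_natCast_dvd hp hr hrp
    rw [hr1] at hdvd
    have hquot : ∀ m ≤ j, (r - 1) / 2 ^ m = 2 ^ (j - m) * n := fun m hm => by
      rw [hr1]
      refine Nat.div_eq_of_eq_mul_left (by positivity) ?_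
      rw [mul_right_comm, ← pow_add, Nat.sub_add_cancel hm]
    have hpow : ∀ m ≤ j, (p : ZMod r) ^ ((r - 1) / 2 ^ m) = 1 ↔
        padicValNat 2 (orderOf (p : ZMod r)) ≤ j - m := fun m hm => by
      rw [hquot m hm, ← orderOf_dvd_iff_pow_eq_one, dvd_two_pow_mul_iff_padicValNat_le ho hdvd]
    have hrodd : Odd r := by
      rw [ht]
      exact (((Nat.even_pow.2 ⟨even_two, by omega⟩)).mul_right _).add_one
    have hmem : memR p k r ↔ padicValNat 2 (orderOf (p : ZMod r)) = k :=
      ⟨fun h => h.2.2.2, fun h => ⟨hr, hrodd, hrp, h⟩⟩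
    simp only [hr, hrp, hc, hc2.1, hc2.2, hmem, hpow (j - k) (by omega),
      hpow (j - k + 1) (by omega), ne_eq, not_false_eq_true, and_true, true_and]
    rw [show j - (j - k) = k by omega, show j - (j - k + 1) = k - 1 by omega]
    rcases lt_trichotomy (padicValNat 2 (orderOf (p : ZMod r))) k with h | h | h
    · rw [if_pos h.le, if_pos (by omega), if_neg h.ne, div_self (by positivity),
        div_self (by positivity), sub_self]
    · rw [if_pos h.le, if_neg (by omega), if_pos h, div_self (by positivity), zero_div, sub_zero]
    · rw [if_neg (by omega), if_neg (by omega), if_neg h.ne', zero_div, zero_div, sub_zero]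
  · rw [if_neg (fun h => hb h.1), if_neg (fun h => hb h.1), if_neg, zero_div, zero_div, sub_zero]
    rintro ⟨⟨hm, hrl⟩, hv⟩
    exact hb ⟨hm.1, hm.2.2.1, (natCast_eq_exactClass_iff hl hodd hm.1).2 ⟨hrl, hv⟩⟩

theorem padicValNat_sub_one_mem (hp : p.Prime) {r J : ℕ} (h : memRp p r) (hJ : r ≤ 2 ^ J) :
    padicValNat 2 (r - 1) ∈ Finset.Ico (rankExponent p) J := by
  rw [memRp_iff] at h
  obtain ⟨hr, -, hrp, hv⟩ := h
  have h0 : r - 1 ≠ 0 := by have := hr.two_le; omega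
  have hd := orderOf_natCast_dvd hp hr hrp
  rw [Finset.mem_Ico]
  constructor
  · rw [← hv]
    exact (padicValNat_dvd_iff_le h0).1 (pow_padicValNat_dvd.trans hd)
  · have h1 : 2 ^ padicValNat 2 (r - 1) ≤ r - 1 :=
      Nat.le_of_dvd (Nat.pos_of_ne_zero h0) pow_padicValNat_dvd
    exact (Nat.pow_lt_pow_iff_right (by norm_num : 1 < 2)).1 (by omega)

theorem sum_memRp_eq (hl : 2 ≤ l) (hodd : Odd l) (hp : p.Prime) {X : ℝ} {J : ℕ}
    (hJ : ⌊Real.exp X⌋₊ ≤ 2 ^ J) :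
    ∑ r ∈ (Finset.range (⌊Real.exp X⌋₊ + 1)).filter
        (fun r => memRp p r ∧ (r : ZMod l) = 1), (1 : ℝ) / r =
      ∑ j ∈ Finset.Ico (rankExponent p) J,
        (classSum p (exactClass j l) (j - rankExponent p) X / 2 ^ (j - rankExponent p) -
          classSum p (exactClass j l) (j - rankExponent p + 1) X /
            2 ^ (j - rankExponent p + 1)) := by
  have hstep : ∀ j ∈ Finset.Ico (rankExponent p) J,
      classSum p (exactClass j l) (j - rankExponent p) X / 2 ^ (j - rankExponent p) -
          classSum p (exactClass j l) (j - rankExponent p + 1) X /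
            2 ^ (j - rankExponent p + 1) =
      ∑ r ∈ Finset.range (⌊Real.exp X⌋₊ + 1),
        if padicValNat 2 (r - 1) = j then
          (if memRp p r ∧ (r : ZMod l) = 1 then (1 : ℝ) / r else 0) else 0 := fun j hj => by
    rw [classSum, classSum, Finset.sum_div, Finset.sum_div, ← Finset.sum_sub_distrib]
    refine Finset.sum_congr rfl fun r _ => ?_
    rw [div_right_comm, div_right_comm _ (r : ℝ), ← sub_div,
      classWeight_sub_eq hl hodd hp (Finset.mem_Ico.1 hj).1]
    by_cases h1 : memRp p r ∧ (r : ZMod l) = 1 <;> by_cases h2 : padicValNat 2 (r - 1) = j <;>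
      simp [h1, h2]
  rw [Finset.sum_congr rfl hstep, Finset.sum_comm, Finset.sum_filter]
  refine Finset.sum_congr rfl fun r hr => ?_
  rw [Finset.sum_ite_eq]
  by_cases h : memRp p r ∧ (r : ZMod l) = 1
  · rw [if_pos (padicValNat_sub_one_mem hp h.1 ?_)]
    exact (Nat.lt_succ_iff.1 (Finset.mem_range.1 hr)).trans hJ
  · simp [h]

/-- The density of the classes of exact exponent `j` counted by `memRp`, up to `1 / (l - 1)`. -/
noncomputable def exactDensity (p j l : ℕ) : ℝ :=
  (classDensity p j l (j - rankExponent p) / 2 ^ (j - rankExponent p) -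
    classDensity p j l (j - rankExponent p + 1) / 2 ^ (j - rankExponent p + 1)) / 2 ^ j

theorem exactDensity_eq (hodd : Odd l) (hj : rankExponent p ≤ j) :
    exactDensity p j l = 4 ^ (rankExponent p - 1) / 4 ^ j := by
  have h4 : (4 : ℝ) ^ j = 2 ^ j * 2 ^ j := by rw [← mul_pow]; norm_num
  by_cases hp : p = 2
  · subst hp
    rw [exactDensity, show rankExponent 2 = 2 from rfl] at *
    obtain ⟨i, rfl⟩ := Nat.exists_eq_add_of_le hj
    rw [Nat.add_sub_cancel_left, h4]
    have hi : (0 : ℝ) < 2 ^ i := by positivity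
    rcases Nat.eq_zero_or_pos i with rfl | hi0
    · have hc : ((1 + 2 ^ 2 * l : ℕ) : ZMod 8) = 5 := by
        obtain ⟨t, rfl⟩ := hodd
        have : ((1 + 2 ^ 2 * (2 * t + 1) : ℕ) : ZMod 8) = ((8 * t + 5 : ℕ) : ZMod 8) := by
          congr 1; ring
        rw [this, Nat.cast_add, Nat.cast_mul, ZMod.natCast_self 8]
        simp
      have h5 : ZMod.χ₈ (5 : ZMod 8) = -1 := by decide
      simp only [classDensity, Nat.add_zero, hc, h5]
      norm_num
    · have hc : ((1 + 2 ^ (2 + i) * l : ℕ) : ZMod 8) = 1 := by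
        obtain ⟨s, rfl⟩ := Nat.exists_eq_add_of_le hi0
        have : (1 + 2 ^ (2 + (1 + s)) * l : ℕ) = 8 * (2 ^ s * l) + 1 := by ring
        rw [this, Nat.cast_add, Nat.cast_mul, ZMod.natCast_self 8]
        simp
      have h1 : ZMod.χ₈ (1 : ZMod 8) = 1 := by decide
      have hi1 : i ≠ 0 := hi0.ne'
      rw [classDensity, classDensity, hc, h1, if_pos ⟨rfl, hi1⟩, if_pos ⟨rfl, i.succ_ne_zero⟩]
      push_cast
      field_simp
      ring
  · rw [exactDensity, show rankExponent p = 1 from if_neg hp] at *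
    obtain ⟨i, rfl⟩ := Nat.exists_eq_add_of_le hj
    rw [Nat.add_sub_cancel_left, h4, classDensity, classDensity, if_neg (fun h => hp h.1),
      if_neg (fun h => hp h.1)]
    have hi : (0 : ℝ) < 2 ^ i := by positivity
    field_simp
    ring

theorem sum_exactDensity (hodd : Odd l) {J : ℕ} (hJ : rankExponent p ≤ J) :
    ∑ j ∈ Finset.Ico (rankExponent p) J, exactDensity p j l =
      (1 - 4 ^ rankExponent p / 4 ^ J) / 3 := by
  induction J, hJ using Nat.le_induction with
  | base => simp
  | succ J hJ ih =>
    rw [Finset.sum_Ico_succ_top hJ, ih, exactDensity_eq hodd hJ]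
    obtain ⟨k, hk⟩ := Nat.exists_eq_add_of_le (rankExponent_pos p)
    rw [hk, Nat.add_sub_cancel_left]
    field_simp
    ring

theorem two_pow_half_div_le (j : ℕ) : (2 : ℝ) ^ (j / 2) / 2 ^ j ≤ (5 / 7) ^ j := by
  rw [div_le_iff₀ (by positivity), ← mul_pow]
  have h : (2 : ℝ) ^ (j / 2) ≤ (10 / 7) ^ (2 * (j / 2)) := by
    rw [pow_mul]
    gcongr
    norm_num
  refine h.trans (le_trans (pow_le_pow_right₀ (by norm_num) (Nat.mul_div_le j 2)) ?_)
  gcongr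
  norm_num

theorem log_modulus_le (hp : p.Prime) (hl : l.Prime) (hodd : Odd l) (j : ℕ) :
    Real.log ((8 * p * (2 ^ (j + 1) * l) : ℕ) : ℝ) ≤
      (Real.log (8 * p) + 2) * ((j + 1) * Real.log l) := by
  have hl0 : (0 : ℝ) < l := by exact_mod_cast hl.pos
  have hp0 : (1 : ℝ) ≤ p := by exact_mod_cast hp.one_lt.le
  have hl3 : (3 : ℝ) ≤ l := by exact_mod_cast hl.two_le.lt_of_ne (fun h => by
    rw [← h] at hodd; exact absurd hodd (by decide))
  have hlog : 1 ≤ Real.log l := by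
    rw [Real.le_log_iff_exp_le hl0]
    exact (Real.exp_one_lt_d9.le.trans (by norm_num)).trans hl3
  have h8 : 0 ≤ Real.log (8 * p) := Real.log_nonneg (by linarith)
  have hsplit : Real.log ((8 * p * (2 ^ (j + 1) * l) : ℕ) : ℝ) =
      Real.log (8 * p) + (((j + 1 : ℕ) : ℝ) * Real.log 2 + Real.log l) := by
    have hpp := hp.pos
    have hlp := hl.pos
    rw [Nat.cast_mul, Nat.cast_mul (2 ^ (j + 1)), Real.log_mul (by positivity) (by positivity),
      Real.log_mul (by positivity) (by positivity), Nat.cast_pow, Real.log_pow]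
    push_cast
    rfl
  rw [hsplit]
  have h2 : Real.log 2 ≤ 1 := Real.log_two_lt_d9.le.trans (by norm_num)
  have hj : (1 : ℝ) ≤ (j : ℝ) + 1 := by have := j.cast_nonneg (α := ℝ); linarith
  have hm : (j : ℝ) + 1 ≤ (j + 1) * Real.log l := le_mul_of_one_le_right (by linarith) hlog
  have hm' : Real.log l ≤ (j + 1) * Real.log l := le_mul_of_one_le_left (by linarith) hj
  have ha : Real.log (8 * p) ≤ Real.log (8 * p) * ((j + 1) * Real.log l) :=
    le_mul_of_one_le_right h8 (hj.trans hm)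
  have hb : ((j + 1 : ℕ) : ℝ) * Real.log 2 ≤ (j + 1) * Real.log l := by
    push_cast
    exact (mul_le_of_le_one_right (by linarith) h2).trans hm
  linarith

theorem abs_sum_memRp_sub_le (hp : p.Prime) (hl : l.Prime) (hodd : Odd l) (hlp : l ≠ p)
    {X : ℝ} (hX : 1 ≤ X) :
    |∑ r ∈ (Finset.range (⌊Real.exp X⌋₊ + 1)).filter
        (fun r => memRp p r ∧ (r : ZMod l) = 1), (1 : ℝ) / r - Real.log X / (3 * ((l : ℝ) - 1))| ≤
      (2 ^ 31 * (Real.log (8 * p) + 2) * ∑' j : ℕ, ((j : ℝ) + 1) * (5 / 7) ^ j + 8) *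
        Real.log l / l := by
  have hl0 : (0 : ℝ) < l := by exact_mod_cast hl.pos
  have hp0 : (1 : ℝ) ≤ p := by exact_mod_cast hp.one_lt.le
  have hl3 : (3 : ℝ) ≤ l := by exact_mod_cast hl.two_le.lt_of_ne (fun h => by
    rw [← h] at hodd; exact absurd hodd (by decide))
  have hlog : 1 ≤ Real.log l := by
    rw [Real.le_log_iff_exp_le hl0]
    exact (Real.exp_one_lt_d9.le.trans (by norm_num)).trans hl3
  have h8 : 0 ≤ Real.log (8 * p) := Real.log_nonneg (by linarith)
  set J := ⌊Real.exp X⌋₊ + 2 with hJdef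
  have hJ : ⌊Real.exp X⌋₊ ≤ 2 ^ J := (by omega : _ ≤ J).trans J.lt_two_pow_self.le
  have hk2 : rankExponent p ≤ 2 := by unfold rankExponent; split_ifs <;> norm_num
  have hkJ : rankExponent p ≤ J := by omega
  rw [sum_memRp_eq hl.two_le hodd hp hJ]
  set k := rankExponent p with hk
  have hterm : ∀ j ∈ Finset.Ico k J,
      |classSum p (exactClass j l) (j - k) X / 2 ^ (j - k) -
        classSum p (exactClass j l) (j - k + 1) X / 2 ^ (j - k + 1) -
        exactDensity p j l * (Real.log X / (l - 1))| ≤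
      2 ^ 31 * (Real.log (8 * p) + 2) * (Real.log l / l) * (((j : ℝ) + 1) * (5 / 7) ^ j) := by
    intro j hj
    have hkj := (Finset.mem_Ico.1 hj).1
    have hk1 := rankExponent_pos p
    have hj2 : p = 2 → 2 ≤ j := fun h => by
      rw [hk, rankExponent, if_pos h] at hkj; exact hkj
    have e1 := classSum_asymptotic hp hl hodd hlp (by omega) hj2 (by omega : j - k ≤ j) hX
    have e2 := classSum_asymptotic hp hl hodd hlp (by omega) hj2 (by omega : j - k + 1 ≤ j) hX
    have hid : exactDensity p j l * (Real.log X / (l - 1)) =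
        classDensity p j l (j - k) / (2 ^ (j - k) * (2 ^ j * (l - 1))) * Real.log X -
        classDensity p j l (j - k + 1) / (2 ^ (j - k + 1) * (2 ^ j * (l - 1))) * Real.log X := by
      rw [exactDensity, ← hk]
      have : (l : ℝ) - 1 ≠ 0 := by linarith
      field_simp
    rw [hid, sub_sub_sub_comm]
    refine (abs_sub _ _).trans ((add_le_add e1 e2).trans ?_)
    have e3 : 2 ^ 30 * Real.log ((8 * p * (2 ^ (j + 1) * l) : ℕ) : ℝ) *
        (2 ^ (j / 2) / 2 ^ j) / l ≤
        2 ^ 30 * ((Real.log (8 * p) + 2) * ((j + 1) * Real.log l)) * (5 / 7) ^ j / l := by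
      have := two_pow_half_div_le j
      have := log_modulus_le hp hl hodd j
      gcongr
    refine (add_le_add e3 e3).trans (le_of_eq ?_)
    ring
  have hsum : Summable fun j : ℕ => ((j : ℝ) + 1) * (5 / 7 : ℝ) ^ j := by
    have h1 := summable_pow_mul_geometric_of_norm_lt_one 1 (r := (5 / 7 : ℝ)) (by norm_num)
    have h2 := summable_geometric_of_lt_one (r := (5 / 7 : ℝ)) (by norm_num) (by norm_num)
    refine (h1.add h2).congr fun j => ?_
    ring
  have hA := Finset.sum_le_sum hterm
  rw [← Finset.mul_sum] at hA
  have hB := hsum.sum_le_tsum (Finset.Ico k J) (fun j _ => by positivity)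
  have hC : |∑ j ∈ Finset.Ico k J, exactDensity p j l * (Real.log X / (l - 1)) -
      Real.log X / (3 * ((l : ℝ) - 1))| ≤ 8 * (Real.log l / l) := by
    rw [← Finset.sum_mul, sum_exactDensity hodd hkJ]
    have hlX : 0 ≤ Real.log X := Real.log_nonneg hX
    have h1 : (1 - (4 : ℝ) ^ rankExponent p / 4 ^ J) / 3 * (Real.log X / (l - 1)) -
        Real.log X / (3 * ((l : ℝ) - 1)) =
        -(4 ^ rankExponent p / 3 * (Real.log X / 4 ^ J) / (l - 1)) := by
      have : (l : ℝ) - 1 ≠ 0 := by linarith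
      field_simp
      ring
    have h2 : Real.log X / 4 ^ J ≤ 1 := by
      rw [div_le_one (by positivity)]
      have a1 : Real.log X ≤ Real.exp X :=
        (Real.log_le_self (by linarith)).trans ((by linarith : X ≤ X + 1).trans
          (Real.add_one_le_exp X))
      have a2 : Real.exp X ≤ J := by
        rw [hJdef]; push_cast; linarith [(Nat.lt_floor_add_one (Real.exp X)).le]
      have a3 : (J : ℝ) ≤ 4 ^ J := by
        exact_mod_cast (Nat.lt_pow_self (by norm_num : 1 < 4)).le
      linarith
    have h3 : (4 : ℝ) ^ rankExponent p ≤ 4 ^ 2 := pow_le_pow_right₀ (by norm_num) hk2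
    have hl1 : (0 : ℝ) < l - 1 := by linarith
    rw [h1, abs_neg, abs_of_nonneg (by positivity)]
    calc (4 : ℝ) ^ rankExponent p / 3 * (Real.log X / 4 ^ J) / (l - 1)
        ≤ 4 ^ 2 / 3 * 1 / (l - 1) := by gcongr
      _ ≤ 8 * (1 / l) := by
        rw [mul_one_div, div_le_div_iff₀ hl1 hl0]
        linarith
      _ ≤ 8 * (Real.log l / l) := by gcongr
  have hD := (Finset.abs_sum_le_sum_abs _ _).trans hA
  rw [Finset.sum_sub_distrib] at hD
  refine (abs_sub_le _ _ _).trans ((add_le_add hD hC).trans ?_)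
  have hE : 2 ^ 31 * (Real.log (8 * p) + 2) * (Real.log l / l) *
      ∑ j ∈ Finset.Ico k J, (((j : ℝ) + 1) * (5 / 7) ^ j) ≤
      2 ^ 31 * (Real.log (8 * p) + 2) * (Real.log l / l) *
      ∑' j : ℕ, (((j : ℝ) + 1) * (5 / 7) ^ j) := by gcongr
  refine (add_le_add hE le_rfl).trans (le_of_eq ?_)
  ring

end Assembly

/-- For every prime `p` there are `C_p > 0` and `x₀(p)` such
that for all `x ≥ x₀(p)` and every odd prime `l ≠ p` with
`l ≤ (log₂ x) log(log₂ x)`, one has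
`|Σ_{r ∈ Q_{p,l}, r ≤ x} 1/r − (log₂ x)/(3(l−1))| ≤ C_p (log l)/l`, where
`Q_{p,l} = {r ∈ R_p : r ≡ 1 (mod l)}`. -/
theorem rank_stats_stmt18 (p : ℕ) (hp : p.Prime) :
    ∃ C : ℝ, 0 < C ∧ ∃ x0 : ℝ, ∀ x : ℝ, x0 ≤ x →
      ∀ l : ℕ, l.Prime → Odd l → l ≠ p →
        (l : ℝ) ≤ logI 2 x * Real.log (logI 2 x) →
        |(∑ r ∈ (Finset.range (⌊x⌋₊ + 1)).filter
              (fun r => memRp p r ∧ (r : ZMod l) = 1), (1 : ℝ) / r)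
            - logI 2 x / (3 * ((l : ℝ) - 1))|
          ≤ C * Real.log l / l := by
  have hp0 : (1 : ℝ) ≤ p := by exact_mod_cast hp.one_lt.le
  have h8 : 0 ≤ Real.log (8 * p) := Real.log_nonneg (by linarith)
  refine ⟨2 ^ 31 * (Real.log (8 * p) + 2) * ∑' j : ℕ, ((j : ℝ) + 1) * (5 / 7) ^ j + 8, ?_,
    Real.exp (Real.exp 1), fun x hx l hl hodd hlp _ => ?_⟩
  · have : 0 ≤ ∑' j : ℕ, ((j : ℝ) + 1) * (5 / 7 : ℝ) ^ j := tsum_nonneg fun j => by positivity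
    positivity
  · have hx0 : 0 < x := (Real.exp_pos _).trans_le hx
    have hX : Real.exp 1 ≤ Real.log x := (Real.le_log_iff_exp_le hx0).2 hx
    have hX1 : 1 ≤ Real.log x := (Real.one_le_exp zero_le_one).trans hX
    have hXX : 1 ≤ Real.log (Real.log x) := (Real.le_log_iff_exp_le (by linarith)).2 hX
    have hlog : logI 2 x = Real.log (Real.log x) := by
      simp only [logI]
      rw [max_eq_left hX1, max_eq_left hXX]
    have h := abs_sum_memRp_sub_le hp hl hodd hlp hX1
    rw [Real.exp_log hx0] at h
    rw [hlog]
    exact h
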